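/- Let α₁ < β₁ < α₂ < β₂. There exist functions A₁, A₂, B₁, B₂ : [0,1] → ℝ, continuous on [0,1], with A₁(c) > 0, A₂(c) > 0 and B₁(c) < B₂(c) for every c ∈ (0,1), such that for EVERY Angelesco system with analytic weights (μ₁, μ₂) on (Δ₁, Δ₂) the following holds: for every c ∈ [0,1], every i ∈ {1,2}, and every sequence (n⃗(k)) in (ℤ≥0)² with n₁(k) + n₂(k) → ∞ and n₁(k)/(n₁(k)+n₂(k)) → c, one has b_{n⃗(k),i} → B_i(c) as k → ∞, and, provided n_i(k) ≥ 1 for all k, also a_{n⃗(k),i} → A_i(c) as k → ∞. In particular these ray limits exist along every ray sequence and depend only on c and the intervals Δ₁, Δ₂ (not on the particular measures). -/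

import Mathlib

open MeasureTheory

noncomputable section

/-- Left endpoints of the two intervals `Δ₁ = [α₁,β₁]`, `Δ₂ = [α₂,β₂]`. -/
def iLo (α₁ α₂ : ℝ) : Fin 2 → ℝ := fun i => if i = 0 then α₁ else α₂

/-- Right endpoints of the two intervals. -/
def iHi (β₁ β₂ : ℝ) : Fin 2 → ℝ := fun i => if i = 0 then β₁ else β₂

/-- An Angelesco system with analytic weights on `([α₁,β₁],[α₂,β₂])`: densities `f i`
positive on `Δ i` that are restrictions of functions `F i` holomorphic and non-vanishing
on open complex neighborhoods `U i` of `Δ i`. -/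
structure AngelescoSystem (α₁ β₁ α₂ β₂ : ℝ) : Type where
  f : Fin 2 → ℝ → ℝ
  F : Fin 2 → ℂ → ℂ
  U : Fin 2 → Set ℂ
  isOpenU : ∀ i, IsOpen (U i)
  subsetU : ∀ i, (Complex.ofReal '' Set.Icc (iLo α₁ α₂ i) (iHi β₁ β₂ i)) ⊆ U i
  holoF : ∀ i, DifferentiableOn ℂ (F i) (U i)
  neF : ∀ i, ∀ z ∈ U i, F i z ≠ 0
  realF : ∀ i, ∀ x ∈ Set.Icc (iLo α₁ α₂ i) (iHi β₁ β₂ i), F i (x : ℂ) = ((f i x : ℝ) : ℂ)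
  posf : ∀ i, ∀ x ∈ Set.Icc (iLo α₁ α₂ i) (iHi β₁ β₂ i), 0 < f i x

variable {α₁ β₁ α₂ β₂ : ℝ}

/-- The measure `dμᵢ = fᵢ(x) dx` on `Δᵢ` (vanishing off `Δᵢ`). -/
noncomputable def AngelescoSystem.μ (S : AngelescoSystem α₁ β₁ α₂ β₂) (i : Fin 2) :
    Measure ℝ :=
  (volume.restrict (Set.Icc (iLo α₁ α₂ i) (iHi β₁ β₂ i))).withDensity
    fun x => ENNReal.ofReal (S.f i x)

/-- The `i`-th component of a multi-index. -/
def nComp (n : ℕ × ℕ) (i : Fin 2) : ℕ := if i = 0 then n.1 else n.2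

/-- The standard multi-index unit vectors `e⃗₁ = (1,0)`, `e⃗₂ = (0,1)`. -/
def evec (i : Fin 2) : ℕ × ℕ := if i = 0 then (1, 0) else (0, 1)

/-- `P` is the family of (monic) type II multiple orthogonal polynomials of `S`. -/
def IsTypeII (S : AngelescoSystem α₁ β₁ α₂ β₂) (P : ℕ × ℕ → Polynomial ℝ) : Prop :=
  ∀ n : ℕ × ℕ, (P n).Monic ∧ (P n).natDegree = n.1 + n.2 ∧
    ∀ i : Fin 2, ∀ l : ℕ, l < nComp n i → (∫ x, (P n).eval x * x ^ l ∂ S.μ i) = 0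

/-- The recurrence coefficient `a_{n⃗,j}`. -/
noncomputable def acoef (S : AngelescoSystem α₁ β₁ α₂ β₂) (P : ℕ × ℕ → Polynomial ℝ)
    (n : ℕ × ℕ) (j : Fin 2) : ℝ :=
  (∫ x, (P n).eval x * x ^ nComp n j ∂ S.μ j)
    / ∫ x, (P (n - evec j)).eval x * x ^ (nComp n j - 1) ∂ S.μ j

/-- The recurrence coefficient `b_{n⃗,j}`. -/
noncomputable def bcoef (S : AngelescoSystem α₁ β₁ α₂ β₂) (P : ℕ × ℕ → Polynomial ℝ)
    (n : ℕ × ℕ) (j : Fin 2) : ℝ :=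
  (P n).coeff (n.1 + n.2 - 1) - (P (n + evec j)).coeff (n.1 + n.2)

namespace RayLimit

open Real Filter Topology Polynomial Metric

section CircleAverages

lemma circleIntegrable_of_sphere {E : Type*} [NormedAddCommGroup E] {f : ℂ → E} {R : ℝ}
    (hR : 0 ≤ R) (hf : ContinuousOn f (sphere 0 R)) : CircleIntegrable f 0 R :=
  hf.circleIntegrable hR

lemma circleAverage_eq_of_annulus {f : ℂ → ℂ} {r R : ℝ} (hr : 0 < r) (hrR : r ≤ R)
    (hf : ∀ z : ℂ, r ≤ ‖z‖ → ‖z‖ ≤ R → DifferentiableAt ℂ f z) :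
    circleAverage f 0 r = circleAverage f 0 R := by
  rw [circleAverage_eq_circleIntegral hr.ne', circleAverage_eq_circleIntegral (hr.trans_le hrR).ne']
  congr 1
  symm
  refine Complex.circleIntegral_sub_center_inv_smul_eq_of_differentiable_on_annulus_off_countable
    hr hrR Set.countable_empty ?_ ?_
  · intro z hz
    simp only [Set.mem_sdiff, mem_closedBall, dist_zero_right, mem_ball, not_lt] at hz
    exact (hf z hz.2 hz.1).continuousAt.continuousWithinAt
  · intro z hz
    simp only [Set.mem_sdiff, mem_closedBall, dist_zero_right, mem_ball, not_le] at hz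
    exact hf z hz.1.2.le hz.1.1.le

lemma circleAverage_eq_center {f : ℂ → ℂ} {R : ℝ} (hR : 0 < R)
    (hf : ∀ z : ℂ, ‖z‖ ≤ R → DifferentiableAt ℂ f z) : circleAverage f 0 R = f 0 := by
  refine circleAverage_of_differentiable_on_off_countable Set.countable_empty ?_ ?_
  · intro z hz
    simp only [mem_closedBall, dist_zero_right, abs_of_pos hR] at hz
    exact (hf z hz).continuousAt.continuousWithinAt
  · intro z hz
    simp only [Set.mem_sdiff, mem_ball, dist_zero_right, abs_of_pos hR] at hz
    exact hf z hz.1.le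

lemma norm_circleAverage_le {f : ℂ → ℂ} {R : ℝ} :
    ‖circleAverage f 0 R‖ ≤ circleAverage (fun z => ‖f z‖) 0 R := by
  unfold circleAverage
  rw [norm_smul, smul_eq_mul, norm_of_nonneg (by positivity)]
  gcongr
  exact intervalIntegral.norm_integral_le_integral_norm (by positivity)

lemma abs_le_sqrt_mul_sqrt_of_quadratic {a b c : ℝ} (ha : 0 ≤ a)
    (h : ∀ t : ℝ, 0 ≤ a * (t * t) + 2 * c * t + b) : |c| ≤ √a * √b := by
  have hd := discrim_le_zero h
  rw [discrim] at hd
  rw [← Real.sqrt_mul ha, ← Real.sqrt_sq_eq_abs]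
  exact Real.sqrt_le_sqrt (by nlinarith)

/-- The `L²` norm on the circle of radius `R`. -/
def cnorm (R : ℝ) (f : ℂ → ℂ) : ℝ := √(circleAverage (fun z => ‖f z‖ ^ 2) 0 R)

lemma cnorm_nonneg (R : ℝ) (f : ℂ → ℂ) : 0 ≤ cnorm R f := Real.sqrt_nonneg _

lemma cnorm_sq {R : ℝ} {f : ℂ → ℂ} : cnorm R f ^ 2 = circleAverage (fun z => ‖f z‖ ^ 2) 0 R :=
  Real.sq_sqrt (circleAverage_nonneg_of_nonneg fun z _ => by positivity)

lemma cnorm_congr {R : ℝ} (hR : 0 ≤ R) {f g : ℂ → ℂ} (h : ∀ z, ‖z‖ = R → ‖f z‖ = ‖g z‖) :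
    cnorm R f = cnorm R g := by
  unfold cnorm
  congr 1
  refine circleAverage_congr_sphere fun z hz => ?_
  simp only [mem_sphere, dist_zero_right, abs_of_nonneg hR] at hz
  simp [h z hz]

lemma circleAverage_norm_mul_le {R : ℝ} (hR : 0 ≤ R) {f g : ℂ → ℂ}
    (hf : ContinuousOn f (sphere 0 R)) (hg : ContinuousOn g (sphere 0 R)) :
    circleAverage (fun z => ‖f z‖ * ‖g z‖) 0 R ≤ cnorm R f * cnorm R g := by
  refine (le_abs_self _).trans (abs_le_sqrt_mul_sqrt_of_quadratic
    (circleAverage_nonneg_of_nonneg fun z _ => by positivity) fun t => ?_)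
  have e : circleAverage (fun z => (t * ‖f z‖ + ‖g z‖) ^ 2) 0 R =
      circleAverage (fun z => ‖f z‖ ^ 2) 0 R * (t * t) +
        2 * circleAverage (fun z => ‖f z‖ * ‖g z‖) 0 R * t +
        circleAverage (fun z => ‖g z‖ ^ 2) 0 R := by
    have i1 : CircleIntegrable (fun z => ‖f z‖ ^ 2) 0 R :=
      circleIntegrable_of_sphere hR (hf.norm.pow 2)
    have i2 : CircleIntegrable (fun z => ‖f z‖ * ‖g z‖) 0 R :=
      circleIntegrable_of_sphere hR (hf.norm.mul hg.norm)
    have i3 : CircleIntegrable (fun z => ‖g z‖ ^ 2) 0 R :=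
      circleIntegrable_of_sphere hR (hg.norm.pow 2)
    have : (fun z => (t * ‖f z‖ + ‖g z‖) ^ 2) = fun z =>
        ((t * t) • ‖f z‖ ^ 2 + (2 * t) • (‖f z‖ * ‖g z‖)) + ‖g z‖ ^ 2 := by
      ext z; simp only [smul_eq_mul]; ring
    rw [this, circleAverage_fun_add _ i3, circleAverage_fun_add, circleAverage_fun_smul,
      circleAverage_fun_smul]
    · simp only [smul_eq_mul]; ring
    · exact i1.const_fun_smul
    · exact i2.const_fun_smul
    · exact (i1.const_fun_smul).add (i2.const_fun_smul)
  rw [← e]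
  exact circleAverage_nonneg_of_nonneg fun z _ => by positivity

lemma norm_circleAverage_mul_le {R : ℝ} (hR : 0 ≤ R) {f g : ℂ → ℂ}
    (hf : ContinuousOn f (sphere 0 R)) (hg : ContinuousOn g (sphere 0 R)) :
    ‖circleAverage (fun z => f z * g z) 0 R‖ ≤ cnorm R f * cnorm R g := by
  refine norm_circleAverage_le.trans (le_trans (le_of_eq ?_) (circleAverage_norm_mul_le hR hf hg))
  simp only [norm_mul]

lemma cnorm_add_le {R : ℝ} (hR : 0 ≤ R) {f g : ℂ → ℂ}
    (hf : ContinuousOn f (sphere 0 R)) (hg : ContinuousOn g (sphere 0 R)) :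
    cnorm R (fun z => f z + g z) ≤ cnorm R f + cnorm R g := by
  refine abs_le_of_sq_le_sq' ?_ (add_nonneg (cnorm_nonneg _ _) (cnorm_nonneg _ _)) |>.2
  have i1 : CircleIntegrable (fun z => ‖f z‖ ^ 2) 0 R :=
    circleIntegrable_of_sphere hR (hf.norm.pow 2)
  have i2 : CircleIntegrable (fun z => ‖f z‖ * ‖g z‖) 0 R :=
    circleIntegrable_of_sphere hR (hf.norm.mul hg.norm)
  have i3 : CircleIntegrable (fun z => ‖g z‖ ^ 2) 0 R :=
    circleIntegrable_of_sphere hR (hg.norm.pow 2)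
  have h1 : circleAverage (fun z => ‖f z + g z‖ ^ 2) 0 R ≤
      circleAverage (fun z => (‖f z‖ ^ 2 + (2:ℝ) • (‖f z‖ * ‖g z‖)) + ‖g z‖ ^ 2) 0 R := by
    refine circleAverage_mono (circleIntegrable_of_sphere hR ((hf.add hg).norm.pow 2))
      ((i1.add i2.const_fun_smul).add i3) fun z _ => ?_
    have := norm_add_le (f z) (g z)
    simp only [smul_eq_mul]
    nlinarith [norm_nonneg (f z + g z), norm_nonneg (f z), norm_nonneg (g z)]
  rw [circleAverage_fun_add _ i3, circleAverage_fun_add i1 i2.const_fun_smul,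
    circleAverage_fun_smul, smul_eq_mul] at h1
  swap
  · exact i1.add i2.const_fun_smul
  have h2 := circleAverage_norm_mul_le hR hf hg
  rw [cnorm_sq, add_sq, cnorm_sq, cnorm_sq]
  linarith

lemma norm_circleAverage_le_of_bound {f : ℂ → ℂ} {R C : ℝ} (hR : 0 ≤ R)
    (hf : ContinuousOn f (sphere 0 R)) (h : ∀ z, ‖z‖ = R → ‖f z‖ ≤ C) :
    ‖circleAverage f 0 R‖ ≤ C := by
  refine norm_circleAverage_le.trans ?_
  refine circleAverage_mono_on_of_le_circle (circleIntegrable_of_sphere hR hf.norm) fun z hz => ?_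
  simp only [mem_sphere, dist_zero_right, abs_of_nonneg hR] at hz
  exact h z hz

/-- `L²` means over circles of a function analytic in the disc increase with the radius. -/
lemma cnorm_le_cnorm_one {f : ℂ → ℂ} (hf : ∀ z : ℂ, ‖z‖ ≤ 1 → DifferentiableAt ℂ f z)
    (hconj : ∀ z, f (starRingEnd ℂ z) = starRingEnd ℂ (f z)) {r : ℝ} (hr : 0 < r) (hr1 : r ≤ 1) :
    cnorm r f ≤ cnorm 1 f := by
  have hcont : ∀ s, s ≤ 1 → ContinuousOn f (sphere 0 s) := fun s hs z hz => by
    simp only [mem_sphere, dist_zero_right] at hz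
    exact (hf z (hz.trans_le hs)).continuousAt.continuousWithinAt
  have key : ∀ s, 0 < s → s ≤ 1 → cnorm s f ^ 2 ≤ cnorm 1 f * cnorm (s ^ 2) f := by
    intro s hs hs1
    have e1 : ((cnorm s f ^ 2 : ℝ) : ℂ) =
        circleAverage (fun z => f z * f ((s ^ 2 : ℝ) / z)) 0 s := by
      rw [cnorm_sq]
      have := Complex.ofRealCLM.circleAverage_comp_comm (c := 0) (R := s)
        (f := fun z => ‖f z‖ ^ 2) (circleIntegrable_of_sphere hs.le ((hcont s hs1).norm.pow 2))
      simp only [Complex.ofRealCLM_apply] at this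
      rw [← this]
      refine circleAverage_congr_sphere fun z hz => ?_
      simp only [mem_sphere, dist_zero_right, abs_of_nonneg hs.le] at hz
      have hz0 : z ≠ 0 := by rintro rfl; simp at hz; linarith
      have : ((s ^ 2 : ℝ) : ℂ) / z = starRingEnd ℂ z := by
        rw [div_eq_iff hz0, mul_comm, Complex.mul_conj, Complex.normSq_eq_norm_sq, hz]
      simp only [Function.comp, Complex.ofRealCLM_apply]
      rw [this, hconj, Complex.mul_conj, Complex.normSq_eq_norm_sq]
    have e2 : circleAverage (fun z => f z * f ((s ^ 2 : ℝ) / z)) 0 s =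
        circleAverage (fun z => f z * f ((s ^ 2 : ℝ) / z)) 0 1 := by
      refine circleAverage_eq_of_annulus hs hs1 fun z h1 h2 => ?_
      have hz0 : z ≠ 0 := by rintro rfl; simp at h1; linarith
      refine (hf z h2).mul (DifferentiableAt.comp z (hf _ ?_) ?_)
      · rw [norm_div, Complex.norm_real, norm_of_nonneg (by positivity),
          div_le_one (by positivity)]
        nlinarith
      · exact (differentiableAt_const _).div differentiableAt_id hz0
    have hsq : s ^ 2 ≤ 1 := by nlinarith
    have e3 : cnorm 1 (fun z => f ((s ^ 2 : ℝ) / z)) = cnorm (s ^ 2) f := by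
      have : cnorm 1 (fun z => f ((s ^ 2 : ℝ) / z)) = cnorm 1 (fun z => f ((s ^ 2 : ℝ) * z)) := by
        refine cnorm_congr zero_le_one fun z hz => ?_
        have hz0 : z ≠ 0 := by rintro rfl; simp at hz
        have : ((s ^ 2 : ℝ) : ℂ) / z = starRingEnd ℂ ((s ^ 2 : ℝ) * z) := by
          rw [map_mul, Complex.conj_ofReal, div_eq_iff hz0, mul_assoc, mul_comm _ z,
            Complex.mul_conj, Complex.normSq_eq_norm_sq, hz]; simp
        rw [this, hconj, Complex.norm_conj]
      rw [this]
      unfold cnorm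
      congr 1
      rw [circleAverage_eq_circleAverage_zero_one (R := s ^ 2)]
      simp
    have e4 := norm_circleAverage_mul_le zero_le_one (hcont 1 le_rfl)
      (g := fun z => f ((s ^ 2 : ℝ) / z)) (fun z hz => by
        simp only [mem_sphere, dist_zero_right] at hz
        have hz0 : z ≠ 0 := by rintro rfl; simp at hz
        refine ContinuousAt.continuousWithinAt ?_
        refine ContinuousAt.comp (hf _ ?_).continuousAt ?_
        · rw [norm_div, Complex.norm_real, norm_of_nonneg (by positivity), hz, div_one]; exact hsq
        · exact continuousAt_const.div continuousAt_id hz0)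
    rw [e3, ← e2, ← e1, Complex.norm_real, norm_of_nonneg (by positivity)] at e4
    exact e4
  obtain ⟨K, hK⟩ := (isCompact_closedBall (0:ℂ) 1).exists_bound_of_continuousOn
    (f := f) (fun z hz => by
      simp only [mem_closedBall, dist_zero_right] at hz
      exact (hf z hz).continuousAt.continuousWithinAt)
  have hbd : ∀ s, 0 < s → s ≤ 1 → cnorm s f ≤ K := by
    intro s hs hs1
    have hK0 : 0 ≤ K := (norm_nonneg _).trans (hK 0 (by simp))
    refine abs_le_of_sq_le_sq' ?_ hK0 |>.2
    rw [cnorm_sq]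
    refine circleAverage_mono_on_of_le_circle
      (circleIntegrable_of_sphere hs.le ((hcont s hs1).norm.pow 2)) fun z hz => ?_
    simp only [mem_sphere, dist_zero_right, abs_of_nonneg hs.le] at hz
    have := hK z (by simpa using hz.trans_le hs1)
    gcongr
  set m := sSup ((fun s => cnorm s f) '' Set.Ioc 0 1) with hm
  have hbdd : BddAbove ((fun s => cnorm s f) '' Set.Ioc 0 1) :=
    ⟨K, by rintro _ ⟨s, hs, rfl⟩; exact hbd s hs.1 hs.2⟩
  have hle : ∀ s, 0 < s → s ≤ 1 → cnorm s f ≤ m := fun s h1 h2 =>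
    le_csSup hbdd ⟨s, ⟨h1, h2⟩, rfl⟩
  have h1m : 0 ≤ m := (cnorm_nonneg 1 f).trans (hle 1 one_pos le_rfl)
  have : m ≤ √(cnorm 1 f * m) := by
    refine csSup_le ⟨_, 1, by simp, rfl⟩ ?_
    rintro _ ⟨s, hs, rfl⟩
    refine Real.le_sqrt_of_sq_le ((key s hs.1 hs.2).trans ?_)
    exact mul_le_mul_of_nonneg_left (hle _ (by have := hs.1; positivity)
      (by nlinarith [hs.1, hs.2])) (cnorm_nonneg _ _)
  have h2 : m ^ 2 ≤ cnorm 1 f * m := by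
    have h3 := mul_nonneg (cnorm_nonneg 1 f) h1m
    calc m ^ 2 ≤ √(cnorm 1 f * m) ^ 2 := by gcongr
      _ = _ := Real.sq_sqrt h3
  refine (hle r hr hr1).trans ?_
  rcases h1m.eq_or_lt with h | h
  · rw [← h]; exact cnorm_nonneg _ _
  · nlinarith

end CircleAverages

lemma norm_ne_zero_of_pos {z : ℂ} {r : ℝ} (hr : 0 < r) (hz : r ≤ ‖z‖) : z ≠ 0 := by
  rintro rfl; simp at hz; linarith

lemma inv_eq_conj_of_norm_one {z : ℂ} (hz : ‖z‖ = 1) : z⁻¹ = starRingEnd ℂ z :=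
  (Complex.inv_eq_conj hz)

lemma norm_aeval_inv {D : ℝ[X]} {z : ℂ} (hz : ‖z‖ = 1) : ‖aeval z⁻¹ D‖ = ‖aeval z D‖ := by
  rw [inv_eq_conj_of_norm_one hz, aeval_conj, Complex.norm_conj]

lemma circleAverage_pow_mul_inv_pow (i j : ℕ) :
    circleAverage (fun z : ℂ => z ^ i * z⁻¹ ^ j) 0 1 = if i = j then 1 else 0 := by
  wlog h : j ≤ i generalizing i j
  · have hji := this j i (by omega)
    rw [← circleAverage_zero_one_congr_inv]
    refine Eq.trans (congrArg (fun g => circleAverage g 0 1) ?_) (hji.trans (by simp [eq_comm]))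
    ext z
    rw [inv_inv, mul_comm]
  have : circleAverage (fun z : ℂ => z ^ i * z⁻¹ ^ j) 0 1 =
      circleAverage (fun z : ℂ => z ^ (i - j)) 0 1 := by
    refine circleAverage_congr_sphere fun z hz => ?_
    have hz0 : z ≠ 0 := by rintro rfl; simp at hz
    rw [inv_pow, ← div_eq_mul_inv, div_eq_iff (pow_ne_zero _ hz0), ← pow_add]
    congr 1; omega
  rw [this, circleAverage_eq_center one_pos fun z _ => by fun_prop]
  by_cases hij : i = j
  · simp [hij]
  · simp [hij]; omega

/-- Parseval's identity for real polynomials on the unit circle. -/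
lemma circleAverage_aeval_mul (u v : ℝ[X]) {K : ℕ} (hu : u.natDegree < K) (hv : v.natDegree < K) :
    circleAverage (fun z : ℂ => aeval z u * aeval z⁻¹ v) 0 1 =
      ((∑ i ∈ Finset.range K, u.coeff i * v.coeff i : ℝ) : ℂ) := by
  have e : (fun z : ℂ => aeval z u * aeval z⁻¹ v) = fun z : ℂ => ∑ i ∈ Finset.range K,
      ∑ j ∈ Finset.range K, ((u.coeff i * v.coeff j : ℝ) : ℂ) • (z ^ i * z⁻¹ ^ j) := by
    ext z
    rw [aeval_eq_sum_range' hu, aeval_eq_sum_range' hv, Finset.sum_mul_sum]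
    refine Finset.sum_congr rfl fun i _ => Finset.sum_congr rfl fun j _ => ?_
    simp only [Complex.real_smul, smul_eq_mul]; push_cast; ring
  have hci : ∀ i j : ℕ, CircleIntegrable (fun z : ℂ => z ^ i * z⁻¹ ^ j) 0 1 := fun i j =>
    circleIntegrable_of_sphere zero_le_one (by
      refine (continuous_pow i).continuousOn.mul ((continuousOn_inv₀.mono ?_).pow j)
      rintro z hz rfl; simp at hz)
  rw [e, circleAverage_fun_sum]
  · push_cast
    refine Finset.sum_congr rfl fun i hi => ?_
    rw [circleAverage_fun_sum]
    · simp_rw [circleAverage_fun_smul, circleAverage_pow_mul_inv_pow]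
      simp [hi]
    · intro j _; exact (hci i j).const_fun_smul
  · intro i _
    exact CircleIntegrable.fun_sum _ fun j _ => (hci i j).const_fun_smul

lemma cnorm_aeval_sq (u : ℝ[X]) {K : ℕ} (hu : u.natDegree < K) :
    cnorm 1 (fun z => aeval z u) ^ 2 = ∑ i ∈ Finset.range K, u.coeff i * u.coeff i := by
  have h := circleAverage_aeval_mul u u hu hu
  have := Complex.ofRealCLM.circleAverage_comp_comm (c := 0) (R := 1)
    (f := fun z => ‖aeval z u‖ ^ 2) (circleIntegrable_of_sphere zero_le_one
      ((u.continuous_aeval).norm.pow 2).continuousOn)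
  simp only [Complex.ofRealCLM_apply] at this
  rw [cnorm_sq]
  apply Complex.ofReal_injective
  rw [← h, ← this]
  refine circleAverage_congr_sphere fun z hz => ?_
  simp only [mem_sphere, dist_zero_right, abs_one] at hz
  simp only [Function.comp, Complex.ofRealCLM_apply]
  rw [inv_eq_conj_of_norm_one hz, aeval_conj, Complex.mul_conj, Complex.normSq_eq_norm_sq]

/-- The data of a polynomial `D` without zeros in a disc of radius `1/r > 1`, such that
`z ^ (2n) D(z) / D(1/z)` is at most `M` on the circle of radius `r`. -/
structure OuterBound (D : ℝ[X]) (n : ℕ) (r M : ℝ) : Prop where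
  r_pos : 0 < r
  r_lt : r < 1
  ne : ∀ z : ℂ, ‖z‖ ≤ r⁻¹ → aeval z D ≠ 0
  M_nonneg : 0 ≤ M
  M_le : M ≤ 1 / 2
  bound : ∀ z : ℂ, ‖z‖ = r → ‖z ^ (2 * n) * aeval z D‖ ≤ M * ‖aeval z⁻¹ D‖

/-- The phase function `z ^ (2n) D(z) / D(1/z)`. -/
def phase (D : ℝ[X]) (n : ℕ) (z : ℂ) : ℂ := z ^ (2 * n) * aeval z D / aeval z⁻¹ D

namespace OuterBound

variable {D : ℝ[X]} {n : ℕ} {r M : ℝ}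

lemma ne_one (h : OuterBound D n r M) {z : ℂ} (hz : ‖z‖ ≤ 1) : aeval z D ≠ 0 :=
  h.ne z (hz.trans (one_le_inv_iff₀.2 ⟨h.r_pos, h.r_lt.le⟩))

lemma ne_inv (h : OuterBound D n r M) {z : ℂ} (hz : r ≤ ‖z‖) : aeval z⁻¹ D ≠ 0 := by
  refine h.ne _ ?_
  rw [norm_inv]
  exact inv_anti₀ h.r_pos hz

lemma norm_phase (h : OuterBound D n r M) {z : ℂ} (hz : ‖z‖ = 1) : ‖phase D n z‖ = 1 := by
  unfold phase
  rw [norm_div, norm_mul, norm_pow, hz, norm_aeval_inv hz, one_pow, one_mul, div_self]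
  exact norm_ne_zero_iff.2 (h.ne_one hz.le)

lemma norm_phase_le (h : OuterBound D n r M) {z : ℂ} (hz : ‖z‖ = r) : ‖phase D n z‖ ≤ M := by
  unfold phase
  rw [norm_div, div_le_iff₀ (norm_pos_iff.2 (h.ne_inv hz.ge))]
  exact h.bound z hz

lemma differentiableAt_phase (h : OuterBound D n r M) {z : ℂ} (hz : r ≤ ‖z‖) :
    DifferentiableAt ℂ (phase D n) z := by
  have hz0 := norm_ne_zero_of_pos h.r_pos hz
  unfold phase
  refine DifferentiableAt.div ?_ ?_ (h.ne_inv hz)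
  · exact (differentiableAt_id.pow _).mul (D.differentiable_aeval z)
  · exact (D.differentiable_aeval _).comp z (differentiableAt_inv hz0)

lemma continuousOn_phase (h : OuterBound D n r M) {s : ℝ} (hs : r ≤ s) :
    ContinuousOn (phase D n) (sphere 0 s) := fun z hz => by
  simp only [mem_sphere, dist_zero_right] at hz
  exact (h.differentiableAt_phase (hs.trans hz.ge)).continuousAt.continuousWithinAt

lemma norm_circleAverage_phase_mul_le (h : OuterBound D n r M) {g : ℂ → ℂ} {C : ℝ}
    (hg : ∀ z : ℂ, r ≤ ‖z‖ → ‖z‖ ≤ 1 → DifferentiableAt ℂ g z)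
    (hgC : ∀ z : ℂ, ‖z‖ = r → ‖g z‖ ≤ C) :
    ‖circleAverage (fun z => phase D n z * g z) 0 1‖ ≤ M * C := by
  rw [← circleAverage_eq_of_annulus (f := fun z => phase D n z * g z) h.r_pos h.r_lt.le
    fun z h1 h2 => (h.differentiableAt_phase h1).mul (hg z h1 h2)]
  refine norm_circleAverage_le_of_bound h.r_pos.le ?_ fun z hz => ?_
  · refine (h.continuousOn_phase le_rfl).mul fun z hz => ?_
    simp only [mem_sphere, dist_zero_right] at hz
    exact (hg z hz.ge (hz.trans_le h.r_lt.le)).continuousAt.continuousWithinAt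
  · rw [norm_mul]
    exact mul_le_mul (h.norm_phase_le hz) (hgC z hz) (norm_nonneg _) h.M_nonneg

lemma norm_circleAverage_phase_mul_mul_le (h : OuterBound D n r M) {A B : ℂ → ℂ}
    (hA : ∀ z : ℂ, ‖z‖ ≤ 1 → DifferentiableAt ℂ A z)
    (hA' : ∀ z, A (starRingEnd ℂ z) = starRingEnd ℂ (A z))
    (hB : ∀ z : ℂ, ‖z‖ ≤ 1 → DifferentiableAt ℂ B z)
    (hB' : ∀ z, B (starRingEnd ℂ z) = starRingEnd ℂ (B z)) :
    ‖circleAverage (fun z => phase D n z * (A z * B z)) 0 1‖ ≤ M * (cnorm 1 A * cnorm 1 B) := by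
  rw [← circleAverage_eq_of_annulus (f := fun z => phase D n z * (A z * B z)) h.r_pos h.r_lt.le
    fun z h1 h2 => (h.differentiableAt_phase h1).mul ((hA z h2).mul (hB z h2))]
  have cA : ContinuousOn A (sphere 0 r) := fun z hz => by
    simp only [mem_sphere, dist_zero_right] at hz
    exact (hA z (hz.trans_le h.r_lt.le)).continuousAt.continuousWithinAt
  have cB : ContinuousOn B (sphere 0 r) := fun z hz => by
    simp only [mem_sphere, dist_zero_right] at hz
    exact (hB z (hz.trans_le h.r_lt.le)).continuousAt.continuousWithinAt
  have i1 : circleAverage (fun z => ‖phase D n z * (A z * B z)‖) 0 r ≤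
      circleAverage (fun z => M • (‖A z‖ * ‖B z‖)) 0 r := by
    refine circleAverage_mono (circleIntegrable_of_sphere h.r_pos.le
      ((h.continuousOn_phase le_rfl).mul (cA.mul cB)).norm)
      (circleIntegrable_of_sphere h.r_pos.le ((cA.norm.mul cB.norm).const_smul M)) fun z hz => ?_
    simp only [mem_sphere, dist_zero_right, abs_of_pos h.r_pos] at hz
    rw [norm_mul, norm_mul, smul_eq_mul]
    exact mul_le_mul_of_nonneg_right (h.norm_phase_le hz) (by positivity)
  rw [circleAverage_fun_smul, smul_eq_mul] at i1
  refine (norm_circleAverage_le.trans i1).trans (mul_le_mul_of_nonneg_left ?_ h.M_nonneg)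
  refine (circleAverage_norm_mul_le h.r_pos.le cA cB).trans ?_
  exact mul_le_mul (cnorm_le_cnorm_one hA hA' h.r_pos h.r_lt.le)
    (cnorm_le_cnorm_one hB hB' h.r_pos h.r_lt.le) (cnorm_nonneg _ _) (cnorm_nonneg _ _)

end OuterBound

/-- The weighted least squares approximation of `1` by `Φ D`, `deg Φ ≤ 2n`. -/
lemma exists_orthogonal_approx {D : ℝ[X]} (hD : D ≠ 0) (n : ℕ) {K : ℕ}
    (hK : 2 * n + D.natDegree < K) :
    ∃ Φ : ℝ[X], Φ.natDegree ≤ 2 * n ∧ ∀ k ≤ 2 * n,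
      ∑ i ∈ Finset.range K, (X ^ k * D).coeff i * (1 - Φ * D).coeff i = 0 := by
  set N := 2 * n + 1
  let e := (degreeLTEquiv ℝ N).symm
  let T : (Fin N → ℝ) →ₗ[ℝ] (Fin N → ℝ) :=
    { toFun := fun v k => ∑ i ∈ Finset.range K,
        (X ^ (k : ℕ) * D).coeff i * (((e v : degreeLT ℝ N) : ℝ[X]) * D).coeff i
      map_add' := fun v w => by
        ext k
        simp only [map_add, Submodule.coe_add, add_mul, coeff_add, mul_add, Finset.sum_add_distrib,
          Pi.add_apply]
      map_smul' := fun c v => by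
        ext k
        simp only [map_smul, Submodule.coe_smul, smul_mul_assoc, coeff_smul, smul_eq_mul,
          RingHom.id_apply, Pi.smul_apply, Finset.mul_sum]
        exact Finset.sum_congr rfl fun i _ => by ring }
  have hT : Function.Injective T := by
    rw [← LinearMap.ker_eq_bot, LinearMap.ker_eq_bot']
    intro v hv
    set Φ : ℝ[X] := ((e v : degreeLT ℝ N) : ℝ[X]) with hΦ
    have hdeg : Φ.natDegree < N := by
      have := (e v).2
      rw [mem_degreeLT] at this
      by_cases h0 : Φ = 0
      · rw [h0]; simp [N]
      · exact (natDegree_lt_iff_degree_lt h0).2 this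
    have h0 : ∑ i ∈ Finset.range K, (Φ * D).coeff i * (Φ * D).coeff i = 0 := by
      have h1 : Φ * D = ∑ k ∈ Finset.range N, C (Φ.coeff k) * (X ^ k * D) := by
        conv_lhs => rw [Φ.as_sum_range' N hdeg, Finset.sum_mul]
        refine Finset.sum_congr rfl fun k _ => ?_
        rw [← C_mul_X_pow_eq_monomial, mul_assoc]
      have h2 : ∀ i, (Φ * D).coeff i = ∑ k ∈ Finset.range N, Φ.coeff k * (X ^ k * D).coeff i := by
        intro i
        conv_lhs => rw [h1, finsetSum_coeff]
        simp only [coeff_C_mul]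
      calc _ = ∑ i ∈ Finset.range K, ∑ k ∈ Finset.range N,
            Φ.coeff k * ((X ^ k * D).coeff i * (Φ * D).coeff i) := by
            refine Finset.sum_congr rfl fun i _ => ?_
            conv_lhs => enter [1]; rw [h2 i]
            rw [Finset.sum_mul]
            exact Finset.sum_congr rfl fun k _ => by ring
        _ = ∑ k ∈ Finset.range N, Φ.coeff k * ∑ i ∈ Finset.range K,
            (X ^ k * D).coeff i * (Φ * D).coeff i := by
            rw [Finset.sum_comm]; simp only [Finset.mul_sum]
        _ = 0 := by
            refine Finset.sum_eq_zero fun k hk => ?_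
            have := congrFun hv ⟨k, Finset.mem_range.1 hk⟩
            simp only [T, LinearMap.coe_mk, AddHom.coe_mk, Pi.zero_apply] at this
            rw [this, mul_zero]
    have h3 : Φ * D = 0 := by
      ext i
      by_cases hi : i < K
      · have := (Finset.sum_eq_zero_iff_of_nonneg fun i _ => mul_self_nonneg _).1 h0 i
          (Finset.mem_range.2 hi)
        simpa using this
      · refine coeff_eq_zero_of_natDegree_lt (lt_of_le_of_lt (natDegree_mul_le) ?_)
        omega
    have h4 : Φ = 0 := (mul_eq_zero.1 h3).resolve_right hD
    have h5 : e v = 0 := Subtype.ext h4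
    simpa [e] using h5
  obtain ⟨v, hv⟩ := (LinearMap.injective_iff_surjective.1 hT)
    (fun k => ∑ i ∈ Finset.range K, (X ^ (k : ℕ) * D).coeff i * (1 : ℝ[X]).coeff i)
  refine ⟨((e v : degreeLT ℝ N) : ℝ[X]), ?_, fun k hk => ?_⟩
  · have := (e v).2
    rw [mem_degreeLT] at this
    by_cases h0 : ((e v : degreeLT ℝ N) : ℝ[X]) = 0
    · rw [h0]; simp
    · have := (natDegree_lt_iff_degree_lt h0).2 this; omega
  · have := congrFun hv ⟨k, by omega⟩
    simp only [T, LinearMap.coe_mk, AddHom.coe_mk] at this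
    simp only [coeff_sub, mul_sub, Finset.sum_sub_distrib]
    rw [this, sub_self]

lemma aeval_reflect {m : ℕ} {f : ℝ[X]} (hf : f.natDegree ≤ m) {z : ℂ} (hz : z ≠ 0) :
    aeval z (f.reflect m) = z ^ m * aeval z⁻¹ f := by
  let : Invertible z⁻¹ := invertibleOfNonzero (inv_ne_zero hz)
  have h := eval₂_reflect_mul_pow (algebraMap ℝ ℂ) z⁻¹ m f hf
  rw [invOf_eq_inv, inv_inv] at h
  rw [aeval_def, aeval_def, ← h, inv_pow]
  field_simp

lemma natDegree_reflect_le' {m : ℕ} {f : ℝ[X]} (hf : f.natDegree ≤ m) :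
    (f.reflect m).natDegree ≤ m := by
  rw [natDegree_le_iff_coeff_eq_zero]
  intro N hN
  rw [coeff_reflect, revAt_eq_self_of_lt hN]
  exact coeff_eq_zero_of_natDegree_lt (by omega)

/-- Coefficients of `z ^ m D(1/z) η(z)` are inner products of `η` with shifts of `D`. -/
lemma coeff_reflect_mul {D η : ℝ[X]} {m k K : ℕ} (hm : D.natDegree ≤ m) (hK : m + k < K) :
    (D.reflect m * η).coeff (m + k) = ∑ i ∈ Finset.range K, (X ^ k * D).coeff i * η.coeff i := by
  rw [mul_comm, coeff_mul, Finset.Nat.sum_antidiagonal_eq_sum_range_succ_mk]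
  rw [← Finset.sum_subset (Finset.range_subset_range.2 (show (m + k).succ ≤ K by omega))]
  · refine Finset.sum_congr rfl fun i hi => ?_
    have hi' : i ≤ m + k := by simpa [Nat.lt_succ_iff] using hi
    rw [coeff_X_pow_mul', coeff_reflect, mul_comm]
    congr 1
    split_ifs with h
    · rw [revAt_le (by omega)]; congr 1; omega
    · rw [revAt_eq_self_of_lt (by omega)]
      exact coeff_eq_zero_of_natDegree_lt (by omega)
  · intro i _ hi
    have : m + k < i := by simpa using hi
    rw [coeff_X_pow_mul', if_pos (by omega), coeff_eq_zero_of_natDegree_lt (by omega), zero_mul]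

namespace OuterBound

variable {D : ℝ[X]} {n : ℕ} {r M : ℝ}

lemma quotient_differentiableAt (h : OuterBound D n r M) (U : ℝ[X]) {z : ℂ} (hz : ‖z‖ ≤ 1) :
    DifferentiableAt ℂ (fun z => aeval z U / aeval z D) z :=
  (U.differentiable_aeval z).div (D.differentiable_aeval z) (h.ne_one hz)

lemma quotient_conj (U : ℝ[X]) (z : ℂ) : aeval (starRingEnd ℂ z) U / aeval (starRingEnd ℂ z) D =
    starRingEnd ℂ (aeval z U / aeval z D) := by
  rw [map_div₀, aeval_conj, aeval_conj]

/-- The function `1` is close in `L²` of the unit circle to `Φ D` with `deg Φ ≤ 2n`. -/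
lemma exists_approx (h : OuterBound D n r M) : ∃ Φ : ℝ[X], Φ.natDegree ≤ 2 * n ∧
    cnorm 1 (fun z => aeval z (1 - Φ * D)) ≤ 2 * M := by
  have hD : D ≠ 0 := by
    rintro rfl
    exact h.ne_one (z := 0) (by simp) (by simp)
  set m := D.natDegree with hm
  obtain ⟨Φ, hΦ, horth⟩ := exists_orthogonal_approx hD n (K := 2 * n + m + 1) (by omega)
  set K := 2 * n + m + 1
  refine ⟨Φ, hΦ, ?_⟩
  set η := 1 - Φ * D with hη
  have hΦD : (Φ * D).natDegree ≤ 2 * n + m := natDegree_mul_le.trans (by omega)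
  have hηdeg : η.natDegree < K := by
    refine lt_of_le_of_lt ((natDegree_sub_le _ _)) ?_
    simp only [natDegree_one]; omega
  have hsq : cnorm 1 (fun z => aeval z η) ^ 2 = η.coeff 0 := by
    rw [cnorm_aeval_sq η hηdeg]
    have e1 : ∀ i, η.coeff i * η.coeff i = (1 : ℝ[X]).coeff i * η.coeff i -
        ∑ k ∈ Finset.range (2 * n + 1), Φ.coeff k * ((X ^ k * D).coeff i * η.coeff i) := by
      intro i
      have h1 : Φ * D = ∑ k ∈ Finset.range (2 * n + 1), C (Φ.coeff k) * (X ^ k * D) := by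
        conv_lhs => rw [Φ.as_sum_range' (2 * n + 1) (by omega), Finset.sum_mul]
        refine Finset.sum_congr rfl fun k _ => ?_
        rw [← C_mul_X_pow_eq_monomial, mul_assoc]
      conv_lhs => enter [1]; rw [hη, coeff_sub, h1, finsetSum_coeff]
      simp only [coeff_C_mul, sub_mul, Finset.sum_mul, mul_assoc]
    simp_rw [e1]
    rw [Finset.sum_sub_distrib, Finset.sum_comm]
    have e2 : ∑ k ∈ Finset.range (2 * n + 1), ∑ i ∈ Finset.range K,
        Φ.coeff k * ((X ^ k * D).coeff i * η.coeff i) = 0 := by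
      refine Finset.sum_eq_zero fun k hk => ?_
      rw [← Finset.mul_sum, horth k (by simpa [Nat.lt_succ_iff] using hk), mul_zero]
    rw [e2, sub_zero, Finset.sum_eq_single 0]
    · simp
    · intro i _ hi; rw [coeff_one, if_neg hi, zero_mul]
    · simp [K]
  set Q := D.reflect m * η with hQ
  set N := m + (2 * n + 1) with hN
  have hmonic : (X ^ N : ℝ[X]).Monic := monic_X_pow N
  set L := Q %ₘ X ^ N with hL
  set G := Q /ₘ X ^ N with hG
  have hdiv : L + X ^ N * G = Q := modByMonic_add_div Q (X ^ N)
  have hLdeg : L.natDegree ≤ m ∧ L.coeff m = 0 := by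
    have hc : ∀ i, m ≤ i → L.coeff i = 0 := by
      intro i hi
      by_cases hiN : i < N
      · have h1 : Q.coeff i = L.coeff i := by
          rw [← hdiv, coeff_add, coeff_X_pow_mul', if_neg (by omega), add_zero]
        rw [← h1, hQ, show i = m + (i - m) by omega,
          coeff_reflect_mul (K := K) le_rfl (by omega)]
        exact horth _ (by omega)
      · refine coeff_eq_zero_of_degree_lt ((degree_modByMonic_lt Q hmonic).trans_le ?_)
        rw [degree_X_pow]; exact_mod_cast not_lt.1 hiN
    exact ⟨natDegree_le_iff_coeff_eq_zero.2 fun i hi => hc i hi.le, hc m le_rfl⟩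
  set U := L.reflect m with hU
  have hU0 : U.coeff 0 = 0 := by
    rw [hU, coeff_reflect, revAt_le (Nat.zero_le _), Nat.sub_zero, hLdeg.2]
  let A : ℂ → ℂ := fun z => aeval z U / aeval z D
  let B : ℂ → ℂ := fun z => aeval z (X * G) / aeval z D
  have hA := fun z hz => h.quotient_differentiableAt U (z := z) hz
  have hB := fun z hz => h.quotient_differentiableAt (X * G) (z := z) hz
  have hA' := quotient_conj (D := D) U
  have hB' := quotient_conj (D := D) (X * G)
  have hA0 : A 0 = 0 := by
    simp [A, hU0, aeval_def, eval₂_at_zero]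
  have cA : ContinuousOn A (sphere 0 1) := fun z hz => by
    simp only [mem_sphere, dist_zero_right] at hz
    exact (hA z hz.le).continuousAt.continuousWithinAt
  have cB : ContinuousOn B (sphere 0 1) := fun z hz => by
    simp only [mem_sphere, dist_zero_right] at hz
    exact (hB z hz.le).continuousAt.continuousWithinAt
  have cP := h.continuousOn_phase (s := 1) h.r_lt.le
  have cAc : ContinuousOn (fun z => starRingEnd ℂ (A z)) (sphere 0 1) :=
    Complex.continuous_conj.comp_continuousOn cA
  have cPB : ContinuousOn (fun z => phase D n z * B z) (sphere 0 1) := cP.mul cB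
  have hdec : ∀ z : ℂ, ‖z‖ = 1 →
      aeval z η = starRingEnd ℂ (A z) + phase D n z * B z := by
    intro z hz
    have hz0 : z ≠ 0 := by rintro rfl; simp at hz
    have hi : z⁻¹ = starRingEnd ℂ z := inv_eq_conj_of_norm_one hz
    have d1 := h.ne_one hz.le
    have d2 : aeval z⁻¹ D ≠ 0 := h.ne_one (by rw [norm_inv, hz, inv_one])
    have h1 : z ^ m * aeval z⁻¹ D * aeval z η = aeval z L + z ^ N * aeval z G := by
      rw [← aeval_reflect le_rfl hz0, ← map_mul, ← hQ, ← hdiv, map_add, map_mul, map_pow, aeval_X]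
    have h2 : aeval z L = z ^ m * aeval z⁻¹ U := by
      have := aeval_reflect (m := m) (f := U) (natDegree_reflect_le' hLdeg.1) hz0
      rw [hU, reflect_reflect] at this
      exact this
    have h3 : starRingEnd ℂ (A z) = aeval z⁻¹ U / aeval z⁻¹ D := by
      simp only [A]; rw [← hA', hi]
    rw [h3, phase]
    simp only [B, map_mul, aeval_X]
    have hzm : z ^ m ≠ 0 := pow_ne_zero _ hz0
    apply mul_left_cancel₀ (mul_ne_zero hzm d2)
    rw [h1, h2, hN]
    generalize aeval z⁻¹ D = d at *
    generalize aeval z⁻¹ U = u at *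
    generalize aeval z D = d' at *
    field_simp
    ring
  have havA : circleAverage (fun z => starRingEnd ℂ (A z)) 0 1 = 0 := by
    have := (Complex.conjCLE : ℂ →L[ℝ] ℂ).circleAverage_comp_comm (c := 0) (R := 1) (f := A)
      (circleIntegrable_of_sphere zero_le_one cA)
    have e : circleAverage A 0 1 = 0 := by rw [circleAverage_eq_center one_pos hA]; exact hA0
    rw [e] at this
    simpa [Function.comp_def] using this
  have hη0 : ((η.coeff 0 : ℝ) : ℂ) = circleAverage (fun z => phase D n z * B z) 0 1 := by
    have e1 : circleAverage (fun z => aeval z η) 0 1 = ((η.coeff 0 : ℝ) : ℂ) := by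
      rw [circleAverage_eq_center one_pos fun z _ => η.differentiable_aeval z]
      simp [aeval_def, eval₂_at_zero]
    rw [← e1]
    have e2 : circleAverage (fun z => aeval z η) 0 1 =
        circleAverage (fun z => starRingEnd ℂ (A z) + phase D n z * B z) 0 1 := by
      refine circleAverage_congr_sphere fun z hz => ?_
      simp only [mem_sphere, dist_zero_right, abs_one] at hz
      exact hdec z hz
    rw [e2, circleAverage_fun_add (circleIntegrable_of_sphere zero_le_one cAc)
      (circleIntegrable_of_sphere zero_le_one cPB), havA, zero_add]
  have hone : cnorm 1 (fun _ => (1 : ℂ)) = 1 := by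
    simp [cnorm, circleAverage_const]
  have hb1 : η.coeff 0 ≤ M * cnorm 1 B := by
    have := h.norm_circleAverage_phase_mul_mul_le (A := fun _ => 1) (B := B)
      (fun z _ => differentiableAt_const _) (fun z => by simp) hB hB'
    simp only [one_mul, hone] at this
    rw [← hη0, Complex.norm_real] at this
    exact (le_abs_self _).trans this
  have hcr := h.norm_circleAverage_phase_mul_mul_le hA hA' hB hB'
  have hlow : cnorm 1 A ^ 2 + cnorm 1 B ^ 2 - 2 * (M * (cnorm 1 A * cnorm 1 B)) ≤
      cnorm 1 (fun z => aeval z η) ^ 2 := by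
    rw [cnorm_sq, cnorm_sq, cnorm_sq]
    have e : circleAverage (fun z => ‖aeval z η‖ ^ 2) 0 1 = circleAverage (fun z =>
        (‖A z‖ ^ 2 + ‖B z‖ ^ 2) + (2:ℝ) • (phase D n z * (A z * B z)).re) 0 1 := by
      refine circleAverage_congr_sphere fun z hz => ?_
      simp only [mem_sphere, dist_zero_right, abs_one] at hz
      have hp := h.norm_phase hz
      rw [hdec z hz, ← Complex.normSq_eq_norm_sq, Complex.normSq_add, Complex.normSq_eq_norm_sq,
        Complex.normSq_eq_norm_sq, Complex.norm_conj, norm_mul, hp, one_mul, smul_eq_mul]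
      congr 2
      rw [← Complex.conj_re]
      congr 1
      simp only [map_mul, Complex.conj_conj]
      ring
    have cPAB : ContinuousOn (fun z => phase D n z * (A z * B z)) (sphere 0 1) :=
      cP.mul (cA.mul cB)
    have i4 := circleIntegrable_of_sphere zero_le_one cPAB
    have e3 := Complex.reCLM.circleAverage_comp_comm (c := 0) (R := 1) i4
    simp only [Complex.reCLM_apply, Function.comp_def] at e3
    have cre : ContinuousOn (fun z => (phase D n z * (A z * B z)).re) (sphere 0 1) :=
      Complex.continuous_re.comp_continuousOn cPAB
    rw [e, circleAverage_fun_add, circleAverage_fun_add, circleAverage_fun_smul, e3, smul_eq_mul]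
    · have := (abs_le.1 ((Complex.abs_re_le_norm _).trans hcr)).1
      linarith
    · exact circleIntegrable_of_sphere zero_le_one (cA.norm.pow 2)
    · exact circleIntegrable_of_sphere zero_le_one (cB.norm.pow 2)
    · exact circleIntegrable_of_sphere zero_le_one ((cA.norm.pow 2).add (cB.norm.pow 2))
    · exact circleIntegrable_of_sphere zero_le_one (cre.const_smul (2:ℝ))
  have hM := h.M_nonneg
  have hM2 := h.M_le
  have nA := cnorm_nonneg 1 A
  have nB := cnorm_nonneg 1 B
  set x := cnorm 1 (fun z => aeval z η)
  have nx : 0 ≤ x := cnorm_nonneg _ _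
  have h5 : cnorm 1 B ^ 2 / 2 ≤ x ^ 2 := by
    nlinarith [sq_nonneg (cnorm 1 A - cnorm 1 B), mul_nonneg nA nB]
  have h6 : cnorm 1 B ≤ 2 * x := by
    refine abs_le_of_sq_le_sq' ?_ (by positivity) |>.2
    nlinarith
  have h7 : x ^ 2 ≤ M * (2 * x) := by
    rw [hsq]; exact hb1.trans (mul_le_mul_of_nonneg_left h6 hM)
  rcases nx.eq_or_lt with h8 | h8
  · rw [← h8]; positivity
  · nlinarith

end OuterBound

/-- The Joukowski map with centre `m` and capacity `a`. -/
def jk (m a : ℝ) (z : ℂ) : ℂ := m + a * (z + z⁻¹)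

/-- The numerator `a z² + m z + a` of the Joukowski map. -/
def jpoly (m a : ℝ) : ℝ[X] := C a * X ^ 2 + C m * X + C a

lemma aeval_jpoly {m a : ℝ} {z : ℂ} (hz : z ≠ 0) : aeval z (jpoly m a) = z * jk m a z := by
  simp only [jpoly, jk, map_add, map_mul, aeval_C, aeval_X, map_pow, Complex.coe_algebraMap]
  field_simp
  ring

lemma natDegree_jpoly_le (m a : ℝ) : (jpoly m a).natDegree ≤ 2 := by
  unfold jpoly; compute_degree

lemma jpoly_coeff_zero (m a : ℝ) : (jpoly m a).coeff 0 = a := by simp [jpoly]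

lemma reflect_jpoly (m a : ℝ) : (jpoly m a).reflect 2 = jpoly m a := by
  ext i
  rw [coeff_reflect]
  rcases le_or_gt i 2 with hi | hi
  · rw [revAt_le hi]
    interval_cases i <;> simp [jpoly, coeff_X, coeff_C]
  · rw [revAt_eq_self_of_lt hi]

lemma natDegree_jpoly_pow_le (m a : ℝ) (n : ℕ) : ((jpoly m a) ^ n).natDegree ≤ 2 * n :=
  natDegree_pow_le.trans (by have := natDegree_jpoly_le m a; nlinarith)

lemma reflect_jpoly_pow (m a : ℝ) (n : ℕ) :
    ((jpoly m a) ^ n).reflect (2 * n) = (jpoly m a) ^ n := by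
  induction n with
  | zero => rw [pow_zero, Nat.mul_zero, ← C_1, reflect_C, pow_zero, mul_one]
  | succ n ih =>
    rw [pow_succ, show 2 * (n + 1) = 2 * n + 2 by ring,
      reflect_mul _ _ (natDegree_jpoly_pow_le m a n) (natDegree_jpoly_le m a), ih, reflect_jpoly]

/-- The polynomial `z ^ n P(m + a (z + 1/z))`. -/
def jlift (m a : ℝ) (n : ℕ) (P : ℝ[X]) : ℝ[X] :=
  ∑ k ∈ Finset.range (n + 1), C (P.coeff k) * (X ^ (n - k) * (jpoly m a) ^ k)

lemma aeval_jlift {m a : ℝ} {n : ℕ} {P : ℝ[X]} (hP : P.natDegree ≤ n) {z : ℂ} (hz : z ≠ 0) :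
    aeval z (jlift m a n P) = z ^ n * aeval (jk m a z) P := by
  rw [jlift, map_sum, aeval_eq_sum_range' (Nat.lt_succ_of_le hP), Finset.mul_sum]
  refine Finset.sum_congr rfl fun k hk => ?_
  have hk' : k ≤ n := by simpa [Nat.lt_succ_iff] using hk
  simp only [map_mul, aeval_C, map_pow, aeval_X, aeval_jpoly hz, Complex.coe_algebraMap,
    Complex.real_smul]
  rw [mul_pow, show z ^ n = z ^ (n - k) * z ^ k by rw [← pow_add]; congr 1; omega]
  ring

lemma jlift_coeff_zero {m a : ℝ} {n : ℕ} {P : ℝ[X]} :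
    (jlift m a n P).coeff 0 = P.coeff n * a ^ n := by
  rw [jlift, finsetSum_coeff, Finset.sum_eq_single n]
  · simp [coeff_zero_eq_eval_zero, jpoly]
  · intro k hk hkn
    have hk' : k ≤ n := by simpa [Nat.lt_succ_iff] using hk
    have : n - k ≠ 0 := by omega
    simp [coeff_zero_eq_eval_zero, this]
  · simp

lemma exists_of_palindromic (m : ℝ) {a : ℝ} (ha : a ≠ 0) (n : ℕ) : ∀ G : ℝ[X],
    G.natDegree ≤ 2 * n → G.reflect (2 * n) = G → ∃ P : ℝ[X], P.natDegree ≤ n ∧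
      P.coeff n = G.coeff 0 / a ^ n ∧ ∀ z : ℂ, z ≠ 0 → z ^ n * aeval (jk m a z) P = aeval z G := by
  induction n with
  | zero =>
    intro G hG _
    refine ⟨G, by simpa using hG, by simp, fun z _ => ?_⟩
    have : G = C (G.coeff 0) := eq_C_of_natDegree_eq_zero (by simpa using hG)
    rw [this]; simp
  | succ n ih =>
    intro G hG hrefl
    set g := G.coeff 0 / a ^ (n + 1) with hg
    set H := G - C g * (jpoly m a) ^ (n + 1) with hH
    have hHr : H.reflect (2 * (n + 1)) = H := by
      rw [hH, reflect_sub, hrefl, reflect_C_mul, reflect_jpoly_pow]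
    have hHd : H.natDegree ≤ 2 * (n + 1) :=
      (natDegree_sub_le _ _).trans (max_le hG ((natDegree_C_mul_le _ _).trans
        (natDegree_jpoly_pow_le _ _ _)))
    have hH0 : H.coeff 0 = 0 := by
      rw [hH, coeff_sub, coeff_C_mul]
      simp only [coeff_zero_eq_eval_zero, eval_pow]
      rw [← coeff_zero_eq_eval_zero, ← coeff_zero_eq_eval_zero, jpoly_coeff_zero, hg,
        div_mul_cancel₀ _ (pow_ne_zero _ ha), sub_self]
    have hHs : ∀ i ≤ 2 * (n + 1), H.coeff (2 * (n + 1) - i) = H.coeff i := by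
      intro i hi
      conv_rhs => rw [← hHr, coeff_reflect, revAt_le hi]
    have hd1 : H.divX.natDegree ≤ 2 * n := by
      rw [natDegree_le_iff_coeff_eq_zero]
      intro N hN
      rw [coeff_divX]
      rcases (show 2 * n + 2 ≤ N + 1 by omega).eq_or_lt with h | h
      · rw [← h]
        have := hHs 0 (by omega)
        rw [hH0] at this
        rw [← this]; congr 1
      · exact coeff_eq_zero_of_natDegree_lt (by omega)
    have hd2 : H.divX.reflect (2 * n) = H.divX := by
      ext i
      rw [coeff_reflect]
      rcases le_or_gt i (2 * n) with hi | hi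
      · rw [revAt_le hi, coeff_divX, coeff_divX, ← hHs (i + 1) (by omega)]
        congr 1; omega
      · rw [revAt_eq_self_of_lt hi]
    obtain ⟨P, hP1, -, hP3⟩ := ih _ hd1 hd2
    refine ⟨C g * X ^ (n + 1) + P, ?_, ?_, fun z hz => ?_⟩
    · exact (natDegree_add_le _ _).trans (max_le (natDegree_C_mul_X_pow_le _ _) (by omega))
    · rw [coeff_add, coeff_C_mul_X_pow, if_pos rfl, coeff_eq_zero_of_natDegree_lt (by omega),
        add_zero]
    · have e : G = X * H.divX + C g * (jpoly m a) ^ (n + 1) := by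
        have := X_mul_divX_add H
        rw [hH0, C_0, add_zero] at this
        rw [this, hH]; ring
      rw [e, map_add, map_add, map_mul (aeval z) X, aeval_X, ← hP3 z hz, map_mul, map_mul,
        map_pow, map_pow, aeval_X, aeval_jpoly hz, aeval_C, aeval_C]
      rw [mul_pow]; ring

lemma jk_inv (m a : ℝ) (z : ℂ) : jk m a z⁻¹ = jk m a z := by
  simp [jk, add_comm]

/-- The function `z ^ n P(x(z)) D(z)`. -/
def szegoFun (m a : ℝ) (n : ℕ) (D P : ℝ[X]) (z : ℂ) : ℂ :=
  z ^ n * aeval (jk m a z) P * aeval z D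

namespace OuterBound

variable {D : ℝ[X]} {n : ℕ} {r M : ℝ}

/-- Lower bound for the weighted `L²` norm of monic polynomials. -/
lemma lower_bound (h : OuterBound D n r M) (m : ℝ) {a : ℝ} {P : ℝ[X]} (hP : P.Monic)
    (hPd : P.natDegree = n) :
    2 * (a ^ n * D.coeff 0) ^ 2 / (1 + M) ≤ cnorm 1 (szegoFun m a n ((1 - X ^ 2) * D) P) ^ 2 := by
  set Q := jlift m a n P * ((1 - X ^ 2) * D) with hQ
  set S : ℂ → ℂ := fun z => aeval z Q with hS
  have hSeq : ∀ z : ℂ, z ≠ 0 → S z = szegoFun m a n ((1 - X ^ 2) * D) P z := by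
    intro z hz
    simp only [hS, hQ, szegoFun]
    rw [map_mul, aeval_jlift hPd.le hz]
  have hcn : cnorm 1 (szegoFun m a n ((1 - X ^ 2) * D) P) = cnorm 1 S := by
    refine cnorm_congr zero_le_one fun z hz => ?_
    rw [hSeq z (by rintro rfl; simp at hz)]
  rw [hcn]
  have hS0 : S 0 = ((a ^ n * D.coeff 0 : ℝ) : ℂ) := by
    have : Q.coeff 0 = a ^ n * D.coeff 0 := by
      rw [hQ, mul_coeff_zero, jlift_coeff_zero, mul_coeff_zero, ← hPd, hP.coeff_natDegree]
      simp
    rw [← this, hS]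
    simp [aeval_def, eval₂_at_zero]
  have cS : ContinuousOn S (sphere 0 1) := (Q.continuous_aeval).continuousOn
  have havS : circleAverage S 0 1 = ((a ^ n * D.coeff 0 : ℝ) : ℂ) := by
    exact (circleAverage_eq_center one_pos fun z _ => Q.differentiable_aeval z).trans hS0
  have cP := h.continuousOn_phase (s := 1) h.r_lt.le
  set ψ : ℂ → ℂ := fun z => z ^ 2 * phase D n z with hψ
  have cψ : ContinuousOn ψ (sphere 0 1) := (continuous_pow 2).continuousOn.mul cP
  have hrel : ∀ z : ℂ, ‖z‖ = 1 → starRingEnd ℂ (ψ z) * S z = - starRingEnd ℂ (S z) := by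
    intro z hz
    have hz0 : z ≠ 0 := by rintro rfl; simp at hz
    have hi := inv_eq_conj_of_norm_one hz
    have hzi : z⁻¹ ≠ 0 := inv_ne_zero hz0
    have d1 := h.ne_one hz.le
    have d2 : aeval z⁻¹ D ≠ 0 := h.ne_one (by rw [norm_inv, hz, inv_one])
    have e1 : starRingEnd ℂ (S z) = S z⁻¹ := by
      simp only [hS]; rw [hi, aeval_conj]
    have e2 : starRingEnd ℂ (ψ z) = ψ z⁻¹ := by
      simp only [hψ, phase, map_mul, map_pow, map_div₀, ← aeval_conj, map_inv₀, ← hi]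
    rw [e1, e2, hSeq z hz0, hSeq _ hzi]
    simp only [szegoFun, hψ, phase, jk_inv, inv_inv, map_mul, map_sub, map_one, map_pow, aeval_X,
      inv_pow, two_mul, pow_add]
    have hzn : z ^ n ≠ 0 := pow_ne_zero _ hz0
    generalize z ^ n = y at *
    generalize aeval z⁻¹ D = d at *
    generalize aeval z D = d' at *
    generalize aeval (jk m a z) P = p
    field_simp
    ring
  have hav : circleAverage (fun z => starRingEnd ℂ (1 - ψ z) * S z) 0 1 =
      ((2 * (a ^ n * D.coeff 0) : ℝ) : ℂ) := by
    have e1 : circleAverage (fun z => starRingEnd ℂ (1 - ψ z) * S z) 0 1 =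
        circleAverage (fun z => S z + starRingEnd ℂ (S z)) 0 1 := by
      refine circleAverage_congr_sphere fun z hz => ?_
      simp only [mem_sphere, dist_zero_right, abs_one] at hz
      simp only [map_sub, map_one, sub_mul, one_mul, hrel z hz]
      ring
    have cSc : ContinuousOn (fun z => starRingEnd ℂ (S z)) (sphere 0 1) :=
      Complex.continuous_conj.comp_continuousOn cS
    have e2 := (Complex.conjCLE : ℂ →L[ℝ] ℂ).circleAverage_comp_comm (c := 0) (R := 1) (f := S)
      (circleIntegrable_of_sphere zero_le_one cS)
    rw [havS] at e2
    have e3 : circleAverage (fun z => starRingEnd ℂ (S z)) 0 1 =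
        ((a ^ n * D.coeff 0 : ℝ) : ℂ) := by
      refine Eq.trans ?_ (e2.trans (Complex.conj_ofReal _))
      rfl
    rw [e1, circleAverage_fun_add (circleIntegrable_of_sphere zero_le_one cS)
      (circleIntegrable_of_sphere zero_le_one cSc), havS, e3]
    push_cast; ring
  have cψ1 : ContinuousOn (fun z => starRingEnd ℂ (1 - ψ z)) (sphere 0 1) :=
    Complex.continuous_conj.comp_continuousOn (continuousOn_const.sub cψ)
  have hcs := norm_circleAverage_mul_le zero_le_one cψ1 cS
  rw [hav, Complex.norm_real] at hcs
  have hψav : ‖circleAverage ψ 0 1‖ ≤ M * 1 := by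
    have := h.norm_circleAverage_phase_mul_le (g := fun z => z ^ 2) (C := 1)
      (fun z _ _ => by fun_prop) (fun z hz => by
        rw [norm_pow, hz]; exact pow_le_one₀ h.r_pos.le h.r_lt.le)
    refine le_trans (le_of_eq ?_) this
    congr 2; ext z; simp only [hψ]; ring
  have hn1 : cnorm 1 (fun z => starRingEnd ℂ (1 - ψ z)) ^ 2 ≤ 2 * (1 + M) := by
    rw [cnorm_sq]
    have e : circleAverage (fun z => ‖starRingEnd ℂ (1 - ψ z)‖ ^ 2) 0 1 =
        circleAverage (fun z => 2 - (2:ℝ) • (ψ z).re) 0 1 := by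
      refine circleAverage_congr_sphere fun z hz => ?_
      simp only [mem_sphere, dist_zero_right, abs_one] at hz
      have hp : ‖ψ z‖ = 1 := by
        simp only [hψ, norm_mul, norm_pow, hz, h.norm_phase hz]; norm_num
      rw [Complex.norm_conj, ← Complex.normSq_eq_norm_sq, Complex.normSq_sub,
        Complex.normSq_eq_norm_sq (ψ z), hp]
      simp; ring
    have cre : ContinuousOn (fun z => (2:ℝ) • (ψ z).re) (sphere 0 1) :=
      (Complex.continuous_re.comp_continuousOn cψ).const_smul (2:ℝ)
    have e3 := Complex.reCLM.circleAverage_comp_comm (c := 0) (R := 1)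
      (circleIntegrable_of_sphere zero_le_one cψ)
    simp only [Complex.reCLM_apply, Function.comp_def] at e3
    rw [e, circleAverage_fun_sub (circleIntegrable_const _ _ _)
      (circleIntegrable_of_sphere zero_le_one cre), circleAverage_const, circleAverage_fun_smul,
      e3, smul_eq_mul]
    have := (abs_le.1 ((Complex.abs_re_le_norm _).trans hψav)).1
    linarith
  have hM := h.M_nonneg
  rw [div_le_iff₀ (by linarith)]
  have h1 : (2 * (a ^ n * D.coeff 0)) ^ 2 ≤
      cnorm 1 (fun z => starRingEnd ℂ (1 - ψ z)) ^ 2 * cnorm 1 S ^ 2 := by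
    rw [← mul_pow, ← sq_abs, ← Real.norm_eq_abs]
    gcongr
  nlinarith [sq_nonneg (cnorm 1 S)]

end OuterBound

section CauchyKernel

variable {z₀ : ℝ}

lemma sub_ne_zero_of_norm {z : ℂ} (h0 : 0 ≤ z₀) (hz : z₀ < ‖z‖) : z - z₀ ≠ 0 := by
  intro h
  rw [sub_eq_zero] at h
  rw [h, Complex.norm_real, norm_of_nonneg h0] at hz
  exact lt_irrefl _ hz

lemma circleAverage_kernel_mul {f : ℂ → ℂ} (hf : ∀ z : ℂ, ‖z‖ ≤ 1 → DifferentiableAt ℂ f z)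
    (h0 : 0 ≤ z₀) (h1 : z₀ < 1) :
    circleAverage (fun z => z / (z - z₀) * f z) 0 1 = f z₀ := by
  have hd : DiffContOnCl ℂ f (ball 0 |1|) := by
    refine DifferentiableOn.diffContOnCl fun z hz => ?_
    rw [abs_one, closure_ball _ one_ne_zero, mem_closedBall, dist_zero_right] at hz
    exact (hf z hz).differentiableWithinAt
  have := hd.circleAverage_smul_div (w := z₀) (by simpa [abs_of_nonneg h0] using h1)
  simpa using this

lemma continuousOn_kernel (h0 : 0 ≤ z₀) (h1 : z₀ < 1) :
    ContinuousOn (fun z : ℂ => z / (z - z₀)) (sphere 0 1) := by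
  refine continuousOn_id.div (continuousOn_id.sub continuousOn_const) fun z hz => ?_
  simp only [mem_sphere, dist_zero_right] at hz
  exact sub_ne_zero_of_norm h0 (by rw [hz]; exact h1)

lemma cnorm_kernel_sq (h0 : 0 ≤ z₀) (h1 : z₀ < 1) :
    cnorm 1 (fun z => z / (z - z₀)) ^ 2 = 1 / (1 - z₀ ^ 2) := by
  have hne : ∀ z : ℂ, ‖z‖ ≤ 1 → 1 - z₀ * z ≠ 0 := by
    intro z hz h
    have : ‖(z₀ : ℂ) * z‖ = 1 := by rw [← sub_eq_zero.1 h, norm_one]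
    rw [norm_mul, Complex.norm_real, norm_of_nonneg h0] at this
    nlinarith [norm_nonneg z]
  have e1 := circleAverage_kernel_mul (f := fun z => 1 / (1 - z₀ * z)) (fun z hz =>
    (differentiableAt_const _).div ((differentiableAt_const _).sub
      ((differentiableAt_const _).mul differentiableAt_id)) (hne z hz)) h0 h1
  have e2 := Complex.ofRealCLM.circleAverage_comp_comm (c := 0) (R := 1)
    (f := fun z : ℂ => ‖z / (z - z₀)‖ ^ 2) (circleIntegrable_of_sphere zero_le_one
      ((continuousOn_kernel h0 h1).norm.pow 2))
  rw [cnorm_sq]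
  apply Complex.ofReal_injective
  simp only [Complex.ofRealCLM_apply] at e2
  rw [← e2]
  refine Eq.trans (circleAverage_congr_sphere fun z hz => ?_) (e1.trans (by push_cast; ring))
  simp only [mem_sphere, dist_zero_right, abs_one] at hz
  have hz0 : z ≠ 0 := by rintro rfl; simp at hz
  have hs := sub_ne_zero_of_norm h0 (z := z) (by rw [hz]; exact h1)
  have hi := inv_eq_conj_of_norm_one hz
  simp only [Function.comp, Complex.ofRealCLM_apply]
  rw [← Complex.normSq_eq_norm_sq, ← Complex.mul_conj]
  congr 1
  rw [map_div₀, map_sub, Complex.conj_ofReal, ← hi, inv_eq_one_div]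
  have := hne z hz.le
  rw [show 1 / z - (z₀ : ℂ) = (1 - z₀ * z) / z by field_simp]
  field_simp

lemma norm_le_of_cnorm {f : ℂ → ℂ} (hf : ∀ z : ℂ, ‖z‖ ≤ 1 → DifferentiableAt ℂ f z)
    (h0 : 0 ≤ z₀) (h1 : z₀ < 1) : ‖f z₀‖ ^ 2 ≤ cnorm 1 f ^ 2 / (1 - z₀ ^ 2) := by
  rw [← circleAverage_kernel_mul hf h0 h1]
  have := norm_circleAverage_mul_le zero_le_one (continuousOn_kernel h0 h1) (g := f) (fun z hz => by
    simp only [mem_sphere, dist_zero_right] at hz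
    exact (hf z hz.le).continuousAt.continuousWithinAt)
  calc _ ≤ (cnorm 1 (fun z => z / (z - z₀)) * cnorm 1 f) ^ 2 := by gcongr
    _ = _ := by rw [mul_pow, cnorm_kernel_sq h0 h1]; ring

lemma norm_kernel_le {z : ℂ} {s : ℝ} (h0 : 0 ≤ z₀) (hs : z₀ < s) (hz : ‖z‖ = s) :
    ‖z / (z - z₀)‖ ≤ s / (s - z₀) := by
  rw [norm_div, hz]
  have : s - z₀ ≤ ‖z - z₀‖ := by
    have := norm_sub_norm_le z z₀
    rwa [hz, Complex.norm_real, norm_of_nonneg h0] at this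
  exact div_le_div_of_nonneg_left (h0.trans hs.le) (by linarith) this

end CauchyKernel

/-- Pointwise bound for `z ^ n P(x(z)) D(z)` inside the disc. -/
lemma norm_szegoFun_le {m a : ℝ} {n : ℕ} {D P : ℝ[X]} (hP : P.natDegree ≤ n) {z₀ : ℝ} (h0 : 0 < z₀)
    (h1 : z₀ < 1) : ‖szegoFun m a n D P z₀‖ ^ 2 ≤
      cnorm 1 (szegoFun m a n D P) ^ 2 / (1 - z₀ ^ 2) := by
  have e : ∀ z : ℂ, z ≠ 0 → szegoFun m a n D P z = aeval z (jlift m a n P * D) := fun z hz => by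
    rw [szegoFun, map_mul, aeval_jlift hP hz]
  rw [e _ (by exact_mod_cast h0.ne'), cnorm_congr zero_le_one (g := fun z =>
    aeval z (jlift m a n P * D)) fun z hz => by rw [e z (by rintro rfl; simp at hz)]]
  exact norm_le_of_cnorm (fun z _ => (jlift m a n P * D).differentiable_aeval z) h0.le h1

namespace OuterBound

variable {D : ℝ[X]} {n : ℕ} {r M : ℝ}

/-- Existence of a nearly optimal monic polynomial together with its strong asymptotics. -/
lemma exists_trial (h : OuterBound D n r M) (hM20 : M ≤ 1 / 20) (m : ℝ) {a : ℝ} (ha : a ≠ 0) :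
    ∃ P : ℝ[X], P.Monic ∧ P.natDegree = n ∧
      cnorm 1 (szegoFun m a n D P) ^ 2 ≤ (a ^ n * D.coeff 0) ^ 2 * (2 + 70 * M) ∧
      ∀ z₀ ρ : ℝ, 0 < z₀ → z₀ ≤ ρ → ρ < 1 → (1 + ρ) / 2 ≤ r →
        ‖szegoFun m a n D P z₀ / (a ^ n * D.coeff 0 : ℝ) - 1‖ ≤ 22 * M / (1 - ρ) := by
  obtain ⟨Φ, hΦ, happ⟩ := h.exists_approx
  have hM := h.M_nonneg
  set η := 1 - Φ * D with hη
  set G := Φ + Φ.reflect (2 * n) with hG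
  have hrd : (Φ.reflect (2 * n)).natDegree ≤ 2 * n := natDegree_reflect_le' hΦ
  have hGd : G.natDegree ≤ 2 * n := (natDegree_add_le _ _).trans (max_le hΦ hrd)
  have hGr : G.reflect (2 * n) = G := by
    rw [hG, reflect_add, reflect_reflect, add_comm]
  set lam := G.coeff 0 with hlam
  set S : ℂ → ℂ := fun z => aeval z (G * D) with hS
  have cP := h.continuousOn_phase (s := 1) h.r_lt.le
  have cη : ContinuousOn (fun z => aeval z η) (sphere (0:ℂ) 1) := η.continuous_aeval.continuousOn
  have cηc : ContinuousOn (fun z => starRingEnd ℂ (aeval z η)) (sphere (0:ℂ) 1) :=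
    Complex.continuous_conj.comp_continuousOn cη
  have hdec : ∀ z : ℂ, ‖z‖ = 1 → S z = (1 + phase D n z) +
      (-aeval z η + -(phase D n z * starRingEnd ℂ (aeval z η))) := by
    intro z hz
    have hz0 : z ≠ 0 := by rintro rfl; simp at hz
    have hi := inv_eq_conj_of_norm_one hz
    have d2 : aeval z⁻¹ D ≠ 0 := h.ne_one (by rw [norm_inv, hz, inv_one])
    simp only [hS, hG, hη, phase, map_mul, map_add, map_sub, map_one]
    rw [aeval_reflect hΦ hz0, ← aeval_conj, ← aeval_conj, ← hi]
    generalize aeval z⁻¹ D = d at *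
    field_simp
    ring
  have cS : ContinuousOn S (sphere 0 1) := (G * D).continuous_aeval.continuousOn
  have hphi1 : ‖circleAverage (phase D n) 0 1‖ ≤ M * 1 := by
    have := h.norm_circleAverage_phase_mul_le (g := fun z => 1) (C := 1)
      (fun z _ _ => by fun_prop) (fun z hz => by simp)
    simpa using this
  have hn1 : cnorm 1 (fun z => 1 + phase D n z) ^ 2 ≤ 2 * (1 + M) := by
    rw [cnorm_sq]
    have e : circleAverage (fun z => ‖1 + phase D n z‖ ^ 2) 0 1 =
        circleAverage (fun z => 2 + (2:ℝ) • (phase D n z).re) 0 1 := by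
      refine circleAverage_congr_sphere fun z hz => ?_
      simp only [mem_sphere, dist_zero_right, abs_one] at hz
      have hp := h.norm_phase hz
      rw [← Complex.normSq_eq_norm_sq, Complex.normSq_add, Complex.normSq_eq_norm_sq (phase D n z),
        hp]
      simp; ring
    have cre : ContinuousOn (fun z => (2:ℝ) • (phase D n z).re) (sphere 0 1) :=
      (Complex.continuous_re.comp_continuousOn cP).const_smul (2:ℝ)
    have e3 := Complex.reCLM.circleAverage_comp_comm (c := 0) (R := 1)
      (circleIntegrable_of_sphere zero_le_one cP)
    simp only [Complex.reCLM_apply, Function.comp_def] at e3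
    rw [e, circleAverage_fun_add (circleIntegrable_const _ _ _)
      (circleIntegrable_of_sphere zero_le_one cre), circleAverage_const, circleAverage_fun_smul,
      e3, smul_eq_mul]
    have := (abs_le.1 ((Complex.abs_re_le_norm _).trans hphi1)).2
    linarith
  have nη : cnorm 1 (fun z => -aeval z η) ≤ 2 * M :=
    (cnorm_congr zero_le_one fun z _ => norm_neg _).trans_le happ
  have nη2 : cnorm 1 (fun z => -(phase D n z * starRingEnd ℂ (aeval z η))) ≤ 2 * M :=
    (cnorm_congr zero_le_one fun z hz => by
      rw [norm_neg, norm_mul, h.norm_phase hz, one_mul, Complex.norm_conj]).trans_le happ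
  have c1 : ContinuousOn (fun z => 1 + phase D n z) (sphere 0 1) := continuousOn_const.add cP
  have c2 : ContinuousOn (fun z => -aeval z η) (sphere (0:ℂ) 1) := cη.neg
  have c3 : ContinuousOn (fun z => -(phase D n z * starRingEnd ℂ (aeval z η))) (sphere 0 1) :=
    (cP.mul cηc).neg
  have hSn : cnorm 1 S ≤ √(2 * (1 + M)) + 4 * M := by
    rw [cnorm_congr zero_le_one fun z hz => by rw [hdec z hz]]
    refine (cnorm_add_le zero_le_one c1 (c2.add c3)).trans (add_le_add (Real.le_sqrt_of_sq_le hn1) ?_)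
    refine (cnorm_add_le zero_le_one c2 c3).trans ?_
    linarith
  have hkey : ∀ z₀ ρ : ℝ, 0 ≤ z₀ → z₀ ≤ ρ → ρ < 1 → (1 + ρ) / 2 ≤ r →
      ‖S z₀ - 1‖ ≤ 6 * M / (1 - ρ) := by
    intro z₀ ρ h0 h1 h2 h3
    have hz1 : z₀ < 1 := h1.trans_lt h2
    set k : ℂ → ℂ := fun z => z / (z - z₀) with hk
    have ck : ContinuousOn k (sphere 0 1) := continuousOn_kernel h0 hz1
    have e1 : circleAverage (fun z => k z * S z) 0 1 = S z₀ :=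
      circleAverage_kernel_mul (fun z _ => (G * D).differentiable_aeval z) h0 hz1
    have e2 : circleAverage k 0 1 = 1 := by
      have := circleAverage_kernel_mul (f := fun _ => 1) (fun z _ => differentiableAt_const _) h0 hz1
      simpa using this
    have e3 : circleAverage (fun z => k z * S z) 0 1 = (circleAverage k 0 1 +
        circleAverage (fun z => phase D n z * k z) 0 1) +
        (circleAverage (fun z => k z * (-aeval z η)) 0 1 +
        circleAverage (fun z => k z * (-(phase D n z * starRingEnd ℂ (aeval z η)))) 0 1) := by
      rw [← circleAverage_fun_add, ← circleAverage_fun_add, ← circleAverage_fun_add]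
      · refine circleAverage_congr_sphere fun z hz => ?_
        simp only [mem_sphere, dist_zero_right, abs_one] at hz
        rw [hdec z hz]; ring
      · exact circleIntegrable_of_sphere zero_le_one (ck.add (cP.mul ck))
      · exact circleIntegrable_of_sphere zero_le_one ((ck.mul c2).add (ck.mul c3))
      · exact circleIntegrable_of_sphere zero_le_one (ck.mul c2)
      · exact circleIntegrable_of_sphere zero_le_one (ck.mul c3)
      · exact circleIntegrable_of_sphere zero_le_one ck
      · exact circleIntegrable_of_sphere zero_le_one (cP.mul ck)
    have hρ : 0 < 1 - ρ := by linarith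
    have hzr : z₀ < r := by linarith
    have nk : cnorm 1 k ≤ 1 / (1 - ρ) := by
      refine abs_le_of_sq_le_sq' ?_ (by positivity) |>.2
      rw [cnorm_kernel_sq h0 hz1, div_pow, one_pow]
      refine one_div_le_one_div_of_le (by positivity) ?_
      nlinarith
    have b1 : ‖circleAverage (fun z => phase D n z * k z) 0 1‖ ≤ M * (2 / (1 - ρ)) := by
      refine h.norm_circleAverage_phase_mul_le (fun z hz1 hz2 => ?_) fun z hz => ?_
      · exact differentiableAt_id.div (differentiableAt_id.sub_const _)
          (sub_ne_zero_of_norm h0 (hzr.trans_le hz1))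
      · refine (norm_kernel_le h0 hzr hz).trans ?_
        rw [div_le_div_iff₀ (by linarith) hρ]
        nlinarith [h.r_lt, h.r_pos]
    have b2 := (norm_circleAverage_mul_le zero_le_one ck c2).trans
      (mul_le_mul nk nη (cnorm_nonneg _ _) (by positivity))
    have b3 := (norm_circleAverage_mul_le zero_le_one ck c3).trans
      (mul_le_mul nk nη2 (cnorm_nonneg _ _) (by positivity))
    have e4 : S z₀ - 1 = circleAverage (fun z => phase D n z * k z) 0 1 +
        (circleAverage (fun z => k z * (-aeval z η)) 0 1 +
        circleAverage (fun z => k z * (-(phase D n z * starRingEnd ℂ (aeval z η)))) 0 1) := by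
      rw [← e1, e3, e2]; ring
    rw [e4]
    refine (norm_add_le _ _).trans ((add_le_add b1 ((norm_add_le _ _).trans (add_le_add b2 b3))).trans
      (le_of_eq ?_))
    ring
  have hS0 : S 0 = ((lam * D.coeff 0 : ℝ) : ℂ) := by
    have : (G * D).coeff 0 = lam * D.coeff 0 := mul_coeff_zero _ _
    rw [← this, hS]
    simp [aeval_def, eval₂_at_zero]
  have hδ : |lam * D.coeff 0 - 1| ≤ 5 * M := by
    have e1 : circleAverage S 0 1 = S 0 :=
      circleAverage_eq_center one_pos fun z _ => (G * D).differentiable_aeval z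
    have e3 : circleAverage S 0 1 = (circleAverage (fun _ => (1:ℂ)) 0 1 +
        circleAverage (phase D n) 0 1) +
        (circleAverage (fun z => 1 * (-aeval z η)) 0 1 +
        circleAverage (fun z => 1 * (-(phase D n z * starRingEnd ℂ (aeval z η)))) 0 1) := by
      rw [← circleAverage_fun_add, ← circleAverage_fun_add, ← circleAverage_fun_add]
      · refine circleAverage_congr_sphere fun z hz => ?_
        simp only [mem_sphere, dist_zero_right, abs_one] at hz
        rw [hdec z hz]; ring
      · exact circleIntegrable_of_sphere zero_le_one c1
      · exact circleIntegrable_of_sphere zero_le_one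
          ((continuousOn_const.mul c2).add (continuousOn_const.mul c3))
      · exact circleIntegrable_of_sphere zero_le_one (continuousOn_const.mul c2)
      · exact circleIntegrable_of_sphere zero_le_one (continuousOn_const.mul c3)
      · exact circleIntegrable_of_sphere zero_le_one continuousOn_const
      · exact circleIntegrable_of_sphere zero_le_one cP
    have none : cnorm 1 (fun _ => (1 : ℂ)) = 1 := by simp [cnorm, circleAverage_const]
    have b2 := norm_circleAverage_mul_le zero_le_one (f := fun _ => (1:ℂ)) continuousOn_const c2
    have b3 := norm_circleAverage_mul_le zero_le_one (f := fun _ => (1:ℂ)) continuousOn_const c3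
    rw [none, one_mul] at b2 b3
    rw [← Real.norm_eq_abs, ← Complex.norm_real]
    push_cast
    rw [← Complex.ofReal_mul, ← hS0, ← e1, e3, circleAverage_const, add_sub_right_comm, add_sub_cancel_left]
    refine (norm_add_le _ _).trans ((add_le_add hphi1 ((norm_add_le _ _).trans
      (add_le_add (b2.trans nη) (b3.trans nη2)))).trans (le_of_eq ?_))
    ring
  obtain ⟨P, hPd, hPc, hPe⟩ := exists_of_palindromic m ha n G hGd hGr
  have hlow : 3 / 4 ≤ lam * D.coeff 0 := by linarith [(abs_le.1 hδ).1]
  have hlam0 : lam ≠ 0 := by intro h0; rw [h0] at hlow; norm_num at hlow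
  have hD0 : D.coeff 0 ≠ 0 := by intro h0; rw [h0] at hlow; norm_num at hlow
  have han : a ^ n ≠ 0 := pow_ne_zero _ ha
  set P' := C (a ^ n / lam) * P with hP'
  have hcoef : P'.coeff n = 1 := by
    rw [hP', coeff_C_mul, hPc]; field_simp
    exact hlam.symm
  have hP'd : P'.natDegree ≤ n := (natDegree_C_mul_le _ _).trans hPd
  have hmon : P'.Monic := monic_of_natDegree_le_of_coeff_eq_one n hP'd hcoef
  have hfun : ∀ z : ℂ, z ≠ 0 → szegoFun m a n D P' z = ((a ^ n / lam : ℝ) : ℂ) * S z := by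
    intro z hz
    simp only [szegoFun, hP', hS, map_mul, aeval_C, ← hPe z hz, Complex.coe_algebraMap]
    ring
  have hquot : ∀ w : ℂ, ((a ^ n / lam : ℝ) : ℂ) * w / (a ^ n * D.coeff 0 : ℝ) =
      w / (lam * D.coeff 0 : ℝ) := by
    intro w
    have h1 : (lam : ℂ) ≠ 0 := by exact_mod_cast hlam0
    have h2 : ((D.coeff 0 : ℝ) : ℂ) ≠ 0 := by exact_mod_cast hD0
    have h3 : (a : ℂ) ^ n ≠ 0 := by exact_mod_cast han
    push_cast
    field_simp
  refine ⟨P', hmon, le_antisymm hP'd (le_natDegree_of_ne_zero (by rw [hcoef]; exact one_ne_zero)),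
    ?_, fun z₀ ρ h0 h1 h2 h3 => ?_⟩
  · have e : cnorm 1 (szegoFun m a n D P') ^ 2 = (a ^ n / lam) ^ 2 * cnorm 1 S ^ 2 := by
      rw [cnorm_sq, cnorm_sq, ← smul_eq_mul, ← circleAverage_fun_smul]
      refine circleAverage_congr_sphere fun z hz => ?_
      simp only [mem_sphere, dist_zero_right, abs_one] at hz
      rw [hfun z (by rintro rfl; simp at hz), norm_mul, mul_pow, Complex.norm_real,
        Real.norm_eq_abs, sq_abs, smul_eq_mul]
    rw [e]
    have e2 : (a ^ n / lam) ^ 2 = (a ^ n * D.coeff 0) ^ 2 / (lam * D.coeff 0) ^ 2 := by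
      field_simp
    rw [e2, div_mul_eq_mul_div, mul_div_assoc]
    refine mul_le_mul_of_nonneg_left ?_ (by positivity)
    rw [div_le_iff₀ (by positivity)]
    have hsq : cnorm 1 S ^ 2 ≤ (√(2 * (1 + M)) + 4 * M) ^ 2 := by
      gcongr
      exact cnorm_nonneg _ _
    have hs2 : √(2 * (1 + M)) ^ 2 = 2 * (1 + M) := Real.sq_sqrt (by positivity)
    have hs3 : √(2 * (1 + M)) ≤ 3 / 2 := by
      refine Real.sqrt_le_iff.2 ⟨by norm_num, ?_⟩
      nlinarith
    have hs4 : cnorm 1 S ^ 2 ≤ 2 + 15 * M := by nlinarith [Real.sqrt_nonneg (2 * (1 + M))]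
    have h5 : 1 - 10 * M ≤ (lam * D.coeff 0) ^ 2 := by nlinarith [(abs_le.1 hδ).1]
    nlinarith
  · have hz0 : (z₀ : ℂ) ≠ 0 := by exact_mod_cast h0.ne'
    rw [hfun _ hz0, hquot]
    have hne : ((lam * D.coeff 0 : ℝ) : ℂ) ≠ 0 := by
      exact_mod_cast mul_ne_zero hlam0 hD0
    rw [div_sub_one hne, norm_div, Complex.norm_real, norm_of_nonneg (by linarith)]
    have hρ : 0 < 1 - ρ := by linarith
    have h5 := hkey z₀ ρ h0.le h1 h2 h3
    have h6 : ‖S z₀ - (lam * D.coeff 0 : ℝ)‖ ≤ 6 * M / (1 - ρ) + 5 * M := by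
      have : S z₀ - (lam * D.coeff 0 : ℝ) = (S z₀ - 1) - ((lam * D.coeff 0 - 1 : ℝ) : ℂ) := by
        push_cast; ring
      rw [this]
      refine (norm_sub_le _ _).trans (add_le_add h5 ?_)
      rw [Complex.norm_real]; exact hδ
    rw [div_le_iff₀ (by linarith)]
    refine h6.trans ?_
    have h7 : 5 * M ≤ 5 * M / (1 - ρ) := by
      rw [le_div_iff₀ hρ]; nlinarith
    have h8 : 0 ≤ M / (1 - ρ) := by positivity
    have e1 : 6 * M / (1 - ρ) = 6 * (M / (1 - ρ)) := by ring
    have e2 : 5 * M / (1 - ρ) = 5 * (M / (1 - ρ)) := by ring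
    have e3 : 22 * M / (1 - ρ) = 22 * (M / (1 - ρ)) := by ring
    rw [e1, e3]; rw [e2] at h7
    nlinarith

end OuterBound

/-- A polynomial in `(z + 1/z)/2` splits as `h(z) + h(1/z)`. -/
lemma exists_split (L : ℝ[X]) : ∃ h : ℝ[X], ∀ z : ℂ, z ≠ 0 →
    aeval ((z + z⁻¹) / 2) L = aeval z h + aeval z⁻¹ h := by
  induction L using Polynomial.induction_on with
  | C c =>
    refine ⟨C (c / 2), fun z _ => ?_⟩
    simp only [aeval_C, Complex.coe_algebraMap]
    push_cast
    ring
  | add p q hp hq =>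
    obtain ⟨hp, h1⟩ := hp
    obtain ⟨hq, h2⟩ := hq
    refine ⟨hp + hq, fun z hz => ?_⟩
    rw [map_add, h1 z hz, h2 z hz, map_add, map_add]
    ring
  | monomial k c ih =>
    obtain ⟨h, ih⟩ := ih
    refine ⟨C (1 / 2) * (X * h + h.divX + C (h.coeff 0) * X), fun z hz => ?_⟩
    have hd : ∀ w : ℂ, aeval w h = w * aeval w h.divX + (h.coeff 0 : ℝ) := by
      intro w
      conv_lhs => rw [← h.divX_mul_X_add, map_add, map_mul, aeval_X, aeval_C,
        Complex.coe_algebraMap]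
      ring
    have e : aeval ((z + z⁻¹) / 2) (C c * X ^ (k + 1)) =
        aeval ((z + z⁻¹) / 2) (C c * X ^ k) * ((z + z⁻¹) / 2) := by
      simp [pow_succ, mul_assoc]
    rw [e, ih z hz]
    have h1 := hd z
    have h2 := hd z⁻¹
    simp only [map_mul, map_add, aeval_C, aeval_X, Complex.coe_algebraMap]
    rw [h1, h2]
    push_cast
    field_simp
    ring

/-- Truncated exponential of a polynomial. -/
def expPoly (h : ℝ[X]) (N : ℕ) : ℝ[X] := ∑ k ∈ Finset.range N, C ((k.factorial : ℝ)⁻¹) * h ^ k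

lemma aeval_expPoly (h : ℝ[X]) (N : ℕ) (z : ℂ) :
    aeval z (expPoly h N) = ∑ k ∈ Finset.range N, aeval z h ^ k / (k.factorial : ℂ) := by
  simp only [expPoly, map_sum, map_mul, aeval_C, map_pow, Complex.coe_algebraMap]
  refine Finset.sum_congr rfl fun k _ => ?_
  push_cast
  rw [div_eq_inv_mul]

lemma exists_expPoly (h : ℝ[X]) {η : ℝ} (hη : 0 < η) : ∃ N, ∀ z : ℂ, ‖z‖ ≤ 2 →
    ‖aeval z (expPoly h N) / Complex.exp (aeval z h) - 1‖ ≤ η := by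
  obtain ⟨H, hH⟩ := (isCompact_closedBall (0:ℂ) 2).exists_bound_of_continuousOn
    (f := fun z => aeval z h) h.continuous_aeval.continuousOn
  have hH0 : 0 ≤ H := (norm_nonneg _).trans (hH 0 (by simp))
  have ht := (FloorSemiring.tendsto_pow_div_factorial_atTop H).mul_const (2 * Real.exp H)
  rw [zero_mul] at ht
  obtain ⟨N, hN1, hN2⟩ := ((ht.eventually (gt_mem_nhds hη)).and (eventually_ge_atTop ⌈2 * H⌉₊)).exists
  refine ⟨N, fun z hz => ?_⟩
  have hz' := hH z (by simpa using hz)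
  have h2 : 2 * H ≤ N := Nat.ceil_le.1 hN2
  have hb := Complex.exp_bound' (x := aeval z h) (n := N) (by
    rw [div_le_iff₀ (by positivity)]; push_cast; linarith)
  rw [aeval_expPoly, div_sub_one (Complex.exp_ne_zero _), norm_div, norm_sub_rev, Complex.norm_exp]
  have hre : -H ≤ (aeval z h).re := by
    have := (abs_le.1 (Complex.abs_re_le_norm (aeval z h))).1
    linarith
  rw [div_le_iff₀ (Real.exp_pos _)]
  refine hb.trans ?_
  have h3 : ‖aeval z h‖ ^ N / N.factorial * 2 ≤ H ^ N / N.factorial * 2 := by gcongr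
  refine h3.trans ?_
  have h4 : H ^ N / N.factorial * 2 = H ^ N / N.factorial * (2 * Real.exp H) * Real.exp (-H) := by
    rw [mul_assoc, mul_assoc, ← Real.exp_add]; simp
  rw [h4]
  exact mul_le_mul hN1.le (Real.exp_le_exp.2 hre) (Real.exp_pos _).le hη.le

lemma half_add_inv_of_norm_one {z : ℂ} (hz : ‖z‖ = 1) : (z + z⁻¹) / 2 = (z.re : ℂ) := by
  rw [inv_eq_conj_of_norm_one hz, Complex.add_conj]
  push_cast
  ring

lemma re_mem_Icc {z : ℂ} (hz : ‖z‖ = 1) : z.re ∈ Set.Icc (-1 : ℝ) 1 :=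
  abs_le.1 (hz ▸ Complex.abs_re_le_norm z)

lemma abs_circleAverage_le_of_bound {f : ℂ → ℝ} {C : ℝ} (hf : ContinuousOn f (sphere 0 1))
    (h : ∀ z, ‖z‖ = 1 → |f z| ≤ C) : |circleAverage f 0 1| ≤ C := by
  refine abs_circleAverage_le_circleAverage_abs.trans ?_
  refine circleAverage_mono_on_of_le_circle
    (circleIntegrable_of_sphere zero_le_one hf.abs) fun z hz => ?_
  exact h z (by simpa using hz)

/-- Polynomial outer functions for continuous positive weights on the circle which are even in the
argument. -/
lemma exists_outer {W : ℝ → ℝ} (hW : ContinuousOn W (Set.Icc (-1) 1))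
    (hpos : ∀ t ∈ Set.Icc (-1 : ℝ) 1, 0 < W t) {ε : ℝ} (hε : 0 < ε) :
    ∃ E : ℝ[X], (∀ z : ℂ, ‖z‖ ≤ 2 → aeval z E ≠ 0) ∧ 0 < E.coeff 0 ∧
      (∀ z : ℂ, ‖z‖ = 1 → exp (-ε) * W z.re ≤ ‖aeval z E‖ ^ 2 ∧
        ‖aeval z E‖ ^ 2 ≤ exp ε * W z.re) ∧
      |2 * log (E.coeff 0) - circleAverage (fun z => log (W z.re)) 0 1| ≤ ε := by
  obtain ⟨L, hL⟩ := exists_polynomial_near_of_continuousOn (-1) 1 (fun t => log (W t))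
    (hW.log fun t ht => (hpos t ht).ne') (ε / 2) (by positivity)
  obtain ⟨h, hh⟩ := exists_split L
  obtain ⟨η, hη0, hη1, hη2, hη3⟩ : ∃ η : ℝ, 0 < η ∧ η < 1 ∧ 1 + η ≤ exp (ε / 4) ∧
      exp (-(ε / 4)) ≤ 1 - η := by
    have h1 : 0 < exp (ε / 4) - 1 := by
      have := Real.add_one_lt_exp (x := ε / 4) (by positivity); linarith
    have h2 : 0 < 1 - exp (-(ε / 4)) := by
      have := Real.exp_lt_one_iff.2 (show -(ε / 4) < 0 by linarith); linarith
    refine ⟨min (exp (ε / 4) - 1) (1 - exp (-(ε / 4))), lt_min h1 h2, ?_, ?_, ?_⟩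
    · exact (min_le_right _ _).trans_lt (by linarith [Real.exp_pos (-(ε / 4))])
    · linarith [min_le_left (exp (ε / 4) - 1) (1 - exp (-(ε / 4)))]
    · linarith [min_le_right (exp (ε / 4) - 1) (1 - exp (-(ε / 4)))]
  obtain ⟨N, hN⟩ := exists_expPoly h hη0
  set E := expPoly h N with hE
  have hquot : ∀ z : ℂ, ‖z‖ ≤ 2 → exp (-(ε / 4)) * exp (aeval z h).re ≤ ‖aeval z E‖ ∧
      ‖aeval z E‖ ≤ exp (ε / 4) * exp (aeval z h).re := by
    intro z hz
    have h1 := hN z hz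
    have h2 : ‖aeval z E / Complex.exp (aeval z h)‖ = ‖aeval z E‖ / exp (aeval z h).re := by
      rw [norm_div, Complex.norm_exp]
    have h3 := norm_sub_norm_le (1:ℂ) (1 - aeval z E / Complex.exp (aeval z h))
    have h4 := norm_add_le (1:ℂ) (aeval z E / Complex.exp (aeval z h) - 1)
    rw [norm_sub_rev (1 : ℂ) (aeval z E / Complex.exp (aeval z h))] at h3
    rw [sub_sub_cancel, norm_one, h2] at h3
    rw [add_sub_cancel, norm_one, h2] at h4
    have hp := Real.exp_pos (aeval z h).re
    constructor
    · have : exp (-(ε / 4)) ≤ ‖aeval z E‖ / exp (aeval z h).re := by linarith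
      rwa [le_div_iff₀ hp] at this
    · have : ‖aeval z E‖ / exp (aeval z h).re ≤ exp (ε / 4) := by linarith
      rwa [div_le_iff₀ hp] at this
  have hne : ∀ z : ℂ, ‖z‖ ≤ 2 → aeval z E ≠ 0 := by
    intro z hz h0
    have := (hquot z hz).1
    rw [h0, norm_zero] at this
    exact absurd this (not_le.2 (by positivity))
  have hre : ∀ z : ℂ, ‖z‖ = 1 → L.eval z.re = 2 * (aeval z h).re := by
    intro z hz
    have hz0 : z ≠ 0 := by rintro rfl; simp at hz
    have h1 := hh z hz0
    rw [half_add_inv_of_norm_one hz, inv_eq_conj_of_norm_one hz, aeval_conj, Complex.add_conj] at h1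
    rw [← Complex.coe_algebraMap, aeval_algebraMap_apply] at h1
    simp only [Complex.coe_algebraMap, coe_aeval_eq_eval] at h1
    exact_mod_cast h1
  have hE0 : aeval (0:ℂ) E = (E.coeff 0 : ℝ) := by simp [aeval_def, eval₂_at_zero]
  have hh0 : aeval (0:ℂ) h = (h.coeff 0 : ℝ) := by simp [aeval_def, eval₂_at_zero]
  have hEpos : 0 < E.coeff 0 := by
    have h1 := hN 0 (by simp)
    rw [hE0, hh0, ← Complex.ofReal_exp, ← Complex.ofReal_div, ← Complex.ofReal_one,
      ← Complex.ofReal_sub, Complex.norm_real] at h1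
    have h2 := (abs_le.1 h1).1
    have h3 : 0 < E.coeff 0 / exp (h.coeff 0) := by linarith
    exact (div_pos_iff_of_pos_right (Real.exp_pos _)).1 h3
  refine ⟨E, hne, hEpos, fun z hz => ?_, ?_⟩
  · obtain ⟨h1, h2⟩ := hquot z (by rw [hz]; norm_num)
    have hWp := hpos z.re (re_mem_Icc hz)
    have h3 := abs_lt.1 (hL z.re (re_mem_Icc hz))
    rw [hre z hz] at h3
    rw [← Real.exp_log hWp, ← Real.exp_add, ← Real.exp_add]
    rw [← Real.exp_add] at h1 h2
    constructor
    · calc _ ≤ exp (-(ε / 4) + (aeval z h).re) ^ 2 := by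
            rw [← Real.exp_nat_mul]; apply Real.exp_le_exp.2; push_cast; linarith
        _ ≤ _ := by gcongr
    · calc _ ≤ exp (ε / 4 + (aeval z h).re) ^ 2 := by gcongr
        _ ≤ _ := by rw [← Real.exp_nat_mul]; apply Real.exp_le_exp.2; push_cast; linarith
  · have cW : ContinuousOn (fun z : ℂ => log (W z.re)) (sphere 0 1) := by
      refine (hW.log fun t ht => (hpos t ht).ne').comp Complex.continuous_re.continuousOn
        fun z hz => ?_
      exact re_mem_Icc (by simpa using hz)
    have cL : ContinuousOn (fun z : ℂ => L.eval z.re) (sphere 0 1) :=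
      (L.continuous.comp Complex.continuous_re).continuousOn
    have e1 : circleAverage (fun z : ℂ => L.eval z.re) 0 1 = 2 * h.coeff 0 := by
      have e2 : circleAverage (fun z => aeval z h) 0 1 = aeval (0:ℂ) h :=
        circleAverage_eq_center one_pos fun z _ => h.differentiable_aeval z
      have e3 := Complex.reCLM.circleAverage_comp_comm (c := 0) (R := 1)
        (circleIntegrable_of_sphere zero_le_one (f := fun z : ℂ => aeval z h)
          h.continuous_aeval.continuousOn)
      simp only [Complex.reCLM_apply, Function.comp_def] at e3
      rw [e2, hh0, Complex.ofReal_re] at e3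
      rw [← e3, ← smul_eq_mul, ← circleAverage_fun_smul]
      refine circleAverage_congr_sphere fun z hz => ?_
      rw [hre z (by simpa using hz), smul_eq_mul]
    have e4 : |circleAverage (fun z : ℂ => L.eval z.re) 0 1 -
        circleAverage (fun z => log (W z.re)) 0 1| ≤ ε / 2 := by
      rw [← circleAverage_fun_sub (circleIntegrable_of_sphere zero_le_one cL)
        (circleIntegrable_of_sphere zero_le_one cW)]
      refine abs_circleAverage_le_of_bound (cL.sub cW) fun z hz => ?_
      exact (hL z.re (re_mem_Icc (by simpa using hz))).le
    have e5 : |log (E.coeff 0) - h.coeff 0| ≤ ε / 4 := by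
      obtain ⟨h1, h2⟩ := hquot 0 (by simp)
      rw [hE0, hh0, Complex.norm_real, Complex.ofReal_re, norm_of_nonneg hEpos.le,
        ← Real.exp_add] at h1 h2
      rw [← Real.le_log_iff_exp_le hEpos] at h1
      rw [← Real.log_le_iff_le_exp hEpos] at h2
      exact abs_le.2 ⟨by linarith, by linarith⟩
    rw [e1] at e4
    have h5 := abs_le.1 e4
    have h6 := abs_le.1 e5
    exact abs_le.2 ⟨by linarith, by linarith⟩

section Sandwich

variable {ρ : ℝ}

lemma norm_sq_one_sub_mul_sq (ρ : ℝ) {z : ℂ} (hz : ‖z‖ = 1) :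
    ‖1 - ρ * z ^ 2‖ ^ 2 = 1 + ρ ^ 2 - 2 * ρ * (2 * z.re ^ 2 - 1) := by
  have h1 : z.re ^ 2 + z.im ^ 2 = 1 := by
    have := Complex.normSq_eq_norm_sq z
    rw [hz, Complex.normSq_apply] at this
    linarith
  rw [← Complex.normSq_eq_norm_sq, Complex.normSq_apply]
  simp only [pow_two, Complex.sub_re, Complex.one_re, Complex.mul_re, Complex.ofReal_re,
    Complex.ofReal_im, zero_mul, sub_zero, Complex.sub_im, Complex.one_im, Complex.mul_im, add_zero,
    zero_sub]
  have h2 : z.im * z.im = 1 - z.re * z.re := by linarith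
  linear_combination (-2 * ρ + ρ ^ 2 * (z.re * z.re + z.im * z.im + 1)) * (h2)
    + 4 * ρ * h2

lemma smoothing_pos (h0 : 0 ≤ ρ) (h1 : ρ < 1) {t : ℝ} (ht : t ∈ Set.Icc (-1 : ℝ) 1) :
    0 < 1 + ρ ^ 2 - 2 * ρ * (2 * t ^ 2 - 1) := by
  have : t ^ 2 ≤ 1 := by nlinarith [ht.1, ht.2]
  nlinarith [mul_nonneg h0 (sub_nonneg.2 this), sq_pos_of_pos (sub_pos.2 h1)]

lemma norm_one_sub_sq_le (ρ : ℝ) {z : ℂ} (hz : ‖z‖ = 1) :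
    (1 + ρ) / 2 * ‖1 - z ^ 2‖ ≤ ‖1 - ρ * z ^ 2‖ := by
  refine abs_le_of_sq_le_sq' ?_ (norm_nonneg _) |>.2
  have h1 := norm_sq_one_sub_mul_sq 1 hz
  rw [Complex.ofReal_one, one_mul] at h1
  rw [mul_pow, norm_sq_one_sub_mul_sq ρ hz, h1]
  nlinarith [mul_nonneg (sq_nonneg (1 - ρ)) (sq_nonneg z.re)]

lemma circleAverage_log_smoothing (h0 : 0 ≤ ρ) (h1 : ρ < 1) :
    circleAverage (fun z : ℂ => log ‖1 - ρ * z ^ 2‖) 0 1 = 0 := by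
  have := AnalyticOnNhd.circleAverage_log_norm_of_ne_zero (R := 1) (c := 0)
    (g := fun z : ℂ => 1 - ρ * z ^ 2) (fun z _ => by fun_prop) fun z hz h => by
      rw [abs_one, mem_closedBall, dist_zero_right] at hz
      have h2 : ‖(ρ : ℂ) * z ^ 2‖ = 1 := by rw [← sub_eq_zero.1 h, norm_one]
      rw [norm_mul, Complex.norm_real, norm_of_nonneg h0, norm_pow] at h2
      have : ‖z‖ ^ 2 ≤ 1 := pow_le_one₀ (norm_nonneg _) hz
      nlinarith
  simpa using this

end Sandwich

/-- Polynomial outer functions bounding a weight times `|1 - z²|` from both sides. -/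
lemma exists_sandwich {w : ℝ → ℝ} (hw : ContinuousOn w (Set.Icc (-1) 1))
    (hpos : ∀ t ∈ Set.Icc (-1 : ℝ) 1, 0 < w t) {ε : ℝ} (hε : 0 < ε) :
    ∃ E F : ℝ[X], (∀ z : ℂ, ‖z‖ ≤ 2 → aeval z E ≠ 0) ∧ (∀ z : ℂ, ‖z‖ ≤ 2 → aeval z F ≠ 0) ∧
      0 < E.coeff 0 ∧ 0 < F.coeff 0 ∧
      (∀ z : ℂ, ‖z‖ = 1 → w z.re * ‖1 - z ^ 2‖ ≤ exp ε * ‖aeval z E‖ ^ 2 ∧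
        exp (-ε) * ‖(1 - z ^ 2) * aeval z F‖ ^ 2 ≤ w z.re * ‖1 - z ^ 2‖) ∧
      |log (E.coeff 0) - log (F.coeff 0)| ≤ ε := by
  obtain ⟨ρ, h0, h1, h2⟩ : ∃ ρ : ℝ, 0 ≤ ρ ∧ ρ < 1 ∧ exp (-(ε / 2)) ≤ (1 + ρ) / 2 := by
    have := Real.exp_lt_one_iff.2 (show -(ε / 2) < 0 by linarith)
    refine ⟨max (2 * exp (-(ε / 2)) - 1) (1 / 2), le_max_of_le_right (by norm_num),
      max_lt (by linarith) (by norm_num), ?_⟩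
    linarith [le_max_left (2 * exp (-(ε / 2)) - 1) (1 / 2)]
  set V : ℝ → ℝ := fun t => √(1 + ρ ^ 2 - 2 * ρ * (2 * t ^ 2 - 1)) with hV
  have cV : ContinuousOn V (Set.Icc (-1) 1) := by
    apply Continuous.continuousOn; rw [hV]; fun_prop
  have hVpos : ∀ t ∈ Set.Icc (-1 : ℝ) 1, 0 < V t := fun t ht => Real.sqrt_pos.2 (smoothing_pos h0 h1 ht)
  have hVz : ∀ z : ℂ, ‖z‖ = 1 → V z.re = ‖1 - ρ * z ^ 2‖ := fun z hz => by
    rw [hV]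
    simp only
    rw [← norm_sq_one_sub_mul_sq ρ hz, Real.sqrt_sq (norm_nonneg _)]
  obtain ⟨E, hE1, hE2, hE3, hE4⟩ := exists_outer (W := fun t => w t * V t) (hw.mul cV)
    (fun t ht => mul_pos (hpos t ht) (hVpos t ht)) (half_pos hε)
  obtain ⟨F, hF1, hF2, hF3, hF4⟩ := exists_outer (W := fun t => w t / V t)
    (hw.div cV fun t ht => (hVpos t ht).ne') (fun t ht => div_pos (hpos t ht) (hVpos t ht))
    (half_pos hε)
  refine ⟨E, F, hE1, hF1, hE2, hF2, fun z hz => ?_, ?_⟩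
  · have hw0 := hpos z.re (re_mem_Icc hz)
    have hV0 := hVpos z.re (re_mem_Icc hz)
    have hb := norm_one_sub_sq_le ρ hz
    rw [← hVz z hz] at hb
    have hb' : exp (-(ε / 2)) * ‖1 - z ^ 2‖ ≤ V z.re :=
      (mul_le_mul_of_nonneg_right h2 (norm_nonneg _)).trans hb
    have he : exp ε = exp (ε / 2) * exp (ε / 2) := by rw [← Real.exp_add]; ring_nf
    have he2 : exp (-ε) = exp (-(ε / 2)) * exp (-(ε / 2)) := by rw [← Real.exp_add]; ring_nf
    have he3 : exp (ε / 2) * exp (-(ε / 2)) = 1 := by rw [← Real.exp_add]; simp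
    constructor
    · have h3 := (hE3 z hz).1
      calc w z.re * ‖1 - z ^ 2‖
          = exp (ε / 2) * (w z.re * (exp (-(ε / 2)) * ‖1 - z ^ 2‖)) := by
            linear_combination -(w z.re * ‖1 - z ^ 2‖) * he3
        _ ≤ exp (ε / 2) * (w z.re * V z.re) := by gcongr
        _ = exp ε * (exp (-(ε / 2)) * (w z.re * V z.re)) := by
            rw [he]; linear_combination -(exp (ε / 2) * (w z.re * V z.re)) * he3
        _ ≤ _ := by gcongr
    · have h3 := (hF3 z hz).2
      rw [norm_mul, mul_pow]
      calc _ ≤ exp (-ε) * (‖1 - z ^ 2‖ ^ 2 * (exp (ε / 2) * (w z.re / V z.re))) := by gcongr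
        _ = (exp (-(ε / 2)) * ‖1 - z ^ 2‖) * ‖1 - z ^ 2‖ * (w z.re / V z.re) := by
            rw [he2]
            linear_combination (exp (-(ε / 2)) * ‖1 - z ^ 2‖ * ‖1 - z ^ 2‖ * (w z.re / V z.re)) * he3
        _ ≤ V z.re * ‖1 - z ^ 2‖ * (w z.re / V z.re) := by gcongr
        _ = _ := by field_simp
  · have c1 : ∀ {g : ℝ → ℝ}, ContinuousOn g (Set.Icc (-1) 1) → (∀ t ∈ Set.Icc (-1 : ℝ) 1, 0 < g t) →
        CircleIntegrable (fun z : ℂ => log (g z.re)) 0 1 := fun hg hp =>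
      circleIntegrable_of_sphere zero_le_one ((hg.log fun t ht => (hp t ht).ne').comp
        Complex.continuous_re.continuousOn fun z hz => re_mem_Icc (by simpa using hz))
    have e1 : circleAverage (fun z => log (w z.re * V z.re)) 0 1 =
        circleAverage (fun z => log (w z.re)) 0 1 + circleAverage (fun z => log (V z.re)) 0 1 := by
      rw [← circleAverage_fun_add (c1 hw hpos) (c1 cV hVpos)]
      refine circleAverage_congr_sphere fun z hz => ?_
      have hz' := re_mem_Icc (z := z) (by simpa using hz)
      exact Real.log_mul (hpos _ hz').ne' (hVpos _ hz').ne'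
    have e2 : circleAverage (fun z => log (w z.re / V z.re)) 0 1 =
        circleAverage (fun z => log (w z.re)) 0 1 - circleAverage (fun z => log (V z.re)) 0 1 := by
      rw [← circleAverage_fun_sub (c1 hw hpos) (c1 cV hVpos)]
      refine circleAverage_congr_sphere fun z hz => ?_
      have hz' := re_mem_Icc (z := z) (by simpa using hz)
      exact Real.log_div (hpos _ hz').ne' (hVpos _ hz').ne'
    have e3 : circleAverage (fun z : ℂ => log (V z.re)) 0 1 = 0 := by
      rw [← circleAverage_log_smoothing h0 h1]
      refine circleAverage_congr_sphere fun z hz => ?_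
      rw [hVz z (by simpa using hz)]
    rw [e1, e3] at hE4
    rw [e2, e3] at hF4
    have h3 := abs_le.1 hE4
    have h4 := abs_le.1 hF4
    exact abs_le.2 ⟨by linarith, by linarith⟩

/-- `lam u = 2 artanh u`. -/
def lam (u : ℝ) : ℝ := log (1 + u) - log (1 - u)

lemma lam_zero : lam 0 = 0 := by simp [lam]

lemma hasDerivAt_lam {u : ℝ} (h0 : -1 < u) (h1 : u < 1) : HasDerivAt lam (2 / (1 - u ^ 2)) u := by
  have h2 : 1 + u ≠ 0 := by linarith
  have h3 : 1 - u ≠ 0 := by linarith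
  have h4 : 1 - u ^ 2 ≠ 0 := by
    rw [show 1 - u ^ 2 = (1 + u) * (1 - u) by ring]; exact mul_ne_zero h2 h3
  have := (((hasDerivAt_id u).const_add 1).log h2).sub (((hasDerivAt_id u).const_sub 1).log h3)
  refine this.congr_deriv ?_
  simp only [id]
  rw [show 1 - u ^ 2 = (1 + u) * (1 - u) by ring]
  field_simp
  ring

lemma lam_sub_le_of_deriv {s v c : ℝ} (h0 : 0 ≤ s) (hsv : s ≤ v) (hv : v < 1)
    (hc : ∀ u, 0 ≤ u → u ≤ v → 2 / (1 - u ^ 2) ≤ c) : lam v - lam s ≤ c * (v - s) := by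
  refine (convex_Icc s v).image_sub_le_mul_sub_of_deriv_le (f := lam)
    (fun u hu => (hasDerivAt_lam (by linarith [hu.1]) (by linarith [hu.2])).continuousAt.continuousWithinAt)
    (fun u hu => ?_) (fun u hu => ?_) s ⟨le_rfl, hsv⟩ v ⟨hsv, le_rfl⟩ hsv
  all_goals rw [interior_Icc] at hu
  · exact (hasDerivAt_lam (by linarith [hu.1]) (by linarith [hu.2])).differentiableAt.differentiableWithinAt
  · rw [(hasDerivAt_lam (by linarith [hu.1]) (by linarith [hu.2])).deriv]
    exact hc u (h0.trans hu.1.le) hu.2.le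

lemma le_lam_sub_of_deriv {s v c : ℝ} (h0 : 0 ≤ s) (hsv : s ≤ v) (hv : v < 1)
    (hc : ∀ u, s ≤ u → u < 1 → c ≤ 2 / (1 - u ^ 2)) : c * (v - s) ≤ lam v - lam s := by
  refine (convex_Icc s v).mul_sub_le_image_sub_of_le_deriv (f := lam)
    (fun u hu => (hasDerivAt_lam (by linarith [hu.1]) (by linarith [hu.2])).continuousAt.continuousWithinAt)
    (fun u hu => ?_) (fun u hu => ?_) s ⟨le_rfl, hsv⟩ v ⟨hsv, le_rfl⟩ hsv
  all_goals rw [interior_Icc] at hu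
  · exact (hasDerivAt_lam (by linarith [hu.1]) (by linarith [hu.2])).differentiableAt.differentiableWithinAt
  · rw [(hasDerivAt_lam (by linarith [hu.1]) (by linarith [hu.2])).deriv]
    exact hc u hu.1.le (by linarith [hu.2])

lemma two_mul_le_lam {s : ℝ} (h0 : 0 ≤ s) (h1 : s < 1) : 2 * s ≤ lam s := by
  have := le_lam_sub_of_deriv (s := 0) (v := s) (c := 2) le_rfl h0 h1 fun u hu hu1 => by
    rw [le_div_iff₀ (by nlinarith)]; nlinarith [sq_nonneg u]
  simpa [lam_zero] using this

lemma lam_le {s s₁ : ℝ} (h0 : 0 ≤ s) (h1 : s ≤ s₁) (h2 : s₁ < 1) :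
    lam s ≤ 2 / (1 - s₁ ^ 2) * s := by
  have := lam_sub_le_of_deriv (s := 0) (v := s) (c := 2 / (1 - s₁ ^ 2)) le_rfl h0 (by linarith)
    fun u hu hu1 => by
      apply div_le_div_of_nonneg_left (by norm_num) (by nlinarith) (by nlinarith)
  simpa [lam_zero] using this

lemma lam_div_sub_le {s σ : ℝ} (h0 : 0 ≤ s) (hσ : 0 < σ) (hσ1 : σ ≤ 1) (hs : s ≤ σ / 2) :
    lam (s / σ) - lam s ≤ (1 / σ - 1) * (2 * s + 8 / 3 * s ^ 3 / σ ^ 2) := by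
  have hv : s / σ ≤ 1 / 2 := by rw [div_le_iff₀ hσ]; linarith
  have hv0 : 0 ≤ s / σ := by positivity
  have := lam_sub_le_of_deriv (s := s) (v := s / σ) (c := 2 + 8 / 3 * (s / σ) ^ 2) h0
    ((le_div_iff₀ hσ).2 (by nlinarith)) (by linarith) fun u hu hu1 => by
      have h3 : u ^ 2 ≤ (s / σ) ^ 2 := by gcongr
      have h4 : (s / σ) ^ 2 ≤ 1 / 4 := by nlinarith
      rw [div_le_iff₀ (by nlinarith)]
      nlinarith [sq_nonneg u]
  refine this.trans (le_of_eq ?_)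
  field_simp

lemma lam_add_cube_le {s : ℝ} (h0 : 0 ≤ s) (h1 : s < 1) :
    lam s + 4 / 3 * s ^ 3 ≤ 2 * s / (1 - s ^ 2) := by
  have hd : ∀ u ∈ Set.Icc (0 : ℝ) s, HasDerivAt (fun u => 2 * u / (1 - u ^ 2) - lam u - 4 / 3 * u ^ 3)
      (4 * u ^ 2 / (1 - u ^ 2) ^ 2 - 4 * u ^ 2) u := by
    intro u hu
    have hu1 : 0 < 1 - u ^ 2 := by nlinarith [hu.1, hu.2]
    have := ((((hasDerivAt_id u).const_mul 2).div (((hasDerivAt_id u).pow 2).const_sub 1) hu1.ne').sub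
      (hasDerivAt_lam (by linarith [hu.1]) (by linarith [hu.2]))).sub
      (((hasDerivAt_id u).pow 3).const_mul (4 / 3))
    refine this.congr_deriv ?_
    simp only [id, Pi.pow_apply]
    push_cast
    field_simp
    ring
  have hm : MonotoneOn (fun u => 2 * u / (1 - u ^ 2) - lam u - 4 / 3 * u ^ 3) (Set.Icc 0 s) := by
    refine monotoneOn_of_deriv_nonneg (convex_Icc _ _)
      (fun u hu => (hd u hu).continuousAt.continuousWithinAt)
      (fun u hu => (hd u (interior_subset hu)).differentiableAt.differentiableWithinAt) fun u hu => ?_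
    have hu := interior_subset hu
    rw [(hd u hu).deriv, sub_nonneg, le_div_iff₀ (by have : 0 < 1 - u ^ 2 := by nlinarith [hu.1, hu.2]
                                                     positivity)]
    have h2 : (1 - u ^ 2) ^ 2 ≤ 1 := by
      apply pow_le_one₀ <;> nlinarith [hu.1, hu.2]
    nlinarith [sq_nonneg u]
  have := hm ⟨le_rfl, h0⟩ ⟨h0, le_rfl⟩ h0
  simp [lam_zero] at this
  linarith

lemma le_lam_div_sub {s σ : ℝ} (h0 : 0 ≤ s) (hσ1 : σ ≤ 1) (hs : s < σ) :
    (1 / σ - 1) * (lam s + 4 / 3 * s ^ 3) ≤ lam (s / σ) - lam s := by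
  have hσ : 0 < σ := h0.trans_lt hs
  have h1 : s < 1 := hs.trans_le hσ1
  have := le_lam_sub_of_deriv (s := s) (v := s / σ) (c := 2 / (1 - s ^ 2)) h0
    ((le_div_iff₀ hσ).2 (by nlinarith)) ((div_lt_one hσ).2 hs) fun u hu hu1 => by
      apply div_le_div_of_nonneg_left (by norm_num) (by nlinarith) (by nlinarith)
  refine le_trans ?_ this
  have h3 : 0 ≤ 1 / σ - 1 := by rw [sub_nonneg, le_div_iff₀ hσ]; linarith
  calc _ ≤ (1 / σ - 1) * (2 * s / (1 - s ^ 2)) := by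
        gcongr; exact lam_add_cube_le h0 h1
    _ = _ := by field_simp

/-- Exponent governing the phase on the circle of radius `(1 - s)/(1 + s)`. -/
def Theta (n : ℕ) (T : Multiset ℝ) (s : ℝ) : ℝ :=
  -(2 * n * lam s) + (T.map fun σ => lam (s / σ) - lam s).sum

/-- The push of the external field. -/
def Psi (T : Multiset ℝ) : ℝ := (T.map fun σ => 1 / σ - 1).sum

lemma sum_map_le_mul_Psi {T : Multiset ℝ} {g : ℝ → ℝ} {c : ℝ}
    (h : ∀ σ ∈ T, g σ ≤ c * (1 / σ - 1)) : (T.map g).sum ≤ c * Psi T := by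
  rw [Psi, ← Multiset.sum_map_mul_left]
  exact Multiset.sum_map_le_sum_map _ _ h

lemma mul_Psi_le_sum_map {T : Multiset ℝ} {g : ℝ → ℝ} {c : ℝ}
    (h : ∀ σ ∈ T, c * (1 / σ - 1) ≤ g σ) : c * Psi T ≤ (T.map g).sum := by
  rw [Psi, ← Multiset.sum_map_mul_left]
  exact Multiset.sum_map_le_sum_map _ _ h

lemma Theta_le {n : ℕ} {T : Multiset ℝ} {s σ₀ : ℝ} (h0 : 0 ≤ s) (hσ₀ : 0 < σ₀)
    (hT : ∀ σ ∈ T, σ₀ ≤ σ ∧ σ ≤ 1) (hs : s ≤ σ₀ / 2) (hs1 : s < 1) (hΨ : Psi T ≤ 2 * n) :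
    Theta n T s ≤ -(2 * s * (2 * n - Psi T)) + 16 / 3 * n * s ^ 3 / σ₀ ^ 2 := by
  have h1 : (T.map fun σ => lam (s / σ) - lam s).sum ≤ (2 * s + 8 / 3 * s ^ 3 / σ₀ ^ 2) * Psi T := by
    refine sum_map_le_mul_Psi fun σ hσ => ?_
    obtain ⟨h2, h3⟩ := hT σ hσ
    have hσ0 : 0 < σ := hσ₀.trans_le h2
    refine (lam_div_sub_le h0 hσ0 h3 (by linarith)).trans ?_
    rw [mul_comm]
    have h4 : 0 ≤ 1 / σ - 1 := by rw [sub_nonneg, le_div_iff₀ hσ0]; linarith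
    gcongr
  have h2 := two_mul_le_lam h0 hs1
  have h3 : 8 / 3 * s ^ 3 / σ₀ ^ 2 * Psi T ≤ 8 / 3 * s ^ 3 / σ₀ ^ 2 * (2 * n) := by gcongr
  have h4 : 2 * n * (2 * s) ≤ 2 * n * lam s := by gcongr
  unfold Theta
  calc _ ≤ -(2 * n * (2 * s)) + (2 * s + 8 / 3 * s ^ 3 / σ₀ ^ 2) * Psi T := by linarith
    _ ≤ -(2 * n * (2 * s)) + 2 * s * Psi T + 8 / 3 * s ^ 3 / σ₀ ^ 2 * (2 * n) := by linarith
    _ = _ := by ring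

lemma le_Theta {n : ℕ} {T : Multiset ℝ} {s : ℝ} (h0 : 0 ≤ s)
    (hT : ∀ σ ∈ T, s < σ ∧ σ ≤ 1) :
    -((2 * n - Psi T) * lam s) + 4 / 3 * s ^ 3 * Psi T ≤ Theta n T s := by
  have h1 : (lam s + 4 / 3 * s ^ 3) * Psi T ≤ (T.map fun σ => lam (s / σ) - lam s).sum :=
    mul_Psi_le_sum_map fun σ hσ => by
      rw [mul_comm]; exact le_lam_div_sub h0 (hT σ hσ).2 (hT σ hσ).1
  unfold Theta
  linarith

/-- The outer polynomial `∏ (1 - t z)` with `t = (1 - σ)/(1 + σ)`. -/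
def outerProd (T : Multiset ℝ) : ℝ[X] := (T.map fun σ => 1 - C ((1 - σ) / (1 + σ)) * X).prod

lemma aeval_outerProd (T : Multiset ℝ) (z : ℂ) :
    aeval z (outerProd T) = (T.map fun σ => 1 - ((1 - σ) / (1 + σ) : ℝ) * z).prod := by
  rw [outerProd, map_multiset_prod, Multiset.map_map]
  congr 1
  refine Multiset.map_congr rfl fun σ _ => ?_
  simp

lemma eval_outerProd (T : Multiset ℝ) (z : ℝ) :
    (outerProd T).eval z = (T.map fun σ => 1 - (1 - σ) / (1 + σ) * z).prod := by
  rw [outerProd, eval_multiset_prod, Multiset.map_map]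
  congr 1
  refine Multiset.map_congr rfl fun σ _ => ?_
  simp

lemma outerProd_coeff_zero (T : Multiset ℝ) : (outerProd T).coeff 0 = 1 := by
  rw [coeff_zero_eq_eval_zero, eval_outerProd]
  simp

lemma exp_neg_lam {s : ℝ} (h0 : 0 ≤ s) (h1 : s < 1) : exp (-lam s) = (1 - s) / (1 + s) := by
  rw [lam, neg_sub, Real.exp_sub, Real.exp_log (by linarith), Real.exp_log (by linarith)]

lemma exp_lam_sub {s σ : ℝ} (h0 : 0 ≤ s) (hs : s < σ) (hσ1 : σ ≤ 1) :
    exp (lam (s / σ) - lam s) = (1 - (1 - σ) / (1 + σ) * ((1 - s) / (1 + s))) /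
      (1 - (1 - σ) / (1 + σ) * ((1 - s) / (1 + s))⁻¹) := by
  have hσ : 0 < σ := h0.trans_lt hs
  have hv : s / σ < 1 := (div_lt_one hσ).2 hs
  have hv0 : 0 ≤ s / σ := by positivity
  rw [sub_eq_add_neg, Real.exp_add, exp_neg_lam h0 (by linarith), lam, Real.exp_sub,
    Real.exp_log (by linarith), Real.exp_log (by linarith), inv_div]
  have h1 : σ - s ≠ 0 := by linarith
  have h2 : 1 - s ≠ 0 := by linarith
  have h3 : 1 + s ≠ 0 := by linarith
  have h4 : 1 + σ ≠ 0 := by linarith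
  have e1 : (1 + s / σ) / (1 - s / σ) = (σ + s) / (σ - s) := by field_simp
  have e2 : 1 - (1 - σ) / (1 + σ) * ((1 - s) / (1 + s)) = 2 * (σ + s) / ((1 + σ) * (1 + s)) := by
    field_simp; ring
  have e3 : 1 - (1 - σ) / (1 + σ) * ((1 + s) / (1 - s)) = 2 * (σ - s) / ((1 + σ) * (1 - s)) := by
    field_simp; ring
  rw [e1, e2, e3]
  field_simp

lemma norm_one_sub_mul_le {r t : ℝ} (hr1 : r ≤ 1) (ht : 0 ≤ t) (htr : t < r) {z : ℂ}
    (hz : ‖z‖ = r) : ‖1 - t * z‖ ≤ (1 - t * r) / (1 - t * r⁻¹) * ‖1 - t * z⁻¹‖ := by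
  have hr : 0 < r := ht.trans_lt htr
  have hz0 : z ≠ 0 := by rintro rfl; simp at hz; linarith
  have hd : 0 < 1 - t * r⁻¹ := by
    rw [← div_eq_mul_inv, sub_pos, div_lt_one hr]; exact htr
  have hn : 0 < 1 - t * r := by nlinarith
  have hsq : z.re ^ 2 + z.im ^ 2 = r ^ 2 := by
    have := Complex.normSq_eq_norm_sq z
    rw [hz, Complex.normSq_apply] at this
    linarith
  have e1 : ‖1 - t * z‖ ^ 2 = 1 - 2 * t * z.re + t ^ 2 * r ^ 2 := by
    rw [← Complex.normSq_eq_norm_sq, Complex.normSq_apply]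
    simp
    linear_combination t ^ 2 * hsq
  have e2 : ‖1 - t * z⁻¹‖ ^ 2 = 1 - 2 * t * z.re / r ^ 2 + t ^ 2 / r ^ 2 := by
    have : (1 - t * z⁻¹ : ℂ) = (z - t) / z := by field_simp
    rw [this, norm_div, div_pow, hz, ← Complex.normSq_eq_norm_sq, Complex.normSq_apply]
    simp
    field_simp
    linear_combination hsq
  have hre : z.re ≤ r := hz ▸ (Complex.re_le_norm z)
  rw [div_mul_eq_mul_div, le_div_iff₀ hd]
  refine abs_le_of_sq_le_sq' ?_ (by positivity) |>.2
  rw [mul_pow, mul_pow, e1, e2]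
  have key : (1 - t * r) ^ 2 * (1 - 2 * t * z.re / r ^ 2 + t ^ 2 / r ^ 2) -
      (1 - 2 * t * z.re + t ^ 2 * r ^ 2) * (1 - t * r⁻¹) ^ 2 =
      2 * t * (1 - t ^ 2) * (1 - r ^ 2) * (r - z.re) / r ^ 2 := by
    field_simp
    ring
  have h5 : 0 ≤ 2 * t * (1 - t ^ 2) * (1 - r ^ 2) * (r - z.re) / r ^ 2 := by
    have h6 : 0 ≤ 1 - t ^ 2 := by nlinarith
    have h7 : 0 ≤ 1 - r ^ 2 := by nlinarith
    have h8 : 0 ≤ r - z.re := by linarith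
    positivity
  linarith

lemma div_lt_of_lt {s σ : ℝ} (h0 : 0 ≤ s) (hs : s < σ) : (1 - σ) / (1 + σ) < (1 - s) / (1 + s) := by
  rw [div_lt_div_iff₀ (by linarith) (by linarith)]
  nlinarith

lemma norm_outerProd_le {T : Multiset ℝ} {s : ℝ} (h0 : 0 ≤ s) (hT : ∀ σ ∈ T, s < σ ∧ σ ≤ 1) {z : ℂ}
    (hz : ‖z‖ = (1 - s) / (1 + s)) : ‖aeval z (outerProd T)‖ ≤
      exp (T.map fun σ => lam (s / σ) - lam s).sum * ‖aeval z⁻¹ (outerProd T)‖ := by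
  rw [aeval_outerProd, aeval_outerProd]
  induction T using Multiset.induction_on with
  | empty => simp
  | cons σ T ih =>
    obtain ⟨h1, h2⟩ := hT σ (by simp)
    simp only [Multiset.map_cons, Multiset.prod_cons, Multiset.sum_cons, norm_mul, Real.exp_add]
    have ih := ih fun τ hτ => hT τ (by simp [hτ])
    have h3 := norm_one_sub_mul_le (t := (1 - σ) / (1 + σ)) (r := (1 - s) / (1 + s))
      ((div_le_one (by linarith)).2 (by linarith)) (div_nonneg (by linarith) (by linarith))
      (div_lt_of_lt h0 h1) hz
    rw [← exp_lam_sub h0 h1 h2] at h3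
    refine (mul_le_mul h3 ih (norm_nonneg _) (by positivity)).trans (le_of_eq ?_)
    ring

lemma exp_sum_mul_eval_outerProd {T : Multiset ℝ} {s : ℝ} (h0 : 0 ≤ s)
    (hT : ∀ σ ∈ T, s < σ ∧ σ ≤ 1) :
    exp (T.map fun σ => lam (s / σ) - lam s).sum * (outerProd T).eval ((1 - s) / (1 + s))⁻¹ =
      (outerProd T).eval ((1 - s) / (1 + s)) := by
  rw [eval_outerProd, eval_outerProd]
  induction T using Multiset.induction_on with
  | empty => simp
  | cons σ T ih =>
    obtain ⟨h1, h2⟩ := hT σ (by simp)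
    simp only [Multiset.map_cons, Multiset.prod_cons, Multiset.sum_cons, Real.exp_add]
    have ih := ih fun τ hτ => hT τ (by simp [hτ])
    rw [← ih, exp_lam_sub h0 h1 h2]
    have h3 := div_lt_of_lt h0 h1
    have h4 : 0 < (1 - s) / (1 + s) := div_pos (by linarith) (by linarith)
    have h5 : 0 < 1 - (1 - σ) / (1 + σ) * ((1 - s) / (1 + s))⁻¹ := by
      rw [← div_eq_mul_inv, sub_pos, div_lt_one h4]; exact h3
    generalize 1 - (1 - σ) / (1 + σ) * ((1 - s) / (1 + s))⁻¹ = d at *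
    field_simp

lemma exp_Theta {n : ℕ} {T : Multiset ℝ} {s : ℝ} (h0 : 0 ≤ s) (h1 : s < 1) :
    exp (Theta n T s) = ((1 - s) / (1 + s)) ^ (2 * n) *
      exp (T.map fun σ => lam (s / σ) - lam s).sum := by
  rw [Theta, Real.exp_add, ← exp_neg_lam h0 h1, ← Real.exp_nat_mul]
  congr 2
  push_cast
  ring

lemma outerProd_ne_zero {T : Multiset ℝ} {s : ℝ} (h0 : 0 ≤ s) (hT : ∀ σ ∈ T, s < σ ∧ σ ≤ 1)
    {z : ℂ} (hz : ‖z‖ ≤ ((1 - s) / (1 + s))⁻¹) : aeval z (outerProd T) ≠ 0 := by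
  rw [aeval_outerProd]
  refine Multiset.prod_ne_zero fun h => ?_
  obtain ⟨σ, hσ, h⟩ := Multiset.mem_map.1 h
  obtain ⟨h1, h2⟩ := hT σ hσ
  have h3 := div_lt_of_lt h0 h1
  have h4 : 0 < (1 - s) / (1 + s) := div_pos (by linarith) (by linarith)
  have h5 : 0 ≤ (1 - σ) / (1 + σ) := div_nonneg (by linarith) (by linarith)
  have h6 : ‖(((1 - σ) / (1 + σ) : ℝ) : ℂ) * z‖ = 1 := by rw [← sub_eq_zero.1 h, norm_one]
  rw [norm_mul, Complex.norm_real, norm_of_nonneg h5] at h6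
  have h7 : (1 - σ) / (1 + σ) * ‖z‖ ≤ (1 - σ) / (1 + σ) * ((1 - s) / (1 + s))⁻¹ := by gcongr
  have h8 : (1 - σ) / (1 + σ) * ((1 - s) / (1 + s))⁻¹ < 1 := by
    rw [← div_eq_mul_inv, div_lt_one h4]; exact h3
  linarith

lemma exists_ratio_bound {E : ℝ[X]} (hE : ∀ z : ℂ, ‖z‖ ≤ 2 → aeval z E ≠ 0) :
    ∃ C, 0 < C ∧ (∀ z : ℂ, 1 / 2 ≤ ‖z‖ → ‖z‖ ≤ 1 → ‖aeval z E‖ ≤ C * ‖aeval z⁻¹ E‖) ∧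
      ∀ z : ℂ, ‖z‖ ≤ 2 → ‖aeval z E‖ ≤ C ∧ 1 ≤ C * ‖aeval z E‖ := by
  have hc : ContinuousOn (fun z => aeval z E) (closedBall (0 : ℂ) 2) :=
    E.continuous_aeval.continuousOn
  obtain ⟨C₁, hC₁⟩ := (isCompact_closedBall (0:ℂ) 2).exists_bound_of_continuousOn hc
  obtain ⟨C₂, hC₂⟩ := (isCompact_closedBall (0:ℂ) 2).exists_bound_of_continuousOn
    (hc.inv₀ fun z hz => hE z (by simpa using hz))
  have b1 : ∀ z : ℂ, ‖z‖ ≤ 2 → ‖aeval z E‖ ≤ C₁ := fun z hz => hC₁ z (by simpa using hz)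
  have b2 : ∀ z : ℂ, ‖z‖ ≤ 2 → 1 ≤ C₂ * ‖aeval z E‖ := fun z hz => by
    have := hC₂ z (by simpa using hz)
    simp only [Pi.inv_apply, norm_inv] at this
    rwa [inv_le_iff_one_le_mul₀ (norm_pos_iff.2 (hE z hz))] at this
  have hC₁0 : 0 ≤ C₁ := (norm_nonneg _).trans (b1 0 (by simp))
  have hC₂0 : 0 < C₂ := by
    have h1 := b2 0 (by simp)
    by_contra h
    nlinarith [norm_nonneg (aeval (0:ℂ) E), not_lt.1 h]
  refine ⟨C₁ + C₂ + C₁ * C₂, by positivity, fun z h1 h2 => ?_, fun z hz => ⟨?_, ?_⟩⟩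
  · have hz : ‖z⁻¹‖ ≤ 2 := by
      rw [norm_inv, inv_le_comm₀ (by linarith) (by norm_num)]
      linarith
    have h3 := b1 z (by linarith)
    have h4 := b2 _ hz
    have h5 : C₁ ≤ C₁ * C₂ * ‖aeval z⁻¹ E‖ := by nlinarith
    nlinarith [norm_nonneg (aeval z⁻¹ E)]
  · have := b1 z hz
    nlinarith [mul_nonneg hC₁0 hC₂0.le]
  · have := b2 z hz
    nlinarith [mul_nonneg hC₁0 hC₂0.le, norm_nonneg (aeval z E)]

lemma outerBound_mul {n : ℕ} {T : Multiset ℝ} {s C M : ℝ} {E : ℝ[X]}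
    (hE : ∀ z : ℂ, ‖z‖ ≤ 2 → aeval z E ≠ 0)
    (hC : ∀ z : ℂ, 1 / 2 ≤ ‖z‖ → ‖z‖ ≤ 1 → ‖aeval z E‖ ≤ C * ‖aeval z⁻¹ E‖)
    (h0 : 0 < s) (hs : s ≤ 1 / 3) (hT : ∀ σ ∈ T, s < σ ∧ σ ≤ 1) (hC0 : 0 ≤ C)
    (hM : C * exp (Theta n T s) ≤ M) (hM2 : M ≤ 1 / 2) :
    OuterBound (outerProd T * E) n ((1 - s) / (1 + s)) M := by
  have hr : 1 / 2 ≤ (1 - s) / (1 + s) := by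
    rw [le_div_iff₀ (by linarith)]; linarith
  have hr1 : (1 - s) / (1 + s) < 1 := by
    rw [div_lt_one (by linarith)]; linarith
  refine ⟨by linarith, hr1, fun z hz => ?_, le_trans (by positivity) hM, hM2, fun z hz => ?_⟩
  · rw [map_mul]
    refine mul_ne_zero (outerProd_ne_zero h0.le hT hz) (hE z (hz.trans ?_))
    rw [inv_le_comm₀ (by linarith) (by norm_num)]
    linarith
  · have h1 := norm_outerProd_le h0.le hT hz
    have h2 := hC z (by rw [hz]; exact hr) (by rw [hz]; exact hr1.le)
    rw [map_mul, map_mul, norm_mul, norm_mul, norm_mul, norm_pow, hz]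
    calc _ ≤ ((1 - s) / (1 + s)) ^ (2 * n) *
          (exp (T.map fun σ => lam (s / σ) - lam s).sum * ‖aeval z⁻¹ (outerProd T)‖ *
            (C * ‖aeval z⁻¹ E‖)) := by gcongr
      _ = C * exp (Theta n T s) * (‖aeval z⁻¹ (outerProd T)‖ * ‖aeval z⁻¹ E‖) := by
          rw [exp_Theta h0.le (by linarith)]; ring
      _ ≤ _ := by gcongr

/-- The local parameter `√((x - β)/(x - α))` of the exterior of `[α, β]`. -/
def sfun (α β x : ℝ) : ℝ := √((x - β) / (x - α))

/-- The conformal map of the exterior of `[α, β]` onto the punctured unit disc. -/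
def zfun (α β x : ℝ) : ℝ := (1 - sfun α β x) / (1 + sfun α β x)

section Geometry

variable {α β x : ℝ}

lemma sfun_nonneg : 0 ≤ sfun α β x := Real.sqrt_nonneg _

lemma sfun_sq (hβ : α < β) (hx : β ≤ x) : sfun α β x ^ 2 = (x - β) / (x - α) :=
  Real.sq_sqrt (div_nonneg (by linarith) (by linarith))

lemma one_sub_sfun_sq (hβ : α < β) (hx : β ≤ x) : 1 - sfun α β x ^ 2 = (β - α) / (x - α) := by
  rw [sfun_sq hβ hx]
  have : x - α ≠ 0 := by linarith
  field_simp
  ring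

lemma sfun_lt_one (hβ : α < β) (hx : β ≤ x) : sfun α β x < 1 := by
  have h1 := one_sub_sfun_sq hβ hx
  have h2 : 0 < (β - α) / (x - α) := div_pos (by linarith) (by linarith)
  nlinarith [sfun_nonneg (α := α) (β := β) (x := x)]

lemma sfun_pos (hβ : α < β) (hx : β < x) : 0 < sfun α β x :=
  Real.sqrt_pos.2 (div_pos (by linarith) (by linarith))

lemma sfun_le_sfun {β' x' : ℝ} (hβ : α ≤ β) (hββ : β ≤ β') (hx' : α < x') (hx : x' ≤ x) :
    sfun α β' x' ≤ sfun α β x := by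
  refine Real.sqrt_le_sqrt ?_
  rw [div_le_div_iff₀ (by linarith) (by linarith)]
  nlinarith [mul_nonneg (sub_nonneg.2 hββ) (sub_nonneg.2 hx),
    mul_nonneg (sub_nonneg.2 hβ) (sub_nonneg.2 hx),
    mul_nonneg (sub_nonneg.2 hββ) (sub_pos.2 hx').le]

lemma zfun_pos (hβ : α < β) (hx : β ≤ x) : 0 < zfun α β x :=
  div_pos (by linarith [sfun_lt_one hβ hx]) (by linarith [sfun_nonneg (α := α) (β := β) (x := x)])

lemma zfun_lt_one (hβ : α < β) (hx : β < x) : zfun α β x < 1 := by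
  rw [zfun, div_lt_one] <;> linarith [sfun_pos hβ hx]

lemma zfun_le_of_le_sfun {σ : ℝ} (h0 : 0 ≤ σ) (hs : σ ≤ sfun α β x) :
    zfun α β x ≤ (1 - σ) / (1 + σ) := by
  rw [zfun, div_le_div_iff₀ (by linarith) (by linarith)]
  nlinarith

lemma sfun_le_one_sub_zfun_sq (hβ : α < β) (hx : β ≤ x) : sfun α β x ≤ 1 - zfun α β x ^ 2 := by
  have h0 := sfun_nonneg (α := α) (β := β) (x := x)
  have h1 := sfun_lt_one hβ hx
  rw [zfun, div_pow, le_sub_iff_add_le, ← le_sub_iff_add_le', div_le_iff₀ (by positivity)]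
  nlinarith [mul_nonneg h0 (sub_nonneg.2 h1.le), mul_nonneg h0 h0,
    mul_nonneg (mul_nonneg h0 h0) (sub_nonneg.2 h1.le)]

lemma div_zfun (hβ : α < β) (hx : β ≤ x) :
    (β - α) / 4 / zfun α β x = (x - α) * (1 + sfun α β x) ^ 2 / 4 := by
  have h0 := sfun_nonneg (α := α) (β := β) (x := x)
  have h1 := sfun_lt_one hβ hx
  have h2 : (x - α) * (1 - sfun α β x ^ 2) = β - α := by
    rw [one_sub_sfun_sq hβ hx, mul_div_cancel₀ _ (by linarith)]
  have h3 : 1 - sfun α β x ≠ 0 := by linarith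
  rw [zfun, ← h2]
  field_simp
  ring

/-- The exterior map inverts the Joukowski map of `[α, β]`. -/
lemma joukowski_zfun (hβ : α < β) (hx : β ≤ x) :
    (α + β) / 2 + (β - α) / 4 * (zfun α β x + (zfun α β x)⁻¹) = x := by
  have h0 := sfun_nonneg (α := α) (β := β) (x := x)
  have h1 := sfun_lt_one hβ hx
  have h2 := one_sub_sfun_sq hβ hx
  have h3 : 1 - sfun α β x ≠ 0 := by linarith
  have h5 : 1 + sfun α β x ≠ 0 := by linarith
  have h4 : x - α ≠ 0 := by linarith
  rw [eq_div_iff h4] at h2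
  have h6 : zfun α β x + (zfun α β x)⁻¹ = 2 * (1 + sfun α β x ^ 2) / (1 - sfun α β x ^ 2) := by
    rw [zfun, inv_div, show 1 - sfun α β x ^ 2 = (1 - sfun α β x) * (1 + sfun α β x) by ring]
    field_simp
    ring
  have h7 : 1 - sfun α β x ^ 2 ≠ 0 := by nlinarith
  rw [h6]
  generalize sfun α β x = s at *
  field_simp
  have e : β = α + (1 - s ^ 2) * (x - α) := by linarith
  rw [e]
  ring

lemma jk_zfun (hβ : α < β) (hx : β ≤ x) :
    jk ((α + β) / 2) ((β - α) / 4) (zfun α β x) = x := by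
  conv_rhs => rw [← joukowski_zfun hβ hx]
  rw [jk]
  push_cast
  ring

lemma sub_jk (hβ : α < β) (hx : β ≤ x) {w : ℂ} (hw : w ≠ 0) :
    (x : ℂ) - jk ((α + β) / 2) ((β - α) / 4) w =
      ((β - α) / 4 / zfun α β x : ℝ) * (1 - zfun α β x * w) * (1 - zfun α β x * w⁻¹) := by
  rw [← jk_zfun hβ hx, jk, jk]
  have hz : (zfun α β x : ℂ) ≠ 0 := by exact_mod_cast (zfun_pos hβ hx).ne'
  push_cast
  field_simp
  ring

end Geometry

/-- The external field polynomial `∏ (xⱼ - x)`. -/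
def qprod (X : Multiset ℝ) (x : ℝ) : ℝ := (X.map fun t => t - x).prod

lemma continuous_qprod (X : Multiset ℝ) : Continuous (qprod X) := by
  unfold qprod
  exact continuous_multiset_prod _ fun i _ => by fun_prop

lemma qprod_pos {X : Multiset ℝ} {x : ℝ} (h : ∀ t ∈ X, x < t) : 0 < qprod X x := by
  induction X using Multiset.induction_on with
  | empty => simp [qprod]
  | cons t T ih =>
    rw [qprod, Multiset.map_cons, Multiset.prod_cons]
    exact mul_pos (sub_pos.2 (h t (Multiset.mem_cons_self _ _)))
      (ih fun t ht => h t (Multiset.mem_cons_of_mem ht))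

/-- The multiplicative constant of the external field in Joukowski coordinates. -/
def kappa (α β : ℝ) (X : Multiset ℝ) : ℝ := (X.map fun x => (β - α) / 4 / zfun α β x).prod

/-- The local parameters of a multiset of points. -/
def sset (α β : ℝ) (X : Multiset ℝ) : Multiset ℝ := X.map (sfun α β)

section Field

variable {α β : ℝ} {X : Multiset ℝ}

lemma kappa_pos (hβ : α < β) (hX : ∀ x ∈ X, β ≤ x) : 0 < kappa α β X := by
  unfold kappa
  induction X using Multiset.induction_on with
  | empty => simp
  | cons t T ih =>
    rw [Multiset.map_cons, Multiset.prod_cons]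
    exact mul_pos (div_pos (by linarith) (zfun_pos hβ (hX t (Multiset.mem_cons_self _ _))))
      (ih fun t ht => hX t (Multiset.mem_cons_of_mem ht))

lemma qprod_jk (hβ : α < β) (hX : ∀ x ∈ X, β ≤ x) {w : ℂ} (hw : w ≠ 0) :
    (X.map fun t : ℝ => (t : ℂ) - jk ((α + β) / 2) ((β - α) / 4) w).prod =
      kappa α β X * aeval w (outerProd (sset α β X)) * aeval w⁻¹ (outerProd (sset α β X)) := by
  rw [aeval_outerProd, aeval_outerProd, sset, kappa, Multiset.map_map, Multiset.map_map]
  induction X using Multiset.induction_on with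
  | empty => simp
  | cons t T ih =>
    simp only [Multiset.map_cons, Multiset.prod_cons]
    rw [ih fun t ht => hX t (Multiset.mem_cons_of_mem ht),
      sub_jk hβ (hX t (Multiset.mem_cons_self _ _)) hw]
    simp only [zfun, Function.comp]
    push_cast
    ring

lemma qprod_ofReal (x : ℝ) : ((qprod X x : ℝ) : ℂ) = (X.map fun t : ℝ => (t : ℂ) - x).prod := by
  unfold qprod
  induction X using Multiset.induction_on with
  | empty => simp
  | cons t T ih =>
    simp only [Multiset.map_cons, Multiset.prod_cons]
    rw [← ih]
    push_cast
    ring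

lemma jk_of_norm_one (m a : ℝ) {z : ℂ} (hz : ‖z‖ = 1) : jk m a z = (m + 2 * a * z.re : ℝ) := by
  have := half_add_inv_of_norm_one hz
  rw [jk, show z + z⁻¹ = 2 * ((z + z⁻¹) / 2) by ring, this]
  push_cast
  ring

lemma qprod_circle (hβ : α < β) (hX : ∀ x ∈ X, β ≤ x) {z : ℂ} (hz : ‖z‖ = 1) :
    qprod X ((α + β) / 2 + 2 * ((β - α) / 4) * z.re) =
      kappa α β X * ‖aeval z (outerProd (sset α β X))‖ ^ 2 := by
  have hz0 : z ≠ 0 := by rintro rfl; simp at hz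
  have h1 := qprod_jk hβ hX hz0
  have h2 : ∀ p : ℝ[X], aeval z⁻¹ p = (starRingEnd ℂ) (aeval z p) := fun p => by
    rw [inv_eq_conj_of_norm_one hz, ← Complex.conjAe_coe, ← aeval_algHom_apply]
  have h3 : ((qprod X ((α + β) / 2 + 2 * ((β - α) / 4) * z.re) : ℝ) : ℂ) =
      ((kappa α β X * ‖aeval z (outerProd (sset α β X))‖ ^ 2 : ℝ) : ℂ) := by
    rw [qprod_ofReal, ← jk_of_norm_one _ _ hz, h1, h2, mul_assoc, Complex.mul_conj,
      Complex.normSq_eq_norm_sq]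
    push_cast
    rfl
  exact_mod_cast h3

lemma qprod_outside (hβ : α < β) (hX : ∀ x ∈ X, β ≤ x) {x : ℝ} (hx : β ≤ x) :
    qprod X x = kappa α β X * (outerProd (sset α β X)).eval (zfun α β x) *
      (outerProd (sset α β X)).eval (zfun α β x)⁻¹ := by
  have hz := zfun_pos hβ hx
  have h1 := qprod_jk hβ hX (w := zfun α β x) (by exact_mod_cast hz.ne')
  rw [jk_zfun hβ hx, ← qprod_ofReal, ← Complex.ofReal_inv] at h1
  have h2 : ∀ (p : ℝ[X]) (t : ℝ), aeval (t : ℂ) p = ((p.eval t : ℝ) : ℂ) := fun p t => by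
    rw [← Complex.coe_algebraMap, aeval_algebraMap_apply_eq_algebraMap_eval]
  rw [h2, h2] at h1
  exact_mod_cast h1

end Field

lemma integral_eq_circleAverage {α β : ℝ} {g : ℝ → ℝ} (h : α < β)
    (hg : ContinuousOn g (Set.Icc α β)) : ∫ x in α..β, g x =
      π * ((β - α) / 4) * circleAverage
        (fun z => g ((α + β) / 2 + 2 * ((β - α) / 4) * z.re) * ‖1 - z ^ 2‖) 0 1 := by
  set m := (α + β) / 2 with hm
  set a := (β - α) / 4 with ha
  have ha0 : 0 < a := by rw [ha]; linarith
  have hmα : m - 2 * a = α := by rw [hm, ha]; ring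
  have hmβ : m + 2 * a = β := by rw [hm, ha]; ring
  set φ : ℝ → ℝ := fun θ => m + 2 * a * cos θ with hφ
  have hφ' : ∀ θ, HasDerivAt φ (-(2 * a * sin θ)) θ := fun θ => by
    refine (((Real.hasDerivAt_cos θ).const_mul (2 * a)).const_add m).congr_deriv (by ring)
  have hφI : ∀ θ, φ θ ∈ Set.Icc α β := fun θ => by
    constructor <;> simp only [hφ] <;> nlinarith [Real.neg_one_le_cos θ, Real.cos_le_one θ]
  have hgφ : Continuous fun θ => g (φ θ) := by
    rw [← continuousOn_univ]
    exact hg.comp (by fun_prop) fun θ _ => hφI θ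
  have hsq : ∀ θ : ℝ, ‖1 - (circleMap 0 1 θ) ^ 2‖ = 2 * |sin θ| := fun θ => by
    have e : (1 - (circleMap 0 1 θ) ^ 2) = circleMap 0 1 θ * (-2 * Complex.I * Complex.sin θ) := by
      simp only [circleMap, Complex.exp_mul_I, Complex.ofReal_one, zero_add, one_mul]
      have := Complex.sin_sq_add_cos_sq (θ : ℂ)
      linear_combination (-1 : ℂ) * this + Complex.sin θ ^ 2 * Complex.I_sq
    rw [e, norm_mul, norm_circleMap_zero, norm_mul, norm_mul, ← Complex.ofReal_sin,
      Complex.norm_real]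
    simp
  have h_int : ∀ u v : ℝ, IntervalIntegrable (fun θ => g (φ θ) * (2 * |sin θ|)) volume u v :=
    fun u v => (hgφ.mul (by fun_prop)).intervalIntegrable _ _
  have h1 : ∫ θ in 0..π, g (φ θ) * (2 * |sin θ|) = a⁻¹ * ∫ x in α..β, g x := by
    have := intervalIntegral.integral_comp_mul_deriv' (a := 0) (b := π) (f := φ)
      (f' := fun θ => -(2 * a * sin θ)) (g := g) (fun θ _ => hφ' θ) (by fun_prop)
      (hg.mono (by rintro _ ⟨θ, _, rfl⟩; exact hφI θ))
    have e0 : φ 0 = β := by simp [hφ, hmβ]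
    have e1 : φ π = α := by simp only [hφ, cos_pi]; linarith
    rw [e0, e1, intervalIntegral.integral_symm α β] at this
    rw [← neg_neg (∫ x in α..β, g x), ← this, ← intervalIntegral.integral_neg,
      ← intervalIntegral.integral_const_mul]
    refine intervalIntegral.integral_congr fun θ hθ => ?_
    rw [Set.uIcc_of_le pi_pos.le] at hθ
    simp only [Function.comp]
    rw [abs_of_nonneg (sin_nonneg_of_nonneg_of_le_pi hθ.1 hθ.2)]
    field_simp
  have h2 : ∫ θ in π..2 * π, g (φ θ) * (2 * |sin θ|) = a⁻¹ * ∫ x in α..β, g x := by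
    have := intervalIntegral.integral_comp_mul_deriv' (a := π) (b := 2 * π) (f := φ)
      (f' := fun θ => -(2 * a * sin θ)) (g := g) (fun θ _ => hφ' θ) (by fun_prop)
      (hg.mono (by rintro _ ⟨θ, _, rfl⟩; exact hφI θ))
    have e0 : φ (2 * π) = β := by simp [hφ, hmβ]
    have e1 : φ π = α := by simp only [hφ, cos_pi]; linarith
    rw [e0, e1] at this
    rw [← this, ← intervalIntegral.integral_const_mul]
    refine intervalIntegral.integral_congr fun θ hθ => ?_
    rw [Set.uIcc_of_le (by linarith [pi_pos])] at hθ
    simp only [Function.comp]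
    rw [abs_of_nonpos]
    · field_simp
    · have := sin_nonneg_of_nonneg_of_le_pi (x := θ - π) (by linarith [hθ.1]) (by linarith [hθ.2])
      rw [Real.sin_sub_pi] at this
      linarith
  have h3 : circleAverage (fun z => g (m + 2 * a * z.re) * ‖1 - z ^ 2‖) 0 1 =
      (2 * π)⁻¹ * ∫ θ in 0..2 * π, g (φ θ) * (2 * |sin θ|) := by
    rw [circleAverage_def, smul_eq_mul]
    congr 1
    refine intervalIntegral.integral_congr fun θ _ => ?_
    simp only [hsq, hφ]
    simp [circleMap, Complex.exp_ofReal_mul_I_re]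
  rw [h3, ← intervalIntegral.integral_add_adjacent_intervals (h_int 0 π) (h_int π (2 * π)), h1, h2]
  field_simp
  ring

/-- `p` is orthogonal to all polynomials of degree less than `n` for the weight `w`. -/
def Orth (lo hi : ℝ) (w : ℝ → ℝ) (n : ℕ) (p : ℝ[X]) : Prop :=
  ∀ l < n, ∫ x in lo..hi, p.eval x * x ^ l * w x = 0

section Orthogonal

variable {lo hi : ℝ} {w : ℝ → ℝ} {n : ℕ} {p : ℝ[X]}

lemma intervalIntegrable_eval_mul (h : lo ≤ hi) (hw : ContinuousOn w (Set.Icc lo hi)) {g : ℝ → ℝ}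
    (hg : ContinuousOn g (Set.Icc lo hi)) :
    IntervalIntegrable (fun x => g x * w x) volume lo hi :=
  ContinuousOn.intervalIntegrable_of_Icc h (hg.mul hw)

lemma Orth.integral_mul_eq_zero (ho : Orth lo hi w n p) (h : lo ≤ hi)
    (hw : ContinuousOn w (Set.Icc lo hi)) {g : ℝ[X]} (hg : g.degree < n) :
    ∫ x in lo..hi, p.eval x * g.eval x * w x = 0 := by
  by_cases h0 : g = 0
  · simp [h0]
  have e : ∀ x, p.eval x * g.eval x * w x =
      ∑ l ∈ Finset.range n, g.coeff l * (p.eval x * x ^ l * w x) := fun x => by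
    rw [eval_eq_sum_range' ((natDegree_lt_iff_degree_lt h0).2 hg) x, Finset.mul_sum, Finset.sum_mul]
    exact Finset.sum_congr rfl fun l _ => by ring
  simp_rw [e]
  rw [intervalIntegral.integral_finsetSum fun l _ => IntervalIntegrable.const_mul
    (intervalIntegrable_eval_mul h hw (g := fun x => p.eval x * x ^ l) (by fun_prop)) _]
  exact Finset.sum_eq_zero fun l hl => by
    rw [intervalIntegral.integral_const_mul, ho l (Finset.mem_range.1 hl), mul_zero]

lemma exists_eval_ne_zero (h : lo < hi) (hp : p ≠ 0) : ∃ x ∈ Set.Ioo lo hi, p.eval x ≠ 0 := by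
  by_contra! hc
  exact (Set.Ioo_infinite h) ((p.roots.toFinset.finite_toSet).subset fun x hx => by
    simp [hp, hc x hx])

lemma integral_sq_mul_pos (h : lo < hi) (hw : ContinuousOn w (Set.Icc lo hi))
    (hpos : ∀ x ∈ Set.Icc lo hi, 0 < w x) (hp : p ≠ 0) :
    0 < ∫ x in lo..hi, p.eval x ^ 2 * w x := by
  obtain ⟨c, hc, hc0⟩ := exists_eval_ne_zero h hp
  refine intervalIntegral.integral_pos h (by fun_prop) (fun x hx => ?_) ⟨c, ⟨hc.1.le, hc.2.le⟩, ?_⟩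
  · exact mul_nonneg (sq_nonneg _) (hpos x ⟨hx.1.le, hx.2⟩).le
  · exact mul_pos (by positivity) (hpos c ⟨hc.1.le, hc.2.le⟩)

lemma Orth.eval_mul_integral (ho : Orth lo hi w n p) (h : lo ≤ hi)
    (hw : ContinuousOn w (Set.Icc lo hi)) {g : ℝ[X]} (hg : g.natDegree ≤ n) {y : ℝ} (hy : hi < y) :
    g.eval y * ∫ x in lo..hi, p.eval x * (w x / (y - x)) =
      ∫ x in lo..hi, g.eval x * p.eval x * (w x / (y - x)) := by
  have hw' : ContinuousOn (fun x => w x / (y - x)) (Set.Icc lo hi) :=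
    hw.div (by fun_prop) fun x hx => by linarith [hx.2]
  obtain ⟨q, hq⟩ : X - C y ∣ g - C (g.eval y) := by
    rw [dvd_iff_isRoot]; simp
  have hq0 : q.degree < n := by
    by_cases h0 : q = 0
    · rw [h0, degree_zero]; exact WithBot.bot_lt_coe n
    · rw [← natDegree_lt_iff_degree_lt h0]
      have h1 := natDegree_sub_C (p := g) (a := g.eval y)
      rw [hq, natDegree_mul (X_sub_C_ne_zero y) h0, natDegree_X_sub_C] at h1
      omega
  have h1 := ho.integral_mul_eq_zero h hw hq0
  rw [← intervalIntegral.integral_const_mul, ← sub_eq_zero, ← h1, ← intervalIntegral.integral_sub]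
  · refine intervalIntegral.integral_congr fun x hx => ?_
    rw [Set.uIcc_of_le h] at hx
    have h2 : y - x ≠ 0 := by linarith [hx.2]
    have h3 := congrArg (eval x) hq
    simp only [eval_sub, eval_C, eval_mul, eval_X] at h3
    rw [← sub_eq_zero]
    field_simp
    linear_combination (-(p.eval x * w x)) * h3
  · exact (intervalIntegrable_eval_mul h hw' (g := fun x => p.eval x) (by fun_prop)).const_mul _
  · exact intervalIntegrable_eval_mul h hw' (g := fun x => g.eval x * p.eval x) (by fun_prop)

lemma Orth.integral_sq_eq (ho : Orth lo hi w n p) (h : lo ≤ hi)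
    (hw : ContinuousOn w (Set.Icc lo hi)) (hp : p.Monic) (hpn : p.natDegree = n) {P : ℝ[X]}
    (hP : P.Monic) (hPn : P.natDegree = n) : ∫ x in lo..hi, P.eval x ^ 2 * w x =
      (∫ x in lo..hi, p.eval x ^ 2 * w x) + ∫ x in lo..hi, (P - p).eval x ^ 2 * w x := by
  have hd : (P - p).degree < n := by
    refine (degree_sub_lt_left ?_ hP.ne_zero (hP.leadingCoeff.trans hp.leadingCoeff.symm)).trans_le ?_
    · rw [degree_eq_natDegree hP.ne_zero, degree_eq_natDegree hp.ne_zero, hPn, hpn]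
    · rw [degree_eq_natDegree hP.ne_zero, hPn]
  have h1 := ho.integral_mul_eq_zero h hw hd
  have i : ∀ {g : ℝ → ℝ}, Continuous g → IntervalIntegrable (fun x => g x * w x) volume lo hi :=
    fun hg => intervalIntegrable_eval_mul h hw hg.continuousOn
  have e : ∀ x, P.eval x ^ 2 * w x = p.eval x ^ 2 * w x + (P - p).eval x ^ 2 * w x +
      2 * (p.eval x * (P - p).eval x * w x) := fun x => by
    rw [eval_sub]; ring
  simp_rw [e]
  rw [intervalIntegral.integral_add, intervalIntegral.integral_add,
    intervalIntegral.integral_const_mul, h1, mul_zero, add_zero]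
  · exact i (g := fun x => p.eval x ^ 2) (by fun_prop)
  · exact i (g := fun x => (P - p).eval x ^ 2) (by fun_prop)
  · exact (i (g := fun x => p.eval x ^ 2) (by fun_prop)).add
      (i (g := fun x => (P - p).eval x ^ 2) (by fun_prop))
  · exact (i (g := fun x => p.eval x * (P - p).eval x) (by fun_prop)).const_mul 2

lemma abs_integral_mul_le (h : lo ≤ hi) (hw : ContinuousOn w (Set.Icc lo hi))
    (hpos : ∀ x ∈ Set.Icc lo hi, 0 < w x) (u v : ℝ[X]) :
    ∫ x in lo..hi, |u.eval x| * |v.eval x| * w x ≤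
      √(∫ x in lo..hi, u.eval x ^ 2 * w x) * √(∫ x in lo..hi, v.eval x ^ 2 * w x) := by
  have i : ∀ {g : ℝ → ℝ}, Continuous g → IntervalIntegrable (fun x => g x * w x) volume lo hi :=
    fun hg => intervalIntegrable_eval_mul h hw hg.continuousOn
  have iu := i (g := fun x => u.eval x ^ 2) (by fun_prop)
  have iv := i (g := fun x => v.eval x ^ 2) (by fun_prop)
  have iuv := i (g := fun x => |u.eval x| * |v.eval x|) (by fun_prop)
  refine (le_abs_self _).trans (abs_le_sqrt_mul_sqrt_of_quadratic ?_ fun t => ?_)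
  · exact intervalIntegral.integral_nonneg h fun x hx => mul_nonneg (sq_nonneg _) (hpos x hx).le
  · rw [mul_comm _ (t * t), ← intervalIntegral.integral_const_mul, mul_right_comm,
      ← intervalIntegral.integral_const_mul, ← intervalIntegral.integral_add (iu.const_mul _)
      (iuv.const_mul _), ← intervalIntegral.integral_add ((iu.const_mul _).add (iuv.const_mul _)) iv]
    refine intervalIntegral.integral_nonneg h fun x hx => ?_
    have : t * t * (u.eval x ^ 2 * w x) + 2 * t * (|u.eval x| * |v.eval x| * w x) +
        v.eval x ^ 2 * w x = (t * |u.eval x| + |v.eval x|) ^ 2 * w x := by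
      rw [← sq_abs (u.eval x), ← sq_abs (v.eval x)]; ring
    rw [this]
    exact mul_nonneg (sq_nonneg _) (hpos x hx).le

/-- A near-minimizer of the `L²` norm is pointwise close to the orthogonal polynomial outside
the interval. -/
theorem Orth.abs_eval_sub_le (ho : Orth lo hi w n p) (h : lo < hi)
    (hw : ContinuousOn w (Set.Icc lo hi)) (hpos : ∀ x ∈ Set.Icc lo hi, 0 < w x)
    (hp : p.Monic) (hpn : p.natDegree = n) {P : ℝ[X]} (hP : P.Monic) (hPn : P.natDegree = n)
    {γ y : ℝ} (hγ : hi < γ) (hy : γ ≤ y) : |P.eval y - p.eval y| ≤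
      √((∫ x in lo..hi, P.eval x ^ 2 * w x) / (∫ x in lo..hi, p.eval x ^ 2 * w x) - 1) *
        ((γ - lo) / (γ - hi)) * |p.eval y| := by
  set H := ∫ x in lo..hi, p.eval x ^ 2 * w x with hH
  have hH0 : 0 < H := integral_sq_mul_pos h hw hpos hp.ne_zero
  have hsum := ho.integral_sq_eq h.le hw hp hpn hP hPn
  rw [← hH] at hsum
  set R := P - p with hR
  set r := ∫ x in lo..hi, R.eval x ^ 2 * w x with hr
  have hr0 : 0 ≤ r := intervalIntegral.integral_nonneg h.le fun x hx =>
    mul_nonneg (sq_nonneg _) (hpos x hx).le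
  have hyh : hi < y := hγ.trans_le hy
  have hw' : ContinuousOn (fun x => w x / (y - x)) (Set.Icc lo hi) :=
    hw.div (by fun_prop) fun x hx => by linarith [hx.2]
  set Q := ∫ x in lo..hi, p.eval x * (w x / (y - x)) with hQ
  have e1 := ho.eval_mul_integral h.le hw (g := R)
    ((natDegree_sub_le_of_le hPn.le hpn.le).trans (by simp)) hyh
  have e2 := ho.eval_mul_integral h.le hw (g := p) hpn.le hyh
  rw [← hQ] at e1 e2
  have b2 : H / (y - lo) ≤ p.eval y * Q := by
    rw [e2, hH, div_eq_mul_inv, mul_comm, ← intervalIntegral.integral_const_mul]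
    refine intervalIntegral.integral_mono_on h.le ?_ ?_ fun x hx => ?_
    · exact (intervalIntegrable_eval_mul h.le hw (g := fun x => p.eval x ^ 2)
        (by fun_prop)).const_mul _
    · exact intervalIntegrable_eval_mul h.le hw' (g := fun x => p.eval x * p.eval x) (by fun_prop)
    · have h1 : (y - lo)⁻¹ ≤ (y - x)⁻¹ := by
        apply inv_anti₀ <;> linarith [hx.1, hx.2]
      calc (y - lo)⁻¹ * (p.eval x ^ 2 * w x) ≤ (y - x)⁻¹ * (p.eval x ^ 2 * w x) := by
            have := (hpos x hx).le
            gcongr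
        _ = _ := by ring
  have b1 : |R.eval y * Q| ≤ √r * √H / (y - hi) := by
    rw [e1]
    refine (intervalIntegral.abs_integral_le_integral_abs h.le).trans ?_
    refine le_trans ?_ (div_le_div_of_nonneg_right (abs_integral_mul_le h.le hw hpos R p)
      (by linarith))
    rw [div_eq_mul_inv, mul_comm, ← intervalIntegral.integral_const_mul]
    refine intervalIntegral.integral_mono_on h.le ?_ ?_ fun x hx => ?_
    · exact (intervalIntegrable_eval_mul h.le hw' (g := fun x => R.eval x * p.eval x)
        (by fun_prop)).abs
    · exact (intervalIntegrable_eval_mul h.le hw (g := fun x => |R.eval x| * |p.eval x|)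
        (by fun_prop)).const_mul _
    · have h1 : (y - x)⁻¹ ≤ (y - hi)⁻¹ := by
        apply inv_anti₀ <;> linarith [hx.1, hx.2]
      have h2 : 0 < y - x := by linarith [hx.2]
      have h3 := hpos x hx
      rw [abs_mul, abs_mul, abs_div, abs_of_pos h2, abs_of_pos h3]
      calc |R.eval x| * |p.eval x| * (w x / (y - x)) =
            (y - x)⁻¹ * (|R.eval x| * |p.eval x| * w x) := by ring
        _ ≤ _ := by gcongr
  have hlo : 0 < y - lo := by linarith
  have hhi : 0 < y - hi := by linarith
  have hpQ : 0 < p.eval y * Q := lt_of_lt_of_le (by positivity) b2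
  have hQ0 : 0 < |Q| := abs_pos.2 fun h0 => by simp [h0] at hpQ
  have b3 : √r * √H / (y - hi) ≤ √(r / H) * ((y - lo) / (y - hi)) * (p.eval y * Q) := by
    calc √r * √H / (y - hi) = √(r / H) * ((y - lo) / (y - hi)) * (H / (y - lo)) := by
          rw [Real.sqrt_div hr0]
          have : √H ≠ 0 := (Real.sqrt_pos.2 hH0).ne'
          have h2 : √H * √H = H := Real.mul_self_sqrt hH0.le
          field_simp
          linear_combination √r * h2
      _ ≤ _ := by gcongr
  have b4 : (y - lo) / (y - hi) ≤ (γ - lo) / (γ - hi) := by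
    rw [div_le_div_iff₀ hhi (by linarith)]
    nlinarith
  have e3 : (∫ x in lo..hi, P.eval x ^ 2 * w x) / H - 1 = r / H := by
    rw [hsum]; field_simp; ring
  rw [e3, ← eval_sub, ← hR, ← mul_le_mul_iff_left₀ hQ0, mul_assoc, ← abs_mul, ← abs_mul,
    abs_of_pos hpQ]
  refine (b1.trans b3).trans ?_
  gcongr

end Orthogonal

lemma aeval_ofReal (p : ℝ[X]) (t : ℝ) : aeval (t : ℂ) p = ((p.eval t : ℝ) : ℂ) := by
  rw [← Complex.coe_algebraMap, aeval_algebraMap_apply_eq_algebraMap_eval]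

section Szego

variable {α β : ℝ} {X : Multiset ℝ} {n : ℕ} {E P : ℝ[X]}

lemma norm_szegoFun_circle (m a : ℝ) (n : ℕ) (D P : ℝ[X]) {z : ℂ} (hz : ‖z‖ = 1) :
    ‖szegoFun m a n D P z‖ ^ 2 = P.eval (m + 2 * a * z.re) ^ 2 * ‖aeval z D‖ ^ 2 := by
  rw [szegoFun, jk_of_norm_one m a hz, aeval_ofReal, norm_mul, norm_mul, norm_pow, hz,
    Complex.norm_real, one_pow, one_mul, mul_pow, norm_eq_abs, sq_abs]

lemma continuousOn_circle (hβ : α < β) {g : ℝ → ℝ} (hg : ContinuousOn g (Set.Icc α β)) :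
    ContinuousOn (fun z : ℂ => g ((α + β) / 2 + 2 * ((β - α) / 4) * z.re)) (sphere 0 1) := by
  refine hg.comp (by fun_prop) fun z hz => ?_
  obtain ⟨h1, h2⟩ := re_mem_Icc (z := z) (by simpa using hz)
  constructor <;> nlinarith

lemma continuousOn_szegoFun_circle (m a : ℝ) (n : ℕ) (D P : ℝ[X]) :
    ContinuousOn (fun z : ℂ => ‖szegoFun m a n D P z‖ ^ 2) (sphere 0 1) := by
  have : ContinuousOn (fun z : ℂ => P.eval (m + 2 * a * z.re) ^ 2 * ‖aeval z D‖ ^ 2)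
      (sphere 0 1) := by
    have := D.continuous_aeval (A := ℂ)
    exact Continuous.continuousOn (by fun_prop)
  exact this.congr fun z hz => norm_szegoFun_circle m a n D P (by simpa using hz)

lemma integral_eq_circleAverage_qprod (hβ : α < β) (hX : ∀ x ∈ X, β ≤ x) {f : ℝ → ℝ}
    (hf : ContinuousOn f (Set.Icc α β)) (P : ℝ[X]) :
    ∫ x in α..β, P.eval x ^ 2 * (qprod X x * f x) = π * ((β - α) / 4) * kappa α β X *
      circleAverage (fun z => P.eval ((α + β) / 2 + 2 * ((β - α) / 4) * z.re) ^ 2 *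
        ‖aeval z (outerProd (sset α β X))‖ ^ 2 *
        (f ((α + β) / 2 + 2 * ((β - α) / 4) * z.re) * ‖1 - z ^ 2‖)) 0 1 := by
  have hq := continuous_qprod X
  rw [integral_eq_circleAverage hβ (by fun_prop), mul_assoc _ (kappa α β X)]
  congr 1
  rw [← smul_eq_mul (kappa α β X), ← circleAverage_fun_smul]
  refine circleAverage_congr_sphere fun z hz => ?_
  rw [smul_eq_mul]
  rw [qprod_circle hβ hX (by simpa using hz)]
  ring

lemma circleIntegrable_weight (hβ : α < β) {f : ℝ → ℝ} (hf : ContinuousOn f (Set.Icc α β))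
    (D P : ℝ[X]) : CircleIntegrable
      (fun z => P.eval ((α + β) / 2 + 2 * ((β - α) / 4) * z.re) ^ 2 * ‖aeval z D‖ ^ 2 *
        (f ((α + β) / 2 + 2 * ((β - α) / 4) * z.re) * ‖1 - z ^ 2‖)) 0 1 := by
  have := D.continuous_aeval (A := ℂ)
  have h2 := continuousOn_circle hβ hf
  exact circleIntegrable_of_sphere zero_le_one ((Continuous.continuousOn (by fun_prop)).mul
    (h2.mul (Continuous.continuousOn (by fun_prop))))

lemma integral_le_cnorm (hβ : α < β) (hX : ∀ x ∈ X, β ≤ x) {f : ℝ → ℝ}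
    (hf : ContinuousOn f (Set.Icc α β)) {K : ℝ}
    (hE : ∀ z : ℂ, ‖z‖ = 1 →
      f ((α + β) / 2 + 2 * ((β - α) / 4) * z.re) * ‖1 - z ^ 2‖ ≤ K * ‖aeval z E‖ ^ 2) :
    ∫ x in α..β, P.eval x ^ 2 * (qprod X x * f x) ≤ π * ((β - α) / 4) * kappa α β X *
      (K * cnorm 1 (szegoFun ((α + β) / 2) ((β - α) / 4) n
        (outerProd (sset α β X) * E) P) ^ 2) := by
  have h0 : 0 < π * ((β - α) / 4) * kappa α β X :=
    mul_pos (mul_pos pi_pos (by linarith)) (kappa_pos hβ hX)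
  rw [integral_eq_circleAverage_qprod hβ hX hf, cnorm_sq]
  refine mul_le_mul_of_nonneg_left ?_ h0.le
  rw [← smul_eq_mul K, ← circleAverage_fun_smul]
  refine circleAverage_mono (circleIntegrable_weight hβ hf _ _)
    (circleIntegrable_of_sphere zero_le_one ((continuousOn_szegoFun_circle _ _ _ _ _).const_smul K))
    fun z hz => ?_
  have hz1 : ‖z‖ = 1 := by simpa using hz
  rw [smul_eq_mul, norm_szegoFun_circle _ _ _ _ _ hz1, map_mul, norm_mul, mul_pow]
  refine (mul_le_mul_of_nonneg_left (hE z hz1) (by positivity)).trans (le_of_eq (by ring))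

lemma cnorm_le_integral (hβ : α < β) (hX : ∀ x ∈ X, β ≤ x) {f : ℝ → ℝ}
    (hf : ContinuousOn f (Set.Icc α β)) {K : ℝ}
    (hE : ∀ z : ℂ, ‖z‖ = 1 → K * ‖(1 - z ^ 2) * aeval z E‖ ^ 2 ≤
      f ((α + β) / 2 + 2 * ((β - α) / 4) * z.re) * ‖1 - z ^ 2‖) :
    π * ((β - α) / 4) * kappa α β X *
      (K * cnorm 1 (szegoFun ((α + β) / 2) ((β - α) / 4) n
        ((1 - Polynomial.X ^ 2) * (outerProd (sset α β X) * E)) P) ^ 2) ≤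
      ∫ x in α..β, P.eval x ^ 2 * (qprod X x * f x) := by
  have h0 : 0 < π * ((β - α) / 4) * kappa α β X :=
    mul_pos (mul_pos pi_pos (by linarith)) (kappa_pos hβ hX)
  rw [integral_eq_circleAverage_qprod hβ hX hf, cnorm_sq]
  refine mul_le_mul_of_nonneg_left ?_ h0.le
  rw [← smul_eq_mul K, ← circleAverage_fun_smul]
  refine circleAverage_mono
    (circleIntegrable_of_sphere zero_le_one ((continuousOn_szegoFun_circle _ _ _ _ _).const_smul K))
    (circleIntegrable_weight hβ hf _ _) fun z hz => ?_
  have hz1 : ‖z‖ = 1 := by simpa using hz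
  rw [smul_eq_mul, norm_szegoFun_circle _ _ _ _ _ hz1]
  refine le_trans (le_of_eq ?_) (mul_le_mul_of_nonneg_left (hE z hz1) (by positivity))
  simp only [map_mul, map_sub, map_one, map_pow, aeval_X, norm_mul, mul_pow]
  ring

lemma sfun_lt_sfun {x t : ℝ} (hβ : α < β) (hx : β ≤ x) (ht : x < t) :
    sfun α β x < sfun α β t := by
  refine Real.sqrt_lt_sqrt (div_nonneg (by linarith) (by linarith)) ?_
  rw [div_lt_div_iff₀ (by linarith) (by linarith)]
  nlinarith [mul_pos (sub_pos.2 hβ) (sub_pos.2 ht)]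

lemma sset_mem (hβ : α < β) {x : ℝ} (hx : β ≤ x) (hX : ∀ t ∈ X, x < t) :
    ∀ σ ∈ sset α β X, sfun α β x < σ ∧ σ ≤ 1 := fun σ hσ => by
  obtain ⟨t, ht, rfl⟩ := Multiset.mem_map.1 hσ
  exact ⟨sfun_lt_sfun hβ hx (hX t ht), (sfun_lt_one hβ (hx.trans (hX t ht).le)).le⟩

lemma szegoFun_outside (hβ : α < β) {x : ℝ} (hx : β ≤ x) (n : ℕ) (D P : ℝ[X]) :
    szegoFun ((α + β) / 2) ((β - α) / 4) n D P (zfun α β x) =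
      (zfun α β x ^ n * P.eval x * D.eval (zfun α β x) : ℝ) := by
  rw [szegoFun, jk_zfun hβ hx, aeval_ofReal, aeval_ofReal]
  push_cast
  rfl

lemma sq_mul_qprod_eq (hβ : α < β) {x : ℝ} (hx : β ≤ x) (hX : ∀ t ∈ X, x < t)
    (hE : E.eval (zfun α β x) ≠ 0) : P.eval x ^ 2 * qprod X x =
      kappa α β X * exp (-Theta n (sset α β X) (sfun α β x)) *
        ‖szegoFun ((α + β) / 2) ((β - α) / 4) n (outerProd (sset α β X) * E) P (zfun α β x)‖ ^ 2 /
          E.eval (zfun α β x) ^ 2 := by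
  have hT := sset_mem hβ hx hX
  have hz := zfun_pos hβ hx
  rw [szegoFun_outside hβ hx, Complex.norm_real, norm_eq_abs, sq_abs, Real.exp_neg,
    exp_Theta sfun_nonneg (sfun_lt_one hβ hx), qprod_outside hβ (fun t ht => hx.trans (hX t ht).le) hx]
  have h1 := exp_sum_mul_eval_outerProd sfun_nonneg hT
  rw [← zfun] at *
  rw [eval_mul, ← h1]
  have h2 := Real.exp_pos ((sset α β X).map fun σ => lam (sfun α β x / σ) - lam (sfun α β x)).sum
  field_simp
  ring

/-- The contribution of a soft edge tail is small. -/
lemma tail_le {β₁ : ℝ} (hβ : α < β) (hβ₁ : β ≤ β₁) (hX : ∀ t ∈ X, β₁ < t) {f : ℝ → ℝ}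
    (hf : ContinuousOn f (Set.Icc β β₁)) (hf0 : ∀ x ∈ Set.Icc β β₁, 0 ≤ f x)
    {C Fm L d : ℝ} (hFm : ∀ x ∈ Set.Icc β β₁, f x ≤ Fm)
    (hC : ∀ z : ℂ, ‖z‖ ≤ 2 → 1 ≤ C * ‖aeval z E‖) (hd : 0 < d) (hP : P.natDegree ≤ n)
    (hΘ : ∀ x ∈ Set.Ioc β β₁, -Theta n (sset α β X) (sfun α β x) ≤ L - d * sfun α β x) :
    ∫ x in β..β₁, P.eval x ^ 2 * (qprod X x * f x) ≤
      kappa α β X * (Fm * C ^ 2 * exp L * (4 * (β₁ - α)) / √d) *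
        cnorm 1 (szegoFun ((α + β) / 2) ((β - α) / 4) n (outerProd (sset α β X) * E) P) ^ 2 := by
  set N := cnorm 1 (szegoFun ((α + β) / 2) ((β - α) / 4) n (outerProd (sset α β X) * E) P) ^ 2
    with hN
  have hN0 : 0 ≤ N := sq_nonneg _
  have hκ : 0 < kappa α β X := kappa_pos hβ fun t ht => hβ₁.trans (hX t ht).le
  have hFm0 : 0 ≤ Fm := (hf0 β ⟨le_rfl, hβ₁⟩).trans (hFm β ⟨le_rfl, hβ₁⟩)
  have hq := continuous_qprod X
  have hα : 0 < β₁ - α := by linarith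
  set G := kappa α β X * N * C ^ 2 * Fm * exp L * (√d)⁻¹ * (β₁ - α) ^ (3 / 4 : ℝ) with hG
  have hG0 : 0 ≤ G := by positivity
  have hpt : ∀ x ∈ Set.Ioo β β₁, P.eval x ^ 2 * (qprod X x * f x) ≤
      G * (x - β) ^ (-(3 / 4) : ℝ) := by
    intro x hx
    have hxI : x ∈ Set.Icc β β₁ := ⟨hx.1.le, hx.2.le⟩
    have hxX : ∀ t ∈ X, x < t := fun t ht => hx.2.trans (hX t ht)
    have hz0 := zfun_pos hβ hx.1.le
    have hz1 := zfun_lt_one hβ hx.1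
    have hs0 := sfun_pos hβ hx.1
    have hzn : ‖(zfun α β x : ℂ)‖ ≤ 2 := by
      rw [Complex.norm_real, norm_of_nonneg hz0.le]; linarith
    have hE1 := hC _ hzn
    rw [aeval_ofReal, Complex.norm_real, norm_eq_abs] at hE1
    have hE0 : E.eval (zfun α β x) ≠ 0 := by
      intro h; rw [h] at hE1; norm_num at hE1
    have hE2 : 1 / E.eval (zfun α β x) ^ 2 ≤ C ^ 2 := by
      rw [div_le_iff₀ (by positivity), ← sq_abs (E.eval _), ← mul_pow]
      exact one_le_pow₀ hE1
    have hS := norm_szegoFun_le (m := (α + β) / 2) (a := (β - α) / 4)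
      (D := outerProd (sset α β X) * E) hP hz0 hz1
    rw [← hN] at hS
    have hS2 : N / (1 - zfun α β x ^ 2) ≤ N / sfun α β x :=
      div_le_div_of_nonneg_left hN0 hs0 (sfun_le_one_sub_zfun_sq hβ hx.1.le)
    have hexp := Real.exp_le_exp.2 (hΘ x ⟨hx.1, hx.2.le⟩)
    have hsv : √((x - β) / (β₁ - α)) ≤ sfun α β x := by
      refine Real.sqrt_le_sqrt ?_
      exact div_le_div_of_nonneg_left (by linarith [hx.1]) (by linarith [hx.1]) (by linarith [hx.2])
    have hds : exp (-(d * sfun α β x)) ≤ (√d)⁻¹ * (√(sfun α β x))⁻¹ := by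
      rw [← mul_inv, ← Real.sqrt_mul hd.le, Real.exp_neg]
      refine inv_anti₀ (Real.sqrt_pos.2 (by positivity)) ?_
      have h1 := Real.add_one_le_exp (d * sfun α β x)
      have h2 : √(d * sfun α β x) ≤ d * sfun α β x + 1 := by
        rw [Real.sqrt_le_iff]
        constructor
        · positivity
        · nlinarith [mul_pos hd hs0]
      linarith
    have hrp : (sfun α β x)⁻¹ * (√(sfun α β x))⁻¹ ≤
        (β₁ - α) ^ (3 / 4 : ℝ) * (x - β) ^ (-(3 / 4) : ℝ) := by
      have hxb : 0 < x - β := by linarith [hx.1]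
      have e1 : (β₁ - α) ^ (3 / 4 : ℝ) * (x - β) ^ (-(3 / 4) : ℝ) =
          (√((x - β) / (β₁ - α)) ^ (3 / 2 : ℝ))⁻¹ := by
        rw [Real.sqrt_eq_rpow, ← Real.rpow_mul (by positivity),
          Real.div_rpow hxb.le hα.le, inv_div, Real.rpow_neg hxb.le]
        norm_num
        rfl
      have e2 : (sfun α β x)⁻¹ * (√(sfun α β x))⁻¹ = (sfun α β x ^ (3 / 2 : ℝ))⁻¹ := by
        rw [← mul_inv, Real.sqrt_eq_rpow]
        congr 1
        nth_rewrite 1 [← Real.rpow_one (sfun α β x)]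
        rw [← Real.rpow_add hs0]
        norm_num
      rw [e1, e2]
      refine inv_anti₀ (Real.rpow_pos_of_pos (Real.sqrt_pos.2 (by positivity)) _) ?_
      exact Real.rpow_le_rpow (Real.sqrt_nonneg _) hsv (by norm_num)
    have hqf : P.eval x ^ 2 * (qprod X x * f x) = kappa α β X *
        exp (-Theta n (sset α β X) (sfun α β x)) *
        ‖szegoFun ((α + β) / 2) ((β - α) / 4) n (outerProd (sset α β X) * E) P (zfun α β x)‖ ^ 2 *
          (1 / E.eval (zfun α β x) ^ 2) * f x := by
      rw [← mul_assoc, sq_mul_qprod_eq hβ hx.1.le hxX hE0 (n := n)]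
      ring
    rw [hqf]
    calc _ ≤ kappa α β X * (exp L * ((√d)⁻¹ * (√(sfun α β x))⁻¹)) * (N / sfun α β x) *
          C ^ 2 * Fm := by
          gcongr
          · exact hf0 x hxI
          · refine hexp.trans ?_
            rw [sub_eq_add_neg, Real.exp_add]
            gcongr
          · exact hS.trans hS2
          · exact hFm x hxI
      _ = kappa α β X * N * C ^ 2 * Fm * exp L * (√d)⁻¹ *
          ((sfun α β x)⁻¹ * (√(sfun α β x))⁻¹) := by ring
      _ ≤ kappa α β X * N * C ^ 2 * Fm * exp L * (√d)⁻¹ *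
          ((β₁ - α) ^ (3 / 4 : ℝ) * (x - β) ^ (-(3 / 4) : ℝ)) := by gcongr
      _ = _ := by rw [hG]; ring
  have hi1 : IntervalIntegrable (fun x => (x - β) ^ (-(3 / 4) : ℝ)) volume β β₁ := by
    have := (intervalIntegral.intervalIntegrable_rpow' (a := 0) (b := β₁ - β)
      (r := -(3 / 4)) (by norm_num)).comp_sub_right β
    simpa using this
  have h_int : ∫ x in β..β₁, (x - β) ^ (-(3 / 4) : ℝ) = 4 * (β₁ - β) ^ (1 / 4 : ℝ) := by
    rw [intervalIntegral.integral_comp_sub_right (fun x => x ^ (-(3 / 4) : ℝ)),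
      integral_rpow (Or.inl (by norm_num)), sub_self, Real.zero_rpow (by norm_num)]
    norm_num
    ring
  calc _ ≤ ∫ x in β..β₁, G * (x - β) ^ (-(3 / 4) : ℝ) :=
        intervalIntegral.integral_mono_on_of_le_Ioo hβ₁
          (ContinuousOn.intervalIntegrable_of_Icc hβ₁ (by fun_prop)) (hi1.const_mul G) hpt
    _ = G * (4 * (β₁ - β) ^ (1 / 4 : ℝ)) := by
        rw [intervalIntegral.integral_const_mul, h_int]
    _ ≤ G * (4 * (β₁ - α) ^ (1 / 4 : ℝ)) := by gcongr
    _ = _ := by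
        have : (β₁ - α) ^ (3 / 4 : ℝ) * (β₁ - α) ^ (1 / 4 : ℝ) = β₁ - α := by
          rw [← Real.rpow_add hα]; norm_num
        rw [hG, div_eq_mul_inv _ (√d)]
        generalize (β₁ - α) ^ (3 / 4 : ℝ) = u at *
        generalize (β₁ - α) ^ (1 / 4 : ℝ) = v at *
        linear_combination (kappa α β X * N * C ^ 2 * Fm * exp L * (√d)⁻¹ * 4) * this

end Szego

/-- `log` of the exterior map of `[α, β]`. -/
def Afun (α β x : ℝ) : ℝ := log ((β - α) / 4 / zfun α β x)

/-- The interaction kernel of two exterior points. -/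
def Bfun (α β x y : ℝ) : ℝ := log (1 - zfun α β x * zfun α β y)

/-- The leading term of `log p(y)`. -/
def Ffun (α β : ℝ) (n : ℕ) (X : Multiset ℝ) (y : ℝ) : ℝ :=
  n * Afun α β y - (X.map fun x => Bfun α β x y).sum

/-- The leading term of the logarithm of the minimal `L²` norm. -/
def Hfun (α β : ℝ) (n : ℕ) (X : Multiset ℝ) : ℝ :=
  2 * n * log ((β - α) / 4) + (X.map (Afun α β)).sum

lemma eval_pos_of_ne_zero {E : ℝ[X]} (hE : ∀ z : ℂ, ‖z‖ ≤ 2 → aeval z E ≠ 0)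
    (h0 : 0 < E.coeff 0) {t : ℝ} (ht : 0 ≤ t) (ht2 : t ≤ 2) : 0 < E.eval t := by
  by_contra! h
  obtain ⟨c, hc, hc0⟩ := intermediate_value_Icc' ht E.continuous.continuousOn
    ⟨h, by rw [← coeff_zero_eq_eval_zero]; exact h0.le⟩
  replace hc0 : E.eval c = 0 := hc0
  refine hE c ?_ (by rw [aeval_ofReal, hc0, Complex.ofReal_zero])
  rw [Complex.norm_real, norm_of_nonneg hc.1]
  exact hc.2.trans ht2

lemma log_kappa {α β : ℝ} {X : Multiset ℝ} (hβ : α < β) (hX : ∀ x ∈ X, β ≤ x) :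
    log (kappa α β X) = (X.map (Afun α β)).sum := by
  unfold kappa
  induction X using Multiset.induction_on with
  | empty => simp
  | cons t T ih =>
    have ht := hX t (Multiset.mem_cons_self _ _)
    have hT : ∀ t ∈ T, β ≤ t := fun t ht => hX t (Multiset.mem_cons_of_mem ht)
    have h1 : (T.map fun x => (β - α) / 4 / zfun α β x).prod ≠ 0 := (kappa_pos hβ hT).ne'
    simp only [Multiset.map_cons, Multiset.prod_cons, Multiset.sum_cons]
    rw [Real.log_mul (div_pos (by linarith) (zfun_pos hβ ht)).ne' h1, ih hT]
    rfl

lemma one_sub_zfun_mul_pos {α β x y : ℝ} (hβ : α < β) (hx : β < x) (hy : β < y) :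
    0 < 1 - zfun α β x * zfun α β y := by
  have h1 := zfun_lt_one hβ hx
  have h2 := zfun_lt_one hβ hy
  have h3 := zfun_pos hβ hx.le
  have h4 := zfun_pos hβ hy.le
  nlinarith

lemma outerProd_zfun {α β y : ℝ} {X : Multiset ℝ} (hβ : α < β) (hX : ∀ x ∈ X, β < x)
    (hy : β < y) : 0 < (outerProd (sset α β X)).eval (zfun α β y) ∧
      log ((outerProd (sset α β X)).eval (zfun α β y)) = (X.map fun x => Bfun α β x y).sum := by
  rw [eval_outerProd, sset, Multiset.map_map]
  induction X using Multiset.induction_on with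
  | empty => simp
  | cons t T ih =>
    have ht := one_sub_zfun_mul_pos hβ (hX t (Multiset.mem_cons_self _ _)) hy
    obtain ⟨h1, h2⟩ := ih fun t ht => hX t (Multiset.mem_cons_of_mem ht)
    simp only [Multiset.map_cons, Multiset.prod_cons, Multiset.sum_cons]
    refine ⟨mul_pos ht h1, ?_⟩
    change log ((1 - zfun α β t * zfun α β y) * _) = _
    rw [Real.log_mul ht.ne' h1.ne', h2]
    rfl

lemma abs_log_one_add_le {u : ℝ} (h : |u| ≤ 1 / 2) : |log (1 + u)| ≤ 2 * |u| := by
  obtain ⟨h1, h2⟩ := abs_le.1 h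
  have h3 : 0 < 1 + u := by linarith
  have h4 := Real.log_le_sub_one_of_pos h3
  have h5 := Real.one_sub_inv_le_log_of_pos h3
  have h6 : -(2 * |u|) ≤ 1 - (1 + u)⁻¹ := by
    have : 1 - (1 + u)⁻¹ = u / (1 + u) := by field_simp; ring
    rw [this, le_div_iff₀ h3]
    rcases abs_cases u with ⟨h, _⟩ | ⟨h, _⟩ <;> rw [h] <;> nlinarith
  rw [abs_le]
  constructor
  · linarith
  · linarith [le_abs_self u, abs_nonneg u]

set_option maxHeartbeats 600000 in
/-- Quantitative one-interval asymptotics. -/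
lemma oneInterval_quantitative {α β β₁ γ : ℝ} (hβ : α < β) (hβ₁ : β ≤ β₁) (hγ : β₁ < γ)
    {f : ℝ → ℝ} (hf : ContinuousOn f (Set.Icc α β₁)) (hf0 : ∀ x ∈ Set.Icc α β₁, 0 < f x)
    {Z : Multiset ℝ} (hZ : ∀ x ∈ Z, γ ≤ x) {n : ℕ} {p : ℝ[X]} (hp : p.Monic)
    (hpn : p.natDegree = n) (ho : Orth α β₁ (fun x => qprod Z x * f x) n p)
    {E F : ℝ[X]} {ε M M' r r' ρ τ τ' δ : ℝ}
    (hE : ∀ z : ℂ, ‖z‖ ≤ 2 → aeval z E ≠ 0) (hE0 : 0 < E.coeff 0) (hF0 : 0 < F.coeff 0)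
    (hEf : ∀ z : ℂ, ‖z‖ = 1 → f ((α + β) / 2 + 2 * ((β - α) / 4) * z.re) * ‖1 - z ^ 2‖ ≤
      exp (2 * ε) * ‖aeval z E‖ ^ 2)
    (hFf : ∀ z : ℂ, ‖z‖ = 1 → exp (-(2 * ε)) * ‖(1 - z ^ 2) * aeval z F‖ ^ 2 ≤
      f ((α + β) / 2 + 2 * ((β - α) / 4) * z.re) * ‖1 - z ^ 2‖)
    (hEF : |log (E.coeff 0) - log (F.coeff 0)| ≤ ε)
    (hO : OuterBound (outerProd (sset α β Z) * E) n r M)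
    (hO' : OuterBound (outerProd (sset α β Z) * F) n r' M') (hM : M ≤ 1 / 20)
    (hρ : ρ < 1) (hρr : (1 + ρ) / 2 ≤ r) (hzρ : ∀ y, γ ≤ y → zfun α β y ≤ ρ)
    (hτ0 : 0 ≤ τ) (hτ : τ' ≤ π * ((β - α) / 4) * exp (2 * ε) * τ)
    (htail : ∀ P : ℝ[X], P.natDegree ≤ n →
      ∫ x in β..β₁, P.eval x ^ 2 * (qprod Z x * f x) ≤ kappa α β Z * τ' *
        cnorm 1 (szegoFun ((α + β) / 2) ((β - α) / 4) n (outerProd (sset α β Z) * E) P) ^ 2)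
    (h35 : (1 + τ) * (1 + 35 * M) ≤ exp ε) (hM' : 1 + M' ≤ exp ε)
    (h22 : 22 * M / (1 - ρ) ≤ ε) (hε : ε ≤ 1 / 2)
    (hδ : √(exp (8 * ε) - 1) * ((γ - α) / (γ - β₁)) ≤ δ) (hδ2 : δ ≤ 1 / 2) :
    |log (∫ x in α..β₁, p.eval x ^ 2 * (qprod Z x * f x)) - Hfun α β n Z -
      log (2 * π * ((β - α) / 4) * E.coeff 0 ^ 2)| ≤ 5 * ε ∧
    ∀ y, γ ≤ y → 0 < p.eval y ∧ |log (p.eval y) - Ffun α β n Z y -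
      log (E.coeff 0 / E.eval (zfun α β y))| ≤ 2 * δ + 2 * ε := by
  set m := (α + β) / 2 with hm
  set a := (β - α) / 4 with ha
  have ha0 : 0 < a := by rw [ha]; linarith
  have hαβ₁ : α < β₁ := hβ.trans_le hβ₁
  have hZβ : ∀ x ∈ Z, β ≤ x := fun x hx => by linarith [hZ x hx]
  have hκ := kappa_pos hβ hZβ
  set κ := kappa α β Z with hκd
  set w : ℝ → ℝ := fun x => qprod Z x * f x with hw
  have hq := continuous_qprod Z
  have hwc : ContinuousOn w (Set.Icc α β₁) := by fun_prop
  have hwpos : ∀ x ∈ Set.Icc α β₁, 0 < w x := fun x hx =>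
    mul_pos (qprod_pos fun t ht => by linarith [hZ t ht, hx.2]) (hf0 x hx)
  have hO0 : (outerProd (sset α β Z) * E).coeff 0 = E.coeff 0 := by
    rw [mul_coeff_zero, outerProd_coeff_zero, one_mul]
  have hO0' : (outerProd (sset α β Z) * F).coeff 0 = F.coeff 0 := by
    rw [mul_coeff_zero, outerProd_coeff_zero, one_mul]
  obtain ⟨P, hP, hPn, hPN, hPt⟩ := hO.exists_trial hM m ha0.ne'
  rw [hO0] at hPN hPt
  set N := cnorm 1 (szegoFun m a n (outerProd (sset α β Z) * E) P) ^ 2 with hN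
  have hfβ : ContinuousOn f (Set.Icc α β) := hf.mono (Set.Icc_subset_Icc_right hβ₁)
  have hi : ∀ {u v : ℝ} {g : ℝ[X]}, u ∈ Set.Icc α β₁ → v ∈ Set.Icc α β₁ → 
      IntervalIntegrable (fun x => g.eval x ^ 2 * w x) volume u v := fun {u v g} hu hv => by
    refine ContinuousOn.intervalIntegrable (ContinuousOn.mul (by fun_prop) (hwc.mono ?_))
    exact Set.uIcc_subset_Icc hu hv
  set V := 2 * π * a * E.coeff 0 ^ 2 * κ * a ^ (2 * n) with hV
  have hV0 : 0 < V := by positivity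
  have hU : ∫ x in α..β₁, P.eval x ^ 2 * w x ≤ V * exp (3 * ε) := by
    rw [← intervalIntegral.integral_add_adjacent_intervals (hi ⟨le_rfl, hαβ₁.le⟩ ⟨hβ.le, hβ₁⟩)
      (hi ⟨hβ.le, hβ₁⟩ ⟨hαβ₁.le, le_rfl⟩)]
    have h1 := integral_le_cnorm (n := n) (P := P) hβ hZβ hfβ hEf
    have h2 := htail P hPn.le
    have hN0 : 0 ≤ N := sq_nonneg _
    calc _ ≤ π * a * κ * (exp (2 * ε) * N) + κ * (π * a * exp (2 * ε) * τ) * N := by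
          refine add_le_add h1 (h2.trans ?_)
          gcongr
      _ = π * a * κ * exp (2 * ε) * (1 + τ) * N := by ring
      _ ≤ π * a * κ * exp (2 * ε) * (1 + τ) * ((a ^ n * E.coeff 0) ^ 2 * (2 + 70 * M)) := by gcongr
      _ = V * (exp (2 * ε) * ((1 + τ) * (1 + 35 * M))) := by rw [hV]; ring
      _ ≤ V * (exp (2 * ε) * exp ε) := by gcongr
      _ = _ := by rw [← Real.exp_add]; ring_nf
  set h := ∫ x in α..β₁, p.eval x ^ 2 * w x with hh
  have hL : V * exp (-(5 * ε)) ≤ h := by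
    have h1 := cnorm_le_integral (n := n) (P := p) hβ hZβ hfβ hFf
    have h2 := hO'.lower_bound m (a := a) hp hpn
    rw [hO0'] at h2
    have h3 : ∫ x in α..β, p.eval x ^ 2 * w x ≤ h := by
      rw [hh, ← intervalIntegral.integral_add_adjacent_intervals
        (hi ⟨le_rfl, hαβ₁.le⟩ ⟨hβ.le, hβ₁⟩) (hi ⟨hβ.le, hβ₁⟩ ⟨hαβ₁.le, le_rfl⟩)]
      have := intervalIntegral.integral_nonneg (f := fun x => p.eval x ^ 2 * w x) hβ₁
        (μ := volume) fun x hx =>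
        mul_nonneg (sq_nonneg _) (hwpos x ⟨hβ.le.trans hx.1, hx.2⟩).le
      linarith
    have h4 : exp (-ε) * E.coeff 0 ≤ F.coeff 0 := by
      rw [← Real.log_le_log_iff (by positivity) hF0, Real.log_mul (Real.exp_pos _).ne' hE0.ne',
        Real.log_exp]
      linarith [(abs_le.1 hEF).2]
    have hM0 := hO'.M_nonneg
    have h5 : exp (-ε) ≤ 1 / (1 + M') := by
      rw [Real.exp_neg, ← one_div]
      exact one_div_le_one_div_of_le (by linarith) hM'
    refine le_trans ?_ (h1.trans h3)
    calc V * exp (-(5 * ε)) = π * a * κ * (exp (-(2 * ε)) *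
          (2 * (a ^ n * (exp (-ε) * E.coeff 0)) ^ 2 * exp (-ε))) := by
          have : exp (-(5 * ε)) = exp (-(2 * ε)) * exp (-ε) * exp (-ε) * exp (-ε) := by
            rw [← Real.exp_add, ← Real.exp_add, ← Real.exp_add]; ring_nf
          rw [hV, this]; ring
      _ ≤ π * a * κ * (exp (-(2 * ε)) * (2 * (a ^ n * F.coeff 0) ^ 2 * (1 / (1 + M')))) := by
          gcongr
      _ ≤ _ := by
          gcongr
          rw [mul_one_div]
          exact h2
  have hh0 : 0 < h := lt_of_lt_of_le (by positivity) hL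
  have hhP : h ≤ ∫ x in α..β₁, P.eval x ^ 2 * w x := by
    rw [ho.integral_sq_eq hαβ₁.le hwc hp hpn hP hPn]
    have : 0 ≤ ∫ x in α..β₁, (P - p).eval x ^ 2 * w x := intervalIntegral.integral_nonneg hαβ₁.le
      fun x hx => mul_nonneg (sq_nonneg _) (hwpos x hx).le
    linarith
  have hε0 : 0 ≤ ε := (abs_nonneg _).trans hEF
  constructor
  · have hlogV : log V = Hfun α β n Z + log (2 * π * a * E.coeff 0 ^ 2) := by
      rw [hV, Real.log_mul (by positivity) (by positivity), Real.log_mul (by positivity) hκ.ne',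
        Real.log_pow, hκd, log_kappa hβ hZβ, Hfun, ← ha]
      push_cast
      ring
    have h1 := Real.log_le_log (by positivity) hL
    have h2 := Real.log_le_log hh0 (hhP.trans hU)
    rw [Real.log_mul hV0.ne' (Real.exp_pos _).ne', Real.log_exp] at h1 h2
    rw [abs_le]
    constructor <;> linarith
  · intro y hy
    have hyβ : β < y := by linarith
    have hratio : (∫ x in α..β₁, P.eval x ^ 2 * w x) / h ≤ exp (8 * ε) := by
      rw [div_le_iff₀ hh0]
      refine hU.trans ?_
      calc V * exp (3 * ε) = exp (8 * ε) * (V * exp (-(5 * ε))) := by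
            rw [mul_left_comm, ← Real.exp_add]; ring_nf
        _ ≤ _ := by gcongr
    have hdiff : |P.eval y - p.eval y| ≤ δ * |p.eval y| := by
      refine (ho.abs_eval_sub_le hαβ₁ hwc hwpos hp hpn hP hPn hγ hy).trans ?_
      refine mul_le_mul_of_nonneg_right (le_trans ?_ hδ) (abs_nonneg _)
      have : 0 ≤ (γ - α) / (γ - β₁) := div_nonneg (by linarith) (by linarith)
      gcongr
    have hz := zfun_pos hβ hyβ.le
    have hz1 := zfun_lt_one hβ hyβ
    have hθ := (hPt (zfun α β y) ρ hz (hzρ y hy) hρ hρr).trans h22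
    rw [szegoFun_outside hβ hyβ.le, ← Complex.ofReal_div, ← Complex.ofReal_one,
      ← Complex.ofReal_sub, Complex.norm_real, norm_eq_abs, eval_mul] at hθ
    obtain ⟨hOp, hOl⟩ := outerProd_zfun hβ (fun x hx => by linarith [hZ x hx]) hyβ
    have hEp := eval_pos_of_ne_zero hE hE0 hz.le (by linarith)
    generalize hζ : zfun α β y = ζ at *
    generalize (outerProd (sset α β Z)).eval ζ = o at *
    set θ := ζ ^ n * P.eval y * (o * E.eval ζ) / (a ^ n * E.coeff 0) - 1 with hθd
    have hlogθ := abs_log_one_add_le (hθ.trans hε)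
    have h1θ : 0 < 1 + θ := by linarith [(abs_le.1 hθ).1]
    have hPe : P.eval y = (a / ζ) ^ n * (E.coeff 0 / E.eval ζ) / o * (1 + θ) := by
      rw [hθd, div_pow]
      field_simp
      ring
    have hPpos : 0 < P.eval y := by rw [hPe]; positivity
    have hlogP : log (P.eval y) = Ffun α β n Z y + log (E.coeff 0 / E.eval ζ) + log (1 + θ) := by
      rw [hPe, Real.log_mul (by positivity) h1θ.ne', Real.log_div (by positivity) hOp.ne',
        Real.log_mul (by positivity) (by positivity), Real.log_pow, hOl, Ffun, Afun, hζ, ← ha]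
      ring
    have hppos : 0 < p.eval y := by
      by_contra! hneg
      rw [abs_of_nonpos hneg, abs_of_nonneg (by linarith)] at hdiff
      have h1 : 0 ≤ (1 - δ) * -p.eval y := mul_nonneg (by linarith) (by linarith)
      linarith
    refine ⟨hppos, ?_⟩
    rw [abs_of_pos hppos] at hdiff
    have hu : |P.eval y / p.eval y - 1| ≤ δ := by
      rw [show P.eval y / p.eval y - 1 = (P.eval y - p.eval y) / p.eval y by field_simp,
        abs_div, abs_of_pos hppos, div_le_iff₀ hppos]
      exact hdiff
    have hlogu := abs_log_one_add_le (hu.trans hδ2)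
    rw [add_sub_cancel, Real.log_div hPpos.ne' hppos.ne', hlogP] at hlogu
    have h1 := abs_le.1 (hlogu.trans (mul_le_mul_of_nonneg_left hu two_pos.le))
    have h2 := abs_le.1 (hlogθ.trans (mul_le_mul_of_nonneg_left hθ two_pos.le))
    rw [abs_le]
    constructor <;> linarith [h1.1, h1.2, h2.1, h2.2]

/-- The admissible gap scale `(n log n)^{1/3}`. -/
def Dn (n : ℕ) : ℝ := ((n : ℝ) * log n) ^ (1 / 3 : ℝ)

lemma Dn_nonneg (n : ℕ) : 0 ≤ Dn n := by
  unfold Dn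
  have := Real.log_natCast_nonneg n
  positivity

lemma Dn_pow_three (n : ℕ) : Dn n ^ 3 = n * log n := by
  unfold Dn
  have := Real.log_natCast_nonneg n
  rw [← Real.rpow_natCast, ← Real.rpow_mul (by positivity)]
  norm_num

lemma tendsto_log_nat : Tendsto (fun n : ℕ => log (n : ℝ)) atTop atTop :=
  Real.tendsto_log_atTop.comp tendsto_natCast_atTop_atTop

lemma tendsto_rpow_third : Tendsto (fun x : ℝ => x ^ (1 / 3 : ℝ)) atTop atTop :=
  tendsto_rpow_atTop (by norm_num)

lemma tendsto_cbrt_nat : Tendsto (fun n : ℕ => (n : ℝ) ^ (1 / 3 : ℝ)) atTop atTop :=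
  tendsto_rpow_third.comp tendsto_natCast_atTop_atTop

lemma Dn_eq (n : ℕ) : Dn n = (n : ℝ) ^ (1 / 3 : ℝ) * (log n) ^ (1 / 3 : ℝ) :=
  Real.mul_rpow (by positivity) (Real.log_natCast_nonneg n)

lemma tendsto_Dn : Tendsto Dn atTop atTop := by
  have := tendsto_cbrt_nat.atTop_mul_atTop₀ (tendsto_rpow_third.comp tendsto_log_nat)
  exact this.congr fun n => (Dn_eq n).symm

lemma tendsto_Dn_div : Tendsto (fun n : ℕ => Dn n / n) atTop (𝓝 0) := by
  have h1 : Tendsto (fun x : ℝ => log x / x) atTop (𝓝 0) :=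
    Real.isLittleO_log_id_atTop.tendsto_div_nhds_zero
  have h2 := (h1.comp tendsto_natCast_atTop_atTop).rpow_const
    (p := (1 / 3 : ℝ)) (Or.inr (by norm_num))
  rw [Real.zero_rpow (by norm_num)] at h2
  refine squeeze_zero' (Eventually.of_forall fun n => div_nonneg (Dn_nonneg n) (by positivity))
    ?_ h2
  filter_upwards [eventually_ge_atTop 1] with n hn
  have hn1 : (1 : ℝ) ≤ n := by exact_mod_cast hn
  have hl := Real.log_natCast_nonneg n
  simp only [Function.comp]
  rw [Real.div_rpow hl (by positivity), Dn_eq, div_le_div_iff₀ (by positivity) (by positivity)]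
  have h3 : (n : ℝ) ^ (1 / 3 : ℝ) * (n : ℝ) ^ (1 / 3 : ℝ) ≤ n := by
    rw [← Real.rpow_add (by positivity)]
    calc (n : ℝ) ^ (1 / 3 + 1 / 3 : ℝ) ≤ (n : ℝ) ^ (1 : ℝ) :=
          Real.rpow_le_rpow_of_exponent_le hn1 (by norm_num)
      _ = n := Real.rpow_one _
  calc _ = (log n) ^ (1 / 3 : ℝ) * ((n : ℝ) ^ (1 / 3 : ℝ) * (n : ℝ) ^ (1 / 3 : ℝ)) := by ring
    _ ≤ _ := by gcongr

lemma tendsto_exp_neg_cbrt_log (A c : ℝ) :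
    Tendsto (fun n : ℕ => A * exp (-(log n) ^ (1 / 3 : ℝ) + c)) atTop (𝓝 0) := by
  have h1 : Tendsto (fun n : ℕ => -(log n) ^ (1 / 3 : ℝ) + c) atTop atBot :=
    tendsto_atBot_add_const_right _ _
      (tendsto_neg_atTop_atBot.comp (tendsto_rpow_third.comp tendsto_log_nat))
  simpa using (Real.tendsto_exp_atBot.comp h1).const_mul A

lemma tendsto_exp_sqrt_log (A K : ℝ) :
    Tendsto (fun n : ℕ => A * exp √(K * log n) / √(Dn n / 2)) atTop (𝓝 0) := by
  have h0 : Tendsto (fun v : ℝ => v / 12) atTop atTop :=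
    tendsto_id.atTop_div_const (by norm_num)
  have h1 : Tendsto (fun n : ℕ => |A| * √2 * exp (-(log n / 12))) atTop (𝓝 0) := by
    simpa using (Real.tendsto_exp_atBot.comp (tendsto_neg_atTop_atBot.comp
      (h0.comp tendsto_log_nat))).const_mul (|A| * √2)
  refine squeeze_zero_norm' ?_ h1
  filter_upwards [eventually_ge_atTop 1, tendsto_log_nat.eventually_ge_atTop (max 1 (144 * |K|))]
    with n hn hv
  have hv1 := (le_max_left _ _).trans hv
  have hv2 := (le_max_right _ _).trans hv
  have hn0 : (0 : ℝ) < n := by exact_mod_cast hn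
  have hD : exp (log n / 3) ≤ Dn n := by
    rw [Dn_eq, Real.rpow_def_of_pos hn0, show log (n : ℝ) / 3 = log n * (1 / 3) by ring]
    exact le_mul_of_one_le_right (exp_pos _).le (Real.one_le_rpow hv1 (by norm_num))
  have h2 : exp (log n / 6) / √2 ≤ √(Dn n / 2) := by
    rw [Real.sqrt_div (Dn_nonneg n)]
    gcongr
    refine Real.le_sqrt_of_sq_le ?_
    rw [← Real.exp_nat_mul]
    refine le_trans (le_of_eq ?_) hD
    congr 1
    push_cast
    ring
  have h3 : √(K * log n) ≤ log n / 12 := by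
    refine Real.sqrt_le_iff.2 ⟨by linarith, ?_⟩
    nlinarith [le_abs_self K]
  have h4 : 0 < exp (log n / 6) / √2 := by positivity
  rw [norm_div, norm_mul, norm_of_nonneg (exp_pos _).le, norm_of_nonneg (Real.sqrt_nonneg _),
    norm_eq_abs]
  calc |A| * exp √(K * log n) / √(Dn n / 2)
      ≤ |A| * exp (log n / 12) / (exp (log n / 6) / √2) := by gcongr
    _ = |A| * √2 * (exp (log n / 12) * (exp (log n / 6))⁻¹) := by field_simp
    _ = _ := by
        rw [← Real.exp_neg, ← Real.exp_add]
        congr 2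
        ring

/-- The weight in the Szegő circle variable has an approximate outer factorization, uniformly
in the right endpoint. -/
lemma exists_uniform_sandwich {α β₁ b ε : ℝ} (hαb : α < b) (hb : b ≤ β₁) {f : ℝ → ℝ}
    (hf : ContinuousOn f (Set.Icc α β₁)) (hf0 : ∀ x ∈ Set.Icc α β₁, 0 < f x) (hε : 0 < ε) :
    ∃ E F : ℝ[X], ∃ η > 0, (∀ z : ℂ, ‖z‖ ≤ 2 → aeval z E ≠ 0) ∧
      (∀ z : ℂ, ‖z‖ ≤ 2 → aeval z F ≠ 0) ∧ 0 < E.coeff 0 ∧ 0 < F.coeff 0 ∧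
      |log (E.coeff 0) - log (F.coeff 0)| ≤ ε ∧
      ∀ β, α < β → β ≤ β₁ → |β - b| < η → ∀ z : ℂ, ‖z‖ = 1 →
        f ((α + β) / 2 + 2 * ((β - α) / 4) * z.re) * ‖1 - z ^ 2‖ ≤
          exp (2 * ε) * ‖aeval z E‖ ^ 2 ∧
        exp (-(2 * ε)) * ‖(1 - z ^ 2) * aeval z F‖ ^ 2 ≤
          f ((α + β) / 2 + 2 * ((β - α) / 4) * z.re) * ‖1 - z ^ 2‖ := by
  have hmem : ∀ β, α < β → β ≤ β₁ → ∀ t ∈ Set.Icc (-1 : ℝ) 1,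
      (α + β) / 2 + 2 * ((β - α) / 4) * t ∈ Set.Icc α β₁ := fun β h1 h2 t ht =>
    ⟨by nlinarith [ht.1, ht.2], by nlinarith [ht.1, ht.2]⟩
  obtain ⟨E, F, hE, hF, hE0, hF0, hEF, hlog⟩ := exists_sandwich
    (w := fun t => f ((α + b) / 2 + 2 * ((b - α) / 4) * t))
    (hf.comp (by fun_prop) fun t ht => hmem b hαb hb t ht)
    (fun t ht => hf0 _ (hmem b hαb hb t ht)) hε
  have huc := isCompact_Icc.uniformContinuousOn_of_continuous
    (hf.log fun x hx => (hf0 x hx).ne')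
  obtain ⟨η, hη, hlf⟩ := Metric.uniformContinuousOn_iff.1 huc ε hε
  refine ⟨E, F, η, hη, hE, hF, hE0, hF0, hlog, fun β h1 h2 hβ z hz => ?_⟩
  have ht := re_mem_Icc hz
  have hx := hmem β h1 h2 _ ht
  have hx' := hmem b hαb hb _ ht
  obtain ⟨h3, h4⟩ := hEF z hz
  set x := (α + β) / 2 + 2 * ((β - α) / 4) * z.re with hxd
  set x' := (α + b) / 2 + 2 * ((b - α) / 4) * z.re with hxd'
  have hd : dist x x' < η := by
    refine lt_of_le_of_lt ?_ hβ
    rw [Real.dist_eq, show x - x' = (β - b) * ((1 + z.re) / 2) by rw [hxd, hxd']; ring, abs_mul]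
    refine mul_le_of_le_one_right (abs_nonneg _) ?_
    rw [abs_le]
    constructor <;> linarith [ht.1, ht.2]
  have hl := abs_lt.1 (hlf x hx x' hx' hd)
  have hfx := hf0 x hx
  have hfx' := hf0 x' hx'
  have e1 : f x ≤ exp ε * f x' := by
    rw [← Real.log_le_log_iff hfx (by positivity), Real.log_mul (exp_pos _).ne' hfx'.ne',
      Real.log_exp]
    linarith [hl.2]
  have e2 : exp (-ε) * f x' ≤ f x := by
    rw [← Real.log_le_log_iff (by positivity) hfx, Real.log_mul (exp_pos _).ne' hfx'.ne',
      Real.log_exp]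
    linarith [hl.1]
  constructor
  · calc f x * ‖1 - z ^ 2‖ ≤ exp ε * f x' * ‖1 - z ^ 2‖ := by gcongr
      _ = exp ε * (f x' * ‖1 - z ^ 2‖) := by ring
      _ ≤ exp ε * (exp ε * ‖aeval z E‖ ^ 2) := by gcongr
      _ = _ := by rw [← mul_assoc, ← Real.exp_add]; ring_nf
  · calc exp (-(2 * ε)) * ‖(1 - z ^ 2) * aeval z F‖ ^ 2
        = exp (-ε) * (exp (-ε) * ‖(1 - z ^ 2) * aeval z F‖ ^ 2) := by
          rw [← mul_assoc, ← Real.exp_add]; ring_nf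
      _ ≤ exp (-ε) * (f x' * ‖1 - z ^ 2‖) := by gcongr
      _ = exp (-ε) * f x' * ‖1 - z ^ 2‖ := by ring
      _ ≤ _ := by gcongr

/-- The soft-edge (or hard-edge) condition on the right endpoint. -/
structure Good (α β₁ β : ℝ) (n : ℕ) (Z : Multiset ℝ) : Prop where
  lower : Dn n / 2 ≤ 2 * n - Psi (sset α β Z)
  upper : β = β₁ ∨ 2 * n - Psi (sset α β Z) ≤ 2 * Dn n

lemma le_of_mem_sset {α β β₁ γ : ℝ} (hβ : α < β) (hβ₁ : β ≤ β₁) (hγ : β₁ < γ) {Z : Multiset ℝ}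
    (hZ : ∀ x ∈ Z, γ ≤ x) : ∀ σ ∈ sset α β Z, sfun α β₁ γ ≤ σ ∧ σ ≤ 1 := fun σ hσ => by
  obtain ⟨t, ht, rfl⟩ := Multiset.mem_map.1 hσ
  exact ⟨sfun_le_sfun hβ.le hβ₁ (by linarith) (hZ t ht),
    (sfun_lt_one hβ (by linarith [hZ t ht])).le⟩

lemma Good.theta_le {α β β₁ γ : ℝ} {n : ℕ} {Z : Multiset ℝ} (hg : Good α β₁ β n Z) (hβ : α < β)
    (hβ₁ : β ≤ β₁) (hγ : β₁ < γ) (hZ : ∀ x ∈ Z, γ ≤ x) (hn : 1 ≤ n)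
    (hs : ((n : ℝ) ^ (1 / 3 : ℝ))⁻¹ ≤ sfun α β₁ γ / 2) :
    Theta n (sset α β Z) ((n : ℝ) ^ (1 / 3 : ℝ))⁻¹ ≤
      -(log n) ^ (1 / 3 : ℝ) + 16 / 3 / sfun α β₁ γ ^ 2 := by
  have hσ₀ : 0 < sfun α β₁ γ := sfun_pos (hβ.trans_le hβ₁) hγ
  have hσ1 := sfun_lt_one (hβ.trans_le hβ₁) hγ.le
  have hD := Dn_nonneg n
  have hn0 : (0 : ℝ) < n := by exact_mod_cast hn
  have hu : 0 < (n : ℝ) ^ (1 / 3 : ℝ) := by positivity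
  have hu3 : ((n : ℝ) ^ (1 / 3 : ℝ)) ^ 3 = n := by
    rw [← Real.rpow_natCast, ← Real.rpow_mul hn0.le]; norm_num
  have hDe := Dn_eq n
  have h1 := Theta_le (n := n) (inv_nonneg.2 hu.le) hσ₀ (le_of_mem_sset hβ hβ₁ hγ hZ) hs
    (by linarith) (by linarith [hg.lower])
  refine h1.trans ?_
  set u := (n : ℝ) ^ (1 / 3 : ℝ)
  have h2 : 16 / 3 * (n : ℝ) * u⁻¹ ^ 3 / sfun α β₁ γ ^ 2 = 16 / 3 / sfun α β₁ γ ^ 2 := by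
    rw [← hu3]; field_simp
  have h3 : (log n) ^ (1 / 3 : ℝ) ≤ 2 * u⁻¹ * (2 * n - Psi (sset α β Z)) := by
    calc _ = 2 * u⁻¹ * (Dn n / 2) := by rw [hDe]; field_simp
      _ ≤ _ := by gcongr; exact hg.lower
  linarith

lemma cubic_tradeoff {c d s n v : ℝ} (hc : 0 ≤ c) (hs : 0 ≤ s) (hn : 0 < n)
    (hv : d ^ 3 ≤ 8 * (n * v)) : c * d * s - s ^ 3 * n ≤ √(8 * c ^ 3 * v) := by
  by_cases h : c * d ≤ n * s ^ 2
  · have : c * d * s ≤ n * s ^ 2 * s := by gcongr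
    have h2 := Real.sqrt_nonneg (8 * c ^ 3 * v)
    nlinarith
  · push Not at h
    have h1 : 0 ≤ s ^ 3 * n := by positivity
    have h2 : c * d * s ≤ √(8 * c ^ 3 * v) := by
      refine Real.le_sqrt_of_sq_le ?_
      have h3 : (c * d * s) ^ 2 * n ≤ 8 * c ^ 3 * v * n := by
        calc (c * d * s) ^ 2 * n = (c * d) ^ 2 * (n * s ^ 2) := by ring
          _ ≤ (c * d) ^ 2 * (c * d) := by gcongr
          _ = c ^ 3 * d ^ 3 := by ring
          _ ≤ c ^ 3 * (8 * (n * v)) := by gcongr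
          _ = _ := by ring
      exact le_of_mul_le_mul_right h3 hn
    linarith

lemma Good.neg_theta_le {α β β₁ b : ℝ} {n : ℕ} {Z : Multiset ℝ} (hg : Good α β₁ β n Z)
    (hb : α < b) (hβ : (b - α) / 2 ≤ β - α) (hββ : β < β₁) (hZ : ∀ x ∈ Z, β₁ < x) (hn : 1 ≤ n)
    (hDn : 2 * Dn n ≤ n) {x : ℝ} (hx : x ∈ Set.Ioc β β₁) :
    -Theta n (sset α β Z) (sfun α β x) ≤
      √(8 * (4 * (β₁ - α) / (b - α) + 1) ^ 3 * log n) - Dn n / 2 * sfun α β x := by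
  have hαβ : α < β := by linarith
  have hn0 : (0 : ℝ) < n := by exact_mod_cast hn
  have hd := hg.upper.resolve_left hββ.ne
  have hD := Dn_nonneg n
  set s := sfun α β x with hs
  have hs0 : 0 ≤ s := sfun_nonneg
  have hs1 : sfun α β β₁ < 1 := sfun_lt_one hαβ hββ.le
  have hss : s ≤ sfun α β β₁ := sfun_le_sfun hαβ.le le_rfl (by linarith [hx.1]) hx.2
  have h1 := le_Theta (n := n) hs0 (sset_mem hαβ hx.1.le fun t ht => hx.2.trans_lt (hZ t ht))
  have h2 := lam_le hs0 hss hs1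
  set d := 2 * n - Psi (sset α β Z) with hdd
  have hd0 : 0 ≤ d := le_trans (by positivity) hg.lower
  have hc : 2 / (1 - sfun α β β₁ ^ 2) ≤ 4 * (β₁ - α) / (b - α) := by
    rw [one_sub_sfun_sq hαβ hββ.le, div_div_eq_mul_div, div_le_div_iff₀ (by linarith)
      (by linarith)]
    nlinarith
  have hc0 : 0 ≤ 4 * (β₁ - α) / (b - α) := div_nonneg (by linarith) (by linarith)
  set c := 4 * (β₁ - α) / (b - α)
  have h3 : d * lam s ≤ d * (c * s) := by
    gcongr
    exact h2.trans (by gcongr)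
  have hΨ : 3 / 4 * (n : ℝ) ≤ Psi (sset α β Z) := by linarith
  have h4 : s ^ 3 * n ≤ 4 / 3 * s ^ 3 * Psi (sset α β Z) := by
    calc s ^ 3 * n = 4 / 3 * s ^ 3 * (3 / 4 * n) := by ring
      _ ≤ _ := by gcongr
  have h5 := cubic_tradeoff (c := c + 1) (d := d) (v := log n) (by linarith) hs0 hn0 (by
    rw [← Dn_pow_three]
    calc d ^ 3 ≤ (2 * Dn n) ^ 3 := by gcongr
      _ = _ := by ring)
  have h6 : Dn n / 2 * s ≤ d * s := by gcongr; exact hg.lower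
  nlinarith

set_option maxHeartbeats 1000000 in
/-- One-interval asymptotics, uniform in the position of the right endpoint. -/
theorem oneInterval {α β₁ γ b ε : ℝ} (hαb : α < b) (hb : b ≤ β₁) (hγ : β₁ < γ) {f : ℝ → ℝ}
    (hf : ContinuousOn f (Set.Icc α β₁)) (hf0 : ∀ x ∈ Set.Icc α β₁, 0 < f x) (hε : 0 < ε) :
    ∃ (ch : ℝ → ℝ) (cp : ℝ → ℝ → ℝ) (K η : ℝ), 0 < η ∧ ∀ᶠ n : ℕ in atTop,
      ∀ β, α < β → β ≤ β₁ → |β - b| < η → ∀ Z : Multiset ℝ, (∀ x ∈ Z, γ ≤ x) →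
      Good α β₁ β n Z → ∀ p : ℝ[X], p.Monic → p.natDegree = n →
      Orth α β₁ (fun x => qprod Z x * f x) n p →
      |log (∫ x in α..β₁, p.eval x ^ 2 * (qprod Z x * f x)) - Hfun α β n Z - ch β| ≤ ε ∧
      ∀ y, γ ≤ y → 0 < p.eval y ∧ |log (p.eval y) - Ffun α β n Z y - cp β y| ≤ ε ∧
        |cp β y| ≤ K := by
  have hαβ₁ : α < β₁ := by linarith
  set Γ := (γ - α) / (γ - β₁) with hΓ
  obtain ⟨e, he0, he⟩ : ∃ e > 0, 5 * e ≤ ε ∧ e ≤ 1 / 2 ∧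
      2 * (√(exp (8 * e) - 1) * Γ) + 2 * e ≤ ε ∧ √(exp (8 * e) - 1) * Γ ≤ 1 / 2 := by
    have hcont : Tendsto (fun e : ℝ => √(exp (8 * e) - 1) * Γ) (𝓝[>] 0) (𝓝 0) := by
      have : Continuous (fun e : ℝ => √(exp (8 * e) - 1) * Γ) := by fun_prop
      have h := this.tendsto 0
      simp only [mul_zero, Real.exp_zero, sub_self, Real.sqrt_zero, zero_mul] at h
      exact h.mono_left nhdsWithin_le_nhds
    have hid : Tendsto (fun e : ℝ => e) (𝓝[>] 0) (𝓝 0) :=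
      tendsto_id.mono_left nhdsWithin_le_nhds
    have h1 := hcont.eventually_le_const (show (0 : ℝ) < min (ε / 4) (1 / 2) by positivity)
    have h2 := hid.eventually_le_const (show (0 : ℝ) < min (ε / 5) (1 / 2) by positivity)
    obtain ⟨e, ⟨h1, h2⟩, h3⟩ := ((h1.and h2).and self_mem_nhdsWithin).exists
    have a1 := h1.trans (min_le_left _ _)
    have a2 := h1.trans (min_le_right _ _)
    have a3 := h2.trans (min_le_left _ _)
    have a4 := h2.trans (min_le_right _ _)
    exact ⟨e, h3, by linarith, a4, by linarith, a2⟩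
  obtain ⟨he5, he2, heδ, heδ2⟩ := he
  obtain ⟨E, F, η, hη, hE, hF, hE0, hF0, hEF, hsand⟩ :=
    exists_uniform_sandwich hαb hb hf hf0 he0
  obtain ⟨C, hC0, hC1, hC2⟩ := exists_ratio_bound hE
  obtain ⟨C', hC0', hC1', -⟩ := exists_ratio_bound hF
  obtain ⟨Fm, hFm⟩ := isCompact_Icc.exists_bound_of_continuousOn hf
  replace hFm : ∀ x ∈ Set.Icc α β₁, f x ≤ Fm := fun x hx => (le_abs_self _).trans (hFm x hx)
  have hFm0 : 0 < Fm := (hf0 α ⟨le_rfl, hαβ₁.le⟩).trans_le (hFm α ⟨le_rfl, hαβ₁.le⟩)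
  set σ₀ := sfun α β₁ γ with hσ₀
  have hσ0 : 0 < σ₀ := sfun_pos hαβ₁ hγ
  have hσ1 : σ₀ < 1 := sfun_lt_one hαβ₁ hγ.le
  set ρ := (1 - σ₀) / (1 + σ₀) with hρ
  have hρ1 : ρ < 1 := by rw [hρ, div_lt_one (by linarith)]; linarith
  set s : ℕ → ℝ := fun n => ((n : ℝ) ^ (1 / 3 : ℝ))⁻¹ with hs
  have hs0 : Tendsto s atTop (𝓝 0) := tendsto_cbrt_nat.inv_tendsto_atTop
  set c := 16 / 3 / σ₀ ^ 2 with hc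
  set M : ℕ → ℝ := fun n => C * exp (-(log n) ^ (1 / 3 : ℝ) + c) with hM
  set M' : ℕ → ℝ := fun n => C' * exp (-(log n) ^ (1 / 3 : ℝ) + c) with hM'
  have hMt : Tendsto M atTop (𝓝 0) := tendsto_exp_neg_cbrt_log _ _
  have hMt' : Tendsto M' atTop (𝓝 0) := tendsto_exp_neg_cbrt_log _ _
  set L : ℕ → ℝ := fun n => √(8 * (4 * (β₁ - α) / (b - α) + 1) ^ 3 * log n) with hL
  set τ' : ℕ → ℝ := fun n => Fm * C ^ 2 * exp (L n) * (4 * (β₁ - α)) / √(Dn n / 2) with hτ'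
  set τ : ℕ → ℝ := fun n => τ' n / (π * ((b - α) / 8)) with hτ
  have hτt : Tendsto τ atTop (𝓝 0) := by
    have := (tendsto_exp_sqrt_log (Fm * C ^ 2 * (4 * (β₁ - α)))
      (8 * (4 * (β₁ - α) / (b - α) + 1) ^ 3)).div_const (π * ((b - α) / 8))
    rw [zero_div] at this
    refine this.congr fun n => ?_
    simp only [hτ, hτ', hL]
    ring
  have hτ'0 : ∀ n, 0 ≤ τ' n := fun n => by
    have : 0 ≤ β₁ - α := by linarith
    simp only [hτ']
    positivity
  have hee : 1 < exp e := Real.one_lt_exp_iff.2 he0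
  have t1 : Tendsto (fun n => (1 + τ n) * (1 + 35 * M n)) atTop (𝓝 1) := by
    simpa using (hτt.const_add 1).mul ((hMt.const_mul 35).const_add 1)
  have t2 : Tendsto (fun n => 1 + M' n) atTop (𝓝 1) := by simpa using hMt'.const_add 1
  have t3 : Tendsto (fun n => 22 * M n / (1 - ρ)) atTop (𝓝 0) := by
    simpa using (hMt.const_mul 22).div_const (1 - ρ)
  have t4 : Tendsto (fun n => (1 - s n) / (1 + s n)) atTop (𝓝 1) := by
    have := (hs0.const_sub 1).div (hs0.const_add 1) (by norm_num)
    rwa [sub_zero, add_zero, div_one] at this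
  refine ⟨fun β => log (2 * π * ((β - α) / 4) * E.coeff 0 ^ 2),
    fun β y => log (E.coeff 0 / E.eval (zfun α β y)), |log (E.coeff 0)| + |log C|,
    min η ((b - α) / 2), lt_min hη (by linarith), ?_⟩
  filter_upwards [eventually_ge_atTop 2, hMt.eventually_le_const (show (0 : ℝ) < 1 / 20 by norm_num),
    hMt'.eventually_le_const (show (0 : ℝ) < 1 / 2 by norm_num),
    t1.eventually_le_const hee, t2.eventually_le_const hee, t3.eventually_le_const he0,
    t4.eventually_const_le (show (1 + ρ) / 2 < 1 by linarith),
    hs0.eventually_le_const (show 0 < min (σ₀ / 2) (1 / 3) by positivity),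
    tendsto_Dn_div.eventually_le_const (show (0 : ℝ) < 1 / 2 by norm_num)]
    with n hn hMn hMn' h1 h2 h3 h4 h5 h6
  intro β hβ hβ₁ hβb Z hZ hg p hp hpn ho
  have hn0 : (0 : ℝ) < n := by exact_mod_cast (by omega : 0 < n)
  have hs1 := h5.trans (min_le_left _ _)
  have hs2 := h5.trans (min_le_right _ _)
  have hsp : 0 < s n := by simp only [hs]; positivity
  have hDp : 0 < Dn n := by
    rw [Dn]
    exact Real.rpow_pos_of_pos (mul_pos hn0 (Real.log_pos (by exact_mod_cast hn))) _
  have hDn : 2 * Dn n ≤ n := by rw [div_le_iff₀ hn0] at h6; linarith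
  have hη1 := hβb.trans_le (min_le_left _ _)
  have hη2 := hβb.trans_le (min_le_right _ _)
  have hββ : (b - α) / 2 ≤ β - α := by linarith [(abs_lt.1 hη2).1]
  have hΘ := hg.theta_le hβ hβ₁ hγ hZ (by omega) hs1
  have hT : ∀ σ ∈ sset α β Z, s n < σ ∧ σ ≤ 1 := fun σ hσ =>
    have := le_of_mem_sset hβ hβ₁ hγ hZ σ hσ
    ⟨by linarith [this.1], this.2⟩
  have hzρ : ∀ y, γ ≤ y → zfun α β y ≤ ρ := fun y hy => zfun_le_of_le_sfun hσ0.le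
    (sfun_le_sfun hβ.le hβ₁ (by linarith) hy)
  have hq := oneInterval_quantitative (τ := τ n) (τ' := τ' n) (δ := √(exp (8 * e) - 1) * Γ)
    hβ hβ₁ hγ hf hf0 hZ hp hpn ho hE hE0 hF0
    (fun z hz => (hsand β hβ hβ₁ hη1 z hz).1) (fun z hz => (hsand β hβ hβ₁ hη1 z hz).2) hEF
    (outerBound_mul hE hC1 hsp hs2 hT hC0.le (M := M n)
      (mul_le_mul_of_nonneg_left (Real.exp_le_exp.2 hΘ) hC0.le) (by linarith))
    (outerBound_mul hF hC1' hsp hs2 hT hC0'.le (M := M' n)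
      (mul_le_mul_of_nonneg_left (Real.exp_le_exp.2 hΘ) hC0'.le) hMn')
    hMn hρ1 h4 hzρ (div_nonneg (hτ'0 n) (by have := Real.pi_pos; nlinarith))
    (by
      have h7 : τ' n = π * ((b - α) / 8) * τ n := by
        simp only [hτ]
        have : b - α ≠ 0 := by linarith
        field_simp
      have hτ0 : 0 ≤ τ n := div_nonneg (hτ'0 n) (by have := Real.pi_pos; nlinarith)
      rw [h7]
      have : 1 ≤ exp (2 * e) := Real.one_le_exp (by linarith)
      have h8 : π * ((b - α) / 8) ≤ π * ((β - α) / 4) :=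
        mul_le_mul_of_nonneg_left (by linarith) Real.pi_pos.le
      refine mul_le_mul_of_nonneg_right ?_ hτ0
      have h9 : 0 ≤ π * ((β - α) / 4) := mul_nonneg Real.pi_pos.le (by linarith)
      nlinarith)
    (fun P hP => by
      rcases hβ₁.eq_or_lt with rfl | hlt
      · rw [intervalIntegral.integral_same]
        have := kappa_pos (X := Z) hβ fun x hx => by linarith [hZ x hx]
        have := hτ'0 n
        positivity
      · exact tail_le hβ hβ₁ (fun t ht => by linarith [hZ t ht])
          (hf.mono (Set.Icc_subset_Icc_left hβ.le))
          (fun x hx => (hf0 x ⟨hβ.le.trans hx.1, hx.2⟩).le)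
          (fun x hx => hFm x ⟨hβ.le.trans hx.1, hx.2⟩) (fun z hz => (hC2 z hz).2)
          (by positivity) hP fun x hx =>
          hg.neg_theta_le hαb hββ hlt (fun t ht => by linarith [hZ t ht]) (by omega) hDn hx)
    h1 h2 h3 he2 le_rfl heδ2
  refine ⟨hq.1.trans he5, fun y hy => ?_⟩
  obtain ⟨q1, q2⟩ := hq.2 y hy
  refine ⟨q1, q2.trans heδ, ?_⟩
  have hz := zfun_pos hβ (by linarith : β ≤ y)
  have hz1 := zfun_lt_one hβ (by linarith : β < y)
  have hEp := eval_pos_of_ne_zero hE hE0 hz.le (by linarith)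
  obtain ⟨e1, e2⟩ := hC2 (zfun α β y : ℝ) (by
    rw [Complex.norm_real, norm_of_nonneg hz.le]; linarith)
  rw [aeval_ofReal, Complex.norm_real, norm_of_nonneg hEp.le] at e1 e2
  rw [Real.log_div hE0.ne' hEp.ne']
  refine (abs_sub _ _).trans (add_le_add_right ?_ _)
  rw [abs_le]
  have l1 := Real.log_le_log hEp e1
  have l2 := Real.log_le_log one_pos e2
  rw [Real.log_one, Real.log_mul hC0.ne' hEp.ne'] at l2
  constructor <;> linarith [le_abs_self (log C)]

/-- The push `1/s - 1` of an exterior point on the right endpoint. -/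
def push (α β x : ℝ) : ℝ := 1 / sfun α β x - 1

/-- The net push `2n - Ψ`. -/
def net (α β : ℝ) (n : ℕ) (Z : Multiset ℝ) : ℝ := 2 * n - (Z.map (push α β)).sum

lemma Psi_sset (α β : ℝ) (Z : Multiset ℝ) : Psi (sset α β Z) = (Z.map (push α β)).sum := by
  rw [Psi, sset, Multiset.map_map]
  rfl

lemma push_nonneg {α β x : ℝ} (hβ : α ≤ β) (hx : β < x) : 0 ≤ push α β x := by
  have h0 : 0 < sfun α β x := Real.sqrt_pos.2 (div_pos (by linarith) (by linarith))
  have h1 : sfun α β x ≤ 1 := by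
    refine Real.sqrt_le_one.2 ((div_le_one (by linarith)).2 (by linarith))
  rw [push, sub_nonneg, le_div_iff₀ h0]
  linarith

lemma hasDerivAt_sfun {α β x : ℝ} (hβ : α < β) (hx : β < x) :
    HasDerivAt (fun β => sfun α β x)
      (-(1 - sfun α β x ^ 2) / (2 * sfun α β x * (β - α))) β := by
  have h1 : HasDerivAt (fun β => (x - β) / (x - α)) (-1 / (x - α)) β :=
    ((hasDerivAt_id β).const_sub x).div_const _
  have h2 : 0 < (x - β) / (x - α) := div_pos (by linarith) (by linarith)
  refine (h1.sqrt h2.ne').congr_deriv ?_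
  have hs : 0 < sfun α β x := sfun_pos hβ hx
  have h3 := one_sub_sfun_sq hβ hx.le
  rw [show √((x - β) / (x - α)) = sfun α β x from rfl, h3]
  have : β - α ≠ 0 := by linarith
  have : x - α ≠ 0 := by linarith
  field_simp

lemma Afun_eq {α β x : ℝ} (hβ : α < β) (hx : β < x) :
    Afun α β x = log (x - α) + 2 * log (1 + sfun α β x) - log 4 := by
  have hs : 0 < sfun α β x := sfun_pos hβ hx
  have h1 : 0 < x - α := by linarith
  rw [Afun, div_zfun hβ hx.le, Real.log_div (by positivity) (by norm_num),
    Real.log_mul (by positivity) (by positivity), Real.log_pow]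
  push_cast
  ring

lemma hasDerivAt_Afun {α β x : ℝ} (hβ : α < β) (hx : β < x) :
    HasDerivAt (fun β => Afun α β x) (-(push α β x / (β - α))) β := by
  have hs : 0 < sfun α β x := sfun_pos hβ hx
  have h1 := ((((hasDerivAt_sfun hβ hx).const_add 1).log (by positivity)).const_mul 2).const_add
    (log (x - α)) |>.sub_const (log 4)
  refine (h1.congr_of_eventuallyEq ?_).congr_deriv ?_
  · filter_upwards [Ioo_mem_nhds hβ hx] with b hb using Afun_eq hb.1 hb.2
  · have : β - α ≠ 0 := by linarith
    rw [push]
    field_simp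
    ring

lemma Bfun_eq {α β x y : ℝ} (hβ : α < β) (hx : β < x) (hy : β < y) :
    Bfun α β x y = log 2 + log (sfun α β x + sfun α β y) - log (1 + sfun α β x) -
      log (1 + sfun α β y) := by
  have hs : 0 < sfun α β x := sfun_pos hβ hx
  have ht : 0 < sfun α β y := sfun_pos hβ hy
  rw [Bfun, ← Real.log_mul (by norm_num) (by positivity), ← Real.log_div (by positivity)
    (by positivity), ← Real.log_div (by positivity) (by positivity)]
  congr 1
  rw [zfun, zfun]
  field_simp
  ring

lemma hasDerivAt_Bfun {α β x y : ℝ} (hβ : α < β) (hx : β < x) (hy : β < y) :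
    HasDerivAt (fun β => Bfun α β x y) (-(push α β x * push α β y / (2 * (β - α)))) β := by
  have hs : 0 < sfun α β x := sfun_pos hβ hx
  have ht : 0 < sfun α β y := sfun_pos hβ hy
  have ds := hasDerivAt_sfun hβ hx
  have dt := hasDerivAt_sfun hβ hy
  have h1 := ((((ds.add dt).log (by simp only [Pi.add_apply]; positivity)).const_add
    (log 2)).sub ((ds.const_add 1).log (by positivity))).sub ((dt.const_add 1).log (by positivity))
  refine (h1.congr_of_eventuallyEq ?_).congr_deriv ?_
  · filter_upwards [Ioo_mem_nhds hβ (lt_min hx hy)] with b hb using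
      Bfun_eq hb.1 (hb.2.trans_le (min_le_left _ _)) (hb.2.trans_le (min_le_right _ _))
  · have : β - α ≠ 0 := by linarith
    simp only [Pi.add_apply]
    rw [push, push]
    generalize sfun α β x = s at *
    generalize sfun α β y = t at *
    field_simp
    ring

lemma hasDerivAt_multiset_sum {Z : Multiset ℝ} {g g' : ℝ → ℝ → ℝ} {β : ℝ}
    (h : ∀ x ∈ Z, HasDerivAt (fun b => g b x) (g' β x) β) :
    HasDerivAt (fun b => (Z.map (g b)).sum) (Z.map (g' β)).sum β := by
  induction Z using Multiset.induction_on with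
  | empty => simpa using hasDerivAt_const β (0 : ℝ)
  | cons t T ih =>
    simp only [Multiset.map_cons, Multiset.sum_cons]
    exact (h t (Multiset.mem_cons_self _ _)).add
      (ih fun x hx => h x (Multiset.mem_cons_of_mem hx))

lemma hasDerivAt_Ffun {α β y : ℝ} {n : ℕ} {Z : Multiset ℝ} (hβ : α < β) (hy : β < y)
    (hZ : ∀ x ∈ Z, β < x) :
    HasDerivAt (fun β => Ffun α β n Z y) (-(push α β y / (2 * (β - α)) * net α β n Z)) β := by
  have h1 := ((hasDerivAt_Afun hβ hy).const_mul (n : ℝ)).sub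
    (hasDerivAt_multiset_sum (Z := Z) (g := fun b x => Bfun α b x y)
      (g' := fun b x => -(push α b x * push α b y / (2 * (b - α))))
      fun x hx => hasDerivAt_Bfun hβ (hZ x hx) hy)
  refine h1.congr_deriv ?_
  rw [show (Z.map fun x => -(push α β x * push α β y / (2 * (β - α)))).sum =
    -(push α β y / (2 * (β - α))) * (Z.map (push α β)).sum by
      rw [← Multiset.sum_map_mul_left]
      congr 1
      refine Multiset.map_congr rfl fun x _ => ?_
      ring, net]
  have : β - α ≠ 0 := by linarith
  field_simp
  ring

lemma hasDerivAt_Hfun {α β : ℝ} {n : ℕ} {Z : Multiset ℝ} (hβ : α < β) (hZ : ∀ x ∈ Z, β < x) :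
    HasDerivAt (fun β => Hfun α β n Z) (net α β n Z / (β - α)) β := by
  have h1 := ((((hasDerivAt_id β).sub_const α).div_const 4).log
    (by simp only [id]; linarith)).const_mul (2 * (n : ℝ))
  have h2 := h1.add (hasDerivAt_multiset_sum (Z := Z) (g := fun b x => Afun α b x)
    (g' := fun b x => -(push α b x / (b - α))) fun x hx => hasDerivAt_Afun hβ (hZ x hx))
  refine h2.congr_deriv ?_
  rw [show (Z.map fun x => -(push α β x / (β - α))).sum =
    -(1 / (β - α)) * (Z.map (push α β)).sum by
      rw [← Multiset.sum_map_mul_left]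
      congr 1
      refine Multiset.map_congr rfl fun x _ => ?_
      ring, net]
  have : β - α ≠ 0 := by linarith
  simp only [id]
  field_simp
  ring

lemma push_eq (α β x : ℝ) : push α β x = √((x - α) / (x - β)) - 1 := by
  rw [push, sfun, one_div, ← Real.sqrt_inv, inv_div]

lemma push_le {α β β₁ γ x : ℝ} (hβ : α ≤ β) (hβ₁ : β ≤ β₁) (hγ : β₁ < γ) (hx : γ ≤ x) :
    push α β x ≤ (β - α) / (γ - β₁) := by
  have h1 : 0 < x - β := by linarith
  rw [push_eq, sub_le_iff_le_add]
  have h2 : (x - α) / (x - β) = 1 + (β - α) / (x - β) := by field_simp; ring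
  have h3 : 0 ≤ (β - α) / (x - β) := div_nonneg (by linarith) h1.le
  have h4 : (β - α) / (x - β) ≤ (β - α) / (γ - β₁) :=
    div_le_div_of_nonneg_left (by linarith) (by linarith) (by linarith)
  refine Real.sqrt_le_iff.2 ⟨by linarith, ?_⟩
  rw [h2]
  nlinarith

lemma push_lipschitz {α β β₁ γ x x' : ℝ} (hβ : α ≤ β) (hβ₁ : β ≤ β₁) (hγ : β₁ < γ) (hx : γ ≤ x)
    (hx' : γ ≤ x') :
    |push α β x - push α β x'| ≤ (β₁ - α) / (γ - β₁) ^ 2 * |x - x'| := by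
  have h1 : 0 < x - β := by linarith
  have h1' : 0 < x' - β := by linarith
  have hr : ∀ t, 0 < t - β → 1 ≤ √((t - α) / (t - β)) := fun t ht =>
    Real.one_le_sqrt.2 ((one_le_div ht).2 (by linarith))
  have ha := hr x h1
  have hb := hr x' h1'
  have hsq : ∀ t, 0 < t - β → √((t - α) / (t - β)) ^ 2 = (t - α) / (t - β) := fun t ht =>
    Real.sq_sqrt (div_nonneg (by linarith) ht.le)
  have ha2 := hsq x h1
  have hb2 := hsq x' h1'
  rw [push_eq, push_eq, sub_sub_sub_cancel_right]
  set u := √((x - α) / (x - β))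
  set v := √((x' - α) / (x' - β))
  have h3 : |u - v| ≤ |u ^ 2 - v ^ 2| := by
    rw [show u ^ 2 - v ^ 2 = (u - v) * (u + v) by ring, abs_mul]
    refine le_mul_of_one_le_right (abs_nonneg _) ?_
    rw [abs_of_nonneg (by linarith)]
    linarith
  refine h3.trans ?_
  have h5 : u ^ 2 - v ^ 2 = (β - α) / ((x - β) * (x' - β)) * -(x - x') := by
    rw [ha2, hb2]; field_simp; ring
  rw [h5, abs_mul, abs_neg, abs_of_nonneg (div_nonneg (by linarith) (by positivity))]
  have h6 : (γ - β₁) ^ 2 ≤ (x - β) * (x' - β) := by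
    rw [sq]; exact mul_le_mul (by linarith) (by linarith) (by linarith) h1.le
  have h7 : 0 < (γ - β₁) ^ 2 := by have : 0 < γ - β₁ := by linarith
                                   positivity
  refine mul_le_mul_of_nonneg_right ?_ (abs_nonneg _)
  exact div_le_div₀ (by linarith) (by linarith) h7 h6

lemma push_sub_ge {α β β' R x : ℝ} (hβ : α ≤ β) (hβ' : β ≤ β') (hx : β' < x) (hR : x ≤ R) :
    (β' - β) / (2 * (R - α)) ≤ push α β' x - push α β x := by
  have h1 : 0 < x - β := by linarith
  have h1' : 0 < x - β' := by linarith
  have h0 : 0 < x - α := by linarith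
  rw [push_eq, push_eq, sub_sub_sub_cancel_right]
  have ha2 : √((x - α) / (x - β')) ^ 2 = (x - α) / (x - β') :=
    Real.sq_sqrt (div_nonneg (by linarith) h1'.le)
  have hb2 : √((x - α) / (x - β)) ^ 2 = (x - α) / (x - β) :=
    Real.sq_sqrt (div_nonneg (by linarith) h1.le)
  have hba : √((x - α) / (x - β)) ≤ √((x - α) / (x - β')) := by gcongr
  have ha : 1 ≤ √((x - α) / (x - β')) :=
    Real.one_le_sqrt.2 ((one_le_div h1').2 (by linarith))
  have hb := Real.sqrt_nonneg ((x - α) / (x - β))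
  set u := √((x - α) / (x - β'))
  set v := √((x - α) / (x - β))
  have h5 : (β' - β) / (x - β') ≤ u ^ 2 - v ^ 2 := by
    have : u ^ 2 - v ^ 2 = (β' - β) / (x - β') * ((x - α) / (x - β)) := by
      rw [ha2, hb2]; field_simp; ring
    rw [this]
    exact le_mul_of_one_le_right (div_nonneg (by linarith) h1'.le)
      ((one_le_div h1).2 (by linarith))
  have h6 : u ≤ (x - α) / (x - β') := by rw [← ha2]; nlinarith
  have h7 : u ^ 2 - v ^ 2 ≤ (u - v) * (2 * ((x - α) / (x - β'))) := by
    rw [show u ^ 2 - v ^ 2 = (u - v) * (u + v) by ring]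
    exact mul_le_mul_of_nonneg_left (by linarith) (by linarith)
  have h8 := h5.trans h7
  rw [div_le_iff₀ h1', mul_assoc, mul_assoc, div_mul_cancel₀ _ h1'.ne'] at h8
  rw [div_le_iff₀ (by linarith)]
  nlinarith

lemma push_mono {α β β' x : ℝ} (hβ : α ≤ β) (hβ' : β ≤ β') (hx : β' < x) :
    push α β x ≤ push α β' x := by
  have := push_sub_ge hβ hβ' hx le_rfl
  have h2 : 0 ≤ (β' - β) / (2 * (x - α)) := div_nonneg (by linarith) (by linarith)
  linarith

lemma continuousOn_push {α β₁ x : ℝ} (hx : β₁ < x) :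
    ContinuousOn (fun β => push α β x) (Set.Icc α β₁) := by
  simp only [push_eq]
  refine ContinuousOn.sub (ContinuousOn.sqrt (ContinuousOn.div (by fun_prop) (by fun_prop)
    fun b hb => ?_)) continuousOn_const
  linarith [hb.2]

lemma continuousOn_net {α β₁ : ℝ} (n : ℕ) {Z : Multiset ℝ} (hZ : ∀ x ∈ Z, β₁ < x) :
    ContinuousOn (fun β => net α β n Z) (Set.Icc α β₁) := by
  unfold net
  refine continuousOn_const.sub ?_
  induction Z using Multiset.induction_on with
  | empty => simpa using continuousOn_const
  | cons t T ih =>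
    simp only [Multiset.map_cons, Multiset.sum_cons]
    exact (continuousOn_push (hZ t (Multiset.mem_cons_self _ _))).add
      (ih fun x hx => hZ x (Multiset.mem_cons_of_mem hx))

lemma net_left {α : ℝ} (n : ℕ) {Z : Multiset ℝ} (hZ : ∀ x ∈ Z, α < x) : net α α n Z = 2 * n := by
  rw [net, Multiset.map_congr rfl (g := fun _ => (0 : ℝ)) fun x hx => ?_]
  · simp
  · rw [push_eq, div_self (by linarith [hZ x hx]), Real.sqrt_one, sub_self]

lemma net_anti {α β β' : ℝ} (n : ℕ) {Z : Multiset ℝ} (hβ : α ≤ β) (hβ' : β ≤ β')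
    (hZ : ∀ x ∈ Z, β' < x) : net α β' n Z ≤ net α β n Z := by
  unfold net
  have := Multiset.sum_map_le_sum_map (s := Z) (push α β) (push α β')
    fun x hx => push_mono hβ hβ' (hZ x hx)
  linarith

lemma net_le_sub {α β β' R : ℝ} (n : ℕ) {Z : Multiset ℝ} (hβ : α ≤ β) (hβ' : β ≤ β')
    (hZ : ∀ x ∈ Z, β' < x ∧ x ≤ R) :
    net α β' n Z ≤ net α β n Z - Z.card * ((β' - β) / (2 * (R - α))) := by
  have h := Multiset.sum_map_le_sum_map (s := Z) (fun x => push α β x + (β' - β) / (2 * (R - α)))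
    (push α β') fun x hx => by
      have := push_sub_ge hβ hβ' (hZ x hx).1 (hZ x hx).2
      linarith
  rw [Multiset.sum_map_add, Multiset.map_const', Multiset.sum_replicate, nsmul_eq_mul] at h
  unfold net
  linarith

/-- A right endpoint at which the net push is the admissible gap, or the hard edge. -/
lemma exists_endpoint {α β₁ d : ℝ} (hα : α < β₁) (n : ℕ) {Z : Multiset ℝ}
    (hZ : ∀ x ∈ Z, β₁ < x) (hd : d < 2 * n) :
    ∃ β, α < β ∧ β ≤ β₁ ∧ d ≤ net α β n Z ∧ (β = β₁ ∨ net α β n Z = d) := by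
  by_cases h : d ≤ net α β₁ n Z
  · exact ⟨β₁, hα, le_rfl, h, Or.inl rfl⟩
  · push Not at h
    have h0 := net_left n (Z := Z) fun x hx => hα.trans (hZ x hx)
    obtain ⟨β, hβ, hβd⟩ := intermediate_value_Icc' hα.le (continuousOn_net n hZ)
      (show d ∈ Set.Icc (net α β₁ n Z) (net α α n Z) from ⟨h.le, by rw [h0]; exact hd.le⟩)
    have hβα : α ≠ β := by
      rintro rfl
      have : net α α n Z = d := hβd
      linarith
    exact ⟨β, lt_of_le_of_ne hβ.1 hβα, hβ.2, le_of_eq hβd.symm, Or.inr hβd⟩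

lemma le_endpoint {α β β₁ γ d : ℝ} {n : ℕ} {Z : Multiset ℝ} (hβ : α < β) (hβ₁ : β ≤ β₁)
    (hγ : β₁ < γ) (hZ : ∀ x ∈ Z, γ ≤ x) (h : β = β₁ ∨ net α β n Z = d) (hd : d ≤ n) :
    β = β₁ ∨ (n : ℝ) * (γ - β₁) ≤ Z.card * (β - α) := by
  refine h.imp_right fun h => ?_
  have h1 := Multiset.sum_map_le_sum_map (s := Z) (push α β) (fun _ => (β - α) / (γ - β₁))
    fun x hx => push_le hβ.le hβ₁ hγ (hZ x hx)
  rw [Multiset.map_const', Multiset.sum_replicate, nsmul_eq_mul] at h1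
  unfold net at h
  have h2 : (n : ℝ) ≤ Z.card * ((β - α) / (γ - β₁)) := by linarith
  rwa [← mul_div_assoc, le_div_iff₀ (by linarith)] at h2

lemma abs_sub_le_of_deriv_le {g g' : ℝ → ℝ} {a b c x y : ℝ}
    (h : ∀ t ∈ Set.Icc a b, HasDerivAt g (g' t) t) (hc : ∀ t ∈ Set.Icc a b, |g' t| ≤ c)
    (hx : x ∈ Set.Icc a b) (hy : y ∈ Set.Icc a b) : |g y - g x| ≤ c * |y - x| :=
  (convex_Icc a b).norm_image_sub_le_of_norm_hasDerivWithin_le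
    (fun t ht => (h t ht).hasDerivWithinAt) hc hx hy

/-- Difference of leading terms for two data sets, Lipschitz in the endpoint. -/
lemma abs_Ffun_sub_sub_le {α a β₁ γ y C β β' : ℝ} {n n' : ℕ} {Z Z' : Multiset ℝ} (ha : α < a)
    (hγ : β₁ < γ) (hZ : ∀ x ∈ Z, γ ≤ x) (hZ' : ∀ x ∈ Z', γ ≤ x) (hy : γ ≤ y)
    (hC : ∀ b ∈ Set.Icc a β₁, |net α b n' Z' - net α b n Z| ≤ C)
    (hβ : β ∈ Set.Icc a β₁) (hβ' : β' ∈ Set.Icc a β₁) :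
    |(Ffun α β' n' Z' y - Ffun α β' n Z y) - (Ffun α β n' Z' y - Ffun α β n Z y)| ≤
      (β₁ - α) / (γ - β₁) / (2 * (a - α)) * C * |β' - β| := by
  refine abs_sub_le_of_deriv_le (g := fun b => Ffun α b n' Z' y - Ffun α b n Z y)
    (fun t ht => (hasDerivAt_Ffun (by linarith [ht.1]) (by linarith [ht.2])
      fun x hx => by linarith [ht.2, hZ' x hx]).sub
      (hasDerivAt_Ffun (by linarith [ht.1]) (by linarith [ht.2])
        fun x hx => by linarith [ht.2, hZ x hx])) (fun t ht => ?_) hβ hβ'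
  have h1 := push_le (x := y) (by linarith [ht.1] : α ≤ t) ht.2 hγ hy
  have h0 := push_nonneg (x := y) (by linarith [ht.1] : α ≤ t) (by linarith [ht.2])
  have h2 : (t - α) / (γ - β₁) ≤ (β₁ - α) / (γ - β₁) :=
    div_le_div_of_nonneg_right (by linarith [ht.2]) (by linarith)
  have h3 : 0 < 2 * (a - α) := by linarith
  rw [neg_sub_neg, ← mul_sub, abs_mul, abs_sub_comm,
    abs_of_nonneg (div_nonneg h0 (by linarith [ht.1]))]
  have h4 : 0 ≤ (β₁ - α) / (γ - β₁) := (h0.trans h1).trans h2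
  refine mul_le_mul ?_ (hC t ht) (abs_nonneg _) (div_nonneg h4 h3.le)
  exact div_le_div₀ h4 (h1.trans h2) h3 (by linarith [ht.1])

lemma abs_Hfun_sub_sub_le {α a β₁ C β β' : ℝ} {n n' : ℕ} {Z Z' : Multiset ℝ} (ha : α < a)
    (hZ : ∀ x ∈ Z, β₁ < x) (hZ' : ∀ x ∈ Z', β₁ < x)
    (hC : ∀ b ∈ Set.Icc a β₁, |net α b n' Z' - net α b n Z| ≤ C)
    (hβ : β ∈ Set.Icc a β₁) (hβ' : β' ∈ Set.Icc a β₁) :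
    |(Hfun α β' n' Z' - Hfun α β' n Z) - (Hfun α β n' Z' - Hfun α β n Z)| ≤
      C / (a - α) * |β' - β| := by
  refine abs_sub_le_of_deriv_le (g := fun b => Hfun α b n' Z' - Hfun α b n Z)
    (fun t ht => (hasDerivAt_Hfun (by linarith [ht.1])
      fun x hx => by linarith [ht.2, hZ' x hx]).sub
      (hasDerivAt_Hfun (by linarith [ht.1])
        fun x hx => by linarith [ht.2, hZ x hx])) (fun t ht => ?_) hβ hβ'
  have h1 := hC t ht
  rw [← sub_div, abs_div, abs_of_pos (by linarith [ht.1] : 0 < t - α)]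
  exact div_le_div₀ ((abs_nonneg _).trans h1) h1 (by linarith) (by linarith [ht.1])

/-- Left of the endpoint the leading term is larger. -/
lemma Ffun_le_of_le {α β β' y : ℝ} {n : ℕ} {Z : Multiset ℝ} (hβ : α < β) (hββ : β ≤ β')
    (hy : β' < y) (hZ : ∀ x ∈ Z, β' < x) (h : 0 ≤ net α β' n Z) :
    Ffun α β' n Z y ≤ Ffun α β n Z y := by
  have hd : ∀ t ∈ Set.Icc β β', HasDerivAt (fun b => Ffun α b n Z y)
      (-(push α t y / (2 * (t - α)) * net α t n Z)) t := fun t ht =>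
    hasDerivAt_Ffun (by linarith [ht.1]) (by linarith [ht.2]) fun x hx => by
      linarith [ht.2, hZ x hx]
  refine antitoneOn_of_deriv_nonpos (convex_Icc β β')
    (fun t ht => (hd t ht).continuousAt.continuousWithinAt)
    (fun t ht => ((hd t (interior_subset ht)).differentiableAt).differentiableWithinAt)
    (fun t ht => ?_) (Set.left_mem_Icc.2 hββ) (Set.right_mem_Icc.2 hββ) hββ
  have ht := interior_subset ht
  rw [(hd t ht).deriv, neg_nonpos]
  have h1 := net_anti n (by linarith [ht.1] : α ≤ t) ht.2 hZ
  exact mul_nonneg (div_nonneg (push_nonneg (by linarith [ht.1]) (by linarith [ht.2]))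
    (by linarith [ht.1])) (h.trans h1)

lemma push_ge {α β y R : ℝ} (hβ : α ≤ β) (hy : β < y) (hR : y ≤ R) :
    (β - α) / (2 * (R - α)) ≤ push α β y := by
  have h := push_sub_ge le_rfl hβ hy hR
  have h0 : push α α y = 0 := by
    rw [push_eq, div_self (by linarith), Real.sqrt_one, sub_self]
  linarith

/-- Right of a soft endpoint the leading term grows. -/
lemma le_Ffun_of_soft {α a β β' γ y d R : ℝ} {n : ℕ} {Z : Multiset ℝ} (ha : α < a)
    (hβ : a ≤ β) (hββ : β ≤ β') (hβγ : β' < γ) (hy : γ ≤ y) (hyR : y ≤ R)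
    (hZ : ∀ x ∈ Z, γ ≤ x ∧ x ≤ R) (h : net α β n Z ≤ d) (hd : 0 ≤ d) :
    Ffun α β n Z y + Z.card * (β' - β) ^ 2 / (16 * (R - α) ^ 2) -
      (β' - α) / (γ - β') / (2 * (a - α)) * d * (β' - β) ≤ Ffun α β' n Z y := by
  set c₁ := Z.card / (8 * (R - α) ^ 2)
  set c₂ := (β' - α) / (γ - β') / (2 * (a - α)) * d
  have hRα : 0 < R - α := by linarith
  have hd' : ∀ t ∈ Set.Icc β β', HasDerivAt
      (fun b => Ffun α b n Z y - c₁ * ((b - β) ^ 2 / 2) + c₂ * (b - β))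
      (-(push α t y / (2 * (t - α)) * net α t n Z) - c₁ * (t - β) + c₂) t := fun t ht => by
    have h1 := hasDerivAt_Ffun (α := α) (β := t) (y := y) (n := n) (Z := Z) (by linarith [ht.1])
      (by linarith [ht.2]) fun x hx => by linarith [ht.2, (hZ x hx).1]
    have h2 : HasDerivAt (fun b => b - β) 1 t := (hasDerivAt_id t).sub_const β
    have h3 := ((h2.pow 2).div_const 2).const_mul c₁
    refine ((h1.sub h3).add (h2.const_mul c₂)).congr_deriv ?_
    simp only [Nat.cast_ofNat]
    ring
  have hm := monotoneOn_of_deriv_nonneg (convex_Icc β β')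
    (fun t ht => (hd' t ht).continuousAt.continuousWithinAt)
    (fun t ht => ((hd' t (interior_subset ht)).differentiableAt).differentiableWithinAt)
    (fun t ht => ?_) (Set.left_mem_Icc.2 hββ) (Set.right_mem_Icc.2 hββ) hββ
  · simp only [sub_self] at hm
    have : c₁ * ((β' - β) ^ 2 / 2) = Z.card * (β' - β) ^ 2 / (16 * (R - α) ^ 2) := by
      simp only [c₁]; field_simp; ring
    linarith
  · have ht := interior_subset ht
    rw [(hd' t ht).deriv]
    have hpos : 0 < t - α := by linarith [ht.1]
    have h1 := net_le_sub (R := R) n (by linarith : α ≤ β) ht.1 (Z := Z) fun x hx =>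
      ⟨by linarith [ht.2, (hZ x hx).1], (hZ x hx).2⟩
    have p0 := push_nonneg (x := y) (by linarith : α ≤ t) (by linarith [ht.2])
    have p1 := push_le (x := y) (by linarith : α ≤ t) ht.2 hβγ hy
    have p2 := push_ge (y := y) (by linarith : α ≤ t) (by linarith [ht.2]) hyR
    have q0 : 0 ≤ push α t y / (2 * (t - α)) := by positivity
    have q1 : push α t y / (2 * (t - α)) ≤ (β' - α) / (γ - β') / (2 * (a - α)) := by
      refine div_le_div₀ (div_nonneg (by linarith) (by linarith)) (p1.trans ?_) (by linarith)
        (by linarith [ht.1])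
      exact div_le_div_of_nonneg_right (by linarith [ht.2]) (by linarith)
    have q2 : 1 / (4 * (R - α)) ≤ push α t y / (2 * (t - α)) := by
      rw [le_div_iff₀ (by positivity)]
      refine le_trans (le_of_eq ?_) p2
      field_simp
      ring
    have e1 : push α t y / (2 * (t - α)) * net α t n Z ≤
        push α t y / (2 * (t - α)) * d - push α t y / (2 * (t - α)) *
          (Z.card * ((t - β) / (2 * (R - α)))) := by
      rw [← mul_sub]
      exact mul_le_mul_of_nonneg_left (by linarith) q0
    have e2 : push α t y / (2 * (t - α)) * d ≤ c₂ := mul_le_mul_of_nonneg_right q1 hd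
    have e3 : c₁ * (t - β) ≤ push α t y / (2 * (t - α)) *
          (Z.card * ((t - β) / (2 * (R - α)))) := by
      have h0 : 0 ≤ (Z.card : ℝ) * ((t - β) / (2 * (R - α))) := by
        have : 0 ≤ t - β := by linarith [ht.1]
        positivity
      refine le_trans (le_of_eq ?_) (mul_le_mul_of_nonneg_right q2 h0)
      simp only [c₁]
      field_simp
      ring
    linarith

/-- Between two points of `Y` there is a point of `X`. -/
def Separates (X Y : Finset ℝ) : Prop := ∀ a ∈ Y, ∀ b ∈ Y, a < b → ∃ x ∈ X, a < x ∧ x < b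

section Interlacing

variable {G : ℝ → ℝ} {K lo hi : ℝ}

private lemma interlace_step {X Y : Finset ℝ} {u : ℝ}
    (hG : ∀ x ∈ Set.Icc lo hi, ∀ y ∈ Set.Icc lo hi, |G x - G y| ≤ K * |x - y|)
    (ih : ∀ X' Y' : Finset ℝ, X'.card + Y'.card < X.card + Y.card → Separates X' Y' →
      Separates Y' X' → Disjoint X' Y' → ∀ h ∈ Set.Icc lo hi, (∀ x ∈ X', x ∈ Set.Icc lo h) →
      (∀ x ∈ Y', x ∈ Set.Icc lo h) →
      |∑ x ∈ Y', G x - ∑ x ∈ X', G x - ((Y'.card : ℝ) - X'.card) * G lo| ≤ K * (h - lo))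
    (h1 : Separates X Y) (h2 : Separates Y X) (h3 : Disjoint X Y) (hu : u ∈ Y)
    (hX : ∀ x ∈ X, x ∈ Set.Icc lo hi ∧ x < u) (hY : ∀ x ∈ Y, x ∈ Set.Icc lo hi ∧ x ≤ u) :
    |∑ x ∈ Y, G x - ∑ x ∈ X, G x - ((Y.card : ℝ) - X.card) * G lo| ≤ K * (u - lo) := by
  have hu' := (hY u hu).1
  have hlo : lo ∈ Set.Icc lo hi := ⟨le_rfl, hu'.1.trans hu'.2⟩
  rw [← Finset.add_sum_erase Y G hu, ← Finset.card_erase_add_one hu]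
  rcases X.eq_empty_or_nonempty with rfl | hne
  · have : Y.erase u = ∅ := by
      refine Finset.eq_empty_of_forall_notMem fun y hy => ?_
      obtain ⟨hyu, hyY⟩ := Finset.mem_erase.1 hy
      obtain ⟨x, hx, -⟩ := h1 y hyY u hu (lt_of_le_of_ne (hY y hyY).2 hyu)
      simp at hx
    have h4 := hG u hu' lo hlo
    rw [abs_of_nonneg (sub_nonneg.2 hu'.1)] at h4
    simpa [this] using h4
  · set v := X.max' hne
    have hv : v ∈ X := X.max'_mem hne
    have hvX : ∀ x ∈ X, x ≤ v := fun x hx => X.le_max' x hx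
    have hvu := (hX v hv).2
    have hYv : ∀ y ∈ Y.erase u, y < v := fun y hy => by
      obtain ⟨hyu, hyY⟩ := Finset.mem_erase.1 hy
      obtain ⟨x, hx, hx1, -⟩ := h1 y hyY u hu (lt_of_le_of_ne (hY y hyY).2 hyu)
      exact hx1.trans_le (hvX x hx)
    rw [← Finset.add_sum_erase X G hv, ← Finset.card_erase_add_one hv]
    have h5 := ih (X.erase v) (Y.erase u)
      (by
        have := Finset.card_erase_add_one hv
        have := Finset.card_erase_add_one hu
        omega)
      (fun a ha b hb hab => by
        obtain ⟨x, hx, h⟩ := h1 a (Finset.mem_of_mem_erase ha) b (Finset.mem_of_mem_erase hb) hab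
        exact ⟨x, Finset.mem_erase.2 ⟨(h.2.trans (hYv b hb)).ne, hx⟩, h⟩)
      (fun a ha b hb hab => by
        obtain ⟨x, hx, h⟩ := h2 a (Finset.mem_of_mem_erase ha) b (Finset.mem_of_mem_erase hb) hab
        exact ⟨x, Finset.mem_erase.2
          ⟨(h.2.trans (hX b (Finset.mem_of_mem_erase hb)).2).ne, hx⟩, h⟩)
      (h3.mono (Finset.erase_subset _ _) (Finset.erase_subset _ _)) v (hX v hv).1
      (fun x hx => ⟨(hX x (Finset.mem_of_mem_erase hx)).1.1, hvX x (Finset.mem_of_mem_erase hx)⟩)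
      (fun x hx => ⟨(hY x (Finset.mem_of_mem_erase hx)).1.1, (hYv x hx).le⟩)
    have h6 := hG u hu' v (hX v hv).1
    rw [abs_of_pos (sub_pos.2 hvu)] at h6
    push_cast
    rw [abs_le] at h5 h6 ⊢
    constructor <;> linarith [h5.1, h5.2, h6.1, h6.2]

lemma interlace_bound (X Y : Finset ℝ) (h1 : Separates X Y) (h2 : Separates Y X)
    (h3 : Disjoint X Y) (hlo : lo ≤ hi)
    (hG : ∀ x ∈ Set.Icc lo hi, ∀ y ∈ Set.Icc lo hi, |G x - G y| ≤ K * |x - y|)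
    (hK : 0 ≤ K) (hX : ∀ x ∈ X, x ∈ Set.Icc lo hi) (hY : ∀ x ∈ Y, x ∈ Set.Icc lo hi) :
    |∑ x ∈ Y, G x - ∑ x ∈ X, G x - ((Y.card : ℝ) - X.card) * G lo| ≤ K * (hi - lo) := by
  induction hN : X.card + Y.card using Nat.strong_induction_on generalizing X Y hi with
  | _ N ih =>
    subst hN
    rcases (X ∪ Y).eq_empty_or_nonempty with he | hne
    · obtain ⟨rfl, rfl⟩ := Finset.union_eq_empty.1 he
      simpa using mul_nonneg hK (sub_nonneg.2 hlo)
    have hum := (X ∪ Y).max'_mem hne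
    have hmax : ∀ x ∈ X ∪ Y, x ≤ (X ∪ Y).max' hne := fun x hx => (X ∪ Y).le_max' x hx
    set u := (X ∪ Y).max' hne
    have key : ∀ X' Y' : Finset ℝ, X'.card + Y'.card < X.card + Y.card → Separates X' Y' →
      Separates Y' X' → Disjoint X' Y' → ∀ h ∈ Set.Icc lo hi, (∀ x ∈ X', x ∈ Set.Icc lo h) →
      (∀ x ∈ Y', x ∈ Set.Icc lo h) →
      |∑ x ∈ Y', G x - ∑ x ∈ X', G x - ((Y'.card : ℝ) - X'.card) * G lo| ≤ K * (h - lo) :=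
      fun X' Y' hc s1 s2 s3 h hh hX' hY' => ih _ hc X' Y' s1 s2 s3 hh.1
        (fun x hx y hy => hG x ⟨hx.1, hx.2.trans hh.2⟩ y ⟨hy.1, hy.2.trans hh.2⟩) hX' hY' rfl
    have hmono : ∀ v ∈ Set.Icc lo hi, K * (v - lo) ≤ K * (hi - lo) := fun v hv =>
      mul_le_mul_of_nonneg_left (by linarith [hv.2]) hK
    rcases Finset.mem_union.1 hum with hu | hu
    · have := interlace_step (u := u) hG
        (X := Y) (Y := X) (fun X' Y' hc s1 s2 s3 => key X' Y' (by omega) s1 s2 s3) h2 h1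
        h3.symm hu
        (fun x hx => ⟨hY x hx, lt_of_le_of_ne (hmax x (Finset.mem_union_right _ hx))
          fun h => Finset.disjoint_left.1 h3 hu (h ▸ hx)⟩)
        (fun x hx => ⟨hX x hx, hmax x (Finset.mem_union_left _ hx)⟩)
      rw [← abs_neg]
      refine le_trans (le_of_eq (congrArg _ (by ring))) (this.trans (hmono u (hX u hu)))
    · exact (interlace_step (u := u) hG key h1 h2 h3 hu
        (fun x hx => ⟨hX x hx, lt_of_le_of_ne (hmax x (Finset.mem_union_left _ hx))
          fun h => Finset.disjoint_left.1 h3 (h ▸ hx) hu⟩)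
        (fun x hx => ⟨hY x hx, hmax x (Finset.mem_union_right _ hx)⟩)).trans
          (hmono u (hY u hu))

end Interlacing

section Zeros

variable {lo hi : ℝ} {w : ℝ → ℝ}

lemma sign_of_even_rootMultiplicity (h : lo < hi) (R : ℝ[X]) (hR : R ≠ 0)
    (he : ∀ r ∈ Set.Ioo lo hi, Even (R.rootMultiplicity r)) :
    (∀ x ∈ Set.Icc lo hi, 0 ≤ R.eval x) ∨ ∀ x ∈ Set.Icc lo hi, R.eval x ≤ 0 := by
  induction hN : R.natDegree using Nat.strong_induction_on generalizing R with
  | _ N ih =>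
    subst hN
    by_cases hroot : ∃ r ∈ Set.Ioo lo hi, R.eval r = 0
    · obtain ⟨r, hr, hr0⟩ := hroot
      have hpos : 0 < R.rootMultiplicity r := (rootMultiplicity_pos hR).2 hr0
      have h2 : 2 ≤ R.rootMultiplicity r := by
        obtain ⟨k, hk⟩ := he r hr
        omega
      obtain ⟨R', hR'⟩ := (le_rootMultiplicity_iff hR).1 h2
      have hR'0 : R' ≠ 0 := by
        rintro rfl
        simp at hR'
        exact hR hR'
      have hsq : (X - C r) ^ 2 ≠ 0 := pow_ne_zero _ (X_sub_C_ne_zero r)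
      have hdeg : R.natDegree = 2 + R'.natDegree := by
        rw [hR', natDegree_mul hsq hR'0, natDegree_pow, natDegree_X_sub_C]
      have hev : ∀ x ∈ Set.Ioo lo hi, Even (R'.rootMultiplicity x) := fun x hx => by
        have h3 := he x hx
        rw [hR', rootMultiplicity_mul (hR' ▸ hR), sq,
          rootMultiplicity_mul (mul_self_ne_zero.2 (X_sub_C_ne_zero r)), Nat.even_add] at h3
        exact h3.1 (Even.add_self _)
      have heval : ∀ x, R.eval x = (x - r) ^ 2 * R'.eval x := fun x => by
        conv_lhs => rw [hR']
        simp
      refine (ih _ (by omega) R' hR'0 hev rfl).imp (fun h x hx => ?_) fun h x hx => ?_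
      · rw [heval]
        exact mul_nonneg (sq_nonneg _) (h x hx)
      · rw [heval]
        exact mul_nonpos_of_nonneg_of_nonpos (sq_nonneg _) (h x hx)
    · push Not at hroot
      have hsgn : (∀ x ∈ Set.Ioo lo hi, 0 ≤ R.eval x) ∨ ∀ x ∈ Set.Ioo lo hi, R.eval x ≤ 0 := by
        by_contra! hcon
        obtain ⟨⟨x, hx, hx0⟩, y, hy, hy0⟩ := hcon
        obtain ⟨z, hz, hz0⟩ := isPreconnected_Ioo.intermediate_value hx hy
          R.continuous.continuousOn ⟨hx0.le, hy0.le⟩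
        exact hroot z hz hz0
      have hcl : Set.Icc lo hi ⊆ closure (Set.Ioo lo hi) := (closure_Ioo h.ne).ge
      refine hsgn.imp (fun h x hx => ?_) fun h x hx => ?_
      · exact closure_minimal h (isClosed_le continuous_const R.continuous) (hcl hx)
      · exact closure_minimal h (isClosed_le R.continuous continuous_const) (hcl hx)

lemma integral_mul_ne_zero_of_sign (h : lo < hi) (hw : ContinuousOn w (Set.Icc lo hi))
    (hpos : ∀ x ∈ Set.Icc lo hi, 0 < w x) {R : ℝ[X]} (hR : R ≠ 0)
    (hs : (∀ x ∈ Set.Icc lo hi, 0 ≤ R.eval x) ∨ ∀ x ∈ Set.Icc lo hi, R.eval x ≤ 0) :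
    ∫ x in lo..hi, R.eval x * w x ≠ 0 := by
  obtain ⟨x, hx, hx0⟩ : ∃ x ∈ Set.Icc lo hi, R.eval x ≠ 0 := by
    by_contra! hcon
    exact hR (eq_zero_of_infinite_isRoot R ((Set.Icc_infinite h).mono hcon))
  have hc : ∀ Q : ℝ[X], (∀ x ∈ Set.Icc lo hi, 0 ≤ Q.eval x) → Q.eval x ≠ 0 →
      0 < ∫ x in lo..hi, Q.eval x * w x := fun Q hQ hx0 =>
    intervalIntegral.integral_pos h (Q.continuous.continuousOn.mul hw)
      (fun y hy => mul_nonneg (hQ y ⟨hy.1.le, hy.2⟩) (hpos y ⟨hy.1.le, hy.2⟩).le)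
      ⟨x, hx, mul_pos (lt_of_le_of_ne (hQ x hx) hx0.symm) (hpos x hx)⟩
  rcases hs with hs | hs
  · exact (hc R hs hx0).ne'
  · have := hc (-R) (fun y hy => by simpa using hs y hy) (by simpa using hx0)
    simp only [eval_neg, neg_mul, intervalIntegral.integral_neg] at this
    linarith

/-- The roots of odd multiplicity in an open interval. -/
def oddRoots (lo hi : ℝ) (Q : ℝ[X]) : Finset ℝ :=
  Q.roots.toFinset.filter fun x => x ∈ Set.Ioo lo hi ∧ Odd (Q.rootMultiplicity x)

lemma mem_oddRoots {Q : ℝ[X]} {x : ℝ} :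
    x ∈ oddRoots lo hi Q ↔ x ∈ Set.Ioo lo hi ∧ Odd (Q.rootMultiplicity x) := by
  simp only [oddRoots, Finset.mem_filter, Multiset.mem_toFinset, and_iff_right_iff_imp]
  rintro ⟨-, h⟩
  rw [← Multiset.count_pos, count_roots]
  exact h.pos

lemma le_card_oddRoots (h : lo < hi) (hw : ContinuousOn w (Set.Icc lo hi))
    (hpos : ∀ x ∈ Set.Icc lo hi, 0 < w x) {n : ℕ} {Q : ℝ[X]} (hQ : Q ≠ 0)
    (ho : Orth lo hi w n Q) : n ≤ (oddRoots lo hi Q).card := by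
  by_contra! hlt
  set T := oddRoots lo hi Q
  set g : ℝ[X] := (T.val.map fun a => X - C a).prod
  have hgm : g.Monic := monic_multiset_prod_of_monic _ _ fun a _ => monic_X_sub_C a
  have hgr : g.roots = T.val := roots_multiset_prod_X_sub_C _
  have hdeg : g.degree < n := by
    rw [degree_eq_natDegree hgm.ne_zero]
    simp only [g, natDegree_multiset_prod_X_sub_C_eq_card]
    exact_mod_cast hlt
  have h0 := ho.integral_mul_eq_zero h.le hw hdeg
  refine integral_mul_ne_zero_of_sign h hw hpos (mul_ne_zero hQ hgm.ne_zero)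
    (sign_of_even_rootMultiplicity h _ (mul_ne_zero hQ hgm.ne_zero) fun r hr => ?_)
    (by simpa only [eval_mul] using h0)
  rw [rootMultiplicity_mul (mul_ne_zero hQ hgm.ne_zero), ← count_roots g, hgr, Nat.even_add]
  by_cases hT : r ∈ T
  · rw [Multiset.count_eq_one_of_mem T.nodup hT]
    have := (mem_oddRoots.1 hT).2
    simpa using this
  · rw [Multiset.count_eq_zero_of_notMem hT]
    have : ¬ Odd (Q.rootMultiplicity r) := fun h' => hT (mem_oddRoots.2 ⟨hr, h'⟩)
    simpa using this

variable {lo' hi' : ℝ} {w' : ℝ → ℝ} {n n' : ℕ} {Q : ℝ[X]}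

lemma oddRoots_count (hsep : hi < lo') (x : ℝ) :
    ((oddRoots lo hi Q).val + (oddRoots lo' hi' Q).val).count x ≤ 1 ∧
      (((oddRoots lo hi Q).val + (oddRoots lo' hi' Q).val).count x = 1 →
        Odd (Q.rootMultiplicity x)) := by
  have hn : (oddRoots lo hi Q).val.count x = 0 ∨ (oddRoots lo' hi' Q).val.count x = 0 := by
    by_contra! hcon
    have h1 := mem_oddRoots.1 (Multiset.count_ne_zero.1 hcon.1)
    have h2 := mem_oddRoots.1 (Multiset.count_ne_zero.1 hcon.2)
    linarith [h1.1.2, h2.1.1]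
  have h1 := Multiset.nodup_iff_count_le_one.1 (oddRoots lo hi Q).nodup x
  have h2 := Multiset.nodup_iff_count_le_one.1 (oddRoots lo' hi' Q).nodup x
  rw [Multiset.count_add]
  refine ⟨by omega, fun h => ?_⟩
  by_cases h3 : (oddRoots lo hi Q).val.count x = 0
  · exact (mem_oddRoots.1 (Multiset.count_pos.1
      (by omega : 0 < (oddRoots lo' hi' Q).val.count x))).2
  · exact (mem_oddRoots.1 (Multiset.count_ne_zero.1 h3)).2

lemma rootMultiplicity_le_one_of_orth (h : lo < hi) (h' : lo' < hi') (hsep : hi < lo')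
    (hw : ContinuousOn w (Set.Icc lo hi)) (hpos : ∀ x ∈ Set.Icc lo hi, 0 < w x)
    (hw' : ContinuousOn w' (Set.Icc lo' hi')) (hpos' : ∀ x ∈ Set.Icc lo' hi', 0 < w' x)
    (hQ : Q ≠ 0) (ho : Orth lo hi w n Q) (ho' : Orth lo' hi' w' n' Q)
    (hd : Q.natDegree ≤ n + n' + 1) (x : ℝ) : Q.rootMultiplicity x ≤ 1 := by
  by_contra! hx
  have hle : (oddRoots lo hi Q).val + (oddRoots lo' hi' Q).val + Multiset.replicate 2 x ≤
      Q.roots := by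
    rw [Multiset.le_iff_count]
    intro t
    have h1 := oddRoots_count (lo := lo) (hi' := hi') (Q := Q) hsep t
    rw [Multiset.count_add, count_roots, Multiset.count_replicate]
    split_ifs with ht
    · subst ht
      rcases Nat.lt_or_ge (((oddRoots lo hi Q).val + (oddRoots lo' hi' Q).val).count x) 1
        with h2 | h2
      · omega
      · obtain ⟨k, hk⟩ := h1.2 (by omega)
        omega
    · rcases Nat.lt_or_ge (((oddRoots lo hi Q).val + (oddRoots lo' hi' Q).val).count t) 1
        with h2 | h2
      · omega
      · obtain ⟨k, hk⟩ := h1.2 (by omega)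
        omega
  have := Multiset.card_le_card hle
  have h1 := le_card_oddRoots h hw hpos hQ ho
  have h2 := le_card_oddRoots h' hw' hpos' hQ ho'
  have h3 := Q.card_roots'
  simp only [Multiset.card_add, Multiset.card_replicate, Finset.card_val] at this
  omega

lemma roots_eq_of_orth (h : lo < hi) (h' : lo' < hi') (hsep : hi < lo')
    (hw : ContinuousOn w (Set.Icc lo hi)) (hpos : ∀ x ∈ Set.Icc lo hi, 0 < w x)
    (hw' : ContinuousOn w' (Set.Icc lo' hi')) (hpos' : ∀ x ∈ Set.Icc lo' hi', 0 < w' x)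
    (hQ : Q ≠ 0) (ho : Orth lo hi w n Q) (ho' : Orth lo' hi' w' n' Q)
    (hd : Q.natDegree = n + n') :
    (oddRoots lo hi Q).val + (oddRoots lo' hi' Q).val = Q.roots ∧
      (oddRoots lo hi Q).card = n ∧ (oddRoots lo' hi' Q).card = n' := by
  have hle : (oddRoots lo hi Q).val + (oddRoots lo' hi' Q).val ≤ Q.roots := by
    rw [Multiset.le_iff_count]
    intro t
    have h1 := oddRoots_count (lo := lo) (hi' := hi') (Q := Q) hsep t
    rw [count_roots]
    rcases Nat.lt_or_ge (((oddRoots lo hi Q).val + (oddRoots lo' hi' Q).val).count t) 1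
        with h2 | h2
    · omega
    · obtain ⟨k, hk⟩ := h1.2 (by omega)
      omega
  have h0 := Multiset.card_le_card hle
  have h1 := le_card_oddRoots h hw hpos hQ ho
  have h2 := le_card_oddRoots h' hw' hpos' hQ ho'
  have h3 := Q.card_roots'
  simp only [Multiset.card_add, Finset.card_val] at h0
  refine ⟨Multiset.eq_of_le_of_card_le hle ?_, by omega, by omega⟩
  simp only [Multiset.card_add, Finset.card_val]
  omega

end Zeros

lemma exists_root_between {p q : ℝ[X]} {a b : ℝ} (hab : a < b)
    (hW : ∀ x, (derivative p).eval x * q.eval x - p.eval x * (derivative q).eval x ≠ 0)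
    (ha : p.eval a = 0) (hb : p.eval b = 0) : ∃ x, a < x ∧ x < b ∧ q.eval x = 0 := by
  by_contra! hcon
  have hq : ∀ x ∈ Set.Icc a b, q.eval x ≠ 0 := fun x hx => by
    rcases eq_or_lt_of_le hx.1 with rfl | h1
    · intro h0
      exact hW a (by rw [ha, h0]; ring)
    rcases eq_or_lt_of_le hx.2 with rfl | h2
    · intro h0
      exact hW x (by rw [hb, h0]; ring)
    exact hcon x h1 h2
  have hd : ∀ x ∈ Set.Icc a b, HasDerivAt (fun x => p.eval x / q.eval x)
      (((derivative p).eval x * q.eval x - p.eval x * (derivative q).eval x) /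
        q.eval x ^ 2) x := fun x hx => (p.hasDerivAt x).div (q.hasDerivAt x) (hq x hx)
  obtain ⟨c, hc, hc0⟩ := exists_hasDerivAt_eq_zero hab
    (fun x hx => (hd x hx).continuousAt.continuousWithinAt) (by simp [ha, hb])
    fun x hx => hd x (Set.Ioo_subset_Icc_self hx)
  exact (div_ne_zero (hW c) (pow_ne_zero _ (hq c (Set.Ioo_subset_Icc_self hc)))) hc0

/-- Continuous positive weights on two separated intervals, with their type II multiple orthogonal
polynomials. -/
structure Sys (α₁ β₁ α₂ β₂ : ℝ) where
  f₁ : ℝ → ℝ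
  f₂ : ℝ → ℝ
  P : ℕ → ℕ → ℝ[X]
  h₁ : α₁ < β₁
  h₂ : β₁ < α₂
  h₃ : α₂ < β₂
  cont₁ : ContinuousOn f₁ (Set.Icc α₁ β₁)
  cont₂ : ContinuousOn f₂ (Set.Icc α₂ β₂)
  pos₁ : ∀ x ∈ Set.Icc α₁ β₁, 0 < f₁ x
  pos₂ : ∀ x ∈ Set.Icc α₂ β₂, 0 < f₂ x
  monic : ∀ k l, (P k l).Monic
  deg : ∀ k l, (P k l).natDegree = k + l
  orth₁ : ∀ k l, Orth α₁ β₁ f₁ k (P k l)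
  orth₂ : ∀ k l, Orth α₂ β₂ f₂ l (P k l)

lemma Orth.sub_smul {lo hi : ℝ} {w : ℝ → ℝ} {n : ℕ} {p q : ℝ[X]} (h : lo ≤ hi)
    (hw : ContinuousOn w (Set.Icc lo hi)) (hp : Orth lo hi w n p) (hq : Orth lo hi w n q)
    (a b : ℝ) : Orth lo hi w n (C a * p - C b * q) := fun l hl => by
  have e : ∀ x, (C a * p - C b * q).eval x * x ^ l * w x =
      a * (p.eval x * x ^ l * w x) - b * (q.eval x * x ^ l * w x) := fun x => by
    simp only [eval_sub, eval_mul, eval_C]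
    ring
  simp_rw [e]
  rw [intervalIntegral.integral_sub, intervalIntegral.integral_const_mul,
    intervalIntegral.integral_const_mul, hp l hl, hq l hl, mul_zero, mul_zero, sub_zero]
  · exact (intervalIntegrable_eval_mul h hw (g := fun x => p.eval x * x ^ l)
      (by fun_prop)).const_mul _
  · exact (intervalIntegrable_eval_mul h hw (g := fun x => q.eval x * x ^ l)
      (by fun_prop)).const_mul _

lemma Orth.mono {lo hi : ℝ} {w : ℝ → ℝ} {n m : ℕ} {p : ℝ[X]} (hp : Orth lo hi w n p)
    (h : m ≤ n) : Orth lo hi w m p := fun l hl => hp l (hl.trans_le h)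

lemma Orth.reflect {lo hi : ℝ} {w : ℝ → ℝ} {n : ℕ} {p : ℝ[X]} (hp : Orth lo hi w n p) (c : ℝ) :
    Orth (-hi) (-lo) (fun x => w (-x)) n (C c * p.comp (-X)) := fun l hl => by
  have e : ∀ x, (C c * p.comp (-X)).eval x * x ^ l * w (-x) =
      (fun y => c * (-1) ^ l * (p.eval y * y ^ l * w y)) (-x) := fun x => by
    simp only [eval_mul, eval_C, eval_comp, eval_neg, eval_X]
    rw [show c * (-1) ^ l * (p.eval (-x) * (-x) ^ l * w (-x)) =
      c * p.eval (-x) * ((-1) ^ l * (-x) ^ l) * w (-x) by ring, ← mul_pow]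
    simp
  rw [intervalIntegral.integral_congr fun x _ => e x,
    intervalIntegral.integral_comp_neg (fun y => c * (-1) ^ l * (p.eval y * y ^ l * w y)), neg_neg,
    neg_neg, intervalIntegral.integral_const_mul, hp l hl, mul_zero]

namespace Sys

variable (S : Sys α₁ β₁ α₂ β₂) (k l : ℕ)

/-- The zeros in the first interval. -/
def Z₁ : Finset ℝ := oddRoots α₁ β₁ (S.P k l)

/-- The zeros in the second interval. -/
def Z₂ : Finset ℝ := oddRoots α₂ β₂ (S.P k l)

lemma ne_zero : S.P k l ≠ 0 := (S.monic k l).ne_zero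

lemma roots_eq : (S.Z₁ k l).val + (S.Z₂ k l).val = (S.P k l).roots ∧
    (S.Z₁ k l).card = k ∧ (S.Z₂ k l).card = l :=
  roots_eq_of_orth S.h₁ S.h₃ S.h₂ S.cont₁ S.pos₁ S.cont₂ S.pos₂ (S.ne_zero k l) (S.orth₁ k l)
    (S.orth₂ k l) (S.deg k l)

@[simp] lemma card_Z₁ : (S.Z₁ k l).card = k := (S.roots_eq k l).2.1

@[simp] lemma card_Z₂ : (S.Z₂ k l).card = l := (S.roots_eq k l).2.2

variable {k l}

lemma mem_Z₁ {x : ℝ} : x ∈ S.Z₁ k l ↔ x ∈ Set.Ioo α₁ β₁ ∧ (S.P k l).eval x = 0 := by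
  have h := S.roots_eq k l
  refine ⟨fun hx => ?_, fun hx => ?_⟩
  · have hm := mem_oddRoots.1 hx
    exact ⟨hm.1, (rootMultiplicity_pos (S.ne_zero k l)).1 hm.2.pos⟩
  · have : x ∈ (S.P k l).roots := (mem_roots (S.ne_zero k l)).2 hx.2
    rw [← h.1, Multiset.mem_add] at this
    refine this.resolve_right fun hx2 => ?_
    have := (mem_oddRoots.1 hx2).1.1
    linarith [hx.1.2, S.h₂]

lemma mem_Z₂ {x : ℝ} : x ∈ S.Z₂ k l ↔ x ∈ Set.Ioo α₂ β₂ ∧ (S.P k l).eval x = 0 := by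
  have h := S.roots_eq k l
  refine ⟨fun hx => ?_, fun hx => ?_⟩
  · have hm := mem_oddRoots.1 hx
    exact ⟨hm.1, (rootMultiplicity_pos (S.ne_zero k l)).1 hm.2.pos⟩
  · have : x ∈ (S.P k l).roots := (mem_roots (S.ne_zero k l)).2 hx.2
    rw [← h.1, Multiset.mem_add] at this
    refine this.resolve_left fun hx2 => ?_
    have := (mem_oddRoots.1 hx2).1.2
    linarith [hx.1.1, S.h₂]

/-- The reflected system. -/
def reflect : Sys (-β₂) (-α₂) (-β₁) (-α₁) where
  f₁ := fun x => S.f₂ (-x)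
  f₂ := fun x => S.f₁ (-x)
  P := fun k l => C ((-1) ^ (k + l)) * (S.P l k).comp (-X)
  h₁ := neg_lt_neg S.h₃
  h₂ := neg_lt_neg S.h₂
  h₃ := neg_lt_neg S.h₁
  cont₁ := S.cont₂.comp continuous_neg.continuousOn fun x hx =>
    ⟨by linarith [hx.2], by linarith [hx.1]⟩
  cont₂ := S.cont₁.comp continuous_neg.continuousOn fun x hx =>
    ⟨by linarith [hx.2], by linarith [hx.1]⟩
  pos₁ := fun x hx => S.pos₂ _ ⟨by linarith [hx.2], by linarith [hx.1]⟩
  pos₂ := fun x hx => S.pos₁ _ ⟨by linarith [hx.2], by linarith [hx.1]⟩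
  monic := fun k l => by
    rw [Monic, leadingCoeff_mul, leadingCoeff_C, leadingCoeff_comp (by simp), S.monic, S.deg,
      leadingCoeff_neg, leadingCoeff_X, one_mul, add_comm, ← mul_pow]
    simp
  deg := fun k l => by
    rw [natDegree_C_mul (by simp), natDegree_comp, natDegree_neg, natDegree_X, mul_one, S.deg,
      add_comm]
  orth₁ := fun k l => (S.orth₂ l k).reflect _
  orth₂ := fun k l => (S.orth₁ l k).reflect _

lemma eval_reflect (x : ℝ) : (S.reflect.P k l).eval x = (-1) ^ (k + l) * (S.P l k).eval (-x) := by
  simp [reflect]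

lemma Z₁_reflect : S.reflect.Z₁ k l = (S.Z₂ l k).map (Equiv.neg ℝ).toEmbedding := by
  ext x
  rw [mem_Z₁, eval_reflect, Finset.mem_map_equiv, mem_Z₂]
  simp only [Set.mem_Ioo, Equiv.neg_symm, Equiv.neg_apply, mul_eq_zero, pow_eq_zero_iff', neg_eq_zero,
    one_ne_zero, false_and, false_or]
  constructor <;> rintro ⟨⟨h1, h2⟩, h3⟩ <;> exact ⟨⟨by linarith, by linarith⟩, h3⟩

lemma Z₂_reflect : S.reflect.Z₂ k l = (S.Z₁ l k).map (Equiv.neg ℝ).toEmbedding := by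
  ext x
  rw [mem_Z₂, eval_reflect, Finset.mem_map_equiv, mem_Z₁]
  simp only [Set.mem_Ioo, Equiv.neg_symm, Equiv.neg_apply, mul_eq_zero, pow_eq_zero_iff', neg_eq_zero,
    one_ne_zero, false_and, false_or]
  constructor <;> rintro ⟨⟨h1, h2⟩, h3⟩ <;> exact ⟨⟨by linarith, by linarith⟩, h3⟩

lemma sum_Z₁_reflect (G : ℝ → ℝ) : ∑ x ∈ S.reflect.Z₁ k l, G x = ∑ x ∈ S.Z₂ l k, G (-x) := by
  rw [Z₁_reflect, Finset.sum_map]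
  rfl

lemma sum_Z₂_reflect (G : ℝ → ℝ) : ∑ x ∈ S.reflect.Z₂ k l, G x = ∑ x ∈ S.Z₁ l k, G (-x) := by
  rw [Z₂_reflect, Finset.sum_map]
  rfl

lemma P_eq : S.P k l = ((S.Z₁ k l).val.map fun a => X - C a).prod *
    ((S.Z₂ k l).val.map fun a => X - C a).prod := by
  have h := S.roots_eq k l
  rw [← Multiset.prod_add, ← Multiset.map_add, h.1]
  refine (prod_multiset_X_sub_C_of_monic_of_roots_card_eq (S.monic k l) ?_).symm
  rw [← h.1, Multiset.card_add, Finset.card_val, Finset.card_val, h.2.1, h.2.2, S.deg]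

lemma wronskian_ne_zero {e e' : ℕ} (he : e + e' = 1) (x : ℝ) :
    (derivative (S.P (k + e) (l + e'))).eval x * (S.P k l).eval x -
      (S.P (k + e) (l + e')).eval x * (derivative (S.P k l)).eval x ≠ 0 := by
  set p := S.P (k + e) (l + e')
  set q := S.P k l
  intro hW
  have hpd : p.natDegree = k + l + 1 := by rw [S.deg]; omega
  have hqd : q.natDegree = k + l := S.deg k l
  have simple : ∀ a b : ℝ, C a * p - C b * q ≠ 0 → ¬ ((C a * p - C b * q).IsRoot x ∧
      (derivative (C a * p - C b * q)).IsRoot x) := fun a b h0 h1 => by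
    have h2 := (one_lt_rootMultiplicity_iff_isRoot h0).2 h1
    have h3 := rootMultiplicity_le_one_of_orth S.h₁ S.h₃ S.h₂ S.cont₁ S.pos₁ S.cont₂ S.pos₂ h0
      (n := k) (n' := l)
      (((S.orth₁ (k + e) (l + e')).mono (by omega)).sub_smul S.h₁.le S.cont₁ (S.orth₁ k l) a b)
      (((S.orth₂ (k + e) (l + e')).mono (by omega)).sub_smul S.h₃.le S.cont₂ (S.orth₂ k l) a b)
      (by
        refine (natDegree_sub_le _ _).trans (max_le ?_ ?_)
        · exact (natDegree_C_mul_le _ _).trans hpd.le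
        · exact (natDegree_C_mul_le _ _).trans (by omega)) x
    omega
  have lead : ∀ a b : ℝ, a ≠ 0 → C a * p - C b * q ≠ 0 := fun a b ha h0 => by
    have h1 := congrArg (fun r : ℝ[X] => r.coeff (k + l + 1)) h0
    have h2 : q.coeff (k + l + 1) = 0 := coeff_eq_zero_of_natDegree_lt (by omega)
    have h3 : p.coeff (k + l + 1) = 1 := by rw [← hpd]; exact S.monic _ _
    simp only [coeff_sub, coeff_C_mul, h2, h3, coeff_zero] at h1
    exact ha (by linarith)
  by_cases hq : q.eval x = 0
  · by_cases hp : p.eval x = 0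
    · have hq' : (derivative q).eval x ≠ 0 := fun h0 => by
        refine simple 0 (-1) (by simpa using S.ne_zero k l) ?_
        simp [IsRoot, hq, h0]
      refine simple _ ((derivative p).eval x) (lead _ _ hq') ⟨?_, ?_⟩
      · simp [IsRoot, hq, hp]
      · simp [IsRoot]
        ring
    · have hq' : (derivative q).eval x = 0 := by
        rw [hq, mul_zero, zero_sub, neg_eq_zero] at hW
        exact (mul_eq_zero.1 hW).resolve_left hp
      refine simple 0 (-1) (by simpa using S.ne_zero k l) ?_
      simp [IsRoot, hq, hq']
  · refine simple _ (p.eval x) (lead _ _ hq) ⟨?_, ?_⟩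
    · simp [IsRoot, mul_comm]
    · simp only [IsRoot.def, derivative_sub, derivative_mul, derivative_C, zero_mul, zero_add,
        eval_sub, eval_mul, eval_C]
      linarith

variable {e e' : ℕ}

lemma abs_sum_Z₁_sub_le_of_le (he : e + e' = 1) {G : ℝ → ℝ} {K b : ℝ} (hK : 0 ≤ K)
    (hb : α₁ ≤ b) (hG : ∀ x ∈ Set.Icc α₁ b, ∀ y ∈ Set.Icc α₁ b, |G x - G y| ≤ K * |x - y|)
    (h1 : ∀ x ∈ S.Z₁ k l, x ≤ b) (h2 : ∀ x ∈ S.Z₁ (k + e) (l + e'), x ≤ b) :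
    |∑ x ∈ S.Z₁ (k + e) (l + e'), G x - ∑ x ∈ S.Z₁ k l, G x - e * G α₁| ≤ K * (b - α₁) := by
  have hW := S.wronskian_ne_zero (k := k) (l := l) he
  have hW' : ∀ x, (derivative (S.P k l)).eval x * (S.P (k + e) (l + e')).eval x -
      (S.P k l).eval x * (derivative (S.P (k + e) (l + e'))).eval x ≠ 0 := fun x h0 =>
    hW x (by linear_combination -h0)
  have hb := interlace_bound (S.Z₁ k l) (S.Z₁ (k + e) (l + e'))
    (fun a ha b hb hab => by
      obtain ⟨x, h1, h2, h3⟩ := exists_root_between hab hW (S.mem_Z₁.1 ha).2 (S.mem_Z₁.1 hb).2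
      exact ⟨x, S.mem_Z₁.2 ⟨⟨(S.mem_Z₁.1 ha).1.1.trans h1, h2.trans (S.mem_Z₁.1 hb).1.2⟩, h3⟩,
        h1, h2⟩)
    (fun a ha b hb hab => by
      obtain ⟨x, h1, h2, h3⟩ := exists_root_between hab hW' (S.mem_Z₁.1 ha).2 (S.mem_Z₁.1 hb).2
      exact ⟨x, S.mem_Z₁.2 ⟨⟨(S.mem_Z₁.1 ha).1.1.trans h1, h2.trans (S.mem_Z₁.1 hb).1.2⟩, h3⟩,
        h1, h2⟩)
    (Finset.disjoint_left.2 fun x h1 h2 => hW x (by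
      rw [(S.mem_Z₁.1 h1).2, (S.mem_Z₁.1 h2).2]; ring))
    hb hG hK (fun x hx => ⟨(S.mem_Z₁.1 hx).1.1.le, h1 x hx⟩)
    (fun x hx => ⟨(S.mem_Z₁.1 hx).1.1.le, h2 x hx⟩)
  simpa using hb

lemma abs_sum_Z₁_sub_le (he : e + e' = 1) {G : ℝ → ℝ} {K : ℝ} (hK : 0 ≤ K)
    (hG : ∀ x ∈ Set.Icc α₁ β₁, ∀ y ∈ Set.Icc α₁ β₁, |G x - G y| ≤ K * |x - y|) :
    |∑ x ∈ S.Z₁ (k + e) (l + e'), G x - ∑ x ∈ S.Z₁ k l, G x - e * G α₁| ≤ K * (β₁ - α₁) :=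
  S.abs_sum_Z₁_sub_le_of_le he hK S.h₁.le hG (fun _ hx => (S.mem_Z₁.1 hx).1.2.le)
    fun _ hx => (S.mem_Z₁.1 hx).1.2.le

lemma abs_sum_Z₂_sub_le (he : e + e' = 1) {G : ℝ → ℝ} {K : ℝ} (hK : 0 ≤ K)
    (hG : ∀ x ∈ Set.Icc α₂ β₂, ∀ y ∈ Set.Icc α₂ β₂, |G x - G y| ≤ K * |x - y|) :
    |∑ x ∈ S.Z₂ (k + e) (l + e'), G x - ∑ x ∈ S.Z₂ k l, G x - e' * G β₂| ≤ K * (β₂ - α₂) := by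
  have h := S.reflect.abs_sum_Z₁_sub_le (k := l) (l := k) (e := e') (e' := e) (by omega)
    (G := fun x => G (-x)) hK fun x hx y hy => by
      have := hG (-x) ⟨by linarith [hx.2], by linarith [hx.1]⟩ (-y)
        ⟨by linarith [hy.2], by linarith [hy.1]⟩
      rwa [show -x - -y = -(x - y) by ring, abs_neg] at this
  rw [sum_Z₁_reflect, sum_Z₁_reflect] at h
  simp only [neg_neg] at h
  exact h.trans (le_of_eq (by ring))

variable (k l) in
/-- The factor of `P k l` with zeros in the first interval. -/
def p₁ : ℝ[X] := ((S.Z₁ k l).val.map fun a => X - C a).prod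

variable (k l) in
lemma p₁_monic : (S.p₁ k l).Monic := monic_multiset_prod_of_monic _ _ fun a _ => monic_X_sub_C a

variable (k l) in
lemma natDegree_p₁ : (S.p₁ k l).natDegree = k := by
  rw [p₁, natDegree_multiset_prod_X_sub_C_eq_card, Finset.card_val, card_Z₁]

lemma eval_P (x : ℝ) : (S.P k l).eval x =
    (-1) ^ l * ((S.p₁ k l).eval x * qprod (S.Z₂ k l).val x) := by
  have h1 : (((S.Z₂ k l).val.map fun a => X - C a).prod).eval x =
      (-1) ^ l * qprod (S.Z₂ k l).val x := by
    have hc : Multiset.card ((S.Z₂ k l).val.map fun t => t - x) = l := by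
      rw [Multiset.card_map]
      exact S.card_Z₂ k l
    have h2 := Multiset.prod_map_neg ((S.Z₂ k l).val.map fun t => t - x)
    rw [hc, Multiset.map_map] at h2
    rw [eval_multiset_prod, Multiset.map_map, qprod, ← h2]
    simp
  rw [P_eq, eval_mul, h1, p₁]
  ring

variable (k l) in
lemma orth_p₁ : Orth α₁ β₁ (fun x => qprod (S.Z₂ k l).val x * S.f₁ x) k (S.p₁ k l) :=
  fun j hj => by
    have h := S.orth₁ k l j hj
    simp only [eval_P, mul_assoc] at h
    rw [intervalIntegral.integral_const_mul] at h
    refine Eq.trans ?_ ((mul_eq_zero.1 h).resolve_left (by simp))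
    exact intervalIntegral.integral_congr fun x _ => by ring

lemma continuousOn_weight (Z : Multiset ℝ) :
    ContinuousOn (fun x => qprod Z x * S.f₁ x) (Set.Icc α₁ β₁) :=
  (continuous_qprod Z).continuousOn.mul S.cont₁

variable (k l) in
/-- The norm of `p₁` for its varying weight. -/
def I₁ : ℝ := ∫ x in α₁..β₁, (S.p₁ k l).eval x ^ 2 * (qprod (S.Z₂ k l).val x * S.f₁ x)

variable (k l) in
lemma I₁_pos : 0 < S.I₁ k l :=
  integral_sq_mul_pos S.h₁ (S.continuousOn_weight _)
    (fun x hx => mul_pos (qprod_pos fun t ht => by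
      have := (S.mem_Z₂.1 ht).1.1
      linarith [hx.2, S.h₂]) (S.pos₁ x hx)) (S.p₁_monic k l).ne_zero

variable (k l) in
lemma integral_P_mul_pow :
    ∫ x in α₁..β₁, (S.P k l).eval x * x ^ k * S.f₁ x = (-1) ^ l * S.I₁ k l := by
  have hd : (X ^ k - S.p₁ k l).degree < (k : WithBot ℕ) := by
    have h := degree_sub_lt_left (p := X ^ k) (q := S.p₁ k l)
      (by rw [degree_X_pow, degree_eq_natDegree (S.p₁_monic k l).ne_zero, natDegree_p₁])
      (pow_ne_zero _ X_ne_zero)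
      (by rw [leadingCoeff_X_pow, (S.p₁_monic k l).leadingCoeff])
    simpa using h
  have h := (S.orth_p₁ k l).integral_mul_eq_zero S.h₁.le (S.continuousOn_weight _) hd
  have hi : ∀ g : ℝ[X], IntervalIntegrable (fun x => (S.p₁ k l).eval x * g.eval x *
      (qprod (S.Z₂ k l).val x * S.f₁ x)) volume α₁ β₁ := fun g =>
    intervalIntegrable_eval_mul S.h₁.le (S.continuousOn_weight _)
      (g := fun x => (S.p₁ k l).eval x * g.eval x) (by fun_prop)
  simp only [eval_sub, mul_sub, sub_mul] at h
  rw [intervalIntegral.integral_sub (hi _) (hi _), sub_eq_zero] at h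
  rw [I₁, ← intervalIntegral.integral_const_mul]
  calc _ = (-1) ^ l * ∫ x in α₁..β₁, (S.p₁ k l).eval x * (X ^ k : ℝ[X]).eval x *
        (qprod (S.Z₂ k l).val x * S.f₁ x) := by
        rw [← intervalIntegral.integral_const_mul]
        refine intervalIntegral.integral_congr fun x _ => ?_
        simp only [eval_P, eval_pow, eval_X]
        ring
    _ = _ := by
        rw [h, ← intervalIntegral.integral_const_mul]
        exact intervalIntegral.integral_congr fun x _ => by ring

end Sys

lemma abs_log_sub_log_le {m u v : ℝ} (hm : 0 < m) (hu : m ≤ u) (hv : m ≤ v) :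
    |log u - log v| ≤ 1 / m * |u - v| := by
  have key : ∀ u v : ℝ, m ≤ u → m ≤ v → log u - log v ≤ 1 / m * |u - v| := fun u v hu hv => by
    rw [← log_div (by linarith) (by linarith)]
    refine (log_le_sub_one_of_pos (div_pos (by linarith) (by linarith))).trans ?_
    rw [div_sub_one (by linarith), div_mul_eq_mul_div, one_mul]
    refine (div_le_div_of_nonneg_right (le_abs_self _) (by linarith)).trans ?_
    exact div_le_div_of_nonneg_left (abs_nonneg _) hm hv
  rw [abs_le]
  have h := key v u hv hu
  rw [abs_sub_comm] at h
  exact ⟨by linarith, key u v hu hv⟩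

namespace Sys

variable (S : Sys α₁ β₁ α₂ β₂) {k l e e' : ℕ}

lemma log_p₁ {y : ℝ} (hy : β₁ ≤ y) :
    log ((S.p₁ k l).eval y) = ∑ x ∈ S.Z₁ k l, log (y - x) := by
  have h : (S.p₁ k l).eval y = ∏ x ∈ S.Z₁ k l, (y - x) := by
    rw [p₁, eval_multiset_prod, Multiset.map_map]
    simp
  rw [h, log_prod fun x hx => by linarith [(S.mem_Z₁.1 hx).1.2]]

lemma p₁_pos {y : ℝ} (hy : β₁ ≤ y) : 0 < (S.p₁ k l).eval y := by
  rw [p₁, eval_multiset_prod, Multiset.map_map]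
  refine Finset.prod_pos (s := S.Z₁ k l) fun x hx => ?_
  simp only [Function.comp, eval_sub, eval_X, eval_C]
  linarith [(S.mem_Z₁.1 hx).1.2]

lemma qprod_Z₂_pos {y : ℝ} (hy : y ≤ α₂) : 0 < qprod (S.Z₂ k l).val y :=
  qprod_pos fun _ ht => hy.trans_lt (S.mem_Z₂.1 ht).1.1

lemma log_qprod_Z₂ {y : ℝ} (hy : y ≤ α₂) :
    log (qprod (S.Z₂ k l).val y) = ∑ x ∈ S.Z₂ k l, log (x - y) :=
  log_prod (s := S.Z₂ k l) fun x hx => by linarith [(S.mem_Z₂.1 hx).1.1]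

lemma coeff_P (h : 1 ≤ k + l) :
    (S.P k l).coeff (k + l - 1) = -(∑ x ∈ S.Z₁ k l, x + ∑ x ∈ S.Z₂ k l, x) := by
  have h1 : (S.P k l).nextCoeff = (S.P k l).coeff (k + l - 1) := by
    rw [nextCoeff_of_natDegree_pos (by rw [S.deg]; omega), S.deg]
  rw [← h1, S.P_eq, ← Multiset.prod_add, ← Multiset.map_add, multiset_prod_X_sub_C_nextCoeff,
    Multiset.sum_add]
  simp

variable (k l e e') in
/-- The recurrence coefficient `b` in terms of zeros. -/
def b : ℝ := (∑ x ∈ S.Z₁ (k + e) (l + e'), x - ∑ x ∈ S.Z₁ k l, x) +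
  (∑ x ∈ S.Z₂ (k + e) (l + e'), x - ∑ x ∈ S.Z₂ k l, x)

lemma coeff_sub_coeff (he : e + e' = 1) (h : 1 ≤ k + l) :
    (S.P k l).coeff (k + l - 1) - (S.P (k + e) (l + e')).coeff (k + l) = S.b k l e e' := by
  have h1 := S.coeff_P (k := k + e) (l := l + e') (by omega)
  rw [show k + e + (l + e') - 1 = k + l by omega] at h1
  rw [S.coeff_P h, h1, b]
  ring

lemma lip_log_sub {y lo hi : ℝ} (hy : hi < y) :
    ∀ x ∈ Set.Icc lo hi, ∀ x' ∈ Set.Icc lo hi,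
      |log (y - x) - log (y - x')| ≤ 1 / (y - hi) * |x - x'| := fun x hx x' hx' => by
  have h := abs_log_sub_log_le (sub_pos.2 hy) (by linarith [hx.2] : y - hi ≤ y - x)
    (by linarith [hx'.2] : y - hi ≤ y - x')
  rwa [show y - x - (y - x') = -(x - x') by ring, abs_neg] at h

lemma lip_log_sub' {y lo hi : ℝ} (hy : y < lo) :
    ∀ x ∈ Set.Icc lo hi, ∀ x' ∈ Set.Icc lo hi,
      |log (x - y) - log (x' - y)| ≤ 1 / (lo - y) * |x - x'| := fun x hx x' hx' => by
  have h := abs_log_sub_log_le (sub_pos.2 hy) (by linarith [hx.1] : lo - y ≤ x - y)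
    (by linarith [hx'.1] : lo - y ≤ x' - y)
  rwa [show x - y - (x' - y) = x - x' by ring] at h

lemma P_sub_P : S.P (k + 1) l - S.P k (l + 1) =
    C ((S.P (k + 1) l).coeff (k + l) - (S.P k (l + 1)).coeff (k + l)) * S.P k l := by
  set d := (S.P (k + 1) l).coeff (k + l) - (S.P k (l + 1)).coeff (k + l)
  have o₁ := (((S.orth₁ (k + 1) l).mono (Nat.le_succ k)).sub_smul S.h₁.le S.cont₁
    (S.orth₁ k (l + 1)) 1 1).sub_smul S.h₁.le S.cont₁ (S.orth₁ k l) 1 d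
  have o₂ := ((S.orth₂ (k + 1) l).sub_smul S.h₃.le S.cont₂
    ((S.orth₂ k (l + 1)).mono (Nat.le_succ l)) 1 1).sub_smul S.h₃.le S.cont₂ (S.orth₂ k l) 1 d
  simp only [C_1, one_mul] at o₁ o₂
  by_contra hne
  have hR := sub_ne_zero.2 hne
  set R := S.P (k + 1) l - S.P k (l + 1) - C d * S.P k l with hRdef
  have hlt : R.natDegree < k + l := by
    rcases Nat.lt_or_ge R.natDegree (k + l) with h | h
    · exact h
    have h1 : R.natDegree ≤ k + l + 1 := by
      refine (natDegree_sub_le _ _).trans (max_le ((natDegree_sub_le _ _).trans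
        (max_le (by rw [S.deg]; omega) (by rw [S.deg]; omega))) ?_)
      exact (natDegree_C_mul_le _ _).trans (by rw [S.deg]; omega)
    have c0 : (S.P k l).coeff (k + l) = 1 := by
      rw [← S.deg k l]; exact S.monic k l
    have c1 : (S.P k l).coeff (k + l + 1) = 0 :=
      coeff_eq_zero_of_natDegree_lt (by rw [S.deg]; omega)
    have c2 : (S.P (k + 1) l).coeff (k + l + 1) = 1 := by
      rw [show k + l + 1 = k + 1 + l by omega, ← S.deg (k + 1) l]; exact S.monic _ _
    have c3 : (S.P k (l + 1)).coeff (k + l + 1) = 1 := by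
      rw [show k + l + 1 = k + (l + 1) by omega, ← S.deg k (l + 1)]; exact S.monic _ _
    exfalso
    have h2 := leadingCoeff_ne_zero.2 hR
    rcases Nat.lt_or_ge (k + l) R.natDegree with h3 | h3
    · rw [leadingCoeff, show R.natDegree = k + l + 1 by omega, hRdef] at h2
      simp [c1, c2, c3] at h2
    · rw [leadingCoeff, show R.natDegree = k + l by omega, hRdef] at h2
      rw [coeff_sub, coeff_sub, coeff_C_mul, c0, mul_one, sub_self] at h2
      exact h2 rfl
  have h1 := le_card_oddRoots S.h₁ S.cont₁ S.pos₁ hR o₁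
  have h2 := le_card_oddRoots S.h₃ S.cont₂ S.pos₂ hR o₂
  have hle : (oddRoots α₁ β₁ R).val + (oddRoots α₂ β₂ R).val ≤ R.roots := by
    rw [Multiset.le_iff_count]
    intro t
    have h1 := oddRoots_count (lo := α₁) (hi' := β₂) (Q := R) S.h₂ t
    rw [count_roots]
    rcases Nat.lt_or_ge (((oddRoots α₁ β₁ R).val + (oddRoots α₂ β₂ R).val).count t) 1
        with h2 | h2
    · omega
    · obtain ⟨k, hk⟩ := h1.2 (by omega)
      omega
  have h0 := Multiset.card_le_card hle
  have h3 := R.card_roots'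
  simp only [Multiset.card_add, Finset.card_val] at h0
  omega

/-- A uniform lower bound for the gap between the two recurrence coefficients `b`. -/
def gap (α₁ β₁ α₂ β₂ : ℝ) : ℝ :=
  exp (log ((β₁ + α₂) / 2 - α₁) - 1 / ((α₂ - β₁) / 2) * (β₁ - α₁) -
    1 / ((α₂ - β₁) / 2) * (β₂ - α₂))

lemma gap_le (h : 1 ≤ k + l) : gap α₁ β₁ α₂ β₂ ≤ S.b k l 0 1 - S.b k l 1 0 := by
  have hh := S.h₂
  set t := (β₁ + α₂) / 2 with ht
  have ht1 : β₁ < t := by linarith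
  have ht2 : t < α₂ := by linarith
  have hd : (S.P (k + 1) l).coeff (k + l) - (S.P k (l + 1)).coeff (k + l) =
      S.b k l 0 1 - S.b k l 1 0 := by
    rw [← S.coeff_sub_coeff (e := 0) (e' := 1) rfl h, ← S.coeff_sub_coeff (e := 1) (e' := 0) rfl h]
    simp
  rw [← hd]
  have h1 := congrArg (eval t) (S.P_sub_P (k := k) (l := l))
  set d := (S.P (k + 1) l).coeff (k + l) - (S.P k (l + 1)).coeff (k + l)
  simp only [eval_sub, eval_mul, eval_C, eval_P] at h1
  have hp : ∀ k l, 0 < (S.p₁ k l).eval t * qprod (S.Z₂ k l).val t := fun k l =>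
    mul_pos (S.p₁_pos ht1.le) (S.qprod_Z₂_pos ht2.le)
  have hl : ∀ k l, log ((S.p₁ k l).eval t * qprod (S.Z₂ k l).val t) =
      ∑ x ∈ S.Z₁ k l, log (t - x) + ∑ x ∈ S.Z₂ k l, log (x - t) := fun k l => by
    rw [log_mul (S.p₁_pos ht1.le).ne' (S.qprod_Z₂_pos ht2.le).ne', S.log_p₁ ht1.le,
      S.log_qprod_Z₂ ht2.le]
  have h2 : (S.p₁ (k + 1) l).eval t * qprod (S.Z₂ (k + 1) l).val t +
      (S.p₁ k (l + 1)).eval t * qprod (S.Z₂ k (l + 1)).val t =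
      d * ((S.p₁ k l).eval t * qprod (S.Z₂ k l).val t) := by
    have : ((-1 : ℝ) ^ l) ≠ 0 := by simp
    apply mul_left_cancel₀ this
    rw [pow_succ] at h1
    linear_combination h1
  have h3 : (S.p₁ (k + 1) l).eval t * qprod (S.Z₂ (k + 1) l).val t ≤
      d * ((S.p₁ k l).eval t * qprod (S.Z₂ k l).val t) := by linarith [hp k (l + 1)]
  rw [← div_le_iff₀ (hp k l)] at h3
  refine le_trans ?_ h3
  rw [gap, ← le_log_iff_exp_le (div_pos (hp _ _) (hp _ _)), log_div (hp _ _).ne' (hp _ _).ne',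
    hl, hl]
  have b1 := S.abs_sum_Z₁_sub_le (k := k) (l := l) (e := 1) (e' := 0) rfl
    (one_div_nonneg.2 (sub_pos.2 ht1).le) (lip_log_sub ht1)
  have b2 := S.abs_sum_Z₂_sub_le (k := k) (l := l) (e := 1) (e' := 0) rfl
    (one_div_nonneg.2 (sub_pos.2 ht2).le) (lip_log_sub' ht2)
  rw [abs_le] at b1 b2
  simp only [add_zero, Nat.cast_one, one_mul, Nat.cast_zero, zero_mul, sub_zero] at b1 b2
  rw [show t - β₁ = (α₂ - β₁) / 2 by rw [ht]; ring] at b1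
  rw [show α₂ - t = (α₂ - β₁) / 2 by rw [ht]; ring] at b2
  linarith [b1.1, b2.1]

end Sys

open InnerProductSpace in
/-- Harnack's inequality on the unit disc. -/
lemma harnack {U : ℂ → ℝ} (hU : HarmonicOnNhd U (closedBall 0 1)) {m : ℝ}
    (hm : ∀ w : ℂ, ‖w‖ = 1 → m ≤ U w) {z : ℝ} (hz0 : 0 ≤ z) (hz : z < 1) :
    (1 - z) / (1 + z) * (U 0 - m) ≤ U z - m := by
  have hV : HarmonicOnNhd (U - fun _ => m) (closedBall 0 1) := 
    hU.sub (harmonicOnNhd_const m)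
  have hzb : (z : ℂ) ∈ ball (0 : ℂ) 1 := by simpa [abs_of_nonneg hz0] using hz
  have h1 := hV.circleAverage_re_herglotzRieszKernel_smul hzb
  have h0 : circleAverage ((U - fun _ => m)) 0 1 = U 0 - m :=
    InnerProductSpace.HarmonicOnNhd.circleAverage_eq (by simpa using hV)
  have hc : ContinuousOn (U - fun _ => m) (sphere 0 1) :=
    hV.continuousOn.mono sphere_subset_closedBall
  have hk : ContinuousOn (herglotzRieszKernel 0 (z : ℂ)) (sphere 0 1) := by
    simpa using continuousOn_herglotzRieszKernel_sphere hzb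
  have h2 : circleAverage (fun w => (1 - z) / (1 + z) * (U - fun _ => m : ℂ → ℝ) w) 0 1 =
      (1 - z) / (1 + z) * (U 0 - m) := by
    rw [← h0, ← smul_eq_mul, ← circleAverage_smul]
    rfl
  rw [← h2]
  refine (circleAverage_mono (f₂ := (Complex.re ∘ herglotzRieszKernel 0 (z : ℂ)) •
    (U - fun _ => m)) ?_ ?_ ?_).trans_eq h1
  · exact circleIntegrable_of_sphere zero_le_one (by fun_prop)
  · exact circleIntegrable_of_sphere zero_le_one
      ((Complex.continuous_re.comp_continuousOn hk).smul hc)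
  · intro w hw
    rw [abs_one] at hw
    have h3 := le_re_herglotzRieszKernel hw hzb
    simp only [sub_zero, Complex.norm_real, norm_of_nonneg hz0] at h3
    have h4 : 0 ≤ U w - m := sub_nonneg.2 (hm w (by simpa using hw))
    simp only [Pi.smul_apply', Function.comp_apply, herglotzRieszKernel, Pi.sub_apply, smul_eq_mul,
      sub_zero]
    exact mul_le_mul_of_nonneg_right h3 h4

/-- Finite real combinations of evaluations at points `≥ γ`. -/
def evalSpan (γ : ℝ) : Submodule ℝ ((ℝ → ℝ) →ₗ[ℝ] ℝ) :=
  Submodule.span ℝ (LinearMap.proj '' Set.Ici γ)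

/-- Summation over a finite set as a functional. -/
def sumOn (Z : Finset ℝ) : (ℝ → ℝ) →ₗ[ℝ] ℝ := ∑ x ∈ Z, LinearMap.proj x

@[simp] lemma sumOn_apply (Z : Finset ℝ) (G : ℝ → ℝ) : sumOn Z G = ∑ x ∈ Z, G x := by
  simp [sumOn]

lemma sumOn_mem {γ : ℝ} {Z : Finset ℝ} (hZ : ∀ x ∈ Z, γ ≤ x) : sumOn Z ∈ evalSpan γ :=
  Submodule.sum_mem _ fun x hx => Submodule.subset_span ⟨x, hZ x hx, rfl⟩

section

variable {α β γ : ℝ} {Λ : (ℝ → ℝ) →ₗ[ℝ] ℝ}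

open InnerProductSpace in
lemma exists_harmonic (hα : α < β) (hγ : β < γ) (hΛ : Λ ∈ evalSpan γ) :
    HarmonicOnNhd (fun w : ℂ => Λ fun x => Afun α β x + 2 * log ‖1 - zfun α β x * w‖)
      (closedBall 0 1) ∧ ∀ w : ℂ, ‖w‖ = 1 →
      (Λ fun x => Afun α β x + 2 * log ‖1 - zfun α β x * w‖) =
        Λ fun x => log (x - ((α + β) / 2 + 2 * ((β - α) / 4) * w.re)) := by
  induction hΛ using Submodule.span_induction with
  | zero => simp only [LinearMap.zero_apply]; exact ⟨harmonicOnNhd_const 0, fun _ _ => trivial⟩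
  | add x y _ _ hx hy =>
    simp only [LinearMap.add_apply]
    exact ⟨hx.1.add hy.1, fun w hw => by rw [hx.2 w hw, hy.2 w hw]⟩
  | smul a x _ hx =>
    simp only [LinearMap.smul_apply]
    exact ⟨hx.1.const_smul (c := a), fun w hw => by rw [hx.2 w hw]⟩
  | mem Λ h =>
    obtain ⟨x, hx, rfl⟩ := h
    have hx : γ ≤ x := hx
    simp only [LinearMap.proj_apply]
    have hz0 := zfun_pos hα (hγ.le.trans hx)
    have hz1 := zfun_lt_one hα (hγ.trans_le hx)
    have hne : ∀ w : ℂ, ‖w‖ ≤ 1 → 1 - (zfun α β x : ℂ) * w ≠ 0 := fun w hw h => by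
      have : ‖(zfun α β x : ℂ) * w‖ = 1 := by rw [← sub_eq_zero.1 h, norm_one]
      rw [norm_mul, Complex.norm_real, norm_of_nonneg hz0.le] at this
      nlinarith [norm_nonneg w]
    constructor
    · refine (harmonicOnNhd_const _).add (HarmonicOnNhd.const_smul (c := (2 : ℝ)) fun w hw => ?_)
      exact AnalyticAt.harmonicAt_log_norm (by fun_prop) (hne w (by simpa using hw))
    · intro w hw
      have hw0 : w ≠ 0 := fun h => by simp [h] at hw
      have h1 := sub_jk hα (hγ.le.trans hx) hw0
      have h2 : ‖1 - (zfun α β x : ℂ) * w⁻¹‖ = ‖1 - (zfun α β x : ℂ) * w‖ := by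
        rw [Complex.inv_def, Complex.normSq_eq_norm_sq, hw, ← Complex.norm_conj]
        simp
      rw [jk_of_norm_one _ _ hw, ← Complex.ofReal_sub] at h1
      have h3 := congrArg norm h1
      have hq : 0 < (β - α) / 4 / zfun α β x := div_pos (by linarith) hz0
      have h4 := norm_pos_iff.2 (hne w hw.le)
      rw [norm_mul, norm_mul, h2, Complex.norm_real, Complex.norm_real, norm_of_nonneg hq.le,
        norm_eq_abs] at h3
      rw [← log_abs (x - _), h3, log_mul (by positivity) (by positivity),
        log_mul (by positivity) (by positivity), Afun]
      ring

lemma le_potential (hα : α < β) (hγ : β < γ) (hΛ : Λ ∈ evalSpan γ) {m : ℝ}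
    (hm : ∀ t ∈ Set.Icc α β, m ≤ Λ fun x => log (x - t)) {y : ℝ} (hy : β < y) :
    m ≤ Λ (Afun α β) ∧ m ≤ Λ (Afun α β) + 2 * Λ (fun x => Bfun α β x y) ∧
      sfun α β y * (Λ (Afun α β) - m) ≤ Λ (Afun α β) + 2 * Λ (fun x => Bfun α β x y) - m := by
  obtain ⟨h1, h2⟩ := exists_harmonic hα hγ hΛ
  have h3 : ∀ w : ℂ, ‖w‖ = 1 → m ≤ Λ fun x => Afun α β x + 2 * log ‖1 - zfun α β x * w‖ :=
    fun w hw => by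
      rw [h2 w hw]
      refine hm _ ?_
      have := re_mem_Icc hw
      constructor <;> nlinarith [this.1, this.2]
  have hU0 : (Λ fun x => Afun α β x + 2 * log ‖1 - zfun α β x * (0 : ℂ)‖) = Λ (Afun α β) := by
    simp
  have hUz : (Λ fun x => Afun α β x + 2 * log ‖1 - zfun α β x * (zfun α β y : ℂ)‖) =
      Λ (Afun α β) + 2 * Λ (fun x => Bfun α β x y) := by
    have hs : ∀ x, log ‖1 - (zfun α β x : ℂ) * (zfun α β y : ℂ)‖ = Bfun α β x y := fun x => by
      rw [← Complex.ofReal_mul, ← Complex.ofReal_one, ← Complex.ofReal_sub, Complex.norm_real,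
        norm_eq_abs, log_abs, Bfun]
    simp only [hs]
    rw [← smul_eq_mul, ← map_smul, ← map_add]
    rfl
  have h0 := harnack h1 h3 le_rfl zero_lt_one
  have hz := harnack h1 h3 (zfun_pos hα hy.le).le (zfun_lt_one hα hy)
  have hs : (1 - zfun α β y) / (1 + zfun α β y) = sfun α β y := by
    have := sfun_nonneg (α := α) (β := β) (x := y)
    rw [zfun]
    field_simp
    ring
  simp only [Complex.ofReal_zero] at h0
  rw [hs, hUz, hU0] at hz
  have hm0 : m ≤ Λ (Afun α β) := by
    have := InnerProductSpace.HarmonicOnNhd.circleAverage_eq (f := fun w : ℂ => Λ fun x =>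
      Afun α β x + 2 * log ‖1 - zfun α β x * w‖) (c := 0) (R := 1) (by simpa using h1)
    rw [← hU0, ← this, ← circleAverage_const m 0 1]
    refine circleAverage_mono (circleIntegrable_of_sphere zero_le_one (by fun_prop))
      (circleIntegrable_of_sphere zero_le_one
        (h1.continuousOn.mono sphere_subset_closedBall)) fun w hw => h3 w (by simpa using hw)
  have := mul_nonneg (sfun_nonneg (α := α) (β := β) (x := y)) (sub_nonneg.2 hm0)
  exact ⟨hm0, by linarith, hz⟩

lemma abs_potential_le (hα : α < β) (hγ : β < γ) (hΛ : Λ ∈ evalSpan γ) {M : ℝ}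
    (hM : ∀ t ∈ Set.Icc α β, |Λ fun x => log (x - t)| ≤ M) :
    |Λ (Afun α β)| ≤ M ∧
      ∀ y, β < y → |Λ fun x => Bfun α β x y| ≤ (1 - sfun α β y) * M := by
  have hp : ∀ t ∈ Set.Icc α β, -M ≤ Λ fun x => log (x - t) := fun t ht => (abs_le.1 (hM t ht)).1
  have hn : ∀ t ∈ Set.Icc α β, -M ≤ (-Λ) fun x => log (x - t) := fun t ht => by
    rw [LinearMap.neg_apply]
    linarith [(abs_le.1 (hM t ht)).2]
  have hΛ' : -Λ ∈ evalSpan γ := Submodule.neg_mem _ hΛ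
  have hA : |Λ (Afun α β)| ≤ M := by
    have h1 := (le_potential hα hγ hΛ hp hγ).1
    have h2 := (le_potential hα hγ hΛ' hn hγ).1
    rw [LinearMap.neg_apply] at h2
    exact abs_le.2 ⟨h1, by linarith⟩
  refine ⟨hA, fun y hy => ?_⟩
  have h1 := (le_potential hα hγ hΛ hp hy).2.2
  have h2 := (le_potential hα hγ hΛ' hn hy).2.2
  simp only [LinearMap.neg_apply] at h2
  have hs := sfun_lt_one hα hy.le
  rw [abs_le] at hA ⊢
  constructor <;> nlinarith [hA.1, hA.2]

lemma osc_potential_le (hα : α < β) (hγ : β < γ) (hΛ : Λ ∈ evalSpan γ) {M : ℝ}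
    (hM : ∀ t ∈ Set.Icc α β, ∀ t' ∈ Set.Icc α β,
      (Λ fun x => log (x - t)) - (Λ fun x => log (x - t')) ≤ M) {y y' : ℝ} (hy : β < y)
    (hy' : β < y') :
    |Λ fun x => Bfun α β x y| ≤ M / 2 ∧
      (Λ fun x => Bfun α β x y) - (Λ fun x => Bfun α β x y') ≤ M / 2 := by
  set g : ℝ → ℝ := fun t => Λ fun x => log (x - t)
  have hα' : α ∈ Set.Icc α β := ⟨le_rfl, hα.le⟩
  have hbdd : BddBelow (g '' Set.Icc α β) := by
    refine ⟨g α - M, ?_⟩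
    rintro _ ⟨t, ht, rfl⟩
    have := hM α hα' t ht
    change g α - M ≤ g t
    change g α - g t ≤ M at this
    linarith
  set m := sInf (g '' Set.Icc α β)
  have hp : ∀ t ∈ Set.Icc α β, m ≤ Λ fun x => log (x - t) := fun t ht => csInf_le hbdd ⟨t, ht, rfl⟩
  have hn : ∀ t ∈ Set.Icc α β, -(m + M) ≤ (-Λ) fun x => log (x - t) := fun t ht => by
    rw [LinearMap.neg_apply]
    have : g t - M ≤ m := by
      refine le_csInf ⟨_, α, hα', rfl⟩ ?_
      rintro _ ⟨t', ht', rfl⟩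
      have := hM t ht t' ht'
      change g t - g t' ≤ M at this
      linarith
    change _ ≤ - g t
    linarith
  have hΛ' : -Λ ∈ evalSpan γ := Submodule.neg_mem _ hΛ
  have h1 := le_potential hα hγ hΛ hp hy
  have h2 := le_potential hα hγ hΛ' hn hy
  have h3 := le_potential hα hγ hΛ hp hy'
  have h4 := le_potential hα hγ hΛ' hn hy'
  simp only [LinearMap.neg_apply] at h2 h4
  refine ⟨abs_le.2 ⟨?_, ?_⟩, ?_⟩ <;> linarith [h1.1, h1.2.1, h2.1, h2.2.1, h3.2.1, h4.2.1]

end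

/-- A version of `oneInterval` that is uniform in the endpoint. -/
theorem oneInterval_uniform {α β₁ γ a ε : ℝ} (haα : α < a) (ha : a ≤ β₁) (hγ : β₁ < γ) {f : ℝ → ℝ}
    (hf : ContinuousOn f (Set.Icc α β₁)) (hf0 : ∀ x ∈ Set.Icc α β₁, 0 < f x) (hε : 0 < ε) :
    ∃ (ch : ℝ → ℝ) (cp : ℝ → ℝ → ℝ) (K : ℝ), ∀ᶠ n : ℕ in atTop,
      ∀ β ∈ Set.Icc a β₁, ∀ Z : Multiset ℝ, (∀ x ∈ Z, γ ≤ x) →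
      Good α β₁ β n Z → ∀ p : ℝ[X], p.Monic → p.natDegree = n →
      Orth α β₁ (fun x => qprod Z x * f x) n p →
      |log (∫ x in α..β₁, p.eval x ^ 2 * (qprod Z x * f x)) - Hfun α β n Z - ch β| ≤ ε ∧
      ∀ y, γ ≤ y → |log (p.eval y) - Ffun α β n Z y - cp β y| ≤ ε ∧ |cp β y| ≤ K := by
  choose ch cp K η hη h using fun b : Set.Icc a β₁ =>
    oneInterval (haα.trans_le b.2.1) b.2.2 hγ hf hf0 hε
  obtain ⟨t, ht⟩ := isCompact_Icc.elim_nhds_subcover' (s := Set.Icc a β₁)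
    (fun x hx => ball x (η ⟨x, hx⟩)) fun x hx => ball_mem_nhds _ (hη _)
  have hg : ∀ β : ℝ, ∃ b : Set.Icc a β₁, β ∈ Set.Icc a β₁ → b ∈ t ∧ |β - b| < η b := fun β => by
    by_cases hβ : β ∈ Set.Icc a β₁
    · obtain ⟨b, hb, hb'⟩ := Set.mem_iUnion₂.1 (ht hβ)
      exact ⟨b, fun _ => ⟨hb, by simpa [Real.dist_eq] using hb'⟩⟩
    · exact ⟨⟨a, le_rfl, ha⟩, fun h => absurd h hβ⟩
  choose g hg using hg
  refine ⟨fun β => ch (g β) β, fun β => cp (g β) β, ∑ b ∈ t, |K b|, ?_⟩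
  filter_upwards [(eventually_all_finset t).2 fun b _ => h b] with n hn β hβ Z hZ hG p hp hd ho
  obtain ⟨h1, h2⟩ := hg β hβ
  obtain ⟨h3, h4⟩ := hn _ h1 β (haα.trans_le hβ.1) hβ.2 h2 Z hZ hG p hp hd ho
  refine ⟨h3, fun y hy => ⟨(h4 y hy).2.1, (h4 y hy).2.2.trans ((le_abs_self _).trans ?_)⟩⟩
  exact Finset.single_le_sum (f := fun b => |K b|) (fun _ _ => abs_nonneg _) h1

lemma eventually_Dn_le (C : ℝ) : ∀ᶠ k : ℕ in atTop, C ≤ Dn k ∧ Dn k ≤ k ∧ Dn k ≤ Dn (k + 1) ∧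
    Dn (k + 1) ≤ 8 / 5 * Dn k := by
  have h1 : Tendsto (fun k : ℕ => Dn k / k) atTop (𝓝 0) := tendsto_Dn_div
  filter_upwards [tendsto_Dn.eventually_ge_atTop C, h1.eventually_le_const one_pos,
    eventually_ge_atTop 2] with k hC hk hk2
  have hk0 : (2 : ℝ) ≤ k := by exact_mod_cast hk2
  have hl : 0 ≤ log (k : ℝ) := Real.log_natCast_nonneg k
  refine ⟨hC, (div_le_one (by linarith)).1 hk, ?_, ?_⟩
  · refine Real.rpow_le_rpow (by positivity) ?_ (by norm_num)
    push_cast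
    gcongr <;> linarith
  · have h3 : Dn (k + 1) ^ 3 ≤ (8 / 5 * Dn k) ^ 3 := by
      rw [mul_pow, Dn_pow_three, Dn_pow_three]
      push_cast
      have h5 : log ((k : ℝ) + 1) ≤ 2 * log k := by
        rw [← Real.log_rpow (by linarith)]
        refine Real.log_le_log (by linarith) ?_
        norm_num
        nlinarith
      have h6 : (k : ℝ) + 1 ≤ 3 / 2 * k := by linarith
      calc ((k : ℝ) + 1) * log (k + 1) ≤ 3 / 2 * k * (2 * log k) :=
            mul_le_mul h6 h5 (Real.log_nonneg (by linarith)) (by linarith)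
        _ ≤ _ := by nlinarith [mul_nonneg (by linarith : (0 : ℝ) ≤ k) hl]
    exact le_of_pow_le_pow_left₀ (by norm_num) (by have := Dn_nonneg k; positivity) h3

namespace Sys

variable (S : Sys α₁ β₁ α₂ β₂) {k l e e' : ℕ}

lemma Z₂_ge {x : ℝ} (hx : x ∈ (S.Z₂ k l).val) : α₂ ≤ x := (S.mem_Z₂.1 hx).1.1.le

/-- The logarithmic potential of the zeros in the first interval. -/
def L₁ (k l : ℕ) (y : ℝ) : ℝ := ∑ x ∈ S.Z₁ k l, log (y - x)

/-- The logarithmic potential of the zeros in the second interval. -/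
def L₂ (k l : ℕ) (y : ℝ) : ℝ := ∑ x ∈ S.Z₂ k l, log (x - y)

lemma L₁_reflect (y : ℝ) : S.reflect.L₁ l k y = S.L₂ k l (-y) := by
  rw [L₁, sum_Z₁_reflect, L₂]
  exact Finset.sum_congr rfl fun x _ => by ring_nf

lemma L₂_reflect (y : ℝ) : S.reflect.L₂ l k y = S.L₁ k l (-y) := by
  rw [L₂, sum_Z₂_reflect, L₁]
  exact Finset.sum_congr rfl fun x _ => by ring_nf

/-- The leading term of `L₁` for the endpoint `b`. -/
def F₁ (k l : ℕ) (b y : ℝ) : ℝ := Ffun α₁ b k (S.Z₂ k l).val y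

/-- The leading term of `log I₁` for the endpoint `b`. -/
def H₁ (k l : ℕ) (b : ℝ) : ℝ := Hfun α₁ b k (S.Z₂ k l).val

lemma F₁_eq (b y : ℝ) :
    S.F₁ k l b y = k * Afun α₁ b y - sumOn (S.Z₂ k l) fun x => Bfun α₁ b x y := by
  rw [sumOn_apply]; rfl

lemma H₁_eq (b : ℝ) :
    S.H₁ k l b = 2 * k * log ((b - α₁) / 4) + sumOn (S.Z₂ k l) (Afun α₁ b) := by
  rw [sumOn_apply]; rfl

/-- The net at the endpoint `b`. -/
def net₁ (k l : ℕ) (b : ℝ) : ℝ := net α₁ b k (S.Z₂ k l).val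

lemma exists_endpt (k l : ℕ) : ∃ b, Dn k < 2 * k → α₁ < b ∧ b ≤ β₁ ∧ Dn k ≤ S.net₁ k l b ∧
    (b = β₁ ∨ S.net₁ k l b = Dn k) := by
  by_cases h : Dn k < 2 * k
  · obtain ⟨b, hb⟩ := exists_endpoint S.h₁ k (Z := (S.Z₂ k l).val)
      (fun x hx => S.h₂.trans_le (S.Z₂_ge hx)) h
    exact ⟨b, fun _ => hb⟩
  · exact ⟨0, fun h' => absurd h' h⟩

/-- The right endpoint of the soft support of the zeros in the first interval. -/
def endpt (k l : ℕ) : ℝ := (S.exists_endpt k l).choose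

lemma endpt_spec : Dn k < 2 * k → α₁ < S.endpt k l ∧ S.endpt k l ≤ β₁ ∧
    Dn k ≤ S.net₁ k l (S.endpt k l) ∧
    (S.endpt k l = β₁ ∨ S.net₁ k l (S.endpt k l) = Dn k) := (S.exists_endpt k l).choose_spec

lemma exists_abs_net_sub_le : ∃ C, ∀ k l b e e', e + e' = 1 → b ∈ Set.Icc α₁ β₁ →
    |S.net₁ (k + e) (l + e') b - S.net₁ k l b| ≤ C := by
  have hg : 0 < α₂ - β₁ := sub_pos.2 S.h₂
  have h1 := S.h₁
  have h3 := S.h₃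
  refine ⟨2 + ((β₁ - α₁) / (α₂ - β₁) ^ 2 * (β₂ - α₂) + (β₁ - α₁) / (α₂ - β₁)),
    fun k l b e e' he hb => ?_⟩
  have h := S.abs_sum_Z₂_sub_le (k := k) (l := l) he (G := push α₁ b)
    (K := (β₁ - α₁) / (α₂ - β₁) ^ 2) (div_nonneg (by linarith) (by positivity))
    fun x hx y hy => push_lipschitz hb.1 hb.2 S.h₂ hx.1 hy.1
  have hp0 := push_nonneg hb.1 (show b < β₂ by linarith [hb.2, S.h₂])
  have hp : push α₁ b β₂ ≤ (β₁ - α₁) / (α₂ - β₁) :=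
    (push_le hb.1 hb.2 S.h₂ h3.le).trans (by gcongr; exact hb.2)
  have he1 : (e : ℝ) ≤ 1 := by exact_mod_cast (by omega : e ≤ 1)
  have he'1 : (e' : ℝ) ≤ 1 := by exact_mod_cast (by omega : e' ≤ 1)
  have e1 : S.net₁ (k + e) (l + e') b - S.net₁ k l b = 2 * e -
      (∑ x ∈ S.Z₂ (k + e) (l + e'), push α₁ b x - ∑ x ∈ S.Z₂ k l, push α₁ b x) := by
    simp only [net₁, net, Nat.cast_add, Finset.sum]
    ring
  rw [e1]
  rw [abs_le] at h ⊢
  have h5 : (0 : ℝ) ≤ e := e.cast_nonneg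
  have h6 : (0 : ℝ) ≤ e' := e'.cast_nonneg
  constructor <;> nlinarith [h.1, h.2]

/-- For `k` comparable with `k + l`, the endpoints stay away from `α₁` and are good, also for
the neighbours of `(k, l)`. -/
lemma endpt_good {c : ℝ} (hc : 0 < c) : ∃ a, α₁ < a ∧ a ≤ β₁ ∧ ∀ᶠ k : ℕ in atTop, ∀ l : ℕ,
    c * (k + l) ≤ k → S.endpt k l ∈ Set.Icc a β₁ ∧ Dn k ≤ S.net₁ k l (S.endpt k l) ∧
      (S.endpt k l = β₁ ∨ S.net₁ k l (S.endpt k l) = Dn k) ∧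
      Good α₁ β₁ (S.endpt k l) k (S.Z₂ k l).val ∧ ∀ e e', e + e' = 1 →
      Good α₁ β₁ (S.endpt k l) (k + e) (S.Z₂ (k + e) (l + e')).val := by
  obtain ⟨C, hC⟩ := S.exists_abs_net_sub_le
  have hg : 0 < α₂ - β₁ := sub_pos.2 S.h₂
  refine ⟨min β₁ (α₁ + c * (α₂ - β₁)), lt_min S.h₁ (by nlinarith), min_le_left _ _, ?_⟩
  filter_upwards [eventually_Dn_le (5 * |C| + 1)] with k hk l hkl
  obtain ⟨hk1, hk2, hk3, hk4⟩ := hk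
  have hC0 := abs_nonneg C
  have hk0 : 0 < (k : ℝ) := by linarith
  obtain ⟨h1, h2, h3, h4⟩ := S.endpt_spec (k := k) (l := l) (by linarith)
  have hgood : Good α₁ β₁ (S.endpt k l) k (S.Z₂ k l).val := by
    constructor
    · rw [Psi_sset]
      change _ ≤ S.net₁ k l (S.endpt k l)
      linarith
    · rw [Psi_sset]
      exact h4.imp_right fun h => by change S.net₁ k l (S.endpt k l) ≤ _; linarith
  refine ⟨⟨?_, h2⟩, h3, h4, hgood, fun e e' he => ?_⟩
  · rcases le_endpoint h1 h2 S.h₂ (fun x hx => S.Z₂_ge hx) h4 hk2 with h | h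
    · rw [h]; exact min_le_left _ _
    · refine (min_le_right _ _).trans ?_
      rw [Finset.card_val, S.card_Z₂] at h
      have h5 : c * l ≤ k := by nlinarith
      rcases Nat.eq_zero_or_pos l with rfl | hl
      · rw [Nat.cast_zero, zero_mul] at h
        nlinarith
      · have hl : (0 : ℝ) < l := by exact_mod_cast hl
        have : l * (c * (α₂ - β₁)) ≤ l * (S.endpt k l - α₁) := by nlinarith
        linarith [le_of_mul_le_mul_left this hl]
  · have h5 := abs_le.1 ((hC k l (S.endpt k l) e e' he ⟨h1.le, h2⟩).trans (le_abs_self C))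
    have h6 : Dn k ≤ Dn (k + e) ∧ Dn (k + e) ≤ 8 / 5 * Dn k := by
      rcases (by omega : e = 0 ∨ e = 1) with rfl | rfl
      · simp only [add_zero]; exact ⟨le_rfl, by linarith⟩
      · exact ⟨hk3, hk4⟩
    constructor
    · rw [Psi_sset]
      change _ ≤ S.net₁ (k + e) (l + e') (S.endpt k l)
      linarith [h5.1]
    · rw [Psi_sset]
      exact h4.imp_right fun h => by
        change S.net₁ (k + e) (l + e') (S.endpt k l) ≤ _
        linarith [h5.2]

lemma asymp {a ε : ℝ} (haα : α₁ < a) (ha : a ≤ β₁) (hε : 0 < ε) :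
    ∃ (ch : ℝ → ℝ) (cp : ℝ → ℝ → ℝ) (K : ℝ), ∀ᶠ k : ℕ in atTop, ∀ l, ∀ b ∈ Set.Icc a β₁,
      Good α₁ β₁ b k (S.Z₂ k l).val → |log (S.I₁ k l) - S.H₁ k l b - ch b| ≤ ε ∧
      ∀ y, α₂ ≤ y → |S.L₁ k l y - S.F₁ k l b y - cp b y| ≤ ε ∧ |cp b y| ≤ K := by
  obtain ⟨ch, cp, K, h⟩ := oneInterval_uniform haα ha S.h₂ S.cont₁ S.pos₁ hε
  refine ⟨ch, cp, K, ?_⟩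
  filter_upwards [h] with k hk l b hb hG
  obtain ⟨h1, h2⟩ := hk b hb _ (fun x hx => S.Z₂_ge hx) hG (S.p₁ k l) (S.p₁_monic k l)
    (S.natDegree_p₁ k l) (S.orth_p₁ k l)
  refine ⟨h1, fun y hy => ?_⟩
  have h3 := h2 y hy
  rwa [S.log_p₁ (S.h₂.le.trans hy)] at h3

lemma asymp_L₁ {c : ℝ} (hc : 0 < c) : ∃ K, ∀ᶠ k : ℕ in atTop, ∀ l : ℕ, c * (k + l) ≤ k →
    ∀ y, α₂ ≤ y → |S.L₁ k l y - S.F₁ k l (S.endpt k l) y| ≤ K := by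
  obtain ⟨a, ha, ha1, hg⟩ := S.endpt_good hc
  obtain ⟨ch, cp, K, h⟩ := S.asymp ha ha1 one_pos
  refine ⟨1 + K, ?_⟩
  filter_upwards [h, hg] with k hk hg l hl y hy
  obtain ⟨h1, -, -, h2, -⟩ := hg l hl
  obtain ⟨h3, h4⟩ := (hk l _ h1 h2).2 y hy
  rw [abs_le] at *
  constructor <;> linarith [h3.1, h3.2, h4.1, h4.2]

lemma asymp_sub {c ε : ℝ} (hc : 0 < c) (hε : 0 < ε) : ∀ᶠ k : ℕ in atTop, ∀ l : ℕ,
    c * (k + l) ≤ k → ∀ e e', e + e' = 1 →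
    |(log (S.I₁ (k + e) (l + e')) - log (S.I₁ k l)) -
      (S.H₁ (k + e) (l + e') (S.endpt k l) - S.H₁ k l (S.endpt k l))| ≤ ε ∧
    ∀ y, α₂ ≤ y → |(S.L₁ (k + e) (l + e') y - S.L₁ k l y) -
      (S.F₁ (k + e) (l + e') (S.endpt k l) y - S.F₁ k l (S.endpt k l) y)| ≤ ε := by
  obtain ⟨a, ha, ha1, hg⟩ := S.endpt_good hc
  obtain ⟨ch, cp, K, h⟩ := S.asymp ha ha1 (half_pos hε)
  filter_upwards [h, (tendsto_add_atTop_nat 1).eventually h, hg] with k hk hk' hg l hl e e' he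
  obtain ⟨h1, -, -, h2, h3⟩ := hg l hl
  have hke : ∀ l, ∀ b ∈ Set.Icc a β₁,
      Good α₁ β₁ b (k + e) (S.Z₂ (k + e) l).val →
      |log (S.I₁ (k + e) l) - S.H₁ (k + e) l b - ch b| ≤ ε / 2 ∧
      ∀ y, α₂ ≤ y → |S.L₁ (k + e) l y - S.F₁ (k + e) l b y - cp b y| ≤ ε / 2 ∧ |cp b y| ≤ K := by
    rcases (by omega : e = 0 ∨ e = 1) with rfl | rfl
    · exact hk
    · exact hk'
  obtain ⟨h4, h5⟩ := hk l _ h1 h2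
  obtain ⟨h6, h7⟩ := hke _ _ h1 (h3 e e' he)
  refine ⟨?_, fun y hy => ?_⟩
  · rw [abs_le] at *
    constructor <;> linarith [h4.1, h4.2, h6.1, h6.2]
  · have h8 := (h5 y hy).1
    have h9 := (h7 y hy).1
    rw [abs_le] at *
    constructor <;> linarith [h8.1, h8.2, h9.1, h9.2]

end Sys

lemma eventually_le_of_contraction {p : ℝ → Prop} {q : ℝ} (hmono : ∀ M M', M ≤ M' → p M → p M')
    (h0 : ∃ M, 0 ≤ M ∧ p M) (hq : q < 1)
    (hstep : ∀ M, 0 ≤ M → p M → ∀ ε, 0 < ε → 0 ≤ q * M + ε ∧ p (q * M + ε)) {ε : ℝ}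
    (hε : 0 < ε) : p ε := by
  set s := {M : ℝ | 0 ≤ M ∧ p M}
  have hs : s.Nonempty := h0
  have hb : BddBelow s := ⟨0, fun M hM => hM.1⟩
  have hm0 : 0 ≤ sInf s := Real.sInf_nonneg fun M hM => hM.1
  have key : ∀ δ, 0 < δ → (1 - q) * sInf s ≤ (|q| + 1) * δ := fun δ hδ => by
    obtain ⟨M, hM, hMδ⟩ := Real.lt_sInf_add_pos hs hδ
    have h1 := csInf_le hb (hstep M hM.1 hM.2 δ hδ)
    have h2 := csInf_le hb hM
    have h3 : q * (M - sInf s) ≤ |q| * δ :=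
      (mul_le_mul_of_nonneg_right (le_abs_self q) (by linarith)).trans
        (mul_le_mul_of_nonneg_left (by linarith) (abs_nonneg q))
    linarith
  have hm : sInf s ≤ 0 := by
    by_contra! h
    have h1 : 0 < (1 - q) * sInf s := mul_pos (by linarith) h
    have h2 : 0 < |q| + 1 := by positivity
    have := key ((1 - q) * sInf s / (2 * (|q| + 1))) (by positivity)
    have e : (|q| + 1) * ((1 - q) * sInf s / (2 * (|q| + 1))) = (1 - q) * sInf s / 2 := by
      field_simp
    linarith
  obtain ⟨M, hM, hMε⟩ := Real.lt_sInf_add_pos hs hε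
  exact hmono M ε (by linarith) hM.2

/-- Two families of multi-indices with the same limiting ratio. -/
structure SameRay {ι : Type*} (F : Filter ι) (k l k' l' : ι → ℕ) (c : ℝ) : Prop where
  sum : Tendsto (fun i => (k i : ℝ) + l i) F atTop
  sum' : Tendsto (fun i => (k' i : ℝ) + l' i) F atTop
  ratio : Tendsto (fun i => (k i : ℝ) / (k i + l i)) F (𝓝 c)
  ratio' : Tendsto (fun i => (k' i : ℝ) / (k' i + l' i)) F (𝓝 c)

namespace SameRay

variable {ι : Type*} {F : Filter ι} {k l k' l' : ι → ℕ} {c : ℝ}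

lemma symm (h : SameRay F k l k' l' c) : SameRay F k' l' k l c :=
  ⟨h.sum', h.sum, h.ratio', h.ratio⟩

lemma swap (h : SameRay F k l k' l' c) : SameRay F l k l' k' (1 - c) := by
  have key : ∀ k l : ι → ℕ, Tendsto (fun i => (k i : ℝ) + l i) F atTop →
      Tendsto (fun i => (k i : ℝ) / (k i + l i)) F (𝓝 c) →
      Tendsto (fun i => (l i : ℝ) / (l i + k i)) F (𝓝 (1 - c)) := fun k l h1 h2 => by
    refine (h2.const_sub 1).congr' ?_
    filter_upwards [h1.eventually_gt_atTop 0] with i hi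
    rw [add_comm (l i : ℝ)]
    field_simp
    ring
  exact ⟨h.sum.congr fun i => add_comm _ _, h.sum'.congr fun i => add_comm _ _,
    key k l h.sum h.ratio, key k' l' h.sum' h.ratio'⟩

lemma comparable (h : SameRay F k l k' l' c) (hc : 0 < c) :
    ∀ᶠ i in F, c / 2 * (k i + l i) ≤ k i := by
  filter_upwards [h.ratio.eventually_const_le (half_lt_self hc), h.sum.eventually_gt_atTop 0]
    with i hi h0
  exact (le_div_iff₀ h0).1 hi

lemma tendsto_left (h : SameRay F k l k' l' c) (hc : 0 < c) : Tendsto k F atTop := by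
  rw [← tendsto_natCast_atTop_iff (R := ℝ)]
  exact tendsto_atTop_mono' F (h.comparable hc) (h.sum.const_mul_atTop (half_pos hc))

end SameRay

lemma abs_Afun_le {α b γ y R : ℝ} (hb : α < b) (hbγ : b < γ) (hy : γ ≤ y) (hyR : y ≤ R) :
    |Afun α b y| ≤ |log (γ - α)| + |log (R - α)| + 4 * log 2 := by
  rw [Afun_eq hb (by linarith)]
  have h1 := sfun_nonneg (α := α) (β := b) (x := y)
  have h2 := sfun_lt_one hb (x := y) (by linarith)
  have h3 : 0 ≤ log (1 + sfun α b y) := log_nonneg (by linarith)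
  have h4 : log (1 + sfun α b y) ≤ log 2 := log_le_log (by linarith) (by linarith)
  have h5 : log (γ - α) ≤ log (y - α) := log_le_log (by linarith) (by linarith)
  have h6 : log (y - α) ≤ log (R - α) := log_le_log (by linarith) (by linarith)
  have h7 : log 4 = 2 * log 2 := by
    rw [show (4 : ℝ) = 2 ^ 2 by norm_num, log_pow]; norm_num
  rw [h7, abs_le]
  constructor <;> linarith [le_abs_self (log (R - α)), neg_abs_le (log (γ - α)),
    abs_nonneg (log (R - α)), abs_nonneg (log (γ - α))]

namespace Sys

variable (S S' : Sys α₁ β₁ α₂ β₂)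

lemma exists_abs_L₁_le : ∃ C, 0 ≤ C ∧ ∀ k l, ∀ y ∈ Set.Icc α₂ β₂, |S.L₁ k l y| ≤ C * k := by
  have h1 := S.h₁; have h2 := S.h₂; have h3 := S.h₃
  refine ⟨|log (α₂ - β₁)| + |log (β₂ - α₁)|, by positivity, fun k l y hy => ?_⟩
  refine (Finset.abs_sum_le_sum_abs _ _).trans ((Finset.sum_le_card_nsmul _ _
    (|log (α₂ - β₁)| + |log (β₂ - α₁)|) fun x hx => ?_).trans_eq ?_)
  · have hx := (S.mem_Z₁.1 hx).1
    have h5 : log (α₂ - β₁) ≤ log (y - x) := log_le_log (by linarith) (by linarith [hy.1, hx.2])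
    have h6 : log (y - x) ≤ log (β₂ - α₁) :=
      log_le_log (by linarith [hy.1, hx.2]) (by linarith [hy.2, hx.1])
    rw [abs_le]
    constructor <;> linarith [le_abs_self (log (β₂ - α₁)), neg_abs_le (log (α₂ - β₁)),
      abs_nonneg (log (β₂ - α₁)), abs_nonneg (log (α₂ - β₁))]
  · rw [S.card_Z₁, nsmul_eq_mul, mul_comm]

/-- `F₁` at any endpoint dominates the potential, with a quadratic gain beyond `endpt`. -/
lemma L₁_le {c ε : ℝ} (hc : 0 < c) (hε : 0 < ε) : ∀ᶠ k : ℕ in atTop, ∀ l : ℕ, c * (k + l) ≤ k →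
    ∀ b, α₁ < b → b ≤ β₁ → ∀ y ∈ Set.Icc α₂ β₂, S.L₁ k l y ≤ S.F₁ k l b y + ε * k ∧
      (S.endpt k l ≤ b → S.L₁ k l y + l * (b - S.endpt k l) ^ 2 / (16 * (β₂ - α₁) ^ 2) ≤
        S.F₁ k l b y + ε * k) := by
  obtain ⟨a, ha, ha1, hg⟩ := S.endpt_good hc
  obtain ⟨K, hK⟩ := S.asymp_L₁ hc
  have h1 := S.h₁; have h2 := S.h₂
  set c₂ := (β₁ - α₁) / (α₂ - β₁) / (2 * (a - α₁)) * (β₁ - α₁) with hc₂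
  have hc₂0 : 0 ≤ c₂ := mul_nonneg (div_nonneg (div_nonneg (by linarith) (by linarith))
    (by linarith)) (by linarith)
  have hlim : Tendsto (fun k : ℕ => K / k + c₂ * (Dn k / k)) atTop (𝓝 0) := by
    have := (tendsto_const_nhds (x := K)).div_atTop (tendsto_natCast_atTop_atTop (R := ℝ))
    simpa using this.add (tendsto_Dn_div.const_mul c₂)
  filter_upwards [hg, hK, hlim.eventually_le_const hε, eventually_gt_atTop 0] with
    k hg hK hk hk0 l hl b hb hb1 y hy
  have hk0' : (0 : ℝ) < k := by exact_mod_cast hk0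
  have hk' : K + c₂ * Dn k ≤ ε * k := by
    have := mul_le_mul_of_nonneg_right hk hk0'.le
    rwa [add_mul, mul_assoc, div_mul_cancel₀ _ hk0'.ne', div_mul_cancel₀ _ hk0'.ne'] at this
  obtain ⟨⟨h3, h4⟩, h5, h6, -, -⟩ := hg l hl
  have h7 := (abs_le.1 (hK l hl y hy.1)).2
  have hD := Dn_nonneg k
  have hcD := mul_nonneg hc₂0 hD
  have hup : S.endpt k l ≤ b → S.L₁ k l y + l * (b - S.endpt k l) ^ 2 / (16 * (β₂ - α₁) ^ 2) ≤
      S.F₁ k l b y + ε * k := fun hle => by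
    rcases h6 with h6 | h6
    · have hb' : b = S.endpt k l := le_antisymm (hb1.trans h6.ge) hle
      rw [hb', sub_self]
      simp only [ne_eq, OfNat.ofNat_ne_zero, not_false_eq_true, zero_pow, mul_zero, zero_div]
      linarith
    · have h8 := le_Ffun_of_soft (n := k) ha h3 hle (hb1.trans_lt h2) hy.1 hy.2
        (fun x hx => ⟨S.Z₂_ge hx, (S.mem_Z₂.1 hx).1.2.le⟩) h6.le hD
      rw [Finset.card_val, S.card_Z₂] at h8
      have h9 : (b - α₁) / (α₂ - b) / (2 * (a - α₁)) * Dn k * (b - S.endpt k l) ≤ c₂ * Dn k := by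
        have : (b - α₁) / (α₂ - b) / (2 * (a - α₁)) * (b - S.endpt k l) ≤ c₂ := by
          have : 0 < α₂ - β₁ := by linarith
          have : 0 < a - α₁ := by linarith
          have : 0 ≤ β₁ - α₁ := by linarith
          rw [hc₂]
          gcongr
          linarith
        nlinarith
      change S.F₁ k l _ y + _ - _ ≤ S.F₁ k l b y at h8
      linarith
  refine ⟨?_, hup⟩
  rcases le_total (S.endpt k l) b with h | h
  · refine le_trans ?_ (hup h)
    have : 0 ≤ l * (b - S.endpt k l) ^ 2 / (16 * (β₂ - α₁) ^ 2) := by positivity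
    linarith
  · have h8 := Ffun_le_of_le (n := k) (β' := S.endpt k l) (y := y) (Z := (S.Z₂ k l).val) hb h
      (by linarith [hy.1]) (fun x hx => by linarith [S.Z₂_ge hx]) (hD.trans h5)
    change S.F₁ k l _ y ≤ S.F₁ k l b y at h8
    linarith

section

variable {ι : Type*} {F : Filter ι} {k l k' l' : ι → ℕ} {c : ℝ}

/-- Comparison of the leading terms with a common endpoint. -/
lemma F₁_div_sub_le (h : SameRay F k l k' l' c) {M ε : ℝ} (hM : 0 ≤ M) (hε : 0 < ε) {b : ι → ℝ}
    (hb : ∀ᶠ i in F, α₁ < b i ∧ b i ≤ β₁)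
    (hD : ∀ᶠ i in F, ∀ t ∈ Set.Icc α₁ β₁,
      |S.L₂ (k i) (l i) t / (k i + l i) - S'.L₂ (k' i) (l' i) t / (k' i + l' i)| ≤ M) :
    ∀ᶠ i in F, ∀ y ∈ Set.Icc α₂ β₂, |S.F₁ (k i) (l i) (b i) y / (k i + l i) -
      S'.F₁ (k' i) (l' i) (b i) y / (k' i + l' i)| ≤ (1 - sfun α₁ β₁ α₂) * M + ε := by
  set A := |log (α₂ - α₁)| + |log (β₂ - α₁)| + 4 * log 2
  have hlim : Tendsto (fun i => |(k i : ℝ) / (k i + l i) - k' i / (k' i + l' i)| * A) F (𝓝 0) := by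
    simpa using ((h.ratio.sub h.ratio').abs).mul_const A
  filter_upwards [hb, hD, hlim.eventually_le_const hε] with i ⟨hb0, hb1⟩ hD hi y hy
  have h2 := S.h₂
  set N : ℝ := k i + l i
  set N' : ℝ := k' i + l' i
  set Λ := N⁻¹ • sumOn (S.Z₂ (k i) (l i)) - N'⁻¹ • sumOn (S'.Z₂ (k' i) (l' i)) with hΛ
  have hmem : Λ ∈ evalSpan α₂ := Submodule.sub_mem _
    (Submodule.smul_mem _ _ (sumOn_mem fun x hx => S.Z₂_ge hx))
    (Submodule.smul_mem _ _ (sumOn_mem fun x hx => S'.Z₂_ge hx))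
  have hΛL : ∀ t, (Λ fun x => log (x - t)) =
      S.L₂ (k i) (l i) t / N - S'.L₂ (k' i) (l' i) t / N' := fun t => by
    simp only [hΛ, LinearMap.sub_apply, LinearMap.smul_apply, sumOn_apply, smul_eq_mul, L₂]
    ring
  have h3 := (abs_potential_le hb0 (hb1.trans_lt h2) hmem (M := M) fun t ht => by
    rw [hΛL]
    exact hD t ⟨ht.1, ht.2.trans hb1⟩).2 y (by linarith [hy.1])
  have hs : sfun α₁ β₁ α₂ ≤ sfun α₁ (b i) y :=
    sfun_le_sfun hb0.le hb1 (by linarith [S.h₁]) hy.1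
  have h4 := mul_le_mul_of_nonneg_right hs hM
  have e : S.F₁ (k i) (l i) (b i) y / N - S'.F₁ (k' i) (l' i) (b i) y / N' =
      (k i / N - k' i / N') * Afun α₁ (b i) y - Λ fun x => Bfun α₁ (b i) x y := by
    simp only [F₁_eq, hΛ, LinearMap.sub_apply, LinearMap.smul_apply, smul_eq_mul]
    ring
  rw [e]
  have h5 : |(k i / N - k' i / N') * Afun α₁ (b i) y| ≤ |k i / N - k' i / N'| * A := by
    rw [abs_mul]
    exact mul_le_mul_of_nonneg_left
      (abs_Afun_le hb0 (hb1.trans_lt h2) hy.1 hy.2) (abs_nonneg _)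
  refine (abs_sub _ _).trans ?_
  linarith

lemma L₁_div_sub_le (h : SameRay F k l k' l' c) (hc : 0 < c) {M ε : ℝ} (hM : 0 ≤ M) (hε : 0 < ε)
    (hD : ∀ᶠ i in F, ∀ t ∈ Set.Icc α₁ β₁,
      |S.L₂ (k i) (l i) t / (k i + l i) - S'.L₂ (k' i) (l' i) t / (k' i + l' i)| ≤ M) :
    ∀ᶠ i in F, ∀ y ∈ Set.Icc α₂ β₂, S.L₁ (k i) (l i) y / (k i + l i) -
      S'.L₁ (k' i) (l' i) y / (k' i + l' i) ≤ (1 - sfun α₁ β₁ α₂) * M + ε := by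
  obtain ⟨a, ha, ha1, hg⟩ := S'.endpt_good (half_pos hc)
  obtain ⟨K, hK⟩ := S'.asymp_L₁ (half_pos hc)
  have hlim : Tendsto (fun i => K / ((k' i : ℝ) + l' i)) F (𝓝 0) :=
    tendsto_const_nhds.div_atTop h.sum'
  have hg' := (h.symm.tendsto_left hc).eventually hg
  have hb : ∀ᶠ i in F, α₁ < S'.endpt (k' i) (l' i) ∧ S'.endpt (k' i) (l' i) ≤ β₁ := by
    filter_upwards [hg', h.symm.comparable hc] with i h1 h2
    exact ⟨ha.trans_le (h1 _ h2).1.1, (h1 _ h2).1.2⟩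
  filter_upwards [hb, F₁_div_sub_le S S' h hM (show 0 < ε / 3 by positivity) hb hD,
    (h.tendsto_left hc).eventually (S.L₁_le (half_pos hc) (show 0 < ε / 3 by positivity)),
    (h.symm.tendsto_left hc).eventually hK, h.comparable hc, h.symm.comparable hc,
    hlim.eventually_le_const (show 0 < ε / 3 by positivity),
    h.sum.eventually_gt_atTop 0, h.sum'.eventually_gt_atTop 0]
    with i ⟨hb0, hb1⟩ h1 h2 h3 h4 h5 h6 hN hN' y hy
  have h7 := (h2 _ h4 _ hb0 hb1 y hy).1
  have h8 := (abs_le.1 (h3 _ h5 y hy.1)).1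
  have h9 := (abs_le.1 (h1 y hy)).2
  have h10 : S.L₁ (k i) (l i) y / (k i + l i) ≤
      S.F₁ (k i) (l i) (S'.endpt (k' i) (l' i)) y / (k i + l i) + ε / 3 := by
    rw [div_add' _ _ _ hN.ne', div_le_div_iff_of_pos_right hN]
    have : (0 : ℝ) ≤ l i := Nat.cast_nonneg _
    nlinarith
  have h11 : S'.F₁ (k' i) (l' i) (S'.endpt (k' i) (l' i)) y / (k' i + l' i) ≤
      S'.L₁ (k' i) (l' i) y / (k' i + l' i) + K / (k' i + l' i) := by
    rw [← add_div, div_le_div_iff_of_pos_right hN']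
    linarith
  linarith

lemma abs_L₁_div_sub_le (h : SameRay F k l k' l' c) (hc : 0 ≤ c) {M ε : ℝ} (hM : 0 ≤ M)
    (hε : 0 < ε) (hD : ∀ᶠ i in F, ∀ t ∈ Set.Icc α₁ β₁,
      |S.L₂ (k i) (l i) t / (k i + l i) - S'.L₂ (k' i) (l' i) t / (k' i + l' i)| ≤ M) :
    ∀ᶠ i in F, ∀ y ∈ Set.Icc α₂ β₂, |S.L₁ (k i) (l i) y / (k i + l i) -
      S'.L₁ (k' i) (l' i) y / (k' i + l' i)| ≤ (1 - sfun α₁ β₁ α₂) * M + ε := by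
  rcases hc.lt_or_eq with hc | rfl
  · filter_upwards [L₁_div_sub_le S S' h hc hM hε hD,
      L₁_div_sub_le S' S h.symm hc hM hε (hD.mono fun i hi t ht => by
        rw [abs_sub_comm]; exact hi t ht)] with i h1 h2 y hy
    exact abs_le.2 ⟨by linarith [h2 y hy], h1 y hy⟩
  · obtain ⟨C, hC0, hC⟩ := S.exists_abs_L₁_le
    obtain ⟨C', hC0', hC'⟩ := S'.exists_abs_L₁_le
    have hlim : Tendsto (fun i => C * ((k i : ℝ) / (k i + l i)) + C' * (k' i / (k' i + l' i)))
        F (𝓝 0) := by simpa using (h.ratio.const_mul C).add (h.ratio'.const_mul C')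
    filter_upwards [hlim.eventually_le_const hε] with i hi y hy
    have hq : 0 ≤ (1 - sfun α₁ β₁ α₂) * M := mul_nonneg
      (by linarith [sfun_lt_one S.h₁ S.h₂.le]) hM
    have h1 : |S.L₁ (k i) (l i) y / (k i + l i)| ≤ C * (k i / (k i + l i)) := by
      rw [abs_div, abs_of_nonneg (by positivity : (0 : ℝ) ≤ k i + l i), ← mul_div_assoc]
      exact div_le_div_of_nonneg_right (hC _ _ y hy) (by positivity)
    have h2 : |S'.L₁ (k' i) (l' i) y / (k' i + l' i)| ≤ C' * (k' i / (k' i + l' i)) := by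
      rw [abs_div, abs_of_nonneg (by positivity : (0 : ℝ) ≤ k' i + l' i), ← mul_div_assoc]
      exact div_le_div_of_nonneg_right (hC' _ _ y hy) (by positivity)
    exact (abs_sub _ _).trans (by linarith)

lemma abs_L₂_div_sub_le (h : SameRay F k l k' l' c) (hc : c ≤ 1) {M ε : ℝ} (hM : 0 ≤ M)
    (hε : 0 < ε) (hD : ∀ᶠ i in F, ∀ y ∈ Set.Icc α₂ β₂,
      |S.L₁ (k i) (l i) y / (k i + l i) - S'.L₁ (k' i) (l' i) y / (k' i + l' i)| ≤ M) :
    ∀ᶠ i in F, ∀ t ∈ Set.Icc α₁ β₁, |S.L₂ (k i) (l i) t / (k i + l i) -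
      S'.L₂ (k' i) (l' i) t / (k' i + l' i)| ≤ (1 - sfun (-β₂) (-α₂) (-β₁)) * M + ε := by
  have := abs_L₁_div_sub_le S.reflect S'.reflect h.swap (by linarith) hM hε
    (hD.mono fun i hi t ht => by
      rw [L₂_reflect, L₂_reflect, add_comm (l i : ℝ), add_comm (l' i : ℝ)]
      exact hi (-t) ⟨by linarith [ht.2], by linarith [ht.1]⟩)
  filter_upwards [this] with i hi t ht
  have := hi (-t) ⟨by linarith [ht.2], by linarith [ht.1]⟩
  rwa [L₁_reflect, L₁_reflect, neg_neg, add_comm (l i : ℝ), add_comm (l' i : ℝ)] at this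

/-- The normalized potentials of two systems along the same ray approach each other. -/
theorem potentials_close (h : SameRay F k l k' l' c) (hc : c ∈ Set.Icc (0 : ℝ) 1) {ε : ℝ}
    (hε : 0 < ε) : ∀ᶠ i in F,
      (∀ y ∈ Set.Icc α₂ β₂, |S.L₁ (k i) (l i) y / (k i + l i) -
        S'.L₁ (k' i) (l' i) y / (k' i + l' i)| ≤ ε) ∧
      ∀ t ∈ Set.Icc α₁ β₁, |S.L₂ (k i) (l i) t / (k i + l i) -
        S'.L₂ (k' i) (l' i) t / (k' i + l' i)| ≤ ε := by
  have hs := sfun_pos S.h₁ S.h₂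
  have hs' := sfun_pos S.reflect.h₁ S.reflect.h₂
  have ht := sfun_lt_one S.h₁ S.h₂.le
  set q := max (1 - sfun α₁ β₁ α₂) (1 - sfun (-β₂) (-α₂) (-β₁))
  have hq0 : 0 ≤ q := le_max_of_le_left (by linarith)
  refine eventually_le_of_contraction (q := q) (p := fun M => ∀ᶠ i in F,
      (∀ y ∈ Set.Icc α₂ β₂, |S.L₁ (k i) (l i) y / (k i + l i) -
        S'.L₁ (k' i) (l' i) y / (k' i + l' i)| ≤ M) ∧
      ∀ t ∈ Set.Icc α₁ β₁, |S.L₂ (k i) (l i) t / (k i + l i) -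
        S'.L₂ (k' i) (l' i) t / (k' i + l' i)| ≤ M) (fun M M' hM hp => ?_) ?_
    (max_lt (by linarith) (by linarith)) (fun M hM hp δ hδ => ⟨by positivity, ?_⟩) hε
  · filter_upwards [hp] with i hi
    exact ⟨fun y hy => (hi.1 y hy).trans hM, fun y hy => (hi.2 y hy).trans hM⟩
  · have key : ∀ {α₁ β₁ α₂ β₂ : ℝ} (S : Sys α₁ β₁ α₂ β₂), ∃ C, 0 ≤ C ∧ ∀ k l : ℕ,
        ∀ y ∈ Set.Icc α₂ β₂, |S.L₁ k l y / (k + l)| ≤ C := fun S => by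
      obtain ⟨C, hC0, hC⟩ := S.exists_abs_L₁_le
      refine ⟨C, hC0, fun k l y hy => ?_⟩
      rw [abs_div, abs_of_nonneg (by positivity : (0 : ℝ) ≤ k + l)]
      have : (0 : ℝ) ≤ l := l.cast_nonneg
      exact div_le_of_le_mul₀ (by positivity) hC0 ((hC k l y hy).trans (by nlinarith))
    obtain ⟨C₁, h1, h1'⟩ := key S
    obtain ⟨C₂, h2, h2'⟩ := key S'
    obtain ⟨C₃, h3, h3'⟩ := key S.reflect
    obtain ⟨C₄, h4, h4'⟩ := key S'.reflect
    refine ⟨C₁ + C₂ + C₃ + C₄, by positivity, .of_forall fun i =>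
      ⟨fun y hy => (abs_sub _ _).trans ?_, fun t ht => (abs_sub _ _).trans ?_⟩⟩
    · linarith [h1' (k i) (l i) y hy, h2' (k' i) (l' i) y hy]
    · have ht' : -t ∈ Set.Icc (-β₁) (-α₁) := ⟨by linarith [ht.2], by linarith [ht.1]⟩
      have h5 := h3' (l i) (k i) (-t) ht'
      have h6 := h4' (l' i) (k' i) (-t) ht'
      rw [L₁_reflect, neg_neg, add_comm (l _ : ℝ)] at h5
      rw [L₁_reflect, neg_neg, add_comm (l' _ : ℝ)] at h6
      linarith
  · filter_upwards [abs_L₁_div_sub_le S S' h hc.1 hM hδ (hp.mono fun i hi => hi.2),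
      abs_L₂_div_sub_le S S' h hc.2 hM hδ (hp.mono fun i hi => hi.1)] with i h1 h2
    exact ⟨fun y hy => (h1 y hy).trans (by gcongr; exact le_max_left _ _),
      fun y hy => (h2 y hy).trans (by gcongr; exact le_max_right _ _)⟩

end

end Sys

/-- Lower bound for the `L²` norm of a monic polynomial. -/
lemma le_integral_sq {lo hi : ℝ} (h : lo < hi) {P : ℝ[X]} (hP : P.Monic) :
    ((hi - lo) / 4) ^ (2 * P.natDegree + 1) ≤ ∫ x in lo..hi, P.eval x ^ 2 := by
  set n := P.natDegree with hn
  set a := (hi - lo) / 4 with ha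
  have ha0 : 0 < a := by rw [ha]; linarith
  rcases Nat.eq_zero_or_pos n with h0 | h0
  · have : P = 1 := hP.natDegree_eq_zero.1 h0
    simp only [h0, this, eval_one, one_pow, intervalIntegral.integral_const, smul_eq_mul, mul_one]
    simp only [mul_zero, zero_add, pow_one]
    linarith
  have hO : OuterBound 1 n (1 / 2) (1 / 2) := by
    refine ⟨by norm_num, by norm_num, fun z _ => by simp, by norm_num, le_rfl, fun z hz => ?_⟩
    simp only [map_one, mul_one, norm_pow, hz, norm_one]
    exact pow_le_of_le_one (by norm_num) (by norm_num) (by omega)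
  have h1 := hO.lower_bound ((lo + hi) / 2) (a := a) hP rfl
  rw [cnorm_sq, mul_one, coeff_one_zero, mul_one] at h1
  have hc : ContinuousOn (fun x => P.eval x ^ 2) (Set.Icc lo hi) := by fun_prop
  have hc' := continuousOn_circle h hc
  have h2 : circleAverage (fun z => ‖szegoFun ((lo + hi) / 2) a n (1 - X ^ 2) P z‖ ^ 2) 0 1 ≤
      circleAverage (fun z => 2 * (P.eval ((lo + hi) / 2 + 2 * a * z.re) ^ 2 * ‖1 - z ^ 2‖)) 0 1 := by
    have hcc : ContinuousOn (fun z : ℂ => P.eval ((lo + hi) / 2 + 2 * a * z.re) ^ 2 * ‖1 - z ^ 2‖)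
        (sphere 0 1) := hc'.mul (by fun_prop)
    refine circleAverage_mono (circleIntegrable_of_sphere zero_le_one (ContinuousOn.congr
      (f := fun z : ℂ => P.eval ((lo + hi) / 2 + 2 * a * z.re) ^ 2 * ‖1 - z ^ 2‖ ^ 2)
      (hc'.mul (by fun_prop)) fun z hz => ?_))
      (circleIntegrable_of_sphere zero_le_one (hcc.const_mul 2)) fun z hz => ?_
    · rw [norm_szegoFun_circle _ _ _ _ _ (by simpa using hz)]; simp
    · have hz : ‖z‖ = 1 := by simpa using hz
      rw [norm_szegoFun_circle _ _ _ _ _ hz]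
      have : ‖1 - z ^ 2‖ ≤ 2 := (norm_sub_le _ _).trans (by rw [norm_pow, hz]; norm_num)
      have h3 : 0 ≤ P.eval ((lo + hi) / 2 + 2 * a * z.re) ^ 2 * ‖1 - z ^ 2‖ := by positivity
      simp only [map_sub, map_one, map_pow, aeval_X]
      nlinarith
  rw [integral_eq_circleAverage h hc]
  have h4 : circleAverage (fun z => 2 * (P.eval ((lo + hi) / 2 + 2 * a * z.re) ^ 2 *
      ‖1 - z ^ 2‖)) 0 1 = 2 * circleAverage (fun z =>
      (P.eval ((lo + hi) / 2 + 2 * a * z.re) ^ 2 * ‖1 - z ^ 2‖)) 0 1 :=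
    circleAverage_fun_smul (a := (2 : ℝ))
  rw [h4] at h2
  have h5 := h1.trans h2
  have h6 : (a ^ n) ^ 2 ≤ π * circleAverage (fun z =>
      (P.eval ((lo + hi) / 2 + 2 * a * z.re) ^ 2 * ‖1 - z ^ 2‖)) 0 1 := by
    have : 0 ≤ (a ^ n) ^ 2 := by positivity
    have h7 : 2 / 3 * (a ^ n) ^ 2 ≤ circleAverage (fun z =>
      (P.eval ((lo + hi) / 2 + 2 * a * z.re) ^ 2 * ‖1 - z ^ 2‖)) 0 1 := by
      norm_num at h5 ⊢
      linarith
    nlinarith [pi_gt_three]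
  rw [pow_succ, pow_mul', mul_right_comm]
  exact mul_le_mul_of_nonneg_right h6 ha0.le

namespace Sys

variable (S : Sys α₁ β₁ α₂ β₂)

/-- With few orthogonality conditions on the first interval, weighted mass sits near `α₁`. -/
lemma concentration {δ : ℝ} (hδ : 0 < δ) : ∃ η : ℝ, 0 < η ∧ ∀ᶠ l : ℕ in atTop, ∀ (k : ℕ) (g : ℝ[X]),
    g.Monic → g.natDegree ≤ η * l →
    (∀ x ∈ Set.Icc α₁ β₁, |g.eval x| ≤ (β₁ - α₁) ^ g.natDegree) →
    ∫ x in α₁..β₁, (x - α₁) * (g.eval x ^ 2 * (qprod (S.Z₂ k l).val x * S.f₁ x)) ≤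
      δ * ∫ x in α₁..β₁, g.eval x ^ 2 * (qprod (S.Z₂ k l).val x * S.f₁ x) := by
  have h1 := S.h₁; have h2 := S.h₂; have h3 := S.h₃
  have hne : (Set.Icc α₁ β₁).Nonempty := ⟨α₁, le_rfl, h1.le⟩
  obtain ⟨x₀, hx₀, hm⟩ := isCompact_Icc.exists_isMinOn hne S.cont₁
  obtain ⟨x₁, hx₁, hM⟩ := isCompact_Icc.exists_isMaxOn hne S.cont₁
  set m := S.f₁ x₀
  set M := S.f₁ x₁
  have hm0 : 0 < m := S.pos₁ x₀ hx₀
  have hM0 : 0 < M := S.pos₁ x₁ hx₁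
  set D := β₁ - α₁ with hD
  have hD0 : 0 < D := by rw [hD]; linarith
  set d := min (δ / 2) (D / 2) with hd
  have hd0 : 0 < d := by rw [hd]; positivity
  have hdδ : 2 * d ≤ δ := by linarith [min_le_left (δ / 2) (D / 2)]
  have hdD : 2 * d ≤ D := by linarith [min_le_right (δ / 2) (D / 2)]
  set θ := d / (β₂ - α₁) with hθ
  have hθ0 : 0 < θ := div_pos hd0 (by linarith)
  set R := D / (d / 4)
  have hR : 1 < R := (one_lt_div (by linarith)).2 (by linarith)
  have hlR := log_pos hR
  have hlθ : 0 < log (1 + θ) := log_pos (by linarith)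
  set C := M * D ^ 2 / (d * m * (d / 4)) with hC
  have hlim : Tendsto (fun l : ℕ => exp (log (1 + θ) / 2 * l)) atTop atTop :=
    tendsto_exp_atTop.comp
      ((tendsto_natCast_atTop_atTop (R := ℝ)).const_mul_atTop (half_pos hlθ))
  refine ⟨log (1 + θ) / (4 * log R), by positivity, ?_⟩
  filter_upwards [hlim.eventually_ge_atTop C] with l hl k g hg hn hgD
  set n := g.natDegree
  set Q := qprod (S.Z₂ k l).val
  have hQ0 : ∀ x ≤ β₁, 0 < Q x := fun x hx => qprod_pos fun t ht => by linarith [S.Z₂_ge ht]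
  have hQanti : ∀ x y, x ≤ y → y ≤ β₁ → Q y ≤ Q x := fun x y hxy hy =>
    Multiset.prod_map_le_prod_map₀ _ _ (fun t ht => by linarith [S.Z₂_ge ht]) fun t _ => by
      linarith
  have hQθ : (1 + θ) ^ l * Q (α₁ + 2 * d) ≤ Q (α₁ + d) := by
    have e : (1 + θ) ^ l * Q (α₁ + 2 * d) =
        ((S.Z₂ k l).val.map fun t => (1 + θ) * (t - (α₁ + 2 * d))).prod := by
      rw [Multiset.prod_map_mul, Multiset.map_const', Multiset.prod_replicate, Finset.card_val,
        S.card_Z₂]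
      rfl
    rw [e]
    refine Multiset.prod_map_le_prod_map₀ _ _ (fun t ht => ?_) fun t ht => ?_
    · exact mul_nonneg (by linarith) (by linarith [S.Z₂_ge ht])
    · have ht2 := (S.mem_Z₂.1 ht).1.2
      have : θ * (β₂ - α₁) = d := div_mul_cancel₀ _ (by linarith)
      nlinarith
  have hmain : C * R ^ (2 * n) ≤ (1 + θ) ^ l := by
    have e1 : R ^ (2 * n) = exp (2 * n * log R) := by
      rw [← exp_log (pow_pos (by linarith : 0 < R) (2 * n)), log_pow]; push_cast; rfl
    have e2 : (1 + θ) ^ l = exp (log (1 + θ) / 2 * l) * exp (log (1 + θ) / 2 * l) := by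
      rw [← exp_add, ← add_mul, add_halves, mul_comm, ← log_pow, exp_log (by positivity)]
    rw [e1, e2]
    refine mul_le_mul hl (exp_le_exp.2 ?_) (exp_pos _).le (exp_pos _).le
    have := mul_le_mul_of_nonneg_right hn (by positivity : 0 ≤ 2 * log R)
    have e : log (1 + θ) / (4 * log R) * l * (2 * log R) = log (1 + θ) / 2 * l := by
      field_simp; ring
    linarith
  have hw : ContinuousOn (fun x => g.eval x ^ 2 * (Q x * S.f₁ x)) (Set.Icc α₁ β₁) :=
    ContinuousOn.mul (by fun_prop) (S.continuousOn_weight _)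
  have hi : ∀ {h : ℝ → ℝ} {u v : ℝ}, ContinuousOn h (Set.Icc α₁ β₁) → α₁ ≤ u → u ≤ v → v ≤ β₁ →
      IntervalIntegrable h volume u v := fun hh hu huv hv =>
    (hh.mono (Set.Icc_subset_Icc hu hv)).intervalIntegrable_of_Icc huv
  set h : ℝ → ℝ := fun x => (x - (α₁ + 2 * d)) * (g.eval x ^ 2 * (Q x * S.f₁ x)) with hh
  have hhc : ContinuousOn h (Set.Icc α₁ β₁) := ContinuousOn.mul (by fun_prop) hw
  have i1 : ∫ x in α₁..(α₁ + d), h x ≤ -(d * m * Q (α₁ + d) * (d / 4) ^ (2 * n + 1)) := by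
    have hle : ∫ x in α₁..(α₁ + d), h x ≤
        ∫ x in α₁..(α₁ + d), -(d * m * Q (α₁ + d)) * g.eval x ^ 2 := by
      refine intervalIntegral.integral_mono_on (by linarith)
        (hi hhc le_rfl (by linarith) (by linarith)) (Continuous.intervalIntegrable (by fun_prop) _ _)
        fun x hx => ?_
      have hxI : x ∈ Set.Icc α₁ β₁ := ⟨hx.1, by linarith [hx.2]⟩
      have h5 : Q (α₁ + d) * m ≤ Q x * S.f₁ x :=
        mul_le_mul (hQanti _ _ hx.2 (by linarith)) (hm hxI) hm0.le (hQ0 x hxI.2).le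
      have h6 := mul_nonneg (hQ0 (α₁ + d) (by linarith)).le hm0.le
      have h7 : d * (Q (α₁ + d) * m) ≤ (α₁ + 2 * d - x) * (Q x * S.f₁ x) :=
        mul_le_mul (by linarith [hx.2]) h5 h6 (by linarith [hx.2])
      have := mul_le_mul_of_nonneg_left h7 (sq_nonneg (g.eval x))
      simp only [hh]
      linarith
    rw [intervalIntegral.integral_const_mul] at hle
    have h5 := le_integral_sq (by linarith : α₁ < α₁ + d) hg
    rw [add_sub_cancel_left] at h5
    have h6 : 0 ≤ d * m * Q (α₁ + d) := by have := hQ0 (α₁ + d) (by linarith); positivity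
    have := mul_le_mul_of_nonneg_left h5 h6
    linarith
  have i2 : ∫ x in (α₁ + d)..(α₁ + 2 * d), h x ≤ 0 := by
    rw [← neg_nonneg, ← intervalIntegral.integral_neg]
    refine intervalIntegral.integral_nonneg (by linarith) fun x hx => ?_
    have hxI : x ∈ Set.Icc α₁ β₁ := ⟨by linarith [hx.1], by linarith [hx.2]⟩
    simp only [hh, ← neg_mul]
    exact mul_nonneg (by linarith [hx.2])
      (mul_nonneg (sq_nonneg _) (mul_pos (hQ0 x hxI.2) (S.pos₁ x hxI)).le)
  have i3 : ∫ x in (α₁ + 2 * d)..β₁, h x ≤ D * (D * D ^ (2 * n) * (Q (α₁ + 2 * d) * M)) := by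
    have hle : ∫ x in (α₁ + 2 * d)..β₁, h x ≤
        ∫ x in (α₁ + 2 * d)..β₁, D * D ^ (2 * n) * (Q (α₁ + 2 * d) * M) := by
      refine intervalIntegral.integral_mono_on (by linarith)
        (hi hhc (by linarith) (by linarith) le_rfl) (by simp) fun x hx => ?_
      have hxI : x ∈ Set.Icc α₁ β₁ := ⟨by linarith [hx.1], hx.2⟩
      have h5 : Q x * S.f₁ x ≤ Q (α₁ + 2 * d) * M :=
        mul_le_mul (hQanti _ _ hx.1 hx.2) (hM hxI) (S.pos₁ x hxI).le (hQ0 _ (by linarith)).le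
      have h6 : g.eval x ^ 2 ≤ D ^ (2 * n) := by
        rw [pow_mul', ← sq_abs]
        exact pow_le_pow_left₀ (abs_nonneg _) (hgD x hxI) 2
      have h7 := (mul_pos (hQ0 x hxI.2) (S.pos₁ x hxI)).le
      simp only [hh, mul_assoc D]
      exact mul_le_mul (by linarith [hx.2]) (mul_le_mul h6 h5 h7 (by positivity))
        (mul_nonneg (sq_nonneg _) h7) hD0.le
    rw [intervalIntegral.integral_const, smul_eq_mul] at hle
    refine hle.trans (mul_le_mul_of_nonneg_right (by linarith) ?_)
    have := hQ0 (α₁ + 2 * d) (by linarith)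
    positivity
  have hsum : ∫ x in α₁..β₁, h x ≤ 0 := by
    rw [← intervalIntegral.integral_add_adjacent_intervals
      (hi hhc le_rfl (by linarith : α₁ ≤ α₁ + d) (by linarith))
      (hi hhc (by linarith) (by linarith) le_rfl),
      ← intervalIntegral.integral_add_adjacent_intervals
      (hi hhc (by linarith) (by linarith : α₁ + d ≤ α₁ + 2 * d) (by linarith))
      (hi hhc (by linarith) (by linarith) le_rfl)]
    have e : D * (D * D ^ (2 * n) * (Q (α₁ + 2 * d) * M)) =
        d * m * (d / 4) ^ (2 * n + 1) * (C * R ^ (2 * n) * Q (α₁ + 2 * d)) := by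
      rw [hC, div_pow D, pow_succ (d / 4)]
      field_simp
    have h5 : C * R ^ (2 * n) * Q (α₁ + 2 * d) ≤ Q (α₁ + d) :=
      (mul_le_mul_of_nonneg_right hmain (hQ0 _ (by linarith)).le).trans hQθ
    have := mul_le_mul_of_nonneg_left h5 (by positivity : 0 ≤ d * m * (d / 4) ^ (2 * n + 1))
    linarith
  have hpos : 0 ≤ ∫ x in α₁..β₁, g.eval x ^ 2 * (Q x * S.f₁ x) :=
    intervalIntegral.integral_nonneg h1.le fun x hx =>
      mul_nonneg (sq_nonneg _) (mul_pos (hQ0 x hx.2) (S.pos₁ x hx)).le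
  have e : ∫ x in α₁..β₁, h x = (∫ x in α₁..β₁, (x - α₁) * (g.eval x ^ 2 * (Q x * S.f₁ x))) -
      2 * d * ∫ x in α₁..β₁, g.eval x ^ 2 * (Q x * S.f₁ x) := by
    have hc : ContinuousOn (fun x => (x - α₁) * (g.eval x ^ 2 * (Q x * S.f₁ x)))
      (Set.Icc α₁ β₁) := ContinuousOn.mul (by fun_prop) hw
    rw [← intervalIntegral.integral_const_mul, ← intervalIntegral.integral_sub
      (hi hc le_rfl h1.le le_rfl) ((hi hw le_rfl h1.le le_rfl).const_mul _)]
    exact intervalIntegral.integral_congr fun x _ => by simp only [hh]; ring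
  have := mul_le_mul_of_nonneg_right hdδ hpos
  linarith

lemma abs_prod_le {s : Finset ℝ} (hs : ∀ a ∈ s, a ∈ Set.Icc α₁ β₁) {x : ℝ}
    (hx : x ∈ Set.Icc α₁ β₁) :
    |((s.val.map fun a => X - C a).prod : ℝ[X]).eval x| ≤ (β₁ - α₁) ^ s.card := by
  have e : ((s.val.map fun a => X - C a).prod : ℝ[X]).eval x = ∏ a ∈ s, (x - a) := by
    rw [eval_multiset_prod, Multiset.map_map]
    simp
  rw [e, Finset.abs_prod, ← Finset.prod_const]
  refine Finset.prod_le_prod (fun _ _ => abs_nonneg _) fun a ha => abs_le.2 ?_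
  have := hs a ha
  constructor <;> linarith [hx.1, hx.2, this.1, this.2]

/-- If `k` is small compared to `l`, the zeros on the first interval cluster at `α₁`. -/
lemma Z₁_le {δ : ℝ} (hδ : 0 < δ) : ∃ η : ℝ, 0 < η ∧ ∀ᶠ l : ℕ in atTop, ∀ k : ℕ, k ≤ η * l →
    ∀ x ∈ S.Z₁ k l, x ≤ α₁ + δ := by
  obtain ⟨η, hη, h⟩ := S.concentration hδ
  refine ⟨η, hη, h.mono fun l hl k hk x hx => ?_⟩
  set g : ℝ[X] := (((S.Z₁ k l).erase x).val.map fun a => X - C a).prod with hgdef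
  have hcard : ((S.Z₁ k l).erase x).card + 1 = k := by
    rw [Finset.card_erase_add_one hx, S.card_Z₁]
  have hg : g.Monic := monic_multiset_prod_of_monic _ _ fun a _ => monic_X_sub_C a
  have hgn : g.natDegree = ((S.Z₁ k l).erase x).card :=
    natDegree_multiset_prod_X_sub_C_eq_card _
  have hp : S.p₁ k l = (X - C x) * g := by
    rw [p₁, hgdef, ← Multiset.prod_cons, ← Multiset.map_cons (fun a => X - C a), Finset.erase_val,
      Multiset.cons_erase hx]
  have hw := S.continuousOn_weight (S.Z₂ k l).val
  have h0 := (S.orth_p₁ k l).integral_mul_eq_zero S.h₁.le hw (g := g) (by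
    rw [← natDegree_lt_iff_degree_lt hg.ne_zero]; omega)
  have hgk : (g.natDegree : ℝ) ≤ η * l := by
    refine le_trans ?_ hk
    exact_mod_cast (by omega : g.natDegree ≤ k)
  have h1 := hl k g hg hgk fun y hy => hgn ▸ abs_prod_le
    (fun a ha => Set.Ioo_subset_Icc_self (S.mem_Z₁.1 (Finset.mem_of_mem_erase ha)).1) hy
  have hc : IntervalIntegrable (fun y => g.eval y ^ 2 * (qprod (S.Z₂ k l).val y * S.f₁ y))
      volume α₁ β₁ := intervalIntegrable_eval_mul S.h₁.le hw (g := fun y => g.eval y ^ 2)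
        (by fun_prop)
  have e : ∫ y in α₁..β₁, (y - α₁) * (g.eval y ^ 2 * (qprod (S.Z₂ k l).val y * S.f₁ y)) =
      (x - α₁) * ∫ y in α₁..β₁, g.eval y ^ 2 * (qprod (S.Z₂ k l).val y * S.f₁ y) := by
    rw [← intervalIntegral.integral_const_mul, ← sub_eq_zero,
      ← intervalIntegral.integral_sub _ (hc.const_mul _), ← h0]
    · refine intervalIntegral.integral_congr fun y _ => ?_
      simp only [hp, eval_mul, eval_sub, eval_X, eval_C]
      ring
    · exact (ContinuousOn.mul (by fun_prop) (ContinuousOn.mul (by fun_prop) hw)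
        ).intervalIntegrable_of_Icc S.h₁.le
  rw [e] at h1
  have h2 := integral_sq_mul_pos S.h₁ hw (fun y hy => mul_pos (S.qprod_Z₂_pos (by
    linarith [hy.2, S.h₂])) (S.pos₁ y hy)) hg.ne_zero
  linarith [le_of_mul_le_mul_right h1 h2]

/-- If `k` is small compared to `l`, raising `k` shrinks the norm. -/
lemma I₁_succ_le {ε : ℝ} (hε : 0 < ε) : ∃ η : ℝ, 0 < η ∧ ∀ᶠ l : ℕ in atTop, ∀ k : ℕ, k ≤ η * l →
    S.I₁ (k + 1) l ≤ ε * S.I₁ k l := by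
  have h1 := S.h₁; have h2 := S.h₂
  have hD : 0 < β₁ - α₁ := by linarith
  set K := 1 / (α₂ - β₁) * (β₂ - α₂) with hK
  obtain ⟨η, hη, h⟩ := S.concentration (δ := ε / (exp K * (β₁ - α₁))) (by positivity)
  refine ⟨η, hη, h.mono fun l hl k hk => ?_⟩
  have h3 := hl k (S.p₁ k l) (S.p₁_monic k l) (by rwa [S.natDegree_p₁]) fun x hx => by
    rw [S.natDegree_p₁]
    have := abs_prod_le (s := S.Z₁ k l) (fun a ha => Set.Ioo_subset_Icc_self (S.mem_Z₁.1 ha).1) hx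
    rwa [S.card_Z₁, ← p₁] at this
  set q := (X - C α₁) * S.p₁ k l with hq
  have hqm : q.Monic := (monic_X_sub_C _).mul (S.p₁_monic k l)
  have hqn : q.natDegree = k + 1 := by
    rw [hq, natDegree_mul (X_sub_C_ne_zero _) (S.p₁_monic k l).ne_zero, natDegree_X_sub_C,
      S.natDegree_p₁, add_comm]
  have h4 := (S.orth_p₁ (k + 1) l).integral_sq_eq h1.le (S.continuousOn_weight (S.Z₂ (k + 1) l).val)
    (S.p₁_monic _ _) (S.natDegree_p₁ (k + 1) l) hqm hqn
  have hwpos : ∀ k l : ℕ, ∀ x ∈ Set.Icc α₁ β₁, 0 < qprod (S.Z₂ k l).val x * S.f₁ x :=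
    fun k l x hx => mul_pos (S.qprod_Z₂_pos (by linarith [hx.2])) (S.pos₁ x hx)
  have h5 : 0 ≤ ∫ x in α₁..β₁, (q - S.p₁ (k + 1) l).eval x ^ 2 *
      (qprod (S.Z₂ (k + 1) l).val x * S.f₁ x) :=
    intervalIntegral.integral_nonneg h1.le fun x hx => mul_nonneg (sq_nonneg _) (hwpos _ _ x hx).le
  have h6 : ∫ x in α₁..β₁, q.eval x ^ 2 * (qprod (S.Z₂ (k + 1) l).val x * S.f₁ x) ≤
      ∫ x in α₁..β₁, exp K * (β₁ - α₁) * ((x - α₁) * ((S.p₁ k l).eval x ^ 2 *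
        (qprod (S.Z₂ k l).val x * S.f₁ x))) := by
    refine intervalIntegral.integral_mono_on h1.le
      (ContinuousOn.intervalIntegrable_of_Icc h1.le (ContinuousOn.mul (by fun_prop)
        (S.continuousOn_weight _)))
      (ContinuousOn.intervalIntegrable_of_Icc h1.le (ContinuousOn.mul (by fun_prop)
        (ContinuousOn.mul (by fun_prop) (ContinuousOn.mul (by fun_prop)
        (S.continuousOn_weight _))))) fun x hx => ?_
    have hxα : x < α₂ := by linarith [hx.2]
    have h7 := (abs_le.1 (S.abs_sum_Z₂_sub_le (k := k) (l := l) (e := 1) (e' := 0) rfl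
      (G := fun y => log (y - x)) (by have : 0 < α₂ - x := by linarith
                                      positivity) (lip_log_sub' hxα))).2
    have h8 : qprod (S.Z₂ (k + 1) l).val x ≤ exp K * qprod (S.Z₂ k l).val x := by
      rw [← exp_log (S.qprod_Z₂_pos (k := k + 1) (l := l) hxα.le),
        ← exp_log (S.qprod_Z₂_pos (k := k) (l := l) hxα.le), ← exp_add,
        S.log_qprod_Z₂ hxα.le, S.log_qprod_Z₂ hxα.le]
      refine exp_le_exp.2 ?_
      have : 1 / (α₂ - x) * (β₂ - α₂) ≤ K := by
        rw [hK]
        have : 0 < α₂ - β₁ := by linarith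
        have : 0 ≤ β₂ - α₂ := by linarith [S.h₃]
        have := hx.2
        gcongr
      simp only [add_zero, Nat.cast_zero, zero_mul, sub_zero] at h7
      linarith
    have h9 : (x - α₁) ^ 2 ≤ (β₁ - α₁) * (x - α₁) := by nlinarith [hx.1, hx.2]
    have h10 := mul_le_mul h9 (mul_le_mul_of_nonneg_right h8 (S.pos₁ x hx).le)
      (hwpos _ _ x hx).le (mul_nonneg hD.le (by linarith [hx.1]))
    have := mul_le_mul_of_nonneg_left h10 (sq_nonneg ((S.p₁ k l).eval x))
    simp only [hq, eval_mul, eval_sub, eval_X, eval_C]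
    linarith
  rw [intervalIntegral.integral_const_mul] at h6
  have h7 := mul_le_mul_of_nonneg_left h3 (by positivity : 0 ≤ exp K * (β₁ - α₁))
  rw [← mul_assoc, mul_div_cancel₀ _ (by positivity)] at h7
  unfold I₁
  linarith

end Sys

namespace Sys

variable (S S' : Sys α₁ β₁ α₂ β₂) {ι : Type*} {F : Filter ι}
  {k l k' l' : ι → ℕ} {c : ℝ}

lemma endpt_sub_le (h : SameRay F k l k' l' c) (hc : 0 < c) (hc1 : c ≤ 1) {ε : ℝ} (hε : 0 < ε) :
    ∀ᶠ i in F, S'.endpt (k' i) (l' i) - S.endpt (k i) (l i) ≤ ε := by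
  obtain ⟨a', ha', -, hg'⟩ := S'.endpt_good (half_pos hc)
  obtain ⟨a, ha, -, hg⟩ := S.endpt_good (half_pos hc)
  have hb : ∀ᶠ i in F, α₁ < S'.endpt (k' i) (l' i) ∧ S'.endpt (k' i) (l' i) ≤ β₁ := by
    filter_upwards [(h.symm.tendsto_left hc).eventually hg', h.symm.comparable hc] with i h1 h2
    exact ⟨ha'.trans_le (h1 _ h2).1.1, (h1 _ h2).1.2⟩
  have h1 := S.h₁; have h2 := S.h₂; have h3 := S.h₃
  rcases hc1.lt_or_eq with hc1 | rfl
  · obtain ⟨K, hK⟩ := S'.asymp_L₁ (half_pos hc)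
    have hlim : Tendsto (fun i => K / ((k' i : ℝ) + l' i)) F (𝓝 0) :=
      tendsto_const_nhds.div_atTop h.sum'
    set R := 16 * (β₂ - α₁) ^ 2
    have hR : 0 < R := by
      have : 0 < β₂ - α₁ := by linarith
      positivity
    set ε₁ := (1 - c) / 2 * (ε ^ 2 / R) / 6 with hε₁
    have hε₁0 : 0 < ε₁ := by
      have : 0 < 1 - c := by linarith
      positivity
    have hpc := potentials_close S S' h ⟨hc.le, hc1.le⟩ hε₁0
    filter_upwards [hb, hpc, F₁_div_sub_le S S' h hε₁0.le hε₁0 hb (hpc.mono fun i hi => hi.2),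
      (h.tendsto_left hc).eventually (S.L₁_le (half_pos hc) hε₁0),
      (h.symm.tendsto_left hc).eventually hK, h.comparable hc, h.symm.comparable hc,
      h.swap.comparable (by linarith), hlim.eventually_le_const hε₁0,
      h.sum.eventually_gt_atTop 0, h.sum'.eventually_gt_atTop 0]
      with i ⟨hb0, hb1⟩ h4 h5 h6 h7 h8 h9 h10 h11 hN hN'
    by_contra! hlt
    have hy : α₂ ∈ Set.Icc α₂ β₂ := ⟨le_rfl, h3.le⟩
    set b := S'.endpt (k' i) (l' i)
    set d := S.endpt (k i) (l i)
    have g1 := (h6 _ h8 b hb0 hb1 α₂ hy).2 (by linarith)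
    have g2 := (abs_le.1 (h4.1 α₂ hy)).1
    have g3 := (abs_le.1 (h5 α₂ hy)).2
    have g4 : S'.F₁ (k' i) (l' i) b α₂ / (k' i + l' i) ≤
        S'.L₁ (k' i) (l' i) α₂ / (k' i + l' i) + K / (k' i + l' i) := by
      rw [← add_div, div_le_div_iff_of_pos_right hN']
      linarith [(abs_le.1 (h7 _ h9 α₂ le_rfl)).1]
    have g5 : S.L₁ (k i) (l i) α₂ / (k i + l i) + l i * (b - d) ^ 2 / R / (k i + l i) ≤
        S.F₁ (k i) (l i) b α₂ / (k i + l i) + ε₁ := by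
      rw [← add_div, div_add' _ _ _ hN.ne', div_le_div_iff_of_pos_right hN]
      have : (0 : ℝ) ≤ l i := Nat.cast_nonneg _
      nlinarith
    have g6 : (1 - sfun α₁ β₁ α₂) * ε₁ ≤ ε₁ := by
      nlinarith [sfun_nonneg (α := α₁) (β := β₁) (x := α₂)]
    have g7 : 6 * ε₁ ≤ l i * (b - d) ^ 2 / R / (k i + l i) := by
      rw [le_div_iff₀ hN, le_div_iff₀ hR, hε₁]
      have e1 : ε ^ 2 ≤ (b - d) ^ 2 := by gcongr
      have e2 := mul_le_mul h10 e1 (sq_nonneg _) (Nat.cast_nonneg _)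
      have e3 : 6 * ((1 - c) / 2 * (ε ^ 2 / R) / 6) * (k i + l i) * R =
        (1 - c) / 2 * (l i + k i) * ε ^ 2 := by field_simp; ring
      linarith
    linarith
  · have hr := h.swap.ratio.const_mul (β₁ - α₁)
    have hlim : Tendsto (fun i => (β₁ - α₁) * ((l i : ℝ) / (l i + k i))) F (𝓝 0) := by
      simpa using hr
    filter_upwards [hb, (h.tendsto_left hc).eventually hg, h.comparable hc,
      (h.tendsto_left hc).eventually (eventually_Dn_le 0), h.sum.eventually_gt_atTop 0,
      hlim.eventually_lt_const (show 0 < (α₂ - β₁) / 2 by linarith)] with i hb h4 h5 h6 hN h7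
    obtain ⟨h8, -, h9, -⟩ := h4 _ h5
    rcases le_endpoint (ha.trans_le h8.1) h8.2 h2 (fun x hx => S.Z₂_ge hx) h9 h6.2.1 with h10 | h10
    · linarith [hb.2]
    · exfalso
      rw [show (S.Z₂ (k i) (l i)).val.card = l i from S.card_Z₂ _ _] at h10
      rw [← mul_div_assoc, div_lt_iff₀ (by linarith)] at h7
      have : (0 : ℝ) ≤ l i := Nat.cast_nonneg _
      nlinarith [h8.2]

lemma abs_endpt_sub_le (h : SameRay F k l k' l' c) (hc : 0 < c) (hc1 : c ≤ 1) {ε : ℝ}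
    (hε : 0 < ε) : ∀ᶠ i in F, |S'.endpt (k' i) (l' i) - S.endpt (k i) (l i)| ≤ ε := by
  filter_upwards [endpt_sub_le S S' h hc hc1 hε, endpt_sub_le S' S h.symm hc hc1 hε] with i h1 h2
  exact abs_le.2 ⟨by linarith, h1⟩

end Sys

namespace Sys

section

variable (S : Sys α₁ β₁ α₂ β₂) {k l e e' : ℕ}

/-- The change of the sum over the zeros in the first interval under a step `(e, e')`. -/
def D₁ (k l e e' : ℕ) : (ℝ → ℝ) →ₗ[ℝ] ℝ := sumOn (S.Z₁ (k + e) (l + e')) - sumOn (S.Z₁ k l)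

/-- The change of the sum over the zeros in the second interval under a step `(e, e')`. -/
def D₂ (k l e e' : ℕ) : (ℝ → ℝ) →ₗ[ℝ] ℝ := sumOn (S.Z₂ (k + e) (l + e')) - sumOn (S.Z₂ k l)

lemma D₁_reflect (G : ℝ → ℝ) : S.reflect.D₁ l k e' e G = S.D₂ k l e e' fun x => G (-x) := by
  simp [D₁, D₂, sum_Z₁_reflect]

lemma D₂_reflect (G : ℝ → ℝ) : S.reflect.D₂ l k e' e G = S.D₁ k l e e' fun x => G (-x) := by
  simp [D₁, D₂, sum_Z₂_reflect]

lemma D₂_mem : S.D₂ k l e e' ∈ evalSpan α₂ := Submodule.sub_mem _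
  (sumOn_mem fun _ hx => S.Z₂_ge hx) (sumOn_mem fun _ hx => S.Z₂_ge hx)

lemma D₁_log (y : ℝ) : (S.D₁ k l e e' fun x => log (y - x)) =
    S.L₁ (k + e) (l + e') y - S.L₁ k l y := by simp [D₁, L₁]

lemma abs_D₁_le (he : e + e' = 1) {G : ℝ → ℝ} {K : ℝ} (hK : 0 ≤ K)
    (hG : ∀ x ∈ Set.Icc α₁ β₁, ∀ y ∈ Set.Icc α₁ β₁, |G x - G y| ≤ K * |x - y|) :
    |S.D₁ k l e e' G - e * G α₁| ≤ K * (β₁ - α₁) := by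
  simpa [D₁] using S.abs_sum_Z₁_sub_le he hK hG

lemma abs_D₁_log_le (he : e + e' = 1) {y : ℝ} (hy : α₂ ≤ y) :
    |(S.D₁ k l e e' fun x => log (y - x)) - e * log (y - α₁)| ≤ (β₁ - α₁) / (α₂ - β₁) := by
  have h := S.h₂
  refine (S.abs_D₁_le he (one_div_nonneg.2 (by linarith)) (lip_log_sub (h.trans_le hy))).trans ?_
  rw [one_div_mul_eq_div]
  exact div_le_div_of_nonneg_left (by linarith [S.h₁]) (by linarith) (by linarith)

end

variable (S S' : Sys α₁ β₁ α₂ β₂) {ι : Type*} {F : Filter ι}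
  {k l k' l' : ι → ℕ} {c : ℝ} {e e' : ℕ}

lemma common_endpt (h : SameRay F k l k' l' c) (hc : 0 < c) (hc1 : c ≤ 1) (he : e + e' = 1)
    {ε : ℝ} (hε : 0 < ε) : ∀ᶠ i in F, ∃ b, α₁ < b ∧ b ≤ β₁ ∧
      |((log (S.I₁ (k i + e) (l i + e')) - log (S.I₁ (k i) (l i))) -
        (log (S'.I₁ (k' i + e) (l' i + e')) - log (S'.I₁ (k' i) (l' i)))) -
        (S.D₂ (k i) (l i) e e' - S'.D₂ (k' i) (l' i) e e') (Afun α₁ b)| ≤ ε ∧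
      ∀ y, α₂ ≤ y → |((S.D₁ (k i) (l i) e e' - S'.D₁ (k' i) (l' i) e e') fun x => log (y - x)) +
        (S.D₂ (k i) (l i) e e' - S'.D₂ (k' i) (l' i) e e') fun x => Bfun α₁ b x y| ≤ ε := by
  have h2 := S.h₂
  obtain ⟨a, ha, -, hg⟩ := S.endpt_good (half_pos hc)
  obtain ⟨a', ha', -, hg'⟩ := S'.endpt_good (half_pos hc)
  obtain ⟨C, hC⟩ := S.exists_abs_net_sub_le
  set a₀ := min a a'
  have ha₀ : α₁ < a₀ := lt_min ha ha'
  have hlim : Tendsto (fun x => max ((β₁ - α₁) / (α₂ - β₁) / (2 * (a₀ - α₁)) * C * x)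
      (C / (a₀ - α₁) * x)) (𝓝 0) (𝓝 0) := by
    have : Continuous fun x => max ((β₁ - α₁) / (α₂ - β₁) / (2 * (a₀ - α₁)) * C * x)
      (C / (a₀ - α₁) * x) := by fun_prop
    simpa using this.tendsto 0
  obtain ⟨r, hr, hball⟩ := Metric.eventually_nhds_iff.1
    (hlim.eventually_le_const (show 0 < ε / 3 by positivity))
  filter_upwards [abs_endpt_sub_le S S' h hc hc1 (half_pos hr),
    (h.tendsto_left hc).eventually hg, (h.symm.tendsto_left hc).eventually hg',
    (h.tendsto_left hc).eventually (S.asymp_sub (half_pos hc) (show 0 < ε / 3 by positivity)),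
    (h.symm.tendsto_left hc).eventually
      (S'.asymp_sub (half_pos hc) (show 0 < ε / 3 by positivity)),
    h.comparable hc, h.symm.comparable hc] with i h3 h4 h5 h6 h7 h8 h9
  obtain ⟨b1, b2⟩ := (h4 _ h8).1
  obtain ⟨b1', b2'⟩ := (h5 _ h9).1
  obtain ⟨p1, p2⟩ := h6 _ h8 e e' he
  obtain ⟨p1', p2'⟩ := h7 _ h9 e e' he
  have hb : S.endpt (k i) (l i) ∈ Set.Icc a₀ β₁ := ⟨(min_le_left _ _).trans b1, b2⟩
  have hb' : S'.endpt (k' i) (l' i) ∈ Set.Icc a₀ β₁ := ⟨(min_le_right _ _).trans b1', b2'⟩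
  have hCi : ∀ b ∈ Set.Icc a₀ β₁, |S.net₁ (k i + e) (l i + e') b - S.net₁ (k i) (l i) b| ≤ C :=
    fun b hb => hC _ _ b e e' he ⟨by linarith [hb.1], hb.2⟩
  have hm := max_le_iff.1 (@hball |S'.endpt (k' i) (l' i) - S.endpt (k i) (l i)| (by
    rw [Real.dist_eq, sub_zero, abs_abs]; linarith))
  set b := S.endpt (k i) (l i)
  set b' := S'.endpt (k' i) (l' i)
  have q1 := (abs_Hfun_sub_sub_le ha₀ (fun x hx => h2.trans_le (S.Z₂_ge hx))
    (fun x hx => h2.trans_le (S.Z₂_ge hx)) hCi hb hb').trans hm.2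
  change |(S.H₁ (k i + e) (l i + e') b' - S.H₁ (k i) (l i) b') -
    (S.H₁ (k i + e) (l i + e') b - S.H₁ (k i) (l i) b)| ≤ _ at q1
  refine ⟨b', ha₀.trans_le hb'.1, hb'.2, ?_, fun y hy => ?_⟩
  · rw [H₁_eq, H₁_eq] at p1' q1
    simp only [D₂, LinearMap.sub_apply]
    push_cast at p1' q1
    rw [abs_le] at *
    constructor <;> linarith [p1.1, p1.2, p1'.1, p1'.2, q1.1, q1.2]
  · have q2 := (abs_Ffun_sub_sub_le ha₀ h2 (fun x hx => S.Z₂_ge hx)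
      (fun x hx => S.Z₂_ge hx) hy hCi hb hb').trans hm.1
    change |(S.F₁ (k i + e) (l i + e') b' y - S.F₁ (k i) (l i) b' y) -
      (S.F₁ (k i + e) (l i + e') b y - S.F₁ (k i) (l i) b y)| ≤ _ at q2
    have p3 := p2 y hy
    have p3' := p2' y hy
    rw [F₁_eq, F₁_eq] at p3' q2
    rw [LinearMap.sub_apply, D₁_log, D₁_log]
    simp only [D₂, LinearMap.sub_apply]
    push_cast at p3' q2
    rw [abs_le] at *
    constructor <;> linarith [p3.1, p3.2, p3'.1, p3'.2, q2.1, q2.2]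

lemma D₁_step_zero (h : SameRay F k l k' l' 0) (he : e + e' = 1) {ε : ℝ} (hε : 0 < ε) :
    ∀ᶠ i in F, ∀ y, α₂ ≤ y →
      |(S.D₁ (k i) (l i) e e' fun x => log (y - x)) - e * log (y - α₁)| ≤ ε := by
  have h1 := S.h₁; have h2 := S.h₂
  set K := 1 / (α₂ - β₁)
  have hK : 0 < K := one_div_pos.2 (by linarith)
  set δ := min (ε / K) (β₁ - α₁)
  have hδ : 0 < δ := lt_min (div_pos hε hK) (by linarith)
  obtain ⟨η, hη, hZ⟩ := S.Z₁_le hδ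
  have hl := h.swap.tendsto_left (by norm_num)
  have hr : Tendsto (fun i => (k i : ℝ) / (k i + l i) + 1 / (k i + l i)) F (𝓝 0) := by
    simpa using h.ratio.add ((tendsto_const_nhds (x := (1 : ℝ))).div_atTop h.sum)
  filter_upwards [hl.eventually hZ, (tendsto_add_atTop_nat e' |>.comp hl).eventually hZ,
    hr.eventually_le_const (show 0 < η / (1 + η) by positivity),
    h.sum.eventually_gt_atTop 0] with i h3 h4 h5 hN y hy
  have h6 : (k i : ℝ) + 1 ≤ η * l i := by
    rw [← add_div, div_le_div_iff₀ hN (by positivity)] at h5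
    nlinarith
  have hb : α₁ + δ ≤ β₁ := by linarith [min_le_right (ε / K) (β₁ - α₁)]
  have e1 : (e : ℝ) ≤ 1 := by exact_mod_cast (by omega : e ≤ 1)
  have h7 := S.abs_sum_Z₁_sub_le_of_le (k := k i) (l := l i) he (G := fun x => log (y - x))
    (K := K) (b := α₁ + δ) hK.le
    (by linarith) (fun x hx x' hx' => ?_) (h3 _ (by linarith)) (h4 _ (by
      have : (0 : ℝ) ≤ η * e' := by positivity
      simp only [Function.comp_apply]
      push_cast
      linarith))
  · have h8 : K * δ ≤ ε := by
      have := min_le_left (ε / K) (β₁ - α₁)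
      rwa [le_div_iff₀ hK, mul_comm] at this
    simp only [add_sub_cancel_left] at h7
    simpa [D₁] using h7.trans h8
  · refine (lip_log_sub (h2.trans_le hy) x ⟨hx.1, hx.2.trans hb⟩ x' ⟨hx'.1, hx'.2.trans hb⟩).trans
      (mul_le_mul_of_nonneg_right ?_ (abs_nonneg _))
    exact one_div_le_one_div_of_le (by linarith) (by linarith)

lemma D₁_step (h : SameRay F k l k' l' c) (hc : c ∈ Set.Icc (0 : ℝ) 1) (he : e + e' = 1) {M : ℝ}
    (hM : 0 ≤ M) (hG : ∀ᶠ i in F, ∀ t ≤ β₁, ∀ t' ≤ β₁,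
      ((S.D₂ (k i) (l i) e e' - S'.D₂ (k' i) (l' i) e e') fun x => log (x - t)) -
      ((S.D₂ (k i) (l i) e e' - S'.D₂ (k' i) (l' i) e e') fun x => log (x - t')) ≤ M)
    {ε : ℝ} (hε : 0 < ε) : ∀ᶠ i in F, ∀ y, α₂ ≤ y →
      |(S.D₁ (k i) (l i) e e' - S'.D₁ (k' i) (l' i) e e') fun x => log (y - x)| ≤ M / 2 + ε ∧
      ∀ y', α₂ ≤ y' →
      ((S.D₁ (k i) (l i) e e' - S'.D₁ (k' i) (l' i) e e') fun x => log (y - x)) -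
      ((S.D₁ (k i) (l i) e e' - S'.D₁ (k' i) (l' i) e e') fun x => log (y' - x)) ≤ M / 2 + ε := by
  rcases hc.1.lt_or_eq with hc0 | rfl
  · have h2 := S.h₂
    filter_upwards [hG, common_endpt S S' h hc0 hc.2 he (half_pos hε)]
      with i h3 ⟨b, hb, hb1, _, h4⟩ y hy
    have hosc := fun y y' hy hy' => osc_potential_le hb (hb1.trans_lt h2)
      (Submodule.sub_mem _ (S.D₂_mem (k := k i) (l := l i) (e := e) (e' := e'))
        (S'.D₂_mem (k := k' i) (l := l' i) (e := e) (e' := e')))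
      (fun t ht t' ht' => h3 t (ht.2.trans hb1) t' (ht'.2.trans hb1)) (y := y) (y' := y') hy hy'
    have g := abs_le.1 (h4 y hy)
    have g' := abs_le.1 (hosc y y (by linarith) (by linarith)).1
    refine ⟨abs_le.2 ⟨by linarith [g.1, g'.2], by linarith [g.2, g'.1]⟩, fun y' hy' => ?_⟩
    have g1 := abs_le.1 (h4 y' hy')
    have g2 := (hosc y' y (by linarith) (by linarith)).2
    linarith [g.2, g1.1]
  · filter_upwards [D₁_step_zero S h he (show 0 < ε / 4 by positivity),
      D₁_step_zero S' h.symm he (show 0 < ε / 4 by positivity)] with i h3 h4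
    have key : ∀ y, α₂ ≤ y →
        |(S.D₁ (k i) (l i) e e' - S'.D₁ (k' i) (l' i) e e') fun x => log (y - x)| ≤ ε / 2 := by
      intro y hy
      have g := abs_le.1 (h3 y hy)
      have g' := abs_le.1 (h4 y hy)
      rw [LinearMap.sub_apply]
      exact abs_le.2 ⟨by linarith [g.1, g'.2], by linarith [g.2, g'.1]⟩
    intro y hy
    refine ⟨(key y hy).trans (by linarith), fun y' hy' => ?_⟩
    linarith [(abs_le.1 (key y hy)).2, (abs_le.1 (key y' hy')).1]

end Sys

namespace Sys

section

variable (S S' : Sys α₁ β₁ α₂ β₂) {k l k' l' e e' : ℕ}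

lemma sub_D₁_reflect (t : ℝ) : ((S.reflect.D₁ l k e' e - S'.reflect.D₁ l' k' e' e) fun x =>
    log (-t - x)) = (S.D₂ k l e e' - S'.D₂ k' l' e e') fun x => log (x - t) := by
  simp only [LinearMap.sub_apply, D₁_reflect, sub_neg_eq_add, neg_add_eq_sub]

lemma sub_D₂_reflect (t : ℝ) : ((S.reflect.D₂ l k e' e - S'.reflect.D₂ l' k' e' e) fun x =>
    log (x - t)) = (S.D₁ k l e e' - S'.D₁ k' l' e e') fun x => log (-t - x) := by
  have : (fun x : ℝ => log (-x - t)) = fun x => log (-t - x) := by ext; ring_nf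
  simp only [LinearMap.sub_apply, D₂_reflect, this]

lemma abs_D₂_log_le (he : e + e' = 1) {t : ℝ} (ht : t ≤ β₁) :
    |(S.D₂ k l e e' fun x => log (x - t)) - e' * log (β₂ - t)| ≤ (β₂ - α₂) / (α₂ - β₁) := by
  have h := S.reflect.abs_D₁_log_le (k := l) (l := k) (e := e') (e' := e) (by omega)
    (neg_le_neg ht)
  simp only [D₁_reflect, sub_neg_eq_add, neg_add_eq_sub] at h
  exact h

lemma abs_sub_D₁_log_le (he : e + e' = 1) {y : ℝ} (hy : α₂ ≤ y) :
    |(S.D₁ k l e e' - S'.D₁ k' l' e e') fun x => log (y - x)| ≤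
      2 * ((β₁ - α₁) / (α₂ - β₁)) := by
  have h1 := abs_le.1 (S.abs_D₁_log_le (k := k) (l := l) he hy)
  have h2 := abs_le.1 (S'.abs_D₁_log_le (k := k') (l := l') he hy)
  rw [LinearMap.sub_apply]
  exact abs_le.2 ⟨by linarith [h1.1, h2.2], by linarith [h1.2, h2.1]⟩

/-- The sum of the zeros in terms of the behaviour of the potential near infinity. -/
lemma abs_sub_D₁_id_le (he : e + e' = 1) {y : ℝ} (hy : β₁ < y) :
    |y * ((S.D₁ k l e e' - S'.D₁ k' l' e e') fun x => log (y - x)) +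
      (S.D₁ k l e e' - S'.D₁ k' l' e e') fun x => x| ≤
      2 * (max |α₁| |β₁| / (y - β₁) * (β₁ - α₁)) := by
  set B := max |α₁| |β₁|
  have hL : ∀ x ∈ Set.Icc α₁ β₁, ∀ x' ∈ Set.Icc α₁ β₁,
      |(y * log (y - x) + x) - (y * log (y - x') + x')| ≤ B / (y - β₁) * |x - x'| := by
    intro x hx x' hx'
    refine abs_sub_le_of_deriv_le (g := fun x => y * log (y - x) + x)
      (g' := fun x => y * (-1 / (y - x)) + 1) (fun t ht => ?_) (fun t ht => ?_) hx' hx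
    · exact ((((hasDerivAt_id t).const_sub y).log (by simp only [id]; linarith [ht.2])).const_mul
        y).add (hasDerivAt_id t)
    · have h0 : 0 < y - t := by linarith [ht.2]
      rw [show y * (-1 / (y - t)) + 1 = -t / (y - t) by field_simp; ring, abs_div, abs_neg,
        abs_of_pos h0]
      exact div_le_div₀ ((abs_nonneg _).trans (le_max_left _ _)) (abs_le_max_abs_abs ht.1 ht.2)
        (by linarith) (by linarith [ht.2])
  have hK : 0 ≤ B / (y - β₁) :=
    div_nonneg ((abs_nonneg _).trans (le_max_left _ _)) (by linarith)
  have h1 := abs_le.1 (S.abs_D₁_le (k := k) (l := l) he hK hL)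
  have h2 := abs_le.1 (S'.abs_D₁_le (k := k') (l := l') he hK hL)
  have key : ∀ Λ : (ℝ → ℝ) →ₗ[ℝ] ℝ, (Λ fun x => y * log (y - x) + x) =
      y * (Λ fun x => log (y - x)) + Λ fun x => x := fun Λ => by
    rw [← smul_eq_mul, ← map_smul, ← map_add]; rfl
  rw [key] at h1 h2
  simp only [LinearMap.sub_apply]
  exact abs_le.2 ⟨by linarith [h1.1, h2.2], by linarith [h1.2, h2.1]⟩

end

variable (S S' : Sys α₁ β₁ α₂ β₂) {ι : Type*} {F : Filter ι}
  {k l k' l' : ι → ℕ} {c : ℝ} {e e' : ℕ}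

lemma D₂_step (h : SameRay F k l k' l' c) (hc : c ∈ Set.Icc (0 : ℝ) 1) (he : e + e' = 1) {M : ℝ}
    (hM : 0 ≤ M) (hG : ∀ᶠ i in F, ∀ y, α₂ ≤ y → ∀ y', α₂ ≤ y' →
      ((S.D₁ (k i) (l i) e e' - S'.D₁ (k' i) (l' i) e e') fun x => log (y - x)) -
      ((S.D₁ (k i) (l i) e e' - S'.D₁ (k' i) (l' i) e e') fun x => log (y' - x)) ≤ M)
    {ε : ℝ} (hε : 0 < ε) : ∀ᶠ i in F, ∀ t ≤ β₁,
      |(S.D₂ (k i) (l i) e e' - S'.D₂ (k' i) (l' i) e e') fun x => log (x - t)| ≤ M / 2 + ε ∧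
      ∀ t' ≤ β₁,
      ((S.D₂ (k i) (l i) e e' - S'.D₂ (k' i) (l' i) e e') fun x => log (x - t)) -
      ((S.D₂ (k i) (l i) e e' - S'.D₂ (k' i) (l' i) e e') fun x => log (x - t')) ≤ M / 2 + ε := by
  have := D₁_step S.reflect S'.reflect h.swap ⟨by linarith [hc.2], by linarith [hc.1]⟩
    (e := e') (e' := e) (by omega) hM (hG.mono fun i hi t ht t' ht' => by
      rw [sub_D₂_reflect, sub_D₂_reflect]
      exact hi _ (by linarith) _ (by linarith)) hε
  filter_upwards [this] with i hi t ht
  have h1 := hi (-t) (neg_le_neg ht)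
  rw [sub_D₁_reflect] at h1
  refine ⟨h1.1, fun t' ht' => ?_⟩
  have h2 := h1.2 (-t') (neg_le_neg ht')
  rwa [sub_D₁_reflect] at h2

/-- The changes of the potentials under a step agree asymptotically along the same ray. -/
theorem steps_close (h : SameRay F k l k' l' c) (hc : c ∈ Set.Icc (0 : ℝ) 1) (he : e + e' = 1)
    {ε : ℝ} (hε : 0 < ε) : ∀ᶠ i in F,
      (∀ y, α₂ ≤ y →
        |(S.D₁ (k i) (l i) e e' - S'.D₁ (k' i) (l' i) e e') fun x => log (y - x)| ≤ ε) ∧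
      ∀ t ≤ β₁,
        |(S.D₂ (k i) (l i) e e' - S'.D₂ (k' i) (l' i) e e') fun x => log (x - t)| ≤ ε := by
  have hp := eventually_le_of_contraction (q := 1 / 2) (ε := ε) (p := fun M => ∀ᶠ i in F,
      (∀ y, α₂ ≤ y → ∀ y', α₂ ≤ y' →
        ((S.D₁ (k i) (l i) e e' - S'.D₁ (k' i) (l' i) e e') fun x => log (y - x)) -
        ((S.D₁ (k i) (l i) e e' - S'.D₁ (k' i) (l' i) e e') fun x => log (y' - x)) ≤ M) ∧
      ∀ t ≤ β₁, ∀ t' ≤ β₁,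
        ((S.D₂ (k i) (l i) e e' - S'.D₂ (k' i) (l' i) e e') fun x => log (x - t)) -
        ((S.D₂ (k i) (l i) e e' - S'.D₂ (k' i) (l' i) e e') fun x => log (x - t')) ≤ M)
    (fun M M' hM hp => ?_) ?_ (by norm_num) (fun M hM hp δ hδ => ⟨by positivity, ?_⟩) hε
  · filter_upwards [D₁_step S S' h hc he hε.le (hp.mono fun i hi => hi.2) (half_pos hε),
      D₂_step S S' h hc he hε.le (hp.mono fun i hi => hi.1) (half_pos hε)] with i h1 h2
    exact ⟨fun y hy => (h1 y hy).1.trans (by linarith), fun t ht => (h2 t ht).1.trans (by linarith)⟩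
  · filter_upwards [hp] with i hi
    exact ⟨fun y hy y' hy' => (hi.1 y hy y' hy').trans hM,
      fun t ht t' ht' => (hi.2 t ht t' ht').trans hM⟩
  · set M₁ := 2 * ((β₁ - α₁) / (α₂ - β₁)) with hM₁
    set M₂ := 2 * ((β₂ - α₂) / (α₂ - β₁)) with hM₂
    have h1 := S.h₁; have h2 := S.h₂; have h3 := S.h₃
    have hM₁0 : 0 ≤ M₁ := mul_nonneg zero_le_two (div_nonneg (by linarith) (by linarith))
    have hM₂0 : 0 ≤ M₂ := mul_nonneg zero_le_two (div_nonneg (by linarith) (by linarith))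
    refine ⟨2 * M₁ + 2 * M₂, by positivity, .of_forall fun i => ⟨fun y hy y' hy' => ?_,
      fun t ht t' ht' => ?_⟩⟩
    · have g1 := abs_le.1 (abs_sub_D₁_log_le S S' (k := k i) (l := l i) (k' := k' i)
        (l' := l' i) he hy)
      have g2 := abs_le.1 (abs_sub_D₁_log_le S S' (k := k i) (l := l i) (k' := k' i)
        (l' := l' i) he hy')
      linarith [g1.2, g2.1]
    · have key : ∀ t ≤ β₁, |(S.D₂ (k i) (l i) e e' - S'.D₂ (k' i) (l' i) e e') fun x =>
          log (x - t)| ≤ M₂ := fun t ht => by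
        have := abs_sub_D₁_log_le S.reflect S'.reflect (k := l i) (l := k i) (k' := l' i)
          (l' := k' i) (e := e') (e' := e) (by omega) (neg_le_neg ht)
        rw [sub_D₁_reflect] at this
        exact this.trans (le_of_eq (by rw [hM₂]; ring))
      linarith [(abs_le.1 (key t ht)).2, (abs_le.1 (key t' ht')).1]
  · filter_upwards [D₁_step S S' h hc he hM (hp.mono fun i hi => hi.2) hδ,
      D₂_step S S' h hc he hM (hp.mono fun i hi => hi.1) hδ] with i h1 h2
    exact ⟨fun y hy y' hy' => ((h1 y hy).2 y' hy').trans (by linarith),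
      fun t ht t' ht' => ((h2 t ht).2 t' ht').trans (by linarith)⟩

lemma D₁_id_close (h : SameRay F k l k' l' c) (hc : c ∈ Set.Icc (0 : ℝ) 1) (he : e + e' = 1)
    {ε : ℝ} (hε : 0 < ε) : ∀ᶠ i in F,
      |(S.D₁ (k i) (l i) e e' - S'.D₁ (k' i) (l' i) e e') fun x => x| ≤ ε := by
  have h1 := S.h₁; have h2 := S.h₂
  set B := max |α₁| |β₁| with hB
  have hB0 : 0 ≤ B := (abs_nonneg _).trans (le_max_left _ _)
  set y := α₂ + |α₂| + 1 + 4 * B * (β₁ - α₁) / ε with hy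
  have h3 : 0 ≤ 4 * B * (β₁ - α₁) / ε :=
    div_nonneg (mul_nonneg (by linarith) (by linarith)) hε.le
  have h4 : 0 < y := by linarith [neg_abs_le α₂]
  have h5 : α₂ ≤ y := by linarith [abs_nonneg α₂]
  filter_upwards [steps_close S S' h hc he (show 0 < ε / (2 * y) by positivity)] with i hi
  have h6 := abs_le.1 (hi.1 y h5)
  have h7 := abs_le.1 (abs_sub_D₁_id_le S S' (k := k i) (l := l i) (k' := k' i) (l' := l' i)
    he (by linarith : β₁ < y))
  have h8 : 2 * (B / (y - β₁) * (β₁ - α₁)) ≤ ε / 2 := by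
    rw [div_mul_eq_mul_div, mul_div_assoc', div_le_iff₀ (by linarith)]
    have : 4 * B * (β₁ - α₁) / ε * ε = 4 * B * (β₁ - α₁) := by field_simp
    nlinarith [abs_nonneg α₂]
  have h9 : y * (ε / (2 * y)) = ε / 2 := by field_simp
  rw [← hB] at h7
  have h10 := mul_le_mul_of_nonneg_left h6.2 h4.le
  have h11 := mul_le_mul_of_nonneg_left h6.1 h4.le
  rw [mul_neg, h9] at h11
  exact abs_le.2 ⟨by linarith [h7.1], by linarith [h7.2]⟩

theorem b_close (h : SameRay F k l k' l' c) (hc : c ∈ Set.Icc (0 : ℝ) 1) (he : e + e' = 1)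
    {ε : ℝ} (hε : 0 < ε) :
    ∀ᶠ i in F, |S.b (k i) (l i) e e' - S'.b (k' i) (l' i) e e'| ≤ ε := by
  filter_upwards [D₁_id_close S S' h hc he (half_pos hε), D₁_id_close S.reflect S'.reflect h.swap
    ⟨by linarith [hc.2], by linarith [hc.1]⟩ (e := e') (e' := e) (by omega) (half_pos hε)]
    with i h1 h2
  have key : ∀ Λ : (ℝ → ℝ) →ₗ[ℝ] ℝ, (Λ fun x => -x) = -Λ fun x => x := fun Λ => by
    rw [← map_neg]; rfl
  simp only [LinearMap.sub_apply, D₁_reflect, key] at h1 h2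
  have hb : ∀ (S : Sys α₁ β₁ α₂ β₂) (k l : ℕ), S.b k l e e' =
      (S.D₁ k l e e' fun x => x) + S.D₂ k l e e' fun x => x := fun S k l => by
    simp [b, D₁, D₂]
  rw [hb, hb]
  rw [abs_le] at *
  constructor <;> linarith [h1.1, h1.2, h2.1, h2.2]

/-- The ratio of consecutive orthogonality constants for a step in the first index. -/
def r₁ (k l : ℕ) : ℝ := S.I₁ (k + 1) l / S.I₁ k l

lemma r₁_pos (k l : ℕ) : 0 < S.r₁ k l := div_pos (S.I₁_pos _ _) (S.I₁_pos _ _)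

lemma log_r₁ (k l : ℕ) : log (S.r₁ k l) = log (S.I₁ (k + 1) (l + 0)) - log (S.I₁ k l) :=
  log_div (S.I₁_pos _ _).ne' (S.I₁_pos _ _).ne'

lemma abs_log_r₁_le (hc : 0 < c) : ∃ B : ℝ, ∀ᶠ k : ℕ in atTop, ∀ l : ℕ, c * (k + l) ≤ k →
    |log (S.r₁ k l)| ≤ B := by
  have h1 := S.h₁; have h2 := S.h₂
  obtain ⟨a, ha, -, hg⟩ := S.endpt_good hc
  set A := max |log ((a - α₁) / 4)| |log ((β₁ - α₁) / 4)|
  refine ⟨2 * A + (β₂ - α₂) / (α₂ - β₁) + 1, ?_⟩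
  filter_upwards [hg, S.asymp_sub hc one_pos] with k h3 h4 l hl
  have hb := (h3 l hl).1
  have h5 := (h4 l hl 1 0 rfl).1
  set d := S.endpt k l
  have h6 := (abs_potential_le (ha.trans_le hb.1) (hb.2.trans_lt h2)
    (S.D₂_mem (k := k) (l := l) (e := 1) (e' := 0)) (M := (β₂ - α₂) / (α₂ - β₁))
    fun t ht => by
      simpa using S.abs_D₂_log_le (k := k) (l := l) (e := 1) (e' := 0) rfl (ht.2.trans hb.2)).1
  have h7 : |log ((d - α₁) / 4)| ≤ A := abs_le_max_abs_abs
    (log_le_log (by linarith) (by linarith [hb.1]))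
    (log_le_log (by linarith [hb.1]) (by linarith [hb.2]))
  rw [← log_r₁, H₁_eq, H₁_eq] at h5
  simp only [D₂, LinearMap.sub_apply] at h6
  push_cast at h5
  rw [abs_le] at *
  constructor <;> linarith [h5.1, h5.2, h6.1, h6.2, h7.1, h7.2]

theorem r₁_close (h : SameRay F k l k' l' c) (hc : c ∈ Set.Icc (0 : ℝ) 1) {ε : ℝ}
    (hε : 0 < ε) : ∀ᶠ i in F, |S.r₁ (k i) (l i) - S'.r₁ (k' i) (l' i)| ≤ ε := by
  rcases hc.1.lt_or_eq with hc0 | rfl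
  · obtain ⟨B, hB⟩ := S.abs_log_r₁_le (half_pos hc0)
    obtain ⟨B', hB'⟩ := S'.abs_log_r₁_le (half_pos hc0)
    set R := exp (max B B')
    have hR : 0 < R := exp_pos _
    have hε' : 0 < ε / R / 2 := by positivity
    have h2 := S.h₂
    filter_upwards [(h.tendsto_left hc0).eventually hB, (h.symm.tendsto_left hc0).eventually hB',
      h.comparable hc0, h.symm.comparable hc0, steps_close S S' h hc (e := 1) (e' := 0) rfl hε',
      common_endpt S S' h hc0 hc.2 (e := 1) (e' := 0) rfl hε']
      with i h3 h4 h5 h6 h7 ⟨b, hb, hb1, h8, _⟩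
    have h9 := (abs_potential_le hb (hb1.trans_lt h2)
      (Submodule.sub_mem _ (S.D₂_mem (k := k i) (l := l i) (e := 1) (e' := 0))
        (S'.D₂_mem (k := k' i) (l := l' i) (e := 1) (e' := 0)))
      fun t ht => h7.2 t (ht.2.trans hb1)).1
    rw [← log_r₁, ← log_r₁] at h8
    have h10 := abs_le.1 ((h3 _ h5).trans (le_max_left B B'))
    have h11 := abs_le.1 ((h4 _ h6).trans (le_max_right B B'))
    have h12 := abs_sub_le_of_deriv_le (g := exp) (g' := exp) (c := R)
      (fun t _ => hasDerivAt_exp t) (fun t ht => by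
        rw [abs_of_pos (exp_pos t)]; exact exp_le_exp.2 ht.2) h11 h10
    rw [exp_log (S.r₁_pos _ _), exp_log (S'.r₁_pos _ _)] at h12
    refine h12.trans ?_
    have h13 : |log (S.r₁ (k i) (l i)) - log (S'.r₁ (k' i) (l' i))| ≤ ε / R := by
      rw [abs_le] at *
      constructor <;> linarith [h8.1, h8.2, h9.1, h9.2]
    calc _ ≤ R * (ε / R) := mul_le_mul_of_nonneg_left h13 hR.le
      _ = ε := by field_simp
  · have key : ∀ (S : Sys α₁ β₁ α₂ β₂) (k l k' l' : ι → ℕ), SameRay F k l k' l' 0 →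
        ∀ᶠ i in F, S.r₁ (k i) (l i) ≤ ε := fun S k l k' l' h => by
      obtain ⟨η, hη, hI⟩ := S.I₁_succ_le hε
      filter_upwards [(h.swap.tendsto_left (by norm_num)).eventually hI,
        h.ratio.eventually_le_const (show 0 < η / (1 + η) by positivity),
        h.sum.eventually_gt_atTop 0] with i h3 h4 hN
      rw [r₁, div_le_iff₀ (S.I₁_pos _ _)]
      rw [div_le_div_iff₀ hN (by positivity)] at h4
      exact h3 _ (by nlinarith)
    filter_upwards [key S k l k' l' h, key S' k' l' k l h.symm] with i h1 h2
    exact abs_sub_le_of_nonneg_of_le (S.r₁_pos _ _).le h1 (S'.r₁_pos _ _).le h2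

end Sys

/-- A sequence of multi-indices `(k, l)` whose length tends to infinity in the direction `c`. -/
structure IsRay (k l : ℕ → ℕ) (c : ℝ) : Prop where
  sum : Tendsto (fun i => (k i : ℝ) + l i) atTop atTop
  ratio : Tendsto (fun i => (k i : ℝ) / (k i + l i)) atTop (𝓝 c)

lemma exists_isRay {c : ℝ} (hc : c ∈ Set.Icc (0 : ℝ) 1) : ∃ k l : ℕ → ℕ, IsRay k l c := by
  have h1 : ∀ a : ℝ, 0 ≤ a → Tendsto (fun i : ℕ => (⌊a * (i : ℝ)⌋₊ : ℝ) / i) atTop (𝓝 a) :=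
    fun a ha => (tendsto_nat_floor_mul_div_atTop ha).comp tendsto_natCast_atTop_atTop
  have h2 := (h1 c hc.1).add (h1 (1 - c) (by linarith [hc.2]))
  rw [add_sub_cancel] at h2
  refine ⟨fun i => ⌊c * (i : ℝ)⌋₊, fun i => ⌊(1 - c) * (i : ℝ)⌋₊, ?_, ?_⟩
  · refine (h2.pos_mul_atTop one_pos tendsto_natCast_atTop_atTop).congr' ?_
    filter_upwards [eventually_gt_atTop 0] with i hi
    have : (i : ℝ) ≠ 0 := by positivity
    field_simp
  · have h3 := (h1 c hc.1).div h2 one_ne_zero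
    rw [div_one] at h3
    refine h3.congr' ?_
    filter_upwards [eventually_gt_atTop 0] with i hi
    have : (i : ℝ) ≠ 0 := by positivity
    rw [Pi.div_apply, ← add_div, div_div_div_cancel_right₀ this]

lemma IsRay.one_le {k l : ℕ → ℕ} {c : ℝ} (h : IsRay k l c) : ∀ᶠ i in atTop, 1 ≤ k i + l i :=
  (h.sum.eventually_ge_atTop 1).mono fun _ hi => by exact_mod_cast hi

lemma IsRay.swap {k l : ℕ → ℕ} {c : ℝ} (h : IsRay k l c) : IsRay l k (1 - c) :=
  have h' := (SameRay.mk h.sum h.sum h.ratio h.ratio).swap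
  ⟨h'.sum, h'.ratio⟩

lemma IsRay.of_le {k l k' l' : ℕ → ℕ} {c : ℝ} (h : IsRay k l c) (hk : ∀ i, k' i ≤ k i)
    (hk1 : ∀ i, k i ≤ k' i + 1) (hl : ∀ i, l' i ≤ l i) (hl1 : ∀ i, l i ≤ l' i + 1) :
    IsRay k' l' c := by
  have cast : ∀ i, (k' i : ℝ) ≤ k i ∧ (k i : ℝ) ≤ k' i + 1 ∧ (l' i : ℝ) ≤ l i ∧
      (l i : ℝ) ≤ l' i + 1 := fun i =>
    ⟨mod_cast hk i, mod_cast hk1 i, mod_cast hl i, mod_cast hl1 i⟩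
  have hs : Tendsto (fun i => (k' i : ℝ) + l' i) atTop atTop := by
    refine tendsto_atTop_mono (fun i => ?_) (tendsto_atTop_add_const_right _ (-2) h.sum)
    obtain ⟨h1, h2, h3, h4⟩ := cast i
    linarith
  refine ⟨hs, tendsto_of_tendsto_of_dist h.ratio ?_⟩
  refine squeeze_zero' (.of_forall fun i => dist_nonneg) ?_
    ((tendsto_const_nhds (x := (2 : ℝ))).div_atTop hs)
  filter_upwards [hs.eventually_gt_atTop 0] with i hi
  obtain ⟨h1, h2, h3, h4⟩ := cast i
  have hN : (0 : ℝ) < k i + l i := by linarith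
  have k0 : (0 : ℝ) ≤ k' i := Nat.cast_nonneg _
  have l0 : (0 : ℝ) ≤ l' i := Nat.cast_nonneg _
  rw [Real.dist_eq, div_sub_div _ _ hN.ne' hi.ne', abs_div, abs_of_pos (mul_pos hN hi),
    div_le_div_iff₀ (mul_pos hN hi) hi]
  have : |(k i : ℝ) * (k' i + l' i) - (k i + l i) * k' i| ≤ 2 * (k i + l i) := by
    rw [abs_le]; constructor <;> nlinarith
  nlinarith

/-- Two arrays approach each other along rays with the same direction. -/
def Close (q q' : ℕ → ℕ → ℝ) : Prop := ∀ ⦃ι : Type⦄ ⦃F : Filter ι⦄ ⦃k l k' l' : ι → ℕ⦄ ⦃c : ℝ⦄,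
  SameRay F k l k' l' c → c ∈ Set.Icc (0 : ℝ) 1 → ∀ ε, 0 < ε →
    ∀ᶠ i in F, |q (k i) (l i) - q' (k' i) (l' i)| ≤ ε

lemma exists_limit {q : ℕ → ℕ → ℝ} (hq : Close q q) {c : ℝ} (hc : c ∈ Set.Icc (0 : ℝ) 1) :
    ∃ L : ℝ, ∀ q', Close q' q → ∀ k l : ℕ → ℕ, IsRay k l c →
      Tendsto (fun i => q' (k i) (l i)) atTop (𝓝 L) := by
  obtain ⟨k, l, h⟩ := exists_isRay hc
  have hcau : CauchySeq fun i => q (k i) (l i) := by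
    rw [cauchySeq_iff_tendsto_dist_atTop_0, ← prod_atTop_atTop_eq]
    have hsame : SameRay (atTop ×ˢ atTop : Filter (ℕ × ℕ)) (fun p => k p.1) (fun p => l p.1)
        (fun p => k p.2) (fun p => l p.2) c :=
      ⟨h.sum.comp tendsto_fst, h.sum.comp tendsto_snd, h.ratio.comp tendsto_fst,
        h.ratio.comp tendsto_snd⟩
    refine Metric.tendsto_nhds.2 fun ε hε => ?_
    filter_upwards [hq hsame hc (ε / 2) (half_pos hε)] with p hp
    rw [dist_zero_right, norm_eq_abs, Real.dist_eq, abs_abs]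
    linarith
  obtain ⟨L, hL⟩ := cauchySeq_tendsto_of_complete hcau
  refine ⟨L, fun q' hq' k' l' h' => tendsto_of_tendsto_of_dist hL ?_⟩
  refine Metric.tendsto_nhds.2 fun ε hε => ?_
  filter_upwards [hq' ⟨h'.sum, h.sum, h'.ratio, h.ratio⟩ hc (ε / 2) (half_pos hε)] with i hi
  rw [dist_zero_right, norm_eq_abs, Real.dist_eq, abs_abs, abs_sub_comm]
  linarith

/-- An array that is close to itself has continuous ray limits, shared by all close arrays. -/
theorem exists_rayLimit {q : ℕ → ℕ → ℝ} (hq : Close q q) :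
    ∃ L : ℝ → ℝ, ContinuousOn L (Set.Icc 0 1) ∧ ∀ c ∈ Set.Icc (0 : ℝ) 1, ∀ q', Close q' q →
      ∀ k l : ℕ → ℕ, IsRay k l c → Tendsto (fun i => q' (k i) (l i)) atTop (𝓝 (L c)) := by
  have hex : ∀ c : ℝ, ∃ L : ℝ, c ∈ Set.Icc (0 : ℝ) 1 → ∀ q', Close q' q → ∀ k l : ℕ → ℕ,
      IsRay k l c → Tendsto (fun i => q' (k i) (l i)) atTop (𝓝 L) := fun c => by
    by_cases hc : c ∈ Set.Icc (0 : ℝ) 1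
    · obtain ⟨L, hL⟩ := exists_limit hq hc
      exact ⟨L, fun _ => hL⟩
    · exact ⟨0, fun h => absurd h hc⟩
  choose L hL using hex
  refine ⟨L, fun c hc => tendsto_of_seq_tendsto fun x hx => ?_, hL⟩
  have hx1 : Tendsto x atTop (𝓝 c) := hx.mono_right nhdsWithin_le_nhds
  have hx2 : ∀ᶠ m in atTop, x m ∈ Set.Icc (0 : ℝ) 1 := hx.eventually self_mem_nhdsWithin
  have hδ : Tendsto (fun m : ℕ => 1 / ((m : ℝ) + 1)) atTop (𝓝 0) :=
    tendsto_one_div_add_atTop_nhds_zero_nat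
  have hpick : ∀ m : ℕ, ∃ k l : ℕ, x m ∈ Set.Icc (0 : ℝ) 1 → (m : ℝ) ≤ (k : ℝ) + l ∧
      |(k : ℝ) / (k + l) - x m| ≤ 1 / ((m : ℝ) + 1) ∧ |q k l - L (x m)| ≤ 1 / ((m : ℝ) + 1) := by
    intro m
    by_cases hm : x m ∈ Set.Icc (0 : ℝ) 1
    · obtain ⟨k, l, h⟩ := exists_isRay hm
      have hm0 : 0 < 1 / ((m : ℝ) + 1) := by positivity
      have h1 := Metric.tendsto_nhds.1 h.ratio _ hm0
      have h2 := Metric.tendsto_nhds.1 (hL _ hm q hq k l h) _ hm0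
      obtain ⟨i, ⟨h3, h4⟩, h5⟩ := ((h1.and h2).and (h.sum.eventually_ge_atTop (m : ℝ))).exists
      exact ⟨k i, l i, fun _ => ⟨h5, h3.le, h4.le⟩⟩
    · exact ⟨0, 0, fun h => absurd h hm⟩
  choose k l hkl using hpick
  have hray : IsRay k l c := by
    refine ⟨tendsto_atTop_mono' _ (hx2.mono fun m hm => (hkl m hm).1)
      tendsto_natCast_atTop_atTop, tendsto_of_tendsto_of_dist hx1 ?_⟩
    refine squeeze_zero' (.of_forall fun i => dist_nonneg) (hx2.mono fun m hm => ?_) hδ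
    rw [dist_comm]
    exact (hkl m hm).2.1
  refine tendsto_of_tendsto_of_dist (hL c hc q hq k l hray) ?_
  exact squeeze_zero' (.of_forall fun i => dist_nonneg)
    (hx2.mono fun m hm => (hkl m hm).2.2) hδ

namespace Sys

variable (S S' : Sys α₁ β₁ α₂ β₂)

lemma close_b {e e' : ℕ} (he : e + e' = 1) :
    Close (fun k l => S.b k l e e') fun k l => S'.b k l e e' :=
  fun _ _ _ _ _ _ _ h hc _ hε => b_close S S' h hc he hε

lemma close_r₁ : Close S.r₁ S'.r₁ := fun _ _ _ _ _ _ _ h hc _ hε => r₁_close S S' h hc hε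

/-- The ratio of consecutive orthogonality constants for a step in the second index. -/
def r₂ (k l : ℕ) : ℝ := S.reflect.r₁ l k

lemma close_r₂ : Close S.r₂ S'.r₂ := fun _ _ _ _ _ _ _ h hc _ hε =>
  r₁_close S.reflect S'.reflect h.swap ⟨by linarith [hc.2], by linarith [hc.1]⟩ hε

lemma limit_r₁_pos {k l : ℕ → ℕ} {c L : ℝ} (h : IsRay k l c) (hc : 0 < c)
    (hL : Tendsto (fun i => S.r₁ (k i) (l i)) atTop (𝓝 L)) : 0 < L := by
  have h' : SameRay atTop k l k l c := ⟨h.sum, h.sum, h.ratio, h.ratio⟩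
  obtain ⟨B, hB⟩ := S.abs_log_r₁_le (half_pos hc)
  refine (exp_pos (-B)).trans_le (ge_of_tendsto hL ?_)
  filter_upwards [(h'.tendsto_left hc).eventually hB, h'.comparable hc] with i h1 h2
  rw [← le_log_iff_exp_le (S.r₁_pos _ _)]
  exact (abs_le.1 (h1 _ h2)).1

lemma integral_P_mul_pow_right (k l : ℕ) :
    ∫ x in α₂..β₂, (S.P k l).eval x * x ^ l * S.f₂ x = S.reflect.I₁ l k := by
  have h := S.reflect.integral_P_mul_pow l k
  have h' := intervalIntegral.integral_comp_neg (a := α₂) (b := β₂)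
    fun x => (S.reflect.P l k).eval x * x ^ l * S.reflect.f₁ x
  rw [h] at h'
  have e : ∀ x : ℝ, (S.reflect.P l k).eval (-x) * (-x) ^ l * S.reflect.f₁ (-x) =
      (-1) ^ k * ((S.P k l).eval x * x ^ l * S.f₂ x) := fun x => by
    have h2 : ((-1 : ℝ) ^ l) * (-1) ^ l = 1 := by rw [← mul_pow]; norm_num
    simp only [reflect, eval_mul, eval_C, eval_comp, eval_neg, eval_X, neg_neg]
    rw [neg_pow x l, pow_add]
    linear_combination (-1) ^ k * (S.P k l).eval x * x ^ l * S.f₂ x * h2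
  simp_rw [e] at h'
  rw [intervalIntegral.integral_const_mul] at h'
  exact mul_left_cancel₀ (pow_ne_zero _ (by norm_num)) h'

end Sys

lemma continuousOn_density (S : AngelescoSystem α₁ β₁ α₂ β₂) (i : Fin 2) :
    ContinuousOn (S.f i) (Set.Icc (iLo α₁ α₂ i) (iHi β₁ β₂ i)) := by
  have h : ContinuousOn (fun x : ℝ => (S.F i x).re) (Set.Icc (iLo α₁ α₂ i) (iHi β₁ β₂ i)) :=
    Complex.continuous_re.comp_continuousOn ((S.holoF i).continuousOn.comp
      Complex.continuous_ofReal.continuousOn fun x hx => S.subsetU i ⟨x, hx, rfl⟩)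
  exact h.congr fun x hx => by simp only [S.realF i x hx, Complex.ofReal_re]

lemma integral_μ (S : AngelescoSystem α₁ β₁ α₂ β₂) {i : Fin 2}
    (hi : iLo α₁ α₂ i ≤ iHi β₁ β₂ i) (g : ℝ → ℝ) :
    ∫ x, g x ∂S.μ i = ∫ x in iLo α₁ α₂ i..iHi β₁ β₂ i, g x * S.f i x := by
  have hm : AEMeasurable (fun x => ENNReal.ofReal (S.f i x))
      (volume.restrict (Set.Icc (iLo α₁ α₂ i) (iHi β₁ β₂ i))) :=
    ((continuousOn_density S i).aemeasurable measurableSet_Icc).ennreal_ofReal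
  rw [AngelescoSystem.μ, integral_withDensity_eq_integral_toReal_smul₀ hm (by simp),
    intervalIntegral.integral_of_le hi, ← integral_Icc_eq_integral_Ioc]
  refine setIntegral_congr_fun measurableSet_Icc fun x hx => ?_
  simp only [ENNReal.toReal_ofReal (S.posf i x hx).le, smul_eq_mul, mul_comm]

section

variable (h₁ : α₁ < β₁) (h₂ : β₁ < α₂) (h₃ : α₂ < β₂) (S : AngelescoSystem α₁ β₁ α₂ β₂)
  {P : ℕ × ℕ → Polynomial ℝ} (hP : IsTypeII S P)

/-- The densities and polynomials of an Angelesco system with analytic weights. -/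
def toSys : Sys α₁ β₁ α₂ β₂ where
  f₁ := S.f 0
  f₂ := S.f 1
  P := fun k l => P (k, l)
  h₁ := h₁
  h₂ := h₂
  h₃ := h₃
  cont₁ := continuousOn_density S 0
  cont₂ := continuousOn_density S 1
  pos₁ := S.posf 0
  pos₂ := S.posf 1
  monic := fun k l => (hP (k, l)).1
  deg := fun k l => (hP (k, l)).2.1
  orth₁ := fun k l j hj => (integral_μ S (i := 0) h₁.le _).symm.trans ((hP (k, l)).2.2 0 j hj)
  orth₂ := fun k l j hj => (integral_μ S (i := 1) h₃.le _).symm.trans ((hP (k, l)).2.2 1 j hj)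

lemma bcoef_zero {k l : ℕ} (h : 1 ≤ k + l) :
    bcoef S P (k, l) 0 = (toSys h₁ h₂ h₃ S hP).b k l 1 0 :=
  (toSys h₁ h₂ h₃ S hP).coeff_sub_coeff rfl h

lemma bcoef_one {k l : ℕ} (h : 1 ≤ k + l) :
    bcoef S P (k, l) 1 = (toSys h₁ h₂ h₃ S hP).b k l 0 1 :=
  (toSys h₁ h₂ h₃ S hP).coeff_sub_coeff rfl h

lemma acoef_zero (k l : ℕ) : acoef S P (k + 1, l) 0 = (toSys h₁ h₂ h₃ S hP).r₁ k l := by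
  rw [acoef, integral_μ S (i := 0) h₁.le, integral_μ S (i := 0) h₁.le]
  exact (congrArg₂ (· / ·) ((toSys h₁ h₂ h₃ S hP).integral_P_mul_pow (k + 1) l)
    ((toSys h₁ h₂ h₃ S hP).integral_P_mul_pow k l)).trans
    (mul_div_mul_left _ _ (pow_ne_zero _ (by norm_num)))

lemma acoef_one (k l : ℕ) : acoef S P (k, l + 1) 1 = (toSys h₁ h₂ h₃ S hP).r₂ k l := by
  rw [acoef, integral_μ S (i := 1) h₃.le, integral_μ S (i := 1) h₃.le]
  exact congrArg₂ (· / ·) ((toSys h₁ h₂ h₃ S hP).integral_P_mul_pow_right k (l + 1))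
    ((toSys h₁ h₂ h₃ S hP).integral_P_mul_pow_right k l)

end

end RayLimit

/-- Ray limits of the recurrence coefficients of an Angelesco system with analytic
weights exist for every `c ∈ [0,1]`, are continuous in `c`, and depend only on `c`
and the intervals. -/
theorem stmt1 (h₁ : α₁ < β₁) (h₂ : β₁ < α₂) (h₃ : α₂ < β₂) :
    ∃ A B : Fin 2 → ℝ → ℝ,
      (∀ i : Fin 2, ContinuousOn (A i) (Set.Icc 0 1)) ∧
      (∀ i : Fin 2, ContinuousOn (B i) (Set.Icc 0 1)) ∧
      (∀ i : Fin 2, ∀ c ∈ Set.Ioo (0 : ℝ) 1, 0 < A i c) ∧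
      (∀ c ∈ Set.Ioo (0 : ℝ) 1, B 0 c < B 1 c) ∧
      ∀ (S : AngelescoSystem α₁ β₁ α₂ β₂) (P : ℕ × ℕ → Polynomial ℝ),
        IsTypeII S P →
        ∀ c ∈ Set.Icc (0 : ℝ) 1, ∀ i : Fin 2, ∀ n : ℕ → ℕ × ℕ,
          Filter.Tendsto (fun k => (n k).1 + (n k).2) Filter.atTop Filter.atTop →
          Filter.Tendsto (fun k => ((n k).1 : ℝ) / (((n k).1 : ℝ) + ((n k).2 : ℝ)))
            Filter.atTop (nhds c) →
          Filter.Tendsto (fun k => bcoef S P (n k) i) Filter.atTop (nhds (B i c)) ∧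
          ((∀ k, 1 ≤ nComp (n k) i) →
            Filter.Tendsto (fun k => acoef S P (n k) i) Filter.atTop (nhds (A i c))) := by
  classical
  by_cases hex : Nonempty (RayLimit.Sys α₁ β₁ α₂ β₂)
  swap
  · exact ⟨fun _ _ => 1, fun i _ => (i : ℕ), fun _ => continuousOn_const,
      fun _ => continuousOn_const, fun _ _ _ => one_pos, fun _ _ => by simp,
      fun S P hP => (hex ⟨RayLimit.toSys h₁ h₂ h₃ S hP⟩).elim⟩
  obtain ⟨T⟩ := hex
  obtain ⟨A₁, cA₁, hA₁⟩ := RayLimit.exists_rayLimit (T.close_r₁ T)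
  obtain ⟨A₂, cA₂, hA₂⟩ := RayLimit.exists_rayLimit (T.close_r₂ T)
  obtain ⟨B₁, cB₁, hB₁⟩ := RayLimit.exists_rayLimit (T.close_b T (e := 1) (e' := 0) rfl)
  obtain ⟨B₂, cB₂, hB₂⟩ := RayLimit.exists_rayLimit (T.close_b T (e := 0) (e' := 1) rfl)
  refine ⟨![A₁, A₂], ![B₁, B₂], Fin.forall_fin_two.2 ⟨cA₁, cA₂⟩, Fin.forall_fin_two.2 ⟨cB₁, cB₂⟩,
    Fin.forall_fin_two.2 ⟨fun c hc => ?_, fun c hc => ?_⟩, fun c hc => ?_,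
    fun S P hP c hc i n hn hr => ?_⟩
  · have hc' := Set.Ioo_subset_Icc_self hc
    obtain ⟨k, l, h⟩ := RayLimit.exists_isRay hc'
    exact T.limit_r₁_pos h hc.1 (hA₁ c hc' _ (T.close_r₁ T) k l h)
  · have hc' := Set.Ioo_subset_Icc_self hc
    obtain ⟨k, l, h⟩ := RayLimit.exists_isRay hc'
    exact T.reflect.limit_r₁_pos h.swap (sub_pos.2 hc.2) (hA₂ c hc' _ (T.close_r₂ T) k l h)
  · have hc' := Set.Ioo_subset_Icc_self hc
    obtain ⟨k, l, h⟩ := RayLimit.exists_isRay hc'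
    have h5 := ge_of_tendsto ((hB₂ c hc' _ (T.close_b T rfl) k l h).sub
      (hB₁ c hc' _ (T.close_b T rfl) k l h)) (b := RayLimit.Sys.gap α₁ β₁ α₂ β₂) (by
      filter_upwards [h.one_le] with i hi
      exact T.gap_le hi)
    have h6 : 0 < RayLimit.Sys.gap α₁ β₁ α₂ β₂ := Real.exp_pos _
    exact sub_pos.1 (h6.trans_le h5)
  · have h : RayLimit.IsRay (fun i => (n i).1) (fun i => (n i).2) c :=
      ⟨by exact_mod_cast tendsto_natCast_atTop_atTop (R := ℝ).comp hn, hr⟩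
    set U := RayLimit.toSys h₁ h₂ h₃ S hP
    fin_cases i
    · refine ⟨(hB₁ c hc _ (U.close_b T rfl) _ _ h).congr' ?_, fun h1 => ?_⟩
      · filter_upwards [h.one_le] with i hi
        exact (RayLimit.bcoef_zero h₁ h₂ h₃ S hP hi).symm
      · have h1' : ∀ i, (n i).1 - 1 + 1 = (n i).1 := fun i => Nat.sub_add_cancel (h1 i)
        refine (hA₁ c hc _ (U.close_r₁ T) _ _ (h.of_le (k' := fun i => (n i).1 - 1)
          (fun i => Nat.sub_le _ _) (fun i => (h1' i).ge) (fun i => le_rfl)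
          fun i => Nat.le_succ _)).congr fun i => ?_
        have h2 := RayLimit.acoef_zero h₁ h₂ h₃ S hP ((n i).1 - 1) (n i).2
        rw [h1'] at h2
        exact h2.symm
    · refine ⟨(hB₂ c hc _ (U.close_b T rfl) _ _ h).congr' ?_, fun h1 => ?_⟩
      · filter_upwards [h.one_le] with i hi
        exact (RayLimit.bcoef_one h₁ h₂ h₃ S hP hi).symm
      · have h1' : ∀ i, (n i).2 - 1 + 1 = (n i).2 := fun i => Nat.sub_add_cancel (h1 i)
        refine (hA₂ c hc _ (U.close_r₂ T) _ _ (h.of_le (l' := fun i => (n i).2 - 1)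
          (fun i => le_rfl) (fun i => Nat.le_succ _) (fun i => Nat.sub_le _ _)
          fun i => (h1' i).ge)).congr fun i => ?_
        have h2 := RayLimit.acoef_one h₁ h₂ h₃ S hP (n i).1 ((n i).2 - 1)
        rw [h1'] at h2
        exact h2.symm
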